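/- Under assumptions (H), for every initial point x = (x1,x2) in ℝ^d × ℝ^d the martingale problem associated with the degenerate operator L started from x at time 0 is well posed: there exists exactly one probability measure P on the space C([0,T], ℝ^{2d}) of continuous paths (with canonical process X and canonical filtration) such that P(X_0 = x) = 1 and, for every φ ∈ C_c^∞(ℝ^{2d}), the process t ↦ φ(X_t) − ∫_0^t (Lφ)(s, X_s) ds, t ∈ [0,T], is a P-martingale with respect to the canonical filtration. -/

import Mathlib

/-!
Statement 0: Under assumptions (H), the martingale problem associated with the degenerate
operator L is well posed for every starting point x = (x1,x2).
-/

open MeasureTheory Set Matrix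

noncomputable section

namespace Stmt0

/-- The non-degenerate/degenerate state space blocks. -/
abbrev E (d : ℕ) := EuclideanSpace ℝ (Fin d)

/-- Borel σ-algebra on the path space `C([0,T], ℝ^d × ℝ^d)`. -/
instance pathMeasurableSpace {α β : Type*} [TopologicalSpace α] [TopologicalSpace β] :
    MeasurableSpace C(α, β) := borel _

instance pathBorelSpace {α β : Type*} [TopologicalSpace α] [TopologicalSpace β] :
    BorelSpace C(α, β) := ⟨rfl⟩

/-- canonical basis vector of the first block. -/
def e1 (d : ℕ) (i : Fin d) : E d × E d := (EuclideanSpace.single i 1, 0)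

/-- canonical basis vector of the second block. -/
def e2 (d : ℕ) (i : Fin d) : E d × E d := (0, EuclideanSpace.single i 1)

/-- The generator `L` of the degenerate diffusion:
`(Lφ)(t,x) = (1/2) Tr(a(t,x) D²_{x1} φ(x)) + F1(t,x)·D_{x1}φ(x) + F2(t,x)·D_{x2}φ(x)`. -/
def gen {d : ℕ} (F1 F2 : ℝ → E d → E d → E d)
    (a : ℝ → E d → E d → Matrix (Fin d) (Fin d) ℝ)
    (φ : E d × E d → ℝ) (t : ℝ) (x : E d × E d) : ℝ :=
  (1 / 2) * ∑ i, ∑ j, a t x.1 x.2 i j *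
      fderiv ℝ (fun y => fderiv ℝ φ y (e1 d j)) x (e1 d i)
    + ∑ i, F1 t x.1 x.2 i * fderiv ℝ φ x (e1 d i)
    + ∑ i, F2 t x.1 x.2 i * fderiv ℝ φ x (e2 d i)

section

/-! ### Part A: matrix calculus -/

/-- entrywise derivative of a matrix valued curve. -/
def MD {m n : Type*} (A : ℝ → Matrix m n ℝ) (A' : Matrix m n ℝ) (s : ℝ) : Prop :=
  ∀ i j, HasDerivAt (fun t => A t i j) (A' i j) s

lemma MD.mul {l m n : Type*} [Fintype m] {A : ℝ → Matrix l m ℝ} {A' : Matrix l m ℝ}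
    {B : ℝ → Matrix m n ℝ} {B' : Matrix m n ℝ} {s : ℝ} (hA : MD A A' s) (hB : MD B B' s) :
    MD (fun t => A t * B t) (A' * B s + A s * B') s := by
  intro i j
  simp only [Matrix.mul_apply, Matrix.add_apply, ← Finset.sum_add_distrib]
  exact HasDerivAt.fun_sum fun k _ => (hA i k).mul (hB k j)

lemma MD.transpose {m n : Type*} {A : ℝ → Matrix m n ℝ} {A' : Matrix m n ℝ} {s : ℝ}
    (hA : MD A A' s) : MD (fun t => (A t)ᵀ) A'ᵀ s := fun i j => hA j i

lemma differentiable_det' {n : Type*} [Fintype n] [DecidableEq n] :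
    Differentiable ℝ (fun M : n → n → ℝ => Matrix.det (Matrix.of M)) := by
  simp only [Matrix.det_apply]
  apply Differentiable.fun_sum
  intro σ _
  apply Differentiable.const_smul
  refine ContDiff.differentiable (n := 1) (contDiff_prod fun i _ => ?_) (by norm_num)
  simp only [Matrix.of_apply]
  fun_prop

lemma hasDerivAt_det {n : Type*} [Fintype n] [DecidableEq n] {K : ℝ → Matrix n n ℝ}
    {K' : Matrix n n ℝ} {s : ℝ} (hK : MD K K' s) (hu : IsUnit (K s).det) :
    HasDerivAt (fun t => (K t).det) ((K s).det * ((K s)⁻¹ * K').trace) s := by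
  have h1 : HasDerivAt (fun t => (fun i j => K t i j : n → n → ℝ)) (fun i j => K' i j) s := by
    rw [hasDerivAt_pi]; intro i; rw [hasDerivAt_pi]; intro j; exact hK i j
  have hd := (differentiable_det' (n := n) (fun i j => K s i j)).hasFDerivAt
  have h2 := hd.comp_hasDerivAt s h1
  have hl : HasDerivAt (fun h : ℝ => (fun i j => K s i j + h * K' i j : n → n → ℝ))
      (fun i j => K' i j) 0 := by
    rw [hasDerivAt_pi]; intro i; rw [hasDerivAt_pi]; intro j
    simpa using ((hasDerivAt_id (0:ℝ)).mul_const (K' i j)).const_add (K s i j)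
  have hd' : HasFDerivAt (fun M : n → n → ℝ => Matrix.det (Matrix.of M))
      (fderiv ℝ (fun M : n → n → ℝ => Matrix.det (Matrix.of M)) (fun i j => K s i j))
      (fun i j => K s i j + 0 * K' i j) := by simpa using hd
  have h3 := hd'.comp_hasDerivAt (0:ℝ) hl
  have hl2 : ∀ h : ℝ, Matrix.det (Matrix.of (fun i j => K s i j + h * K' i j))
      = (K s).det * (1 + h • ((K s)⁻¹ * K')).det := by
    intro h
    rw [← Matrix.det_mul, Matrix.mul_add, Matrix.mul_one, Matrix.mul_smul, ← Matrix.mul_assoc,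
      Matrix.mul_nonsing_inv _ hu, Matrix.one_mul]
    rfl
  have h4 : HasDerivAt (fun h : ℝ => (K s).det * (1 + h • ((K s)⁻¹ * K')).det)
      ((K s).det * ((K s)⁻¹ * K').trace) 0 := by
    have : ∀ h : ℝ, (K s).det * (1 + h • ((K s)⁻¹ * K')).det =
        (K s).det * (1 + ((K s)⁻¹ * K').trace * h +
          Polynomial.eval h ((1 + (Polynomial.X : Polynomial ℝ) • ((K s)⁻¹ * K').map
            Polynomial.C).det.divX.divX) * h ^ 2) := by
      intro h; rw [Matrix.det_one_add_smul]
    rw [funext this]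
    have h5 := (((hasDerivAt_const (0:ℝ) (1:ℝ)).add
      ((hasDerivAt_id (0:ℝ)).const_mul ((K s)⁻¹ * K').trace)).add
      ((Polynomial.hasDerivAt ((1 + (Polynomial.X : Polynomial ℝ) • ((K s)⁻¹ * K').map
            Polynomial.C).det.divX.divX) 0).mul ((hasDerivAt_id (0:ℝ)).pow 2))).const_mul
      ((K s).det)
    refine HasDerivAt.congr_deriv h5 ?_
    simp
  have h3' : HasDerivAt (fun h : ℝ => Matrix.det (Matrix.of (fun i j => K s i j + h * K' i j)))
      _ 0 := h3
  rw [funext hl2] at h3'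
  have h6 := h3'.unique h4
  rw [h6] at h2
  exact h2

lemma differentiableAt_inv_entry {n : Type*} [Fintype n] [DecidableEq n] {K : ℝ → Matrix n n ℝ}
    {K' : Matrix n n ℝ} {s : ℝ} (hK : MD K K' s) (hu : IsUnit (K s).det) (i j : n) :
    DifferentiableAt ℝ (fun t => (K t)⁻¹ i j) s := by
  have h1 : (fun t => (K t)⁻¹ i j) = fun t => ((K t).det)⁻¹ * (K t).adjugate i j := by
    ext t
    rw [Matrix.inv_def, Matrix.smul_apply, smul_eq_mul, Ring.inverse_eq_inv']
  rw [h1]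
  apply DifferentiableAt.mul
  · exact (hasDerivAt_det hK hu).differentiableAt.inv hu.ne_zero
  · simp_rw [Matrix.adjugate_apply]
    have : DifferentiableAt ℝ (fun t => (fun a b => (K t).updateRow j (Pi.single i 1) a b :
        n → n → ℝ)) s := by
      rw [differentiableAt_pi]; intro a; rw [differentiableAt_pi]; intro b
      by_cases h : a = j
      · subst h; simp
      · simp only [Matrix.updateRow_ne h]
        exact (hK a b).differentiableAt
    exact (differentiable_det' (n := n) _).comp s this

lemma MD.inv {n : Type*} [Fintype n] [DecidableEq n] {K : ℝ → Matrix n n ℝ}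
    {K' : Matrix n n ℝ} {s : ℝ} (hK : MD K K' s) (hu : IsUnit (K s).det) :
    MD (fun t => (K t)⁻¹) (-((K s)⁻¹ * K' * (K s)⁻¹)) s := by
  set Q' : Matrix n n ℝ := Matrix.of fun i j => deriv (fun t => (K t)⁻¹ i j) s with hQ'
  have hQ : MD (fun t => (K t)⁻¹) Q' s := fun i j =>
    (differentiableAt_inv_entry hK hu i j).hasDerivAt
  have h1 := hQ.mul hK
  have hev : ∀ᶠ t in nhds s, IsUnit (K t).det := by
    have := (hasDerivAt_det hK hu).continuousAt.eventually_ne hu.ne_zero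
    filter_upwards [this] with t ht using isUnit_iff_ne_zero.2 ht
  have h2 : MD (fun t => (K t)⁻¹ * K t) 0 s := by
    intro i j
    have : (fun t => ((K t)⁻¹ * K t) i j) =ᶠ[nhds s] fun _ => (1 : Matrix n n ℝ) i j := by
      filter_upwards [hev] with t ht
      rw [Matrix.nonsing_inv_mul _ ht]
    exact (hasDerivAt_const s _).congr_of_eventuallyEq this
  have h3 : Q' * K s + (K s)⁻¹ * K' = 0 := by
    ext i j; exact (h1 i j).unique (h2 i j)
  have h4 : Q' = -((K s)⁻¹ * K' * (K s)⁻¹) := by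
    have h5 : Q' * K s = -((K s)⁻¹ * K') := eq_neg_of_add_eq_zero_left h3
    calc Q' = Q' * K s * (K s)⁻¹ := by
            rw [Matrix.mul_assoc, Matrix.mul_nonsing_inv _ hu, Matrix.mul_one]
      _ = _ := by rw [h5, Matrix.neg_mul]
  rw [← h4]; exact hQ

end

section

/-! ### Part B: the Gaussian proxy -/

/-- index set of the full space -/
abbrev N2 (d : ℕ) := Fin d ⊕ Fin d

/-- squared euclidean norm -/
def nsq {ι : Type*} [Fintype ι] (v : ι → ℝ) : ℝ := v ⬝ᵥ v

lemma nsq_eq {ι : Type*} [Fintype ι] (v : ι → ℝ) : nsq v = ∑ i, v i ^ 2 := by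
  simp [nsq, dotProduct, sq]

lemma nsq_nonneg {ι : Type*} [Fintype ι] (v : ι → ℝ) : 0 ≤ nsq v := by
  rw [nsq_eq]; positivity

lemma nsq_add_le {ι : Type*} [Fintype ι] (v w : ι → ℝ) : nsq (v + w) ≤ 2 * nsq v + 2 * nsq w := by
  simp only [nsq_eq, Finset.mul_sum, ← Finset.sum_add_distrib, Pi.add_apply]
  exact Finset.sum_le_sum fun i _ => by nlinarith [sq_nonneg (v i - w i)]

lemma nsq_sub_le {ι : Type*} [Fintype ι] (v w : ι → ℝ) : nsq (v - w) ≤ 2 * nsq v + 2 * nsq w := by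
  simp only [nsq_eq, Finset.mul_sum, ← Finset.sum_add_distrib, Pi.sub_apply]
  exact Finset.sum_le_sum fun i _ => by nlinarith [sq_nonneg (v i + w i)]

lemma sq_le_nsq {ι : Type*} [Fintype ι] (v : ι → ℝ) (i : ι) : v i ^ 2 ≤ nsq v := by
  rw [nsq_eq]
  exact Finset.single_le_sum (f := fun i => v i ^ 2) (fun j _ => sq_nonneg _) (Finset.mem_univ i)

/-- first block -/
def v1 {d : ℕ} (ξ : N2 d → ℝ) : Fin d → ℝ := fun i => ξ (Sum.inl i)
/-- second block -/
def v2 {d : ℕ} (ξ : N2 d → ℝ) : Fin d → ℝ := fun i => ξ (Sum.inr i)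

/-- weighted form -/
def W {d : ℕ} (τ : ℝ) (ξ : N2 d → ℝ) : ℝ := τ * nsq (v1 ξ) + τ ^ 3 * nsq (v2 ξ)
/-- inverse weighted form -/
def Wi {d : ℕ} (τ : ℝ) (ξ : N2 d → ℝ) : ℝ := nsq (v1 ξ) / τ + nsq (v2 ξ) / τ ^ 3

def Bm {d : ℕ} (D : ℝ → Matrix (Fin d) (Fin d) ℝ) (r s : ℝ) : Matrix (Fin d) (Fin d) ℝ :=
  Matrix.of fun i j => ∫ u in s..r, D u i j

def Rm {d : ℕ} (D : ℝ → Matrix (Fin d) (Fin d) ℝ) (r s : ℝ) : Matrix (N2 d) (N2 d) ℝ :=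
  fromBlocks 1 0 (Bm D r s) 1

/-- noise matrix seen at time `r`. -/
def Sm {d : ℕ} (σ D : ℝ → Matrix (Fin d) (Fin d) ℝ) (r s : ℝ) : Matrix (N2 d) (Fin d) ℝ :=
  fromRows (σ s) (Bm D r s * σ s)

def Kd {d : ℕ} (κ : ℝ) : N2 d → ℝ := Sum.elim (fun _ => κ) (fun _ => κ ^ 3)

def Km {d : ℕ} (σ D : ℝ → Matrix (Fin d) (Fin d) ℝ) (r κ s : ℝ) : Matrix (N2 d) (N2 d) ℝ :=
  diagonal (Kd κ) + Matrix.of fun i j => ∫ u in s..r, (Sm σ D r u * (Sm σ D r u)ᵀ) i j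

/-- the precision matrix -/
def Pm {d : ℕ} (σ D : ℝ → Matrix (Fin d) (Fin d) ℝ) (r κ s : ℝ) : Matrix (N2 d) (N2 d) ℝ :=
  (Rm D r s)ᵀ * (Km σ D r κ s)⁻¹ * Rm D r s

/-- hypotheses on frozen curves -/
structure CH {d : ℕ} (σ D : ℝ → Matrix (Fin d) (Fin d) ℝ) (c C : ℝ) : Prop where
  σc : ∀ i j, Continuous fun u => σ u i j
  Dc : ∀ i j, Continuous fun u => D u i j
  c0 : 0 < c
  C0 : 1 ≤ C
  σlow : ∀ u ζ, c * nsq ζ ≤ nsq ((σ u)ᵀ *ᵥ ζ)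
  σup : ∀ u ζ, nsq ((σ u)ᵀ *ᵥ ζ) ≤ C * nsq ζ
  Dlow : ∀ u u' ξ, u ≤ u' → c * (u' - u) ^ 2 * nsq ξ ≤ nsq ((Bm D u' u)ᵀ *ᵥ ξ)
  Dup : ∀ u u' ξ, u ≤ u' → nsq ((Bm D u' u)ᵀ *ᵥ ξ) ≤ C * (u' - u) ^ 2 * nsq ξ
  DupT : ∀ u u' ξ, u ≤ u' → nsq ((Bm D u' u) *ᵥ ξ) ≤ C * (u' - u) ^ 2 * nsq ξ

section
variable {d : ℕ} {σ D : ℝ → Matrix (Fin d) (Fin d) ℝ} {c C : ℝ}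

lemma Bm_entry_deriv (h : CH σ D c C) (r s : ℝ) : MD (fun s => Bm D r s) (-(D s)) s := by
  intro i j
  exact intervalIntegral.integral_hasDerivAt_left ((h.Dc i j).intervalIntegrable _ _)
    ((h.Dc i j).stronglyMeasurableAtFilter _ _) (h.Dc i j).continuousAt

lemma Bm_cont (h : CH σ D c C) (r : ℝ) (i j : Fin d) : Continuous fun s => Bm D r s i j :=
  continuous_iff_continuousAt.2 fun s => (Bm_entry_deriv h r s i j).continuousAt

lemma Bm_sub (h : CH σ D c C) (r s u : ℝ) : Bm D r s - Bm D r u = Bm D u s := by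
  ext i j
  simp only [Bm, Matrix.sub_apply, Matrix.of_apply]
  rw [sub_eq_iff_eq_add, intervalIntegral.integral_add_adjacent_intervals] <;>
  exact (h.Dc i j).intervalIntegrable _ _

lemma Sm_cont (h : CH σ D c C) (r : ℝ) (i : N2 d) (j : Fin d) :
    Continuous fun s => Sm σ D r s i j := by
  rcases i with i | i
  · exact h.σc i j
  · simp only [Sm, fromRows_apply_inr, Matrix.mul_apply]
    exact continuous_finsetSum _ fun k _ => (Bm_cont h r i k).mul (h.σc k j)

lemma SmT_mulVec (r s : ℝ) (ξ : N2 d → ℝ) :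
    (Sm σ D r s)ᵀ *ᵥ ξ = (σ s)ᵀ *ᵥ (v1 ξ + (Bm D r s)ᵀ *ᵥ v2 ξ) := by
  rw [Sm, transpose_fromRows, fromCols_mulVec, Matrix.transpose_mul, Matrix.mulVec_add,
    Matrix.mulVec_mulVec]
  rfl

lemma SS_cont (h : CH σ D c C) (r : ℝ) (i j : N2 d) :
    Continuous fun s => (Sm σ D r s * (Sm σ D r s)ᵀ) i j := by
  simp only [Matrix.mul_apply, Matrix.transpose_apply]
  exact continuous_finsetSum _ fun k _ => (Sm_cont h r i k).mul (Sm_cont h r j k)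

lemma form_mul_transpose {m n : Type*} [Fintype m] [Fintype n] (S : Matrix m n ℝ) (ξ : m → ℝ) :
    ξ ⬝ᵥ ((S * Sᵀ) *ᵥ ξ) = nsq (Sᵀ *ᵥ ξ) := by
  rw [nsq, ← Matrix.mulVec_mulVec, Matrix.dotProduct_mulVec, ← Matrix.mulVec_transpose]

lemma nsq_SmT_cont (h : CH σ D c C) (r : ℝ) (ξ : N2 d → ℝ) :
    Continuous fun u => nsq ((Sm σ D r u)ᵀ *ᵥ ξ) := by
  simp only [nsq_eq, Matrix.mulVec, dotProduct, Matrix.transpose_apply]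
  exact continuous_finsetSum _ fun k _ => (continuous_finsetSum _ fun j _ =>
    (Sm_cont h r j k).mul continuous_const).pow 2

lemma form_Km (h : CH σ D c C) (r κ s : ℝ) (ξ : N2 d → ℝ) :
    ξ ⬝ᵥ (Km σ D r κ s *ᵥ ξ) = W κ ξ + ∫ u in s..r, nsq ((Sm σ D r u)ᵀ *ᵥ ξ) := by
  rw [Km, Matrix.add_mulVec, dotProduct_add]
  congr 1
  · simp [dotProduct, mulVec_diagonal, W, nsq_eq, Kd, v1, v2, Finset.mul_sum]
    congr 1 <;> exact Finset.sum_congr rfl fun i _ => by ring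
  · simp_rw [← form_mul_transpose]
    simp only [dotProduct, Matrix.mulVec, Matrix.of_apply]
    rw [intervalIntegral.integral_finsetSum]
    · refine Finset.sum_congr rfl fun i _ => ?_
      rw [intervalIntegral.integral_const_mul, intervalIntegral.integral_finsetSum]
      · simp_rw [intervalIntegral.integral_mul_const]
      · intro j _
        exact ((SS_cont h r i j).mul continuous_const).intervalIntegrable _ _
    · intro i _
      exact (continuous_const.mul (continuous_finsetSum _ fun j _ =>
        (SS_cont h r i j).mul continuous_const)).intervalIntegrable _ _

def wv (D : ℝ → Matrix (Fin d) (Fin d) ℝ) (r : ℝ) (ξ : N2 d → ℝ) (u : ℝ) : Fin d → ℝ :=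
  v1 ξ + (Bm D r u)ᵀ *ᵥ v2 ξ

lemma wv_cont (h : CH σ D c C) (r : ℝ) (ξ : N2 d → ℝ) : Continuous fun u => nsq (wv D r ξ u) := by
  simp only [nsq_eq, wv, Matrix.mulVec, dotProduct, Matrix.transpose_apply, Pi.add_apply]
  exact continuous_finsetSum _ fun k _ => (continuous_const.add (continuous_finsetSum _ fun j _ =>
    (Bm_cont h r j k).mul continuous_const)).pow 2

lemma wv_bound2 (h : CH σ D c C) {r s : ℝ} (hs : s ≤ r) (ξ : N2 d → ℝ) :
    c * (r - s) ^ 3 * nsq (v2 ξ) ≤ 16 * ∫ u in s..r, nsq (wv D r ξ u) := by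
  set l := (r - s) / 2 with hl
  have hl0 : 0 ≤ l := by rw [hl]; linarith
  have hf := wv_cont h r ξ
  have h1 : ∀ u, c * l ^ 2 * nsq (v2 ξ) ≤ 2 * nsq (wv D r ξ u) + 2 * nsq (wv D r ξ (u + l)) := by
    intro u
    refine le_trans ?_ (nsq_sub_le _ _)
    have : wv D r ξ u - wv D r ξ (u + l) = (Bm D (u + l) u)ᵀ *ᵥ v2 ξ := by
      rw [← Bm_sub h r u (u + l), Matrix.transpose_sub, Matrix.sub_mulVec, wv, wv]
      abel
    rw [this]
    have := h.Dlow u (u + l) (v2 ξ) (by linarith)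
    simpa using this
  have h2 : ∫ u in s..(s + l), c * l ^ 2 * nsq (v2 ξ) ≤
      ∫ u in s..(s + l), (2 * nsq (wv D r ξ u) + 2 * nsq (wv D r ξ (u + l))) := by
    apply intervalIntegral.integral_mono_on (by linarith)
    · exact intervalIntegrable_const
    · apply Continuous.intervalIntegrable
      exact (continuous_const.mul hf).add (continuous_const.mul
        (hf.comp (continuous_id.add continuous_const)))
    · intro u _; exact h1 u
  rw [intervalIntegral.integral_const, intervalIntegral.integral_add,
    intervalIntegral.integral_const_mul, intervalIntegral.integral_const_mul,
    intervalIntegral.integral_comp_add_right (fun u => nsq (wv D r ξ u)), ← mul_add,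
    intervalIntegral.integral_add_adjacent_intervals] at h2
  · have e : s + l + l = r := by rw [hl]; ring
    rw [e] at h2
    have e2 : r - s = 2 * l := by rw [hl]; ring
    rw [e2]
    simp only [add_sub_cancel_left, smul_eq_mul] at h2
    nlinarith
  · exact hf.intervalIntegrable _ _
  · exact hf.intervalIntegrable _ _
  · exact (continuous_const.mul hf).intervalIntegrable _ _
  · exact (continuous_const.mul (hf.comp (continuous_id.add continuous_const))).intervalIntegrable
      _ _

lemma wv_bound1 (h : CH σ D c C) {r s : ℝ} (hs : s ≤ r) (ξ : N2 d → ℝ) :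
    (r - s) * nsq (v1 ξ) ≤ 2 * (∫ u in s..r, nsq (wv D r ξ u))
      + 2 * C * (r - s) ^ 3 * nsq (v2 ξ) := by
  have hf := wv_cont h r ξ
  have hC := h.C0
  have h1 : ∀ u ∈ Icc s r, nsq (v1 ξ) ≤
      2 * nsq (wv D r ξ u) + 2 * C * (r - s) ^ 2 * nsq (v2 ξ) := by
    intro u hu
    have e : v1 ξ = wv D r ξ u - (Bm D r u)ᵀ *ᵥ v2 ξ := by rw [wv]; abel
    have h3 := h.Dup u r (v2 ξ) hu.2
    have h4 : (r - u) ^ 2 ≤ (r - s) ^ 2 := by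
      apply pow_le_pow_left₀ <;> linarith [hu.1, hu.2]
    have h5 : C * (r - u) ^ 2 * nsq (v2 ξ) ≤ C * (r - s) ^ 2 * nsq (v2 ξ) := by
      have := nsq_nonneg (v2 ξ); gcongr
    have := nsq_sub_le (wv D r ξ u) ((Bm D r u)ᵀ *ᵥ v2 ξ)
    rw [← e] at this
    linarith
  have h2 : ∫ u in s..r, nsq (v1 ξ) ≤
      ∫ u in s..r, (2 * nsq (wv D r ξ u) + 2 * C * (r - s) ^ 2 * nsq (v2 ξ)) := by
    apply intervalIntegral.integral_mono_on hs
    · exact intervalIntegrable_const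
    · exact ((continuous_const.mul hf).add continuous_const).intervalIntegrable _ _
    · exact h1
  rw [intervalIntegral.integral_const, intervalIntegral.integral_add,
    intervalIntegral.integral_const_mul, intervalIntegral.integral_const] at h2
  · simp only [smul_eq_mul] at h2
    nlinarith
  · exact (continuous_const.mul hf).intervalIntegrable _ _
  · exact intervalIntegrable_const

lemma wv_up (h : CH σ D c C) {r s : ℝ} (hs : s ≤ r) (ξ : N2 d → ℝ) :
    (∫ u in s..r, nsq (wv D r ξ u)) ≤ 2 * (r - s) * nsq (v1 ξ)
      + 2 * C * (r - s) ^ 3 * nsq (v2 ξ) := by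
  have hf := wv_cont h r ξ
  have hC := h.C0
  have h1 : ∀ u ∈ Icc s r, nsq (wv D r ξ u) ≤
      2 * nsq (v1 ξ) + 2 * C * (r - s) ^ 2 * nsq (v2 ξ) := by
    intro u hu
    have h3 := h.Dup u r (v2 ξ) hu.2
    have h4 : (r - u) ^ 2 ≤ (r - s) ^ 2 := by
      apply pow_le_pow_left₀ <;> linarith [hu.1, hu.2]
    have h5 : C * (r - u) ^ 2 * nsq (v2 ξ) ≤ C * (r - s) ^ 2 * nsq (v2 ξ) := by
      have := nsq_nonneg (v2 ξ); gcongr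
    have := nsq_add_le (v1 ξ) ((Bm D r u)ᵀ *ᵥ v2 ξ)
    rw [wv]
    linarith
  have h2 : ∫ u in s..r, nsq (wv D r ξ u) ≤
      ∫ u in s..r, (2 * nsq (v1 ξ) + 2 * C * (r - s) ^ 2 * nsq (v2 ξ)) := by
    apply intervalIntegral.integral_mono_on hs
    · exact hf.intervalIntegrable _ _
    · exact intervalIntegrable_const
    · exact h1
  rw [intervalIntegral.integral_const] at h2
  simp only [smul_eq_mul] at h2
  nlinarith

/-- lower constant -/
def cK (c C : ℝ) : ℝ := 1 / (4 * (1 + (2 + (2 * C + 1) * (16 / c)) / c))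

/-- upper constant -/
def CK (C : ℝ) : ℝ := 1 + 2 * C + 2 * C ^ 2

lemma cK_pos (h : CH σ D c C) : 0 < cK c C := by
  have := h.c0; have := h.C0; unfold cK; positivity

lemma CK_pos (h : CH σ D c C) : 0 < CK C := by
  have := h.C0; unfold CK; positivity

lemma J_bounds (h : CH σ D c C) {r s : ℝ} (hs : s ≤ r) (ξ : N2 d → ℝ) :
    c * (∫ u in s..r, nsq (wv D r ξ u)) ≤ (∫ u in s..r, nsq ((Sm σ D r u)ᵀ *ᵥ ξ)) ∧
    (∫ u in s..r, nsq ((Sm σ D r u)ᵀ *ᵥ ξ)) ≤ C * ∫ u in s..r, nsq (wv D r ξ u) := by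
  have hf := wv_cont h r ξ
  have hg := nsq_SmT_cont h r ξ
  rw [← intervalIntegral.integral_const_mul, ← intervalIntegral.integral_const_mul]
  constructor
  · apply intervalIntegral.integral_mono_on hs ((continuous_const.mul hf).intervalIntegrable _ _)
      (hg.intervalIntegrable _ _)
    intro u _
    rw [SmT_mulVec]; exact h.σlow u _
  · apply intervalIntegral.integral_mono_on hs (hg.intervalIntegrable _ _)
      ((continuous_const.mul hf).intervalIntegrable _ _)
    intro u _
    rw [SmT_mulVec]; exact h.σup u _

lemma Km_low (h : CH σ D c C) {r κ s : ℝ} (hs : s ≤ r) (hκ : 0 < κ) (ξ : N2 d → ℝ) :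
    cK c C * W (r - s + κ) ξ ≤ ξ ⬝ᵥ (Km σ D r κ s *ᵥ ξ) := by
  rw [form_Km h]
  obtain ⟨hJ, -⟩ := J_bounds h hs ξ
  have b2 := wv_bound2 h hs ξ
  have b1 := wv_bound1 h hs ξ
  set I := ∫ u in s..r, nsq (wv D r ξ u)
  set J := ∫ u in s..r, nsq ((Sm σ D r u)ᵀ *ᵥ ξ)
  have hc := h.c0
  have hC := h.C0
  set l := r - s with hl
  have hl0 : 0 ≤ l := by linarith
  have n1 := nsq_nonneg (v1 ξ)
  have n2 := nsq_nonneg (v2 ξ)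
  set A := (2 + (2 * C + 1) * (16 / c)) / c with hA
  have e2 : l ^ 3 * nsq (v2 ξ) ≤ 16 / c * I := by
    rw [div_mul_eq_mul_div, le_div_iff₀ hc]; linarith
  have eI : I ≤ J / c := by rw [le_div_iff₀ hc]; linarith
  have e1 : l * nsq (v1 ξ) + l ^ 3 * nsq (v2 ξ) ≤ A * J := by
    have : A * J = (2 + (2 * C + 1) * (16 / c)) * (J / c) := by rw [hA]; field_simp
    rw [this]
    calc _ ≤ (2 + (2 * C + 1) * (16 / c)) * I := by nlinarith
      _ ≤ _ := by gcongr
  have hA0 : 0 < A := by rw [hA]; positivity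
  have hc3 : (l + κ) ^ 3 ≤ 4 * (κ ^ 3 + l ^ 3) := by
    nlinarith [mul_nonneg (add_nonneg hl0 hκ.le) (sq_nonneg (l - κ))]
  have hJ0 : 0 ≤ J := by
    have : 0 ≤ l * nsq (v1 ξ) + l ^ 3 * nsq (v2 ξ) := by positivity
    by_contra hneg
    push Not at hneg
    nlinarith
  unfold cK
  rw [← hA, one_div_mul_eq_div, div_le_iff₀ (by positivity)]
  unfold W
  have h3 : (l + κ) ^ 3 * nsq (v2 ξ) ≤ 4 * (κ ^ 3 + l ^ 3) * nsq (v2 ξ) := by gcongr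
  have p1 : 0 ≤ κ * nsq (v1 ξ) := by positivity
  have p2 : 0 ≤ κ ^ 3 * nsq (v2 ξ) := by positivity
  have p3 : 0 ≤ l * nsq (v1 ξ) := by positivity
  have p4 : 0 ≤ A * (κ * nsq (v1 ξ)) := by positivity
  have p5 : 0 ≤ A * (κ ^ 3 * nsq (v2 ξ)) := by positivity
  nlinarith

lemma Km_up (h : CH σ D c C) {r κ s : ℝ} (hs : s ≤ r) (hκ : 0 < κ) (ξ : N2 d → ℝ) :
    ξ ⬝ᵥ (Km σ D r κ s *ᵥ ξ) ≤ CK C * W (r - s + κ) ξ := by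
  rw [form_Km h]
  obtain ⟨-, hJ⟩ := J_bounds h hs ξ
  have b := wv_up h hs ξ
  set I := ∫ u in s..r, nsq (wv D r ξ u)
  set J := ∫ u in s..r, nsq ((Sm σ D r u)ᵀ *ᵥ ξ)
  have hC := h.C0
  set l := r - s with hl
  have hl0 : 0 ≤ l := by linarith
  have n1 := nsq_nonneg (v1 ξ)
  have n2 := nsq_nonneg (v2 ξ)
  have hJ2 : J ≤ C * (2 * l * nsq (v1 ξ) + 2 * C * l ^ 3 * nsq (v2 ξ)) :=
    hJ.trans (by gcongr)
  have hc3 : κ ^ 3 + l ^ 3 ≤ (l + κ) ^ 3 := by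
    nlinarith [mul_nonneg (mul_nonneg hl0 hκ.le) (add_nonneg hl0 hκ.le)]
  have h3 : (κ ^ 3 + l ^ 3) * nsq (v2 ξ) ≤ (l + κ) ^ 3 * nsq (v2 ξ) := by gcongr
  unfold CK W
  have p1 : 0 ≤ κ * nsq (v1 ξ) := by positivity
  have p2 : 0 ≤ κ ^ 3 * nsq (v2 ξ) := by positivity
  have p3 : 0 ≤ l * nsq (v1 ξ) := by positivity
  have p4 : 0 ≤ l ^ 3 * nsq (v2 ξ) := by positivity
  have q1 : 0 ≤ C * (κ * nsq (v1 ξ)) := by positivity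
  have q2 : 0 ≤ C ^ 2 * (κ * nsq (v1 ξ)) := by positivity
  have q3 : 0 ≤ C ^ 2 * (l * nsq (v1 ξ)) := by positivity
  have q4 : (2 * C + 2 * C ^ 2) * ((κ ^ 3 + l ^ 3) * nsq (v2 ξ)) ≤
    (2 * C + 2 * C ^ 2) * ((l + κ) ^ 3 * nsq (v2 ξ)) := by gcongr
  have q5 : 0 ≤ (2 * C + 2 * C ^ 2) * (κ ^ 3 * nsq (v2 ξ)) := by positivity
  have q6 : 0 ≤ C * (l ^ 3 * nsq (v2 ξ)) := by positivity
  nlinarith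

lemma Km_symm (r κ s : ℝ) : (Km σ D r κ s)ᵀ = Km σ D r κ s := by
  rw [Km, Matrix.transpose_add, diagonal_transpose]
  congr 1
  ext i j
  simp only [Matrix.transpose_apply, Matrix.of_apply]
  congr 1
  ext u
  rw [← Matrix.transpose_apply (Sm σ D r u * (Sm σ D r u)ᵀ), Matrix.transpose_mul,
    Matrix.transpose_transpose]

lemma W_pos {τ : ℝ} (hτ : 0 < τ) {ξ : N2 d → ℝ} (hξ : ξ ≠ 0) : 0 < W τ ξ := by
  obtain ⟨i, hi⟩ := Function.ne_iff.1 hξ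
  have hi2 : 0 < ξ i ^ 2 := by
    have : ξ i ≠ 0 := hi
    positivity
  have n1 := nsq_nonneg (v1 ξ)
  have n2 := nsq_nonneg (v2 ξ)
  unfold W
  rcases i with i | i
  · have : 0 < nsq (v1 ξ) := lt_of_lt_of_le hi2 (sq_le_nsq (v1 ξ) i)
    positivity
  · have : 0 < nsq (v2 ξ) := lt_of_lt_of_le hi2 (sq_le_nsq (v2 ξ) i)
    positivity

lemma Km_posDef (h : CH σ D c C) {r κ s : ℝ} (hs : s ≤ r) (hκ : 0 < κ) :
    (Km σ D r κ s).PosDef := by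
  refine Matrix.PosDef.of_dotProduct_mulVec_pos ?_ ?_
  · rw [Matrix.IsHermitian, Matrix.conjTranspose_eq_transpose_of_trivial, Km_symm]
  · intro ξ hξ
    simp only [star_trivial]
    refine lt_of_lt_of_le ?_ (Km_low h hs hκ ξ)
    exact mul_pos (cK_pos h) (W_pos (by linarith) hξ)

lemma Km_det_pos (h : CH σ D c C) {r κ s : ℝ} (hs : s ≤ r) (hκ : 0 < κ) :
    0 < (Km σ D r κ s).det := (Km_posDef h hs hκ).det_pos

end

end

section

/-! ### Part C: bounds and derivatives for the precision matrix -/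

section
variable {d : ℕ} {σ D : ℝ → Matrix (Fin d) (Fin d) ℝ} {c C : ℝ}

lemma W_nonneg {τ : ℝ} (hτ : 0 < τ) (ξ : N2 d → ℝ) : 0 ≤ W τ ξ := by
  have n1 := nsq_nonneg (v1 ξ)
  have n2 := nsq_nonneg (v2 ξ)
  unfold W; positivity

lemma Wi_nonneg {τ : ℝ} (hτ : 0 < τ) (ξ : N2 d → ℝ) : 0 ≤ Wi τ ξ := by
  have n1 := nsq_nonneg (v1 ξ)
  have n2 := nsq_nonneg (v2 ξ)
  unfold Wi; positivity

lemma dot_split (ξ z : N2 d → ℝ) : ξ ⬝ᵥ z = v1 ξ ⬝ᵥ v1 z + v2 ξ ⬝ᵥ v2 z := by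
  simp [dotProduct, v1, v2]

lemma dot_le {ι : Type*} [Fintype ι] (v w : ι → ℝ) {a : ℝ} (ha : 0 < a) :
    2 * (v ⬝ᵥ w) ≤ a * nsq v + nsq w / a := by
  have := nsq_nonneg (a • v - w)
  have e : nsq (a • v - w) = a ^ 2 * nsq v - 2 * a * (v ⬝ᵥ w) + nsq w := by
    simp only [nsq, sub_dotProduct, dotProduct_sub, smul_dotProduct, dotProduct_smul, smul_eq_mul,
      dotProduct_comm w v]
    ring
  rw [e] at this
  have h2 : a * (2 * (v ⬝ᵥ w)) ≤ a * (a * nsq v + nsq w / a) := by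
    have : a * (nsq w / a) = nsq w := by field_simp
    rw [mul_add, this]; nlinarith
  exact le_of_mul_le_mul_left h2 ha

lemma dot_W_le {τ ε : ℝ} (hτ : 0 < τ) (hε : 0 < ε) (ξ z : N2 d → ℝ) :
    2 * (ξ ⬝ᵥ z) ≤ ε * W τ ξ + Wi τ z / ε := by
  rw [dot_split]
  have h1 := dot_le (v1 ξ) (v1 z) (a := ε * τ) (by positivity)
  have h2 := dot_le (v2 ξ) (v2 z) (a := ε * τ ^ 3) (by positivity)
  have e : ε * W τ ξ + Wi τ z / ε = (ε * τ * nsq (v1 ξ) + nsq (v1 z) / (ε * τ)) +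
    (ε * τ ^ 3 * nsq (v2 ξ) + nsq (v2 z) / (ε * τ ^ 3)) := by
    unfold W Wi; field_simp; ring
  rw [e]; linarith

lemma Km_unit (h : CH σ D c C) {r κ s : ℝ} (hs : s ≤ r) (hκ : 0 < κ) :
    IsUnit (Km σ D r κ s).det := (Km_det_pos h hs hκ).ne'.isUnit

lemma Q_up (h : CH σ D c C) {r κ s : ℝ} (hs : s ≤ r) (hκ : 0 < κ) (z : N2 d → ℝ) :
    W (r - s + κ) ((Km σ D r κ s)⁻¹ *ᵥ z) ≤ Wi (r - s + κ) z / cK c C ^ 2 := by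
  set τ := r - s + κ with hτ
  have hτ0 : 0 < τ := by linarith
  set ξ := (Km σ D r κ s)⁻¹ *ᵥ z with hξ
  have hK : Km σ D r κ s *ᵥ ξ = z := by
    rw [hξ, Matrix.mulVec_mulVec, Matrix.mul_nonsing_inv _ (Km_unit h hs hκ), Matrix.one_mulVec]
  have h1 := Km_low h hs hκ ξ
  rw [hK] at h1
  have hc := cK_pos h
  have h2 := dot_W_le hτ0 hc ξ z
  have h3 : cK c C * W τ ξ ≤ Wi τ z / cK c C := by linarith
  rw [le_div_iff₀ (by positivity)]
  rw [le_div_iff₀ hc] at h3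
  nlinarith

lemma Q_low (h : CH σ D c C) {r κ s : ℝ} (hs : s ≤ r) (hκ : 0 < κ) (z : N2 d → ℝ) :
    Wi (r - s + κ) z ≤ CK C * (z ⬝ᵥ ((Km σ D r κ s)⁻¹ *ᵥ z)) := by
  set τ := r - s + κ with hτ
  have hτ0 : 0 < τ := by linarith
  set ξ := (Km σ D r κ s)⁻¹ *ᵥ z with hξ
  have hK : Km σ D r κ s *ᵥ ξ = z := by
    rw [hξ, Matrix.mulVec_mulVec, Matrix.mul_nonsing_inv _ (Km_unit h hs hκ), Matrix.one_mulVec]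
  set e : N2 d → ℝ := Sum.elim (fun i => v1 z i / τ) (fun i => v2 z i / τ ^ 3) with he
  have hez : e ⬝ᵥ z = Wi τ z := by
    rw [dot_split]
    simp only [dotProduct, Wi, nsq, Finset.sum_div, he, v1, v2, Sum.elim_inl, Sum.elim_inr]
    congr 1 <;> exact Finset.sum_congr rfl fun i _ => by ring
  have heW : W τ e = Wi τ z := by
    simp only [W, Wi, nsq_eq, he, v1, v2, Sum.elim_inl, Sum.elim_inr, Finset.sum_div,
      Finset.mul_sum]
    congr 1 <;> exact Finset.sum_congr rfl fun i _ => by field_simp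
  have hC := CK_pos h
  have h1 := Km_up h hs hκ e
  have h0 := Km_low h hs hκ (CK C • ξ - e)
  have hW : 0 ≤ W τ (CK C • ξ - e) := W_nonneg hτ0 _
  have hc := cK_pos h
  have h0' : 0 ≤ (CK C • ξ - e) ⬝ᵥ (Km σ D r κ s *ᵥ (CK C • ξ - e)) :=
    le_trans (by positivity) h0
  have sy : ξ ⬝ᵥ (Km σ D r κ s *ᵥ e) = Wi τ z := by
    rw [Matrix.dotProduct_mulVec, ← Matrix.mulVec_transpose, Km_symm, hK, dotProduct_comm, hez]
  rw [Matrix.mulVec_sub, Matrix.mulVec_smul, hK] at h0'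
  simp only [sub_dotProduct, dotProduct_sub, smul_dotProduct, dotProduct_smul, smul_eq_mul, sy,
    hez, dotProduct_comm ξ z] at h0'
  rw [heW] at h1
  nlinarith

lemma v1_Rm (r s : ℝ) (w : N2 d → ℝ) : v1 (Rm D r s *ᵥ w) = v1 w := by
  ext i; simp [v1, Rm, fromBlocks_mulVec]

lemma v2_Rm (r s : ℝ) (w : N2 d → ℝ) : v2 (Rm D r s *ᵥ w) = Bm D r s *ᵥ v1 w + v2 w := by
  ext i; simp [v1, v2, Rm, fromBlocks_mulVec]; rfl

lemma v1_RmT (r s : ℝ) (w : N2 d → ℝ) :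
    v1 ((Rm D r s)ᵀ *ᵥ w) = v1 w + (Bm D r s)ᵀ *ᵥ v2 w := by
  ext i; simp [v1, v2, Rm, fromBlocks_transpose, fromBlocks_mulVec]; rfl

lemma v2_RmT (r s : ℝ) (w : N2 d → ℝ) : v2 ((Rm D r s)ᵀ *ᵥ w) = v2 w := by
  ext i; simp [v2, Rm, fromBlocks_transpose, fromBlocks_mulVec]

lemma Wi_aux (h : CH σ D c C) {r κ s : ℝ} (hs : s ≤ r) (hκ : 0 < κ) (v : Fin d → ℝ) :
    nsq (Bm D r s *ᵥ v) / (r - s + κ) ^ 3 ≤ C * (nsq v / (r - s + κ)) := by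
  have h1 := h.DupT s r v hs
  have hC := h.C0
  have n := nsq_nonneg v
  have hl : 0 ≤ r - s := by linarith
  have hτ0 : 0 < r - s + κ := by linarith
  rw [div_le_iff₀ (by positivity)]
  have e : C * (nsq v / (r - s + κ)) * (r - s + κ) ^ 3 = C * (r - s + κ) ^ 2 * nsq v := by
    field_simp
  rw [e]
  refine h1.trans ?_
  gcongr
  linarith

lemma Wi_le_R (h : CH σ D c C) {r κ s : ℝ} (hs : s ≤ r) (hκ : 0 < κ) (w : N2 d → ℝ) :
    Wi (r - s + κ) w ≤ (2 + 2 * C) * Wi (r - s + κ) (Rm D r s *ᵥ w) := by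
  have hτ0 : 0 < r - s + κ := by linarith
  have ha := Wi_aux h hs hκ (v1 w)
  have hC := h.C0
  unfold Wi
  rw [v1_Rm, v2_Rm]
  set τ := r - s + κ
  have e : v2 w = (Bm D r s *ᵥ v1 w + v2 w) - Bm D r s *ᵥ v1 w := by abel
  have h1 := nsq_sub_le (Bm D r s *ᵥ v1 w + v2 w) (Bm D r s *ᵥ v1 w)
  rw [← e] at h1
  have h2 : nsq (v2 w) / τ ^ 3 ≤ 2 * (nsq (Bm D r s *ᵥ v1 w + v2 w) / τ ^ 3) +
      2 * (nsq (Bm D r s *ᵥ v1 w) / τ ^ 3) := by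
    rw [← mul_div_assoc, ← mul_div_assoc, ← add_div]; gcongr
  have n1 : 0 ≤ nsq (v1 w) / τ := div_nonneg (nsq_nonneg _) hτ0.le
  have n2 : 0 ≤ nsq (Bm D r s *ᵥ v1 w + v2 w) / τ ^ 3 := div_nonneg (nsq_nonneg _) (by positivity)
  nlinarith

lemma Wi_R_le (h : CH σ D c C) {r κ s : ℝ} (hs : s ≤ r) (hκ : 0 < κ) (w : N2 d → ℝ) :
    Wi (r - s + κ) (Rm D r s *ᵥ w) ≤ (2 + 2 * C) * Wi (r - s + κ) w := by
  have hτ0 : 0 < r - s + κ := by linarith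
  have ha := Wi_aux h hs hκ (v1 w)
  have hC := h.C0
  unfold Wi
  rw [v1_Rm, v2_Rm]
  set τ := r - s + κ
  have h1 := nsq_add_le (Bm D r s *ᵥ v1 w) (v2 w)
  have h2 : nsq (Bm D r s *ᵥ v1 w + v2 w) / τ ^ 3 ≤ 2 * (nsq (Bm D r s *ᵥ v1 w) / τ ^ 3) +
      2 * (nsq (v2 w) / τ ^ 3) := by
    rw [← mul_div_assoc, ← mul_div_assoc, ← add_div]; gcongr
  have n1 : 0 ≤ nsq (v1 w) / τ := div_nonneg (nsq_nonneg _) hτ0.le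
  have n2 : 0 ≤ nsq (v2 w) / τ ^ 3 := div_nonneg (nsq_nonneg _) (by positivity)
  nlinarith

lemma W_RT_le (h : CH σ D c C) {r κ s : ℝ} (hs : s ≤ r) (hκ : 0 < κ) (ξ : N2 d → ℝ) :
    W (r - s + κ) ((Rm D r s)ᵀ *ᵥ ξ) ≤ (2 + 2 * C) * W (r - s + κ) ξ := by
  have hC := h.C0
  unfold W
  rw [v1_RmT, v2_RmT]
  have h1 := nsq_add_le (v1 ξ) ((Bm D r s)ᵀ *ᵥ v2 ξ)
  have h2 := h.Dup s r (v2 ξ) hs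
  have hl : 0 ≤ r - s := by linarith
  have n1 := nsq_nonneg (v1 ξ)
  have n2 := nsq_nonneg (v2 ξ)
  have h3 : C * (r - s) ^ 2 * nsq (v2 ξ) ≤ C * (r - s + κ) ^ 2 * nsq (v2 ξ) := by
    gcongr; linarith
  set τ := r - s + κ
  have hτ0 : 0 < τ := by linarith
  have h4 : τ * nsq (v1 ξ + (Bm D r s)ᵀ *ᵥ v2 ξ) ≤
      τ * (2 * nsq (v1 ξ) + 2 * (C * τ ^ 2 * nsq (v2 ξ))) := by gcongr; linarith
  have p1 : 0 ≤ C * (τ * nsq (v1 ξ)) := by positivity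
  have p2 : 0 ≤ τ ^ 3 * nsq (v2 ξ) := by positivity
  nlinarith

/-- constants for `Pm` -/
def c3 (C : ℝ) : ℝ := 1 / ((2 + 2 * C) * CK C)
def C3 (c C : ℝ) : ℝ := (2 + 2 * C) ^ 2 / cK c C ^ 2

lemma c3_pos (h : CH σ D c C) : 0 < c3 C := by
  have := h.C0; have := CK_pos h; unfold c3; positivity
lemma C3_pos (h : CH σ D c C) : 0 < C3 c C := by
  have := h.C0; have := cK_pos h; unfold C3; positivity

lemma form_Pm (r κ s : ℝ) (w : N2 d → ℝ) : w ⬝ᵥ (Pm σ D r κ s *ᵥ w) =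
    (Rm D r s *ᵥ w) ⬝ᵥ ((Km σ D r κ s)⁻¹ *ᵥ (Rm D r s *ᵥ w)) := by
  rw [Pm, ← Matrix.mulVec_mulVec, ← Matrix.mulVec_mulVec, Matrix.dotProduct_mulVec w,
    Matrix.vecMul_transpose]

lemma Pm_low (h : CH σ D c C) {r κ s : ℝ} (hs : s ≤ r) (hκ : 0 < κ) (w : N2 d → ℝ) :
    c3 C * Wi (r - s + κ) w ≤ w ⬝ᵥ (Pm σ D r κ s *ᵥ w) := by
  rw [form_Pm]
  have h1 := Q_low h hs hκ (Rm D r s *ᵥ w)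
  have h2 := Wi_le_R h hs hκ w
  have hC := h.C0
  have := CK_pos h
  unfold c3
  rw [one_div_mul_eq_div, div_le_iff₀ (by positivity)]
  refine h2.trans ?_
  have := mul_le_mul_of_nonneg_left h1 (show 0 ≤ 2 + 2 * C by linarith)
  linarith

lemma Pm_up (h : CH σ D c C) {r κ s : ℝ} (hs : s ≤ r) (hκ : 0 < κ) (w : N2 d → ℝ) :
    W (r - s + κ) (Pm σ D r κ s *ᵥ w) ≤ C3 c C * Wi (r - s + κ) w := by
  have hC := h.C0
  have hc := cK_pos h
  rw [Pm, ← Matrix.mulVec_mulVec, ← Matrix.mulVec_mulVec]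
  refine (W_RT_le h hs hκ _).trans ?_
  have h1 := Q_up h hs hκ (Rm D r s *ᵥ w)
  have h2 := Wi_R_le h hs hκ w
  calc _ ≤ (2 + 2 * C) * (Wi (r - s + κ) (Rm D r s *ᵥ w) / cK c C ^ 2) := by gcongr
    _ ≤ (2 + 2 * C) * ((2 + 2 * C) * Wi (r - s + κ) w / cK c C ^ 2) := by gcongr
    _ = _ := by unfold C3; ring

lemma Pm_symm (r κ s : ℝ) : (Pm σ D r κ s)ᵀ = Pm σ D r κ s := by
  rw [Pm, Matrix.transpose_mul, Matrix.transpose_mul, Matrix.transpose_transpose,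
    Matrix.transpose_nonsing_inv, Km_symm, Matrix.mul_assoc]

lemma Wi_single_inl {τ : ℝ} (j : Fin d) : Wi τ (Pi.single (Sum.inl j) 1) = 1 / τ := by
  simp [Wi, nsq_eq, v1, v2, Pi.single_apply]

lemma Wi_single_inr {τ : ℝ} (j : Fin d) : Wi τ (Pi.single (Sum.inr j) 1) = 1 / τ ^ 3 := by
  simp [Wi, nsq_eq, v1, v2, Pi.single_apply]

lemma P11_bound (h : CH σ D c C) {r κ s : ℝ} (hs : s ≤ r) (hκ : 0 < κ) (i j : Fin d) :
    |Pm σ D r κ s (Sum.inl i) (Sum.inl j)| ≤ √(C3 c C) / (r - s + κ) := by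
  have hτ0 : 0 < r - s + κ := by linarith
  have h1 := Pm_up h hs hκ (Pi.single (Sum.inl j) 1)
  rw [Wi_single_inl] at h1
  have h2 := sq_le_nsq (v1 (Pm σ D r κ s *ᵥ (Pi.single (Sum.inl j) 1))) i
  have n2 := nsq_nonneg (v2 (Pm σ D r κ s *ᵥ (Pi.single (Sum.inl j) 1)))
  have e : v1 (Pm σ D r κ s *ᵥ (Pi.single (Sum.inl j) 1)) i = Pm σ D r κ s (Sum.inl i) (Sum.inl j) := by
    simp [v1]
  rw [e] at h2
  unfold W at h1
  set τ := r - s + κ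
  have h3 : τ * (Pm σ D r κ s (Sum.inl i) (Sum.inl j)) ^ 2 ≤ C3 c C * (1 / τ) := by
    have : 0 ≤ τ ^ 3 * nsq (v2 (Pm σ D r κ s *ᵥ (Pi.single (Sum.inl j) 1))) := by positivity
    nlinarith
  refine abs_le_of_sq_le_sq ?_ (by positivity)
  rw [div_pow, Real.sq_sqrt (C3_pos h).le, le_div_iff₀ (by positivity)]
  have h4 := mul_le_mul_of_nonneg_left h3 hτ0.le
  have e2 : τ * (C3 c C * (1 / τ)) = C3 c C := by field_simp
  rw [e2] at h4
  linarith

/-- constant for the determinant -/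
def C4 (d : ℕ) (c C : ℝ) : ℝ := (Nat.factorial (d + d)) * (1 / cK c C) ^ (d + d)

lemma C4_pos (h : CH σ D c C) : 0 < C4 d c C := by
  have := cK_pos h; unfold C4; positivity

def tw {d : ℕ} (τ : ℝ) : N2 d → ℝ := Sum.elim (fun _ => √τ) (fun _ => √τ ^ 3)

lemma Q_entry (h : CH σ D c C) {r κ s : ℝ} (hs : s ≤ r) (hκ : 0 < κ) (i j : N2 d) :
    |tw (r - s + κ) i * (Km σ D r κ s)⁻¹ i j * tw (r - s + κ) j| ≤ 1 / cK c C := by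
  have hτ0 : 0 < r - s + κ := by linarith
  have h1 := Q_up h hs hκ (Pi.single j 1)
  set τ := r - s + κ
  have hc := cK_pos h
  have hsq : √τ ^ 2 = τ := Real.sq_sqrt hτ0.le
  have ht0 : ∀ j : N2 d, 0 < tw τ j ^ 2 := by
    rintro (j | j) <;> simp [tw] <;> positivity
  have e1 : Wi τ (Pi.single j 1) = 1 / tw τ j ^ 2 := by
    rcases j with j | j
    · rw [Wi_single_inl, tw, Sum.elim_inl, hsq]
    · rw [Wi_single_inr, tw, Sum.elim_inr, ← pow_mul, mul_comm, pow_mul, hsq]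
  have e2 : tw τ i ^ 2 * ((Km σ D r κ s)⁻¹ i j) ^ 2 ≤ W τ ((Km σ D r κ s)⁻¹ *ᵥ (Pi.single j 1)) := by
    set ξ := (Km σ D r κ s)⁻¹ *ᵥ (Pi.single j 1) with hξ
    have e3 : (Km σ D r κ s)⁻¹ i j = ξ i := by simp [hξ]
    rw [e3]
    have n1 := nsq_nonneg (v1 ξ)
    have n2 := nsq_nonneg (v2 ξ)
    rcases i with i | i
    · have := sq_le_nsq (v1 ξ) i
      simp only [tw, Sum.elim_inl, hsq, W]
      have h2 : τ * (v1 ξ i) ^ 2 ≤ τ * nsq (v1 ξ) := by gcongr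
      have h3 : 0 ≤ τ ^ 3 * nsq (v2 ξ) := by positivity
      have e4 : v1 ξ i = ξ (Sum.inl i) := rfl
      rw [e4] at h2
      linarith
    · have := sq_le_nsq (v2 ξ) i
      simp only [tw, Sum.elim_inr, W]
      rw [← pow_mul, mul_comm 3 2, pow_mul, hsq]
      have h2 : τ ^ 3 * (v2 ξ i) ^ 2 ≤ τ ^ 3 * nsq (v2 ξ) := by gcongr
      have h3 : 0 ≤ τ * nsq (v1 ξ) := by positivity
      have e4 : v2 ξ i = ξ (Sum.inr i) := rfl
      rw [e4] at h2
      linarith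
  rw [e1] at h1
  refine abs_le_of_sq_le_sq ?_ (by positivity)
  have h2 := e2.trans h1
  rw [div_div, le_div_iff₀ (by have := ht0 j; positivity)] at h2
  rw [div_pow, le_div_iff₀ (by positivity)]
  nlinarith

lemma det_bound (h : CH σ D c C) {r κ s : ℝ} (hs : s ≤ r) (hκ : 0 < κ) :
    (√(Km σ D r κ s).det)⁻¹ ≤ √(C4 d c C) * ((r - s + κ) ^ (2 * d))⁻¹ := by
  have hτ0 : 0 < r - s + κ := by linarith
  have hdet := Km_det_pos h hs hκ
  set K := Km σ D r κ s with hK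
  set τ := r - s + κ with hτ
  have hsq : √τ ^ 2 = τ := Real.sq_sqrt hτ0.le
  set M : Matrix (N2 d) (N2 d) ℝ := diagonal (tw τ) * K⁻¹ * diagonal (tw τ) with hM
  have h1 : |M.det| ≤ C4 d c C := by
    have := Matrix.det_le (A := M) (abv := AbsoluteValue.abs) (x := 1 / cK c C) (by
      intro i j
      rw [hM, Matrix.mul_diagonal, Matrix.diagonal_mul]
      exact Q_entry h hs hκ i j)
    simpa [C4, Fintype.card_sum] using this
  have h2 : M.det = τ ^ (4 * d) * (K.det)⁻¹ := by
    rw [hM, Matrix.det_mul, Matrix.det_mul, Matrix.det_diagonal, Matrix.det_nonsing_inv,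
      Ring.inverse_eq_inv']
    have : ∏ i : N2 d, tw τ i = √τ ^ (4 * d) := by
      simp [Fintype.prod_sum_type, tw, ← pow_mul, ← pow_add]
      congr 1; ring
    rw [this]
    have e : τ ^ (4 * d) = √τ ^ (4 * d) * √τ ^ (4 * d) := by
      rw [← pow_add, ← two_mul, pow_mul (√τ) 2, hsq]
    rw [e]; ring
  rw [h2, abs_of_nonneg (by positivity), ← div_eq_mul_inv, div_le_iff₀ hdet] at h1
  have h3 : τ ^ (2 * d) ≤ √(C4 d c C) * √K.det := by
    rw [← Real.sqrt_mul (C4_pos h).le]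
    apply Real.le_sqrt_of_sq_le
    rw [← pow_mul, show 2 * d * 2 = 4 * d by ring]; exact h1
  have hq : 0 < √K.det := Real.sqrt_pos.2 hdet
  rw [inv_le_iff_one_le_mul₀ hq, mul_assoc, mul_comm _ (√K.det), ← mul_assoc,
    ← div_eq_mul_inv, le_div_iff₀ (by positivity), one_mul]
  exact h3

/-! derivatives -/

def Am {d : ℕ} (M : Matrix (Fin d) (Fin d) ℝ) : Matrix (N2 d) (N2 d) ℝ := fromBlocks 0 0 M 0
def ah {d : ℕ} (a : Matrix (Fin d) (Fin d) ℝ) : Matrix (N2 d) (N2 d) ℝ := fromBlocks a 0 0 0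

lemma SS_eq (r s : ℝ) : Sm σ D r s * (Sm σ D r s)ᵀ =
    Rm D r s * ah (σ s * (σ s)ᵀ) * (Rm D r s)ᵀ := by
  rw [Sm, Rm, ah, transpose_fromRows, fromRows_mul_fromCols, fromBlocks_transpose,
    fromBlocks_multiply, fromBlocks_multiply]
  simp [Matrix.mul_assoc]

lemma Km_deriv (h : CH σ D c C) (r κ s : ℝ) :
    MD (fun s => Km σ D r κ s) (-(Rm D r s * ah (σ s * (σ s)ᵀ) * (Rm D r s)ᵀ)) s := by
  intro i j
  rw [← SS_eq]
  simp only [Km, Matrix.add_apply, Matrix.of_apply, Matrix.neg_apply]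
  have := intervalIntegral.integral_hasDerivAt_left (a := s) (b := r)
    ((SS_cont h r i j).intervalIntegrable _ _)
    ((SS_cont h r i j).stronglyMeasurableAtFilter _ _) (SS_cont h r i j).continuousAt
  exact this.const_add _

lemma Rm_deriv (h : CH σ D c C) (r s : ℝ) :
    MD (fun s => Rm D r s) (-(Rm D r s * Am (D s))) s := by
  have e : Rm D r s * Am (D s) = Am (D s) := by
    rw [Rm, Am, fromBlocks_multiply]; simp
  rw [e]
  intro i j
  rcases i with i | i <;> rcases j with j | j
  · simpa [Rm, Am] using hasDerivAt_const s _
  · simpa [Rm, Am] using hasDerivAt_const s _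
  · simpa [Rm, Am] using Bm_entry_deriv h r s i j
  · simpa [Rm, Am] using hasDerivAt_const s _

def Pm' (σ D : ℝ → Matrix (Fin d) (Fin d) ℝ) (r κ s : ℝ) : Matrix (N2 d) (N2 d) ℝ :=
  Pm σ D r κ s * ah (σ s * (σ s)ᵀ) * Pm σ D r κ s - Pm σ D r κ s * Am (D s)
    - (Am (D s))ᵀ * Pm σ D r κ s

lemma Pm_deriv (h : CH σ D c C) {r κ s : ℝ} (hs : s ≤ r) (hκ : 0 < κ) :
    MD (fun s => Pm σ D r κ s) (Pm' σ D r κ s) s := by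
  have hK := (Km_deriv h r κ s).inv (Km_unit h hs hκ)
  have hR := Rm_deriv h r s
  have := (hR.transpose.mul hK).mul hR
  intro i j
  refine (this i j).congr_deriv ?_
  refine congrFun (congrFun ?_ i) j
  rw [Pm', Pm, Matrix.transpose_neg, Matrix.transpose_mul]
  noncomm_ring

lemma logdet_deriv (h : CH σ D c C) {r κ s : ℝ} (hs : s ≤ r) (hκ : 0 < κ) :
    HasDerivAt (fun s => (√(Km σ D r κ s).det)⁻¹)
      ((√(Km σ D r κ s).det)⁻¹ * (1 / 2 * (ah (σ s * (σ s)ᵀ) * Pm σ D r κ s).trace)) s := by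
  have hd := hasDerivAt_det (Km_deriv h r κ s) (Km_unit h hs hκ)
  have hp := Km_det_pos h hs hκ
  have h2 := (hd.sqrt hp.ne').inv (Real.sqrt_pos.2 hp).ne'
  refine h2.congr_deriv ?_
  have e : ((Km σ D r κ s)⁻¹ * -(Rm D r s * ah (σ s * (σ s)ᵀ) * (Rm D r s)ᵀ)).trace =
      - (ah (σ s * (σ s)ᵀ) * Pm σ D r κ s).trace := by
    rw [Matrix.mul_neg, Matrix.trace_neg, Pm, ← Matrix.mul_assoc, Matrix.trace_mul_comm]
    rw [← Matrix.mul_assoc, ← Matrix.mul_assoc,  Matrix.trace_mul_comm, ]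
  rw [e]
  have hq : 0 < √(Km σ D r κ s).det := Real.sqrt_pos.2 hp
  have hqq : √(Km σ D r κ s).det ^ 2 = (Km σ D r κ s).det := Real.sq_sqrt hp.le
  rw [hqq]
  field_simp

end

end

section

/-! ### Part D: calculus for functions of a quadratic form -/

/-- the state space -/
abbrev V (d : ℕ) := E d × E d

/-- coordinates -/
def vecL (d : ℕ) : V d →L[ℝ] (N2 d → ℝ) :=
  ContinuousLinearMap.pi fun i => Sum.elim
    (fun i => (EuclideanSpace.proj i : E d →L[ℝ] ℝ).comp (ContinuousLinearMap.fst ℝ (E d) (E d)))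
    (fun i => (EuclideanSpace.proj i : E d →L[ℝ] ℝ).comp (ContinuousLinearMap.snd ℝ (E d) (E d))) i

section
variable {d : ℕ}

@[simp] lemma vecL_inl (x : V d) (i : Fin d) : vecL d x (Sum.inl i) = x.1 i := rfl
@[simp] lemma vecL_inr (x : V d) (i : Fin d) : vecL d x (Sum.inr i) = x.2 i := rfl

lemma nsq_ofLp (x : E d) : nsq (fun i => x i) = ‖x‖ ^ 2 := by
  rw [nsq_eq, EuclideanSpace.norm_sq_eq]; simp

lemma nsq_v1 (x : V d) : nsq (v1 (vecL d x)) = ‖x.1‖ ^ 2 := nsq_ofLp x.1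
lemma nsq_v2 (x : V d) : nsq (v2 (vecL d x)) = ‖x.2‖ ^ 2 := nsq_ofLp x.2

lemma nsq_split (w : N2 d → ℝ) : nsq w = nsq (v1 w) + nsq (v2 w) := by
  simp [nsq_eq, v1, v2]

lemma nsq_vec (x : V d) : nsq (vecL d x) = ‖x.1‖ ^ 2 + ‖x.2‖ ^ 2 := by
  rw [nsq_split, nsq_v1, nsq_v2]

lemma norm_sq_le_nsq (x : V d) : ‖x‖ ^ 2 ≤ nsq (vecL d x) := by
  rw [nsq_vec, Prod.norm_def]
  rcases max_cases ‖x.1‖ ‖x.2‖ with h | h <;> rw [h.1] <;> nlinarith [sq_nonneg ‖x.1‖, sq_nonneg ‖x.2‖]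

lemma nsq_le_norm_sq (x : V d) : nsq (vecL d x) ≤ 2 * ‖x‖ ^ 2 := by
  rw [nsq_vec]
  have h1 := norm_fst_le x
  have h2 := norm_snd_le x
  have := pow_le_pow_left₀ (norm_nonneg _) h1 2
  have := pow_le_pow_left₀ (norm_nonneg _) h2 2
  linarith

lemma vecL_e1 (i : Fin d) : vecL d (e1 d i) = Pi.single (Sum.inl i) 1 := by
  ext j; rcases j with j | j <;> simp [e1, Pi.single_apply]

lemma vecL_e2 (i : Fin d) : vecL d (e2 d i) = Pi.single (Sum.inr i) 1 := by
  ext j; rcases j with j | j <;> simp [e2, Pi.single_apply]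

/-- the quadratic form -/
def qf (P : Matrix (N2 d) (N2 d) ℝ) (θ x : V d) : ℝ :=
  vecL d (x - θ) ⬝ᵥ (P *ᵥ vecL d (x - θ))

lemma hasFDerivAt_vec (θ x : V d) (i : N2 d) : HasFDerivAt (fun x => vecL d (x - θ) i)
    ((ContinuousLinearMap.proj i).comp (vecL d)) x := by
  have h : HasFDerivAt (fun x => vecL d (x - θ)) (vecL d) x := by
    have := (vecL d).hasFDerivAt.comp x ((hasFDerivAt_id x).sub_const θ)
    simpa using this
  have h2 := (ContinuousLinearMap.proj (R := ℝ) (φ := fun _ : N2 d => ℝ) i).hasFDerivAt.comp x h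
  exact h2

lemma hasFDerivAt_Pvec (P : Matrix (N2 d) (N2 d) ℝ) (θ x : V d) (i : N2 d) :
    HasFDerivAt (fun x => (P *ᵥ vecL d (x - θ)) i)
    (∑ j, P i j • ((ContinuousLinearMap.proj j).comp (vecL d)) : V d →L[ℝ] ℝ) x := by
  simp only [Matrix.mulVec, dotProduct]
  exact HasFDerivAt.fun_sum fun j _ => (hasFDerivAt_vec θ x j).const_mul _

lemma hasFDerivAt_qf (P : Matrix (N2 d) (N2 d) ℝ) (θ x : V d) : ∃ L : V d →L[ℝ] ℝ,
    HasFDerivAt (qf P θ) L x ∧ (Pᵀ = P → ∀ v, L v = 2 * (vecL d v ⬝ᵥ (P *ᵥ vecL d (x - θ)))) := by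
  have h := HasFDerivAt.fun_sum (u := Finset.univ) fun i (_ : i ∈ Finset.univ) =>
    (hasFDerivAt_vec θ x i).mul (hasFDerivAt_Pvec P θ x i)
  refine ⟨_, h, fun hP v => ?_⟩
  simp only [ContinuousLinearMap.sum_apply, ContinuousLinearMap.add_apply,
    ContinuousLinearMap.smul_apply, ContinuousLinearMap.comp_apply, ContinuousLinearMap.proj_apply,
    smul_eq_mul, Finset.sum_add_distrib]
  have e1 : ∑ i, vecL d (x - θ) i * ∑ j, P i j * vecL d v j =
      vecL d (x - θ) ⬝ᵥ (P *ᵥ vecL d v) := rfl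
  have e2 : ∑ i, (P *ᵥ vecL d (x - θ)) i * vecL d v i = vecL d v ⬝ᵥ (P *ᵥ vecL d (x - θ)) :=
    dotProduct_comm _ _
  rw [e1, e2, Matrix.dotProduct_mulVec, ← Matrix.mulVec_transpose, hP, dotProduct_comm]
  ring

lemma contDiff_qf (P : Matrix (N2 d) (N2 d) ℝ) (θ : V d) : ContDiff ℝ (⊤ : ℕ∞) (qf P θ) := by
  unfold qf
  simp only [Matrix.mulVec, dotProduct]
  have h : ∀ i, ContDiff ℝ (⊤ : ℕ∞) fun x => vecL d (x - θ) i := fun i =>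
    (((ContinuousLinearMap.proj (R := ℝ) (φ := fun _ : N2 d => ℝ) i).comp (vecL d)).contDiff).comp
      (contDiff_id.sub contDiff_const)
  exact ContDiff.sum fun i _ => (h i).mul (ContDiff.sum fun j _ => contDiff_const.mul (h j))

/-- generator of a function of a quadratic form -/
def genR (a : Matrix (Fin d) (Fin d) ℝ) (b1 b2 : E d) (f' f'' : ℝ) (P : Matrix (N2 d) (N2 d) ℝ)
    (w : N2 d → ℝ) : ℝ :=
  (1 / 2) * ∑ i, ∑ j, a i j * (4 * f'' * (P *ᵥ w) (Sum.inl i) * (P *ᵥ w) (Sum.inl j)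
      + 2 * f' * P (Sum.inl i) (Sum.inl j))
    + ∑ i, b1 i * (2 * f' * (P *ᵥ w) (Sum.inl i))
    + ∑ i, b2 i * (2 * f' * (P *ᵥ w) (Sum.inr i))

lemma gen_qf (F1 F2 : ℝ → E d → E d → E d) (a : ℝ → E d → E d → Matrix (Fin d) (Fin d) ℝ)
    {P : Matrix (N2 d) (N2 d) ℝ} (hP : Pᵀ = P) (θ : V d) {f f' f'' : ℝ → ℝ}
    (hf : ∀ v, HasDerivAt f (f' v) v) (hf' : ∀ v, HasDerivAt f' (f'' v) v) (t : ℝ) (x : V d) :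
    gen F1 F2 a (fun x => f (qf P θ x)) t x =
      genR (a t x.1 x.2) (F1 t x.1 x.2) (F2 t x.1 x.2) (f' (qf P θ x)) (f'' (qf P θ x)) P
        (vecL d (x - θ)) := by
  have h1 : ∀ x v, fderiv ℝ (fun x => f (qf P θ x)) x v =
      f' (qf P θ x) * (2 * (vecL d v ⬝ᵥ (P *ᵥ vecL d (x - θ)))) := by
    intro x v
    obtain ⟨L, hL, hL2⟩ := hasFDerivAt_qf P θ x
    have := (hf (qf P θ x)).comp_hasFDerivAt x hL
    have e : fderiv ℝ (fun x => f (qf P θ x)) x = f' (qf P θ x) • L := this.fderiv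
    rw [e, ContinuousLinearMap.smul_apply, hL2 hP, smul_eq_mul]
  have h1a : ∀ x i, fderiv ℝ (fun x => f (qf P θ x)) x (e1 d i) =
      2 * f' (qf P θ x) * (P *ᵥ vecL d (x - θ)) (Sum.inl i) := by
    intro x i; rw [h1, vecL_e1, single_one_dotProduct]; ring
  have h1b : ∀ x i, fderiv ℝ (fun x => f (qf P θ x)) x (e2 d i) =
      2 * f' (qf P θ x) * (P *ᵥ vecL d (x - θ)) (Sum.inr i) := by
    intro x i; rw [h1, vecL_e2, single_one_dotProduct]; ring
  have h2 : ∀ i j, fderiv ℝ (fun y => fderiv ℝ (fun x => f (qf P θ x)) y (e1 d j)) x (e1 d i) =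
      4 * f'' (qf P θ x) * (P *ᵥ vecL d (x - θ)) (Sum.inl i) * (P *ᵥ vecL d (x - θ)) (Sum.inl j)
      + 2 * f' (qf P θ x) * P (Sum.inl i) (Sum.inl j) := by
    intro i j
    simp_rw [h1a]
    obtain ⟨L, hL, hL2⟩ := hasFDerivAt_qf P θ x
    have h3 := (((hf' (qf P θ x)).comp_hasFDerivAt x hL).const_mul 2).mul
      (hasFDerivAt_Pvec P θ x (Sum.inl j))
    have e : fderiv ℝ (fun x => 2 * f' (qf P θ x) * (P *ᵥ vecL d (x - θ)) (Sum.inl j)) x = _ :=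
      h3.fderiv
    rw [e]
    simp only [ContinuousLinearMap.add_apply, ContinuousLinearMap.smul_apply, hL2 hP, smul_eq_mul,
      vecL_e1, single_one_dotProduct, ContinuousLinearMap.sum_apply,
      ContinuousLinearMap.comp_apply, ContinuousLinearMap.proj_apply, Function.comp]
    have e3 : ∑ k, P (Sum.inl j) k * (Pi.single (Sum.inl i) 1 : N2 d → ℝ) k =
        P (Sum.inl i) (Sum.inl j) := by
      simp only [Pi.single_apply, mul_ite, mul_one, mul_zero, Finset.sum_ite_eq', Finset.mem_univ,
        if_true]
      conv_lhs => rw [← hP]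
      rfl
    rw [e3]; ring
  unfold gen genR
  refine congrArg₂ _ (congrArg₂ _ (congrArg₂ _ rfl (Finset.sum_congr rfl fun i _ =>
    Finset.sum_congr rfl fun j _ => ?_)) (Finset.sum_congr rfl fun i _ => ?_))
    (Finset.sum_congr rfl fun i _ => ?_)
  · rw [h2]
  · rw [h1a]
  · rw [h1b]

/-- bounds on a precision matrix -/
structure PBd (P : Matrix (N2 d) (N2 d) ℝ) (c0 C0 : ℝ) : Prop where
  symm : Pᵀ = P
  c0p : 0 < c0
  C0p : 0 ≤ C0
  low : ∀ w, c0 * nsq w ≤ w ⬝ᵥ (P *ᵥ w)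
  up : ∀ w i, |(P *ᵥ w) i| ≤ C0 * √(nsq w)

lemma PBd.entry {P : Matrix (N2 d) (N2 d) ℝ} {c0 C0 : ℝ} (h : PBd P c0 C0) (i j : N2 d) :
    |P i j| ≤ C0 := by
  have := h.up (Pi.single j 1) i
  simpa [nsq] using this

lemma PBd.qf_low {P : Matrix (N2 d) (N2 d) ℝ} {c0 C0 : ℝ} (h : PBd P c0 C0) (θ x : V d) :
    c0 * nsq (vecL d (x - θ)) ≤ qf P θ x := h.low _

lemma PBd.qf_nonneg {P : Matrix (N2 d) (N2 d) ℝ} {c0 C0 : ℝ} (h : PBd P c0 C0) (θ x : V d) :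
    0 ≤ qf P θ x :=
  le_trans (mul_nonneg h.c0p.le (nsq_nonneg _)) (h.qf_low θ x)

lemma abs_sum2_le {ι : Type*} [Fintype ι] {f : ι → ι → ℝ} {B : ℝ} (h : ∀ i j, |f i j| ≤ B) :
    |∑ i, ∑ j, f i j| ≤ (Fintype.card ι : ℝ) ^ 2 * B := by
  calc _ ≤ ∑ i, |∑ j, f i j| := Finset.abs_sum_le_sum_abs _ _
    _ ≤ ∑ i, ∑ j, |f i j| := Finset.sum_le_sum fun i _ => Finset.abs_sum_le_sum_abs _ _
    _ ≤ ∑ _i : ι, ∑ _j : ι, B := Finset.sum_le_sum fun i _ => Finset.sum_le_sum fun j _ => h i j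
    _ = _ := by simp; ring

lemma abs_sum1_le {ι : Type*} [Fintype ι] {f : ι → ℝ} {B : ℝ} (h : ∀ i, |f i| ≤ B) :
    |∑ i, f i| ≤ (Fintype.card ι : ℝ) * B := by
  calc _ ≤ ∑ i, |f i| := Finset.abs_sum_le_sum_abs _ _
    _ ≤ ∑ _i : ι, B := Finset.sum_le_sum fun i _ => h i
    _ = _ := by simp

lemma abs_apply_le (x : E d) (i : Fin d) : |x i| ≤ ‖x‖ := by
  simpa using EuclideanSpace.norm_eq x ▸ (PiLp.norm_apply_le x i)

lemma genR_bound {P : Matrix (N2 d) (N2 d) ℝ} {c0 C0 Ca R B : ℝ} (h : PBd P c0 C0)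
    (a : Matrix (Fin d) (Fin d) ℝ) (ha : ∀ i j, |a i j| ≤ Ca) (hCa : 0 ≤ Ca) (b1 b2 : E d)
    (hR : 0 ≤ R) (w : N2 d → ℝ)
    (hb1 : ‖b1‖ ≤ R * (1 + √(nsq w))) (hb2 : ‖b2‖ ≤ R * (1 + √(nsq w))) (f' f'' : ℝ)
    (hf' : |f'| ≤ B) (hf'' : |f''| ≤ B) :
    |genR a b1 b2 f' f'' P w| ≤
      (d ^ 2 * (Ca * (2 * C0 ^ 2 + C0)) + 8 * d * R * C0) * B * (1 + nsq w) := by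
  set ρ := √(nsq w) with hρ
  have hρ0 : 0 ≤ ρ := Real.sqrt_nonneg _
  have hρ2 : ρ ^ 2 = nsq w := Real.sq_sqrt (nsq_nonneg _)
  have hC0 := h.C0p
  have hB : 0 ≤ B := (abs_nonneg _).trans hf'
  have hu := h.up w
  rw [← hρ] at hu
  have t1 : |∑ i, ∑ j, a i j * (4 * f'' * (P *ᵥ w) (Sum.inl i) * (P *ᵥ w) (Sum.inl j)
      + 2 * f' * P (Sum.inl i) (Sum.inl j))| ≤ (d:ℝ) ^ 2 * (Ca * (4 * B * (C0 * ρ) * (C0 * ρ)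
        + 2 * B * C0)) := by
    refine (abs_sum2_le (B := Ca * (4 * B * (C0 * ρ) * (C0 * ρ) + 2 * B * C0))
      fun i j => ?_).trans (by simp)
    rw [abs_mul]
    have h1 : |4 * f'' * (P *ᵥ w) (Sum.inl i) * (P *ᵥ w) (Sum.inl j)| ≤
        4 * B * (C0 * ρ) * (C0 * ρ) := by
      rw [abs_mul, abs_mul, abs_mul, abs_of_pos (show (0:ℝ) < 4 by norm_num)]
      have := hu (Sum.inl i); have := hu (Sum.inl j)
      gcongr
    have h2 : |2 * f' * P (Sum.inl i) (Sum.inl j)| ≤ 2 * B * C0 := by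
      rw [abs_mul, abs_mul, abs_of_pos (show (0:ℝ) < 2 by norm_num)]
      have := h.entry (Sum.inl i) (Sum.inl j)
      gcongr
    have h3 := ha i j
    have h4 := (abs_add_le (4 * f'' * (P *ᵥ w) (Sum.inl i) * (P *ᵥ w) (Sum.inl j))
      (2 * f' * P (Sum.inl i) (Sum.inl j))).trans (add_le_add h1 h2)
    gcongr
  have t2 : ∀ (b : E d) (k : Fin d → N2 d), ‖b‖ ≤ R * (1 + ρ) →
      |∑ i, b i * (2 * f' * (P *ᵥ w) (k i))| ≤ (d:ℝ) * (R * (1 + ρ) * (2 * B * (C0 * ρ))) := by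
    intro b k hb
    refine (abs_sum1_le (B := R * (1 + ρ) * (2 * B * (C0 * ρ))) fun i => ?_).trans (by simp)
    rw [abs_mul, abs_mul, abs_mul, abs_of_pos (show (0:ℝ) < 2 by norm_num)]
    have := (abs_apply_le b i).trans hb
    have := hu (k i)
    gcongr
  have t3 := t2 b1 Sum.inl hb1
  have t4 := t2 b2 Sum.inr hb2
  have hbase : |genR a b1 b2 f' f'' P w| ≤ 1 / 2 * ((d:ℝ) ^ 2 * (Ca * (4 * B * (C0 * ρ) * (C0 * ρ)
        + 2 * B * C0))) + (d:ℝ) * (R * (1 + ρ) * (2 * B * (C0 * ρ))) +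
        (d:ℝ) * (R * (1 + ρ) * (2 * B * (C0 * ρ))) := by
    unfold genR
    refine (abs_add_le _ _).trans (add_le_add ((abs_add_le _ _).trans (add_le_add ?_ t3)) t4)
    rw [abs_mul, abs_of_pos (show (0:ℝ) < 1/2 by norm_num)]
    gcongr
  refine hbase.trans ?_
  rw [← hρ2]
  have k1 : (1 + ρ) * ρ ≤ 2 * (1 + ρ ^ 2) := by nlinarith [sq_nonneg (ρ - 1)]
  have k2 : (d:ℝ) * (R * (1 + ρ) * (2 * B * (C0 * ρ))) ≤ 4 * d * R * C0 * B * (1 + ρ ^ 2) := by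
    have : (d:ℝ) * (R * (1 + ρ) * (2 * B * (C0 * ρ))) = (2 * d * R * C0 * B) * ((1 + ρ) * ρ) := by
      ring
    rw [this]
    have := mul_le_mul_of_nonneg_left k1 (show 0 ≤ 2 * (d:ℝ) * R * C0 * B by positivity)
    linarith
  have k3 : 1 / 2 * ((d:ℝ) ^ 2 * (Ca * (4 * B * (C0 * ρ) * (C0 * ρ) + 2 * B * C0))) ≤
      d ^ 2 * (Ca * (2 * C0 ^ 2 + C0)) * B * (1 + ρ ^ 2) := by
    have : 0 ≤ (d:ℝ) ^ 2 * Ca * B * (2 * C0 ^ 2 + C0 * ρ ^ 2) := by positivity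
    nlinarith
  linarith

/-! cutoff exponentials -/

/-- smooth cutoff -/
def sT : ℝ → ℝ := Real.smoothTransition

lemma sT_contDiff (n : ℕ∞) : ContDiff ℝ n sT := Real.smoothTransition.contDiff

def sT1 : ℝ → ℝ := deriv sT
def sT2 : ℝ → ℝ := deriv sT1

lemma sT_deriv (v : ℝ) : HasDerivAt sT (sT1 v) v :=
  (((sT_contDiff 1).differentiable (by norm_num)) v).hasDerivAt

lemma sT1_contDiff : ContDiff ℝ 1 sT1 := by
  have h : ContDiff ℝ (1 + 1) sT := by
    have := sT_contDiff 2
    norm_num at this ⊢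
    exact this
  exact (contDiff_succ_iff_deriv.1 h).2.2

lemma sT1_deriv (v : ℝ) : HasDerivAt sT1 (sT2 v) v :=
  (sT1_contDiff.differentiable (by norm_num) v).hasDerivAt

lemma sT2_cont : Continuous sT2 := by
  have h : ContDiff ℝ (0 + 1) sT1 := by simpa using sT1_contDiff
  exact ((contDiff_succ_iff_deriv.1 h).2.2).continuous

lemma sT_out {v : ℝ} (hv : v < 0 ∨ 1 < v) : sT1 v = 0 ∧ sT2 v = 0 := by
  have key : ∀ v : ℝ, (v < 0 ∨ 1 < v) → sT1 v = 0 := by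
    intro v hv
    rcases hv with h | h
    · have : sT =ᶠ[nhds v] fun _ => 0 := by
        filter_upwards [Iio_mem_nhds h] with u hu
        exact Real.smoothTransition.zero_of_nonpos (le_of_lt hu)
      rw [sT1, this.deriv_eq]; simp
    · have : sT =ᶠ[nhds v] fun _ => 1 := by
        filter_upwards [Ioi_mem_nhds h] with u hu
        exact Real.smoothTransition.one_of_one_le (le_of_lt hu)
      rw [sT1, this.deriv_eq]; simp
  refine ⟨key v hv, ?_⟩
  have : sT1 =ᶠ[nhds v] fun _ => 0 := by
    rcases hv with h | h
    · filter_upwards [Iio_mem_nhds h] with u hu using key u (Or.inl hu)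
    · filter_upwards [Ioi_mem_nhds h] with u hu using key u (Or.inr hu)
  rw [sT2, this.deriv_eq]; simp

lemma sT_bdd : ∃ M : ℝ, 1 ≤ M ∧ ∀ v, |sT1 v| ≤ M ∧ |sT2 v| ≤ M := by
  obtain ⟨M1, h1⟩ := (isCompact_Icc (a := (0:ℝ)) (b := 1)).exists_bound_of_continuousOn
    sT1_contDiff.continuous.continuousOn
  obtain ⟨M2, h2⟩ := (isCompact_Icc (a := (0:ℝ)) (b := 1)).exists_bound_of_continuousOn
    sT2_cont.continuousOn
  refine ⟨max 1 (max M1 M2), le_max_left _ _, fun v => ?_⟩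
  by_cases hv : v ∈ Icc (0:ℝ) 1
  · exact ⟨(h1 v hv).trans ((le_max_left _ _).trans (le_max_right _ _)),
      (h2 v hv).trans ((le_max_right _ _).trans (le_max_right _ _))⟩
  · have : v < 0 ∨ 1 < v := by
      by_contra hc; push Not at hc; exact hv ⟨hc.1, hc.2⟩
    rw [(sT_out this).1, (sT_out this).2]; simp

def Fn (n : ℕ) (v : ℝ) : ℝ := Real.exp (-v / 2) * sT (n + 1 - v)
def Fn1 (n : ℕ) (v : ℝ) : ℝ := Real.exp (-v / 2) * (-(1 / 2) * sT (n + 1 - v) - sT1 (n + 1 - v))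
def Fn2 (n : ℕ) (v : ℝ) : ℝ :=
  Real.exp (-v / 2) * (1 / 4 * sT (n + 1 - v) + sT1 (n + 1 - v) + sT2 (n + 1 - v))

lemma exp_half_deriv (v : ℝ) :
    HasDerivAt (fun v : ℝ => Real.exp (-v / 2)) (-(1 / 2) * Real.exp (-v / 2)) v := by
  have h : HasDerivAt (fun v : ℝ => -v / 2) (-1 / 2) v := ((hasDerivAt_id v).neg).div_const 2
  exact h.exp.congr_deriv (by ring)

lemma sub_deriv (n : ℕ) (v : ℝ) : HasDerivAt (fun v : ℝ => (n + 1 - v : ℝ)) (-1) v := by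
  simpa using (hasDerivAt_id v).const_sub (n + 1 : ℝ)

lemma Fn_deriv (n : ℕ) (v : ℝ) : HasDerivAt (Fn n) (Fn1 n v) v := by
  have h2 := (sT_deriv (n + 1 - v)).comp v (sub_deriv n v)
  exact ((exp_half_deriv v).mul h2).congr_deriv (by simp only [Fn1, Function.comp]; ring)

lemma Fn1_deriv (n : ℕ) (v : ℝ) : HasDerivAt (Fn1 n) (Fn2 n v) v := by
  have h2 := (sT_deriv (n + 1 - v)).comp v (sub_deriv n v)
  have h3 := (sT1_deriv (n + 1 - v)).comp v (sub_deriv n v)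
  exact ((exp_half_deriv v).mul ((h2.const_mul (-(1 / 2))).sub h3)).congr_deriv
    (by simp only [Fn2, Function.comp, Pi.sub_apply]; ring)

lemma sT_abs (v : ℝ) : |sT v| ≤ 1 := by
  rw [sT, abs_of_nonneg (Real.smoothTransition.nonneg v)]; exact Real.smoothTransition.le_one v

lemma Fn_bdd : ∃ M : ℝ, 0 < M ∧ ∀ n v, |Fn n v| ≤ M * Real.exp (-v / 2) ∧
    |Fn1 n v| ≤ M * Real.exp (-v / 2) ∧ |Fn2 n v| ≤ M * Real.exp (-v / 2) := by
  obtain ⟨M, hM1, hM⟩ := sT_bdd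
  refine ⟨1 + 2 * M, by positivity, fun n v => ?_⟩
  have h0 := abs_le.1 (sT_abs (n + 1 - v))
  have h1 := abs_le.1 (hM (n + 1 - v)).1
  have h2 := abs_le.1 (hM (n + 1 - v)).2
  have he := Real.exp_pos (-v / 2)
  refine ⟨?_, ?_, ?_⟩
  all_goals
    simp only [Fn, Fn1, Fn2]
    rw [abs_mul, abs_of_pos he, mul_comm]
    gcongr
    rw [abs_le]; constructor <;> linarith

lemma Fn_eq {n : ℕ} {v : ℝ} (hv : v < n) : Fn n v = Real.exp (-v / 2) ∧
    Fn1 n v = -(1 / 2) * Real.exp (-v / 2) ∧ Fn2 n v = 1 / 4 * Real.exp (-v / 2) := by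
  have h := sT_out (v := n + 1 - v) (Or.inr (by linarith))
  have h2 : sT (n + 1 - v) = 1 := Real.smoothTransition.one_of_one_le (by linarith)
  simp only [Fn, Fn1, Fn2, h.1, h.2, h2]
  refine ⟨by ring, by ring, by ring⟩

lemma Fn_contDiff (n : ℕ) : ContDiff ℝ (⊤ : ℕ∞) (Fn n) := by
  unfold Fn
  refine ContDiff.mul (Real.contDiff_exp.comp (contDiff_neg.div_const 2)) ?_
  exact (sT_contDiff ⊤).comp (contDiff_const.sub contDiff_id)

lemma Fn_zero {n : ℕ} {v : ℝ} (hv : n + 1 ≤ v) : Fn n v = 0 := by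
  have : sT (n + 1 - v) = 0 := Real.smoothTransition.zero_of_nonpos (by linarith)
  simp [Fn, this]

lemma compact_Fn {P : Matrix (N2 d) (N2 d) ℝ} {c0 C0 : ℝ} (h : PBd P c0 C0) (θ : V d) (n : ℕ) :
    HasCompactSupport fun x => Fn n (qf P θ x) := by
  refine HasCompactSupport.of_support_subset_isCompact
    (isCompact_closedBall θ (√((n + 1) / c0))) fun x hx => ?_
  by_contra hc
  apply hx
  apply Fn_zero
  rw [mem_closedBall_iff_norm, not_le] at hc
  have h1 := Real.lt_sq_of_sqrt_lt hc
  have h2 := norm_sq_le_nsq (x - θ)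
  have h3 := h.qf_low θ x
  have hc0 := h.c0p
  rw [div_lt_iff₀ hc0] at h1
  nlinarith

end

end

section

/-! ### Part E: hypotheses, abstract solutions, Ito formula for a fixed Gaussian -/

/-- hypotheses on (time-clamped) coefficients -/
structure Hyp {d : ℕ} (F1 F2 : ℝ → E d → E d → E d) (σ D : ℝ → E d → E d → Matrix (Fin d) (Fin d) ℝ)
    (c C b1 b2 b3 η : ℝ) : Prop where
  c0 : 0 < c
  C1 : 1 ≤ C
  hb1 : b1 ∈ Ioo (0:ℝ) 1
  hb2 : b2 ∈ Ioo (0:ℝ) 1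
  hb3 : b3 ∈ Ioo (0:ℝ) 1
  hb3' : 1 / 3 < b3
  hη : η ∈ Ioo (0:ℝ) 1
  cF1 : Continuous fun p : ℝ × V d => F1 p.1 p.2.1 p.2.2
  cF2 : Continuous fun p : ℝ × V d => F2 p.1 p.2.1 p.2.2
  cσ : ∀ i j, Continuous fun p : ℝ × V d => σ p.1 p.2.1 p.2.2 i j
  cD : ∀ i j, Continuous fun p : ℝ × V d => D p.1 p.2.1 p.2.2 i j
  F1h : ∀ t x1 x2 y1 y2, ‖F1 t x1 x2 - F1 t y1 y2‖ ≤ C * (‖x1 - y1‖ ^ b1 + ‖x2 - y2‖ ^ b2)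
  F2h : ∀ t x1 x2 y1 y2, ‖F2 t x1 x2 - F2 t y1 y2‖ ≤ C * (‖x1 - y1‖ + ‖x2 - y2‖ ^ b3)
  σh : ∀ t x1 x2 y1 y2 i j, |σ t x1 x2 i j - σ t y1 y2 i j| ≤ C * (‖x1 - y1‖ + ‖x2 - y2‖)
  gF1 : ∀ t (x : V d), ‖F1 t x.1 x.2‖ ≤ C * (1 + ‖x‖)
  gF2 : ∀ t (x : V d), ‖F2 t x.1 x.2‖ ≤ C * (1 + ‖x‖)
  σb : ∀ t x1 x2 i j, |σ t x1 x2 i j| ≤ C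
  tay : ∀ t x1 x2 y1 y2, ‖F2 t x1 x2 - F2 t y1 y2 - Matrix.toEuclideanLin (D t y1 y2) (x1 - y1)‖ ≤
    C * (‖x1 - y1‖ ^ (1 + η) + ‖x2 - y2‖ ^ b3)
  ch : ∀ θ : ℝ → V d, Continuous θ →
    CH (fun u => σ u (θ u).1 (θ u).2) (fun u => D u (θ u).1 (θ u).2) c C

/-- the diffusion matrix -/
def aσ {d : ℕ} (σ : ℝ → E d → E d → Matrix (Fin d) (Fin d) ℝ) :
    ℝ → E d → E d → Matrix (Fin d) (Fin d) ℝ := fun r y1 y2 => σ r y1 y2 * (σ r y1 y2)ᵀ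

/-- abstract (distributional) solutions -/
structure IsSol {d : ℕ} (F1 F2 : ℝ → E d → E d → E d) (σ : ℝ → E d → E d → Matrix (Fin d) (Fin d) ℝ)
    {Ω : Type*} [MeasurableSpace Ω] (m : Measure Ω) (Y : ℝ → Ω → V d) (s0 T : ℝ) : Prop where
  meas : ∀ t, Measurable (Y t)
  cont : ∀ ω, Continuous fun t => Y t ω
  eq : ∀ φ : V d → ℝ, ContDiff ℝ (⊤ : ℕ∞) φ → HasCompactSupport φ → ∀ s t, s0 ≤ s → s ≤ t → t ≤ T →
    ∫ ω, φ (Y t ω) ∂m - ∫ ω, φ (Y s ω) ∂m =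
      ∫ u in s..t, ∫ ω, gen F1 F2 (aσ σ) φ u (Y u ω) ∂m

section
variable {d : ℕ} {F1 F2 : ℝ → E d → E d → E d} {σ D : ℝ → E d → E d → Matrix (Fin d) (Fin d) ℝ}
  {c C b1 b2 b3 η : ℝ}

/-- generator of a Gaussian-like function, evaluated -/
def Lq (F1 F2 : ℝ → E d → E d → E d) (σ : ℝ → E d → E d → Matrix (Fin d) (Fin d) ℝ)
    (f' f'' : ℝ) (P : Matrix (N2 d) (N2 d) ℝ) (θ : V d) (u : ℝ) (x : V d) : ℝ :=
  genR (aσ σ u x.1 x.2) (F1 u x.1 x.2) (F2 u x.1 x.2) f' f'' P (vecL d (x - θ))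

lemma Hyp.ca (H : Hyp F1 F2 σ D c C b1 b2 b3 η) (i j : Fin d) :
    Continuous fun p : ℝ × V d => aσ σ p.1 p.2.1 p.2.2 i j := by
  simp only [aσ, Matrix.mul_apply, Matrix.transpose_apply]
  exact continuous_finsetSum _ fun k _ => (H.cσ i k).mul (H.cσ j k)

lemma Hyp.ab (H : Hyp F1 F2 σ D c C b1 b2 b3 η) (t : ℝ) (x1 x2 : E d) (i j : Fin d) :
    |aσ σ t x1 x2 i j| ≤ d * C ^ 2 := by
  simp only [aσ, Matrix.mul_apply, Matrix.transpose_apply]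
  have hC := H.C1
  refine (abs_sum1_le (B := C ^ 2) fun k => ?_).trans (by simp)
  rw [abs_mul, sq]
  have := H.σb t x1 x2 i k
  have := H.σb t x1 x2 j k
  gcongr

lemma Lq_cont (H : Hyp F1 F2 σ D c C b1 b2 b3 η) {X : Type*} [TopologicalSpace X]
    {f' f'' : X → ℝ} {P : X → Matrix (N2 d) (N2 d) ℝ} {θ x : X → V d} {u : X → ℝ}
    (hf' : Continuous f') (hf'' : Continuous f'') (hP : ∀ i j, Continuous fun z => P z i j)
    (hθ : Continuous θ) (hx : Continuous x) (hu : Continuous u) :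
    Continuous fun z => Lq F1 F2 σ (f' z) (f'' z) (P z) (θ z) (u z) (x z) := by
  have hp : Continuous fun z => (u z, x z) := hu.prodMk hx
  have hw : ∀ i, Continuous fun z => vecL d (x z - θ z) i := fun i =>
    (continuous_apply i).comp ((vecL d).continuous.comp (hx.sub hθ))
  have hPw : ∀ i, Continuous fun z => (P z *ᵥ vecL d (x z - θ z)) i := fun i => by
    simp only [Matrix.mulVec, dotProduct]
    exact continuous_finsetSum _ fun k _ => (hP i k).mul (hw k)
  have hF1 : ∀ i, Continuous fun z => F1 (u z) (x z).1 (x z).2 i := fun i =>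
    (EuclideanSpace.proj (𝕜 := ℝ) i).continuous.comp (H.cF1.comp hp)
  have hF2 : ∀ i, Continuous fun z => F2 (u z) (x z).1 (x z).2 i := fun i =>
    (EuclideanSpace.proj (𝕜 := ℝ) i).continuous.comp (H.cF2.comp hp)
  have ha : ∀ i j, Continuous fun z => aσ σ (u z) (x z).1 (x z).2 i j := fun i j =>
    (H.ca i j).comp hp
  unfold Lq genR
  refine ((continuous_const.mul ?_).add ?_).add ?_
  · exact continuous_finsetSum _ fun i _ => continuous_finsetSum _ fun j _ => (ha i j).mul
      ((((continuous_const.mul hf'').mul (hPw _)).mul (hPw _)).add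
        ((continuous_const.mul hf').mul (hP _ _)))
  · exact continuous_finsetSum _ fun i _ => (hF1 i).mul ((continuous_const.mul hf').mul (hPw _))
  · exact continuous_finsetSum _ fun i _ => (hF2 i).mul ((continuous_const.mul hf').mul (hPw _))

lemma qf_cont {X : Type*} [TopologicalSpace X] {P : X → Matrix (N2 d) (N2 d) ℝ} {θ x : X → V d}
    (hP : ∀ i j, Continuous fun z => P z i j) (hθ : Continuous θ) (hx : Continuous x) :
    Continuous fun z => qf (P z) (θ z) (x z) := by
  have hw : ∀ i, Continuous fun z => vecL d (x z - θ z) i := fun i =>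
    (continuous_apply i).comp ((vecL d).continuous.comp (hx.sub hθ))
  simp only [qf, Matrix.mulVec, dotProduct]
  exact continuous_finsetSum _ fun k _ => (hw k).mul
    (continuous_finsetSum _ fun j _ => (hP k j).mul (hw j))

/-- uniform bound constant -/
def KL (d : ℕ) (C c0 C0 R M : ℝ) : ℝ :=
  (d ^ 2 * (d * C ^ 2 * (2 * C0 ^ 2 + C0)) + 8 * d * (C * (1 + R)) * C0) * M * (1 + 2 / c0)

lemma exp_absorb {c0 n q : ℝ} (hc0 : 0 < c0) (hn : 0 ≤ n) (hq : c0 * n ≤ q) :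
    Real.exp (-q / 2) * (1 + n) ≤ 1 + 2 / c0 := by
  have h1 : 1 + n ≤ (1 + 2 / c0) * Real.exp (q / 2) := by
    have h2 : c0 * n / 2 + 1 ≤ Real.exp (q / 2) := by
      refine le_trans ?_ (Real.add_one_le_exp _)
      linarith
    have h3 : 1 + n ≤ (1 + 2 / c0) * (c0 * n / 2 + 1) := by
      have e : (1 + 2 / c0) * (c0 * n / 2 + 1) = 1 + n + (c0 * n / 2 + 2 / c0) := by
        field_simp; ring
      rw [e]
      have : 0 ≤ c0 * n / 2 + 2 / c0 := by positivity
      linarith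
    refine h3.trans ?_
    gcongr
  have h4 := mul_le_mul_of_nonneg_left h1 (Real.exp_pos (-q / 2)).le
  refine h4.trans (le_of_eq ?_)
  rw [mul_left_comm, ← Real.exp_add, show -q / 2 + q / 2 = 0 by ring, Real.exp_zero, mul_one]

lemma Lq_bound (H : Hyp F1 F2 σ D c C b1 b2 b3 η) {P : Matrix (N2 d) (N2 d) ℝ} {c0 C0 R M : ℝ}
    (h : PBd P c0 C0) {θ : V d} (hθ : ‖θ‖ ≤ R) (hM : 0 ≤ M) {f' f'' : ℝ} (u : ℝ) (x : V d)
    (hf' : |f'| ≤ M * Real.exp (-(qf P θ x) / 2)) (hf'' : |f''| ≤ M * Real.exp (-(qf P θ x) / 2)) :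
    |Lq F1 F2 σ f' f'' P θ u x| ≤ KL d C c0 C0 R M := by
  have hC := H.C1
  have hC0 := h.C0p
  have hR : 0 ≤ R := (norm_nonneg _).trans hθ
  have hx : 1 + ‖x‖ ≤ (1 + R) * (1 + √(nsq (vecL d (x - θ)))) := by
    have h1 : ‖x - θ‖ ≤ √(nsq (vecL d (x - θ))) := Real.le_sqrt_of_sq_le (norm_sq_le_nsq _)
    have h2 : ‖x‖ ≤ ‖x - θ‖ + ‖θ‖ := by simpa using norm_add_le (x - θ) θ
    nlinarith [Real.sqrt_nonneg (nsq (vecL d (x - θ)))]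
  have hg : ∀ {b : E d}, ‖b‖ ≤ C * (1 + ‖x‖) →
      ‖b‖ ≤ C * (1 + R) * (1 + √(nsq (vecL d (x - θ)))) := fun hb => hb.trans (by
    rw [mul_assoc]; gcongr)
  refine (genR_bound h _ (H.ab u x.1 x.2) (by positivity) _ _ (R := C * (1 + R)) (by positivity) _
    (hg (H.gF1 u x)) (hg (H.gF2 u x)) f' f'' hf' hf'').trans ?_
  have he := exp_absorb h.c0p (nsq_nonneg (vecL d (x - θ))) (h.qf_low θ x)
  unfold KL
  set A := (d:ℝ) ^ 2 * (d * C ^ 2 * (2 * C0 ^ 2 + C0)) + 8 * d * (C * (1 + R)) * C0 with hA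
  have hA0 : 0 ≤ A := by positivity
  have := mul_le_mul_of_nonneg_left he (mul_nonneg hA0 hM)
  calc _ = A * M * (Real.exp (-(qf P θ x) / 2) * (1 + nsq (vecL d (x - θ)))) := by ring
    _ ≤ _ := this

variable {Ω : Type*} [MeasurableSpace Ω] {m : Measure Ω} [IsFiniteMeasure m] {Y : ℝ → Ω → V d}
  {s0 T : ℝ}

lemma IsSol.pair_meas (S : IsSol F1 F2 σ m Y s0 T) {G : ℝ × V d → ℝ}
    (hG : Continuous G) (u v : ℝ) : AEStronglyMeasurable (fun ω => G (u, Y v ω)) m := by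
  have h1 : Continuous fun x => G (u, x) := hG.comp (Continuous.prodMk_right u)
  exact (h1.measurable.comp (S.meas v)).aestronglyMeasurable

lemma IsSol.cont_int (S : IsSol F1 F2 σ m Y s0 T) {G : ℝ × V d → ℝ}
    (hG : Continuous G) {K : ℝ} (hK : ∀ p, |G p| ≤ K) :
    Continuous fun u => ∫ ω, G (u, Y u ω) ∂m := by
  refine continuous_of_dominated (bound := fun _ => K) ?_ ?_ (integrable_const _) ?_
  · exact fun u => S.pair_meas hG u u
  · exact fun u => Filter.Eventually.of_forall fun ω => hK _
  · exact Filter.Eventually.of_forall fun ω => hG.comp (continuous_id.prodMk (S.cont ω))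

lemma Fn1_cont (n : ℕ) : Continuous (Fn1 n) :=
  continuous_iff_continuousAt.2 fun v => (Fn1_deriv n v).continuousAt
lemma Fn2_cont (n : ℕ) : Continuous (Fn2 n) := by
  unfold Fn2
  have := sT2_cont
  have h1 := sT1_contDiff.continuous
  have h0 := (sT_contDiff 0).continuous
  fun_prop

/-- Ito for a fixed Gaussian -/
lemma ito_static (H : Hyp F1 F2 σ D c C b1 b2 b3 η) (S : IsSol F1 F2 σ m Y s0 T)
    {P : Matrix (N2 d) (N2 d) ℝ} {c0 C0 : ℝ} (h : PBd P c0 C0) (θ : V d) {s t : ℝ}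
    (hs : s0 ≤ s) (hst : s ≤ t) (ht : t ≤ T) :
    ∫ ω, Real.exp (-(qf P θ (Y t ω)) / 2) ∂m - ∫ ω, Real.exp (-(qf P θ (Y s ω)) / 2) ∂m =
      ∫ u in s..t, ∫ ω, Lq F1 F2 σ (-(1 / 2) * Real.exp (-(qf P θ (Y u ω)) / 2))
        (1 / 4 * Real.exp (-(qf P θ (Y u ω)) / 2)) P θ u (Y u ω) ∂m := by
  obtain ⟨M, hM, hb⟩ := Fn_bdd
  have hcq : Continuous (qf P θ) := (contDiff_qf P θ).continuous
  have hPc : ∀ i j, Continuous fun _ : ℝ × V d => P i j := fun i j => continuous_const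
  have hgen : ∀ n u x, gen F1 F2 (aσ σ) (fun x => Fn n (qf P θ x)) u x =
      Lq F1 F2 σ (Fn1 n (qf P θ x)) (Fn2 n (qf P θ x)) P θ u x := fun n u x =>
    gen_qf F1 F2 (aσ σ) h.symm θ (Fn_deriv n) (Fn1_deriv n) u x
  have hLc : ∀ n, Continuous fun p : ℝ × V d =>
      Lq F1 F2 σ (Fn1 n (qf P θ p.2)) (Fn2 n (qf P θ p.2)) P θ p.1 p.2 := fun n =>
    Lq_cont H ((Fn1_cont n).comp (hcq.comp continuous_snd))
      ((Fn2_cont n).comp (hcq.comp continuous_snd)) hPc continuous_const continuous_snd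
      continuous_fst
  have hLb : ∀ n u x, |Lq F1 F2 σ (Fn1 n (qf P θ x)) (Fn2 n (qf P θ x)) P θ u x| ≤
      KL d C c0 C0 ‖θ‖ M := fun n u x =>
    Lq_bound H h le_rfl hM.le u x (hb n _).2.1 (hb n _).2.2
  have key : ∀ n, ∫ ω, Fn n (qf P θ (Y t ω)) ∂m - ∫ ω, Fn n (qf P θ (Y s ω)) ∂m =
      ∫ u in s..t, ∫ ω, Lq F1 F2 σ (Fn1 n (qf P θ (Y u ω))) (Fn2 n (qf P θ (Y u ω))) P θ u (Y u ω)
        ∂m := by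
    intro n
    have := S.eq (fun x => Fn n (qf P θ x)) ((Fn_contDiff n).comp (contDiff_qf P θ))
      (compact_Fn h θ n) s t hs hst ht
    simp only [hgen] at this
    exact this
  have hev : ∀ x, ∀ᶠ n : ℕ in Filter.atTop, qf P θ x < n := fun x => by
    obtain ⟨N, hN⟩ := exists_nat_gt (qf P θ x)
    filter_upwards [Filter.eventually_ge_atTop N] with n hn
    exact hN.trans_le (by exact_mod_cast hn)
  have hL : ∀ u, Filter.Tendsto (fun n => ∫ ω, Fn n (qf P θ (Y u ω)) ∂m) Filter.atTop
      (nhds (∫ ω, Real.exp (-(qf P θ (Y u ω)) / 2) ∂m)) := by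
    intro u
    refine tendsto_integral_of_dominated_convergence (fun _ => M) ?_ (integrable_const _) ?_ ?_
    · intro n
      exact (((Fn_contDiff n).continuous.comp hcq).measurable.comp (S.meas u)).aestronglyMeasurable
    · intro n
      refine Filter.Eventually.of_forall fun ω => ?_
      refine ((hb n _).1).trans ?_
      have : Real.exp (-(qf P θ (Y u ω)) / 2) ≤ 1 := by
        rw [Real.exp_le_one_iff]
        have := h.qf_nonneg θ (Y u ω)
        linarith
      nlinarith
    · refine Filter.Eventually.of_forall fun ω => ?_
      refine tendsto_const_nhds.congr' ?_
      filter_upwards [hev (Y u ω)] with n hn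
      exact (Fn_eq hn).1.symm
  have hR1 : ∀ u, Filter.Tendsto (fun n => ∫ ω, Lq F1 F2 σ (Fn1 n (qf P θ (Y u ω)))
      (Fn2 n (qf P θ (Y u ω))) P θ u (Y u ω) ∂m) Filter.atTop
      (nhds (∫ ω, Lq F1 F2 σ (-(1 / 2) * Real.exp (-(qf P θ (Y u ω)) / 2))
        (1 / 4 * Real.exp (-(qf P θ (Y u ω)) / 2)) P θ u (Y u ω) ∂m)) := by
    intro u
    refine tendsto_integral_of_dominated_convergence (fun _ => KL d C c0 C0 ‖θ‖ M) ?_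
      (integrable_const _) ?_ ?_
    · intro n
      exact S.pair_meas (hLc n) u u
    · intro n
      exact Filter.Eventually.of_forall fun ω => hLb n u _
    · refine Filter.Eventually.of_forall fun ω => ?_
      refine tendsto_const_nhds.congr' ?_
      filter_upwards [hev (Y u ω)] with n hn
      rw [(Fn_eq hn).2.1, (Fn_eq hn).2.2]
  have hR : Filter.Tendsto (fun n => ∫ u in s..t, ∫ ω, Lq F1 F2 σ (Fn1 n (qf P θ (Y u ω)))
      (Fn2 n (qf P θ (Y u ω))) P θ u (Y u ω) ∂m) Filter.atTop
      (nhds (∫ u in s..t, ∫ ω, Lq F1 F2 σ (-(1 / 2) * Real.exp (-(qf P θ (Y u ω)) / 2))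
        (1 / 4 * Real.exp (-(qf P θ (Y u ω)) / 2)) P θ u (Y u ω) ∂m)) := by
    refine intervalIntegral.tendsto_integral_filter_of_dominated_convergence
      (fun _ => KL d C c0 C0 ‖θ‖ M * m.real univ) ?_ ?_ ?_ ?_
    · refine Filter.Eventually.of_forall fun n => ?_
      have := S.cont_int (G := fun p : ℝ × V d =>
        Lq F1 F2 σ (Fn1 n (qf P θ p.2)) (Fn2 n (qf P θ p.2)) P θ p.1 p.2) (hLc n)
        (fun p => hLb n p.1 p.2)
      exact this.aestronglyMeasurable
    · refine Filter.Eventually.of_forall fun n => Filter.Eventually.of_forall fun u _ => ?_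
      exact norm_integral_le_of_norm_le_const (Filter.Eventually.of_forall fun ω => hLb n u _)
    · exact intervalIntegrable_const
    · exact Filter.Eventually.of_forall fun u _ => hR1 u
  refine tendsto_nhds_unique ?_ hR
  simp_rw [← key]
  exact (hL t).sub (hL s)

end

end

section

/-! ### Part F: Ito formula for time dependent Gaussians -/

section
variable {d : ℕ} {F1 F2 : ℝ → E d → E d → E d} {σ D : ℝ → E d → E d → Matrix (Fin d) (Fin d) ℝ}
  {c C b1 b2 b3 η : ℝ}
variable {Ω : Type*} [MeasurableSpace Ω] {m : Measure Ω} [IsFiniteMeasure m] {Y : ℝ → Ω → V d}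
  {s0 T : ℝ}

/-- abstract diagonal differentiation -/
lemma diag_ito (S : IsSol F1 F2 σ m Y s0 T) {r : ℝ} (hr : s0 ≤ r)
    {g g1 : ℝ × V d → ℝ} {g2 : ℝ → ℝ × V d → ℝ} {K : ℝ}
    (hg : Continuous g) (hg1 : Continuous g1) (hg2 : Continuous fun p : ℝ × ℝ × V d => g2 p.1 p.2)
    (bg : ∀ p, |g p| ≤ K) (bg1 : ∀ p, |g1 p| ≤ K) (bg2 : ∀ s p, |g2 s p| ≤ K)
    (d1 : ∀ s ∈ Ioo s0 r, ∀ x, HasDerivAt (fun s => g (s, x)) (g1 (s, x)) s)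
    (d2 : ∀ s, ∀ t ∈ Icc s0 r, ∫ ω, g (s, Y t ω) ∂m - ∫ ω, g (s, Y s0 ω) ∂m =
      ∫ u in s0..t, ∫ ω, g2 s (u, Y u ω) ∂m) :
    (∫ ω, g (r, Y r ω) ∂m - ∫ ω, g (s0, Y s0 ω) ∂m =
      ∫ s in s0..r, ∫ ω, (g1 (s, Y s ω) + g2 s (s, Y s ω)) ∂m) ∧
    (∀ s, Integrable (fun ω => g1 (s, Y s ω) + g2 s (s, Y s ω)) m) ∧
    Continuous fun s => ∫ ω, (g1 (s, Y s ω) + g2 s (s, Y s ω)) ∂m := by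
  have hc2 : ∀ s, Continuous (g2 s) := fun s => hg2.comp (Continuous.prodMk_right s)
  -- continuity of the two partial derivatives
  have c1 : Continuous fun p : ℝ × ℝ => ∫ ω, g1 (p.1, Y p.2 ω) ∂m := by
    refine continuous_of_dominated (bound := fun _ => K) ?_ ?_ (integrable_const _) ?_
    · exact fun p => S.pair_meas hg1 p.1 p.2
    · exact fun p => Filter.Eventually.of_forall fun ω => bg1 _
    · exact Filter.Eventually.of_forall fun ω =>
        hg1.comp (continuous_fst.prodMk ((S.cont ω).comp continuous_snd))
  have c2 : Continuous fun p : ℝ × ℝ => ∫ ω, g2 p.1 (p.2, Y p.2 ω) ∂m := by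
    refine continuous_of_dominated (bound := fun _ => K) ?_ ?_ (integrable_const _) ?_
    · exact fun p => S.pair_meas (hc2 p.1) p.2 p.2
    · exact fun p => Filter.Eventually.of_forall fun ω => bg2 _ _
    · exact Filter.Eventually.of_forall fun ω =>
        hg2.comp (continuous_fst.prodMk (continuous_snd.prodMk ((S.cont ω).comp continuous_snd)))
  have D1 : ∀ s ∈ Ioo s0 r, ∀ t, HasDerivAt (fun s => ∫ ω, g (s, Y t ω) ∂m)
      (∫ ω, g1 (s, Y t ω) ∂m) s := by
    intro s hs t
    refine (hasDerivAt_integral_of_dominated_loc_of_deriv_le (F := fun s ω => g (s, Y t ω))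
      (F' := fun s ω => g1 (s, Y t ω)) (bound := fun _ => K) (Ioo_mem_nhds hs.1 hs.2) ?_ ?_ ?_ ?_
      (integrable_const _) ?_).2
    · exact Filter.Eventually.of_forall fun s => S.pair_meas hg s t
    · exact Integrable.of_bound (S.pair_meas hg s t) K (Filter.Eventually.of_forall fun ω => bg _)
    · exact S.pair_meas hg1 s t
    · exact Filter.Eventually.of_forall fun ω s _ => bg1 _
    · exact Filter.Eventually.of_forall fun ω s hs => d1 s hs _
  have D2 : ∀ s, ∀ t ∈ Ioo s0 r, HasDerivAt (fun t => ∫ ω, g (s, Y t ω) ∂m)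
      (∫ ω, g2 s (t, Y t ω) ∂m) t := by
    intro s t ht
    have hcc : Continuous fun u => ∫ ω, g2 s (u, Y u ω) ∂m := S.cont_int (hc2 s) (bg2 s)
    have h1 := (hcc.integral_hasStrictDerivAt s0 t).hasDerivAt
    refine (h1.const_add (∫ ω, g (s, Y s0 ω) ∂m)).congr_of_eventuallyEq ?_
    filter_upwards [Ioo_mem_nhds ht.1 ht.2] with u hu
    have := d2 s u ⟨hu.1.le, hu.2.le⟩
    linarith
  have Dd : ∀ s ∈ Ioo s0 r, HasDerivAt (fun s => ∫ ω, g (s, Y s ω) ∂m)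
      (∫ ω, g1 (s, Y s ω) ∂m + ∫ ω, g2 s (s, Y s ω) ∂m) s := by
    intro s hs
    have hmem : ∀ᶠ v : ℝ × ℝ in nhds (s, s), v.1 ∈ Ioo s0 r ∧ v.2 ∈ Ioo s0 r :=
      prod_mem_nhds (Ioo_mem_nhds hs.1 hs.2) (Ioo_mem_nhds hs.1 hs.2)
    have hspan : Continuous fun y : ℝ => ContinuousLinearMap.toSpanSingleton ℝ y :=
      (ContinuousLinearMap.toSpanSingletonCLE (𝕜 := ℝ) (E := ℝ)).continuous
    have key := hasStrictFDerivAt_uncurry_coprod (𝕜 := ℝ) (u := (s, s))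
      (f := fun a b : ℝ => ∫ ω, g (a, Y b ω) ∂m)
      (f₁ := fun a b : ℝ => ContinuousLinearMap.toSpanSingleton ℝ (∫ ω, g1 (a, Y b ω) ∂m))
      (f₂ := fun a b : ℝ => ContinuousLinearMap.toSpanSingleton ℝ (∫ ω, g2 a (b, Y b ω) ∂m))
      (hmem.mono fun v hv => (D1 v.1 hv.1 v.2).hasFDerivAt)
      (hmem.mono fun v hv => (D2 v.1 v.2 hv.2).hasFDerivAt)
      ((hspan.comp c1).continuousAt)
      ((hspan.comp c2).continuousAt)
    have h2 : HasDerivAt (fun s : ℝ => (s, s)) ((1 : ℝ), (1 : ℝ)) s :=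
      (hasDerivAt_id s).prodMk (hasDerivAt_id s)
    have := HasFDerivAt.comp_hasDerivAt (f := fun s : ℝ => (s, s)) s key.hasFDerivAt h2
    refine HasDerivAt.congr_deriv this ?_
    simp [Function.HasUncurry.uncurry]
  have hfin := intervalIntegral.integral_eq_sub_of_hasDerivAt_of_le hr
    (f := fun s => ∫ ω, g (s, Y s ω) ∂m) (S.cont_int hg bg).continuousOn Dd
    (((c1.comp (continuous_id.prodMk continuous_id)).add
      (c2.comp (continuous_id.prodMk continuous_id))).intervalIntegrable _ _)
  have i1 : ∀ s, Integrable (fun ω => g1 (s, Y s ω)) m := fun s =>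
    Integrable.of_bound (S.pair_meas hg1 s s) K (Filter.Eventually.of_forall fun ω => bg1 _)
  have i2 : ∀ s, Integrable (fun ω => g2 s (s, Y s ω)) m := fun s =>
    Integrable.of_bound (S.pair_meas (hc2 s) s s) K
      (Filter.Eventually.of_forall fun ω => bg2 _ _)
  have ia : ∀ s, ∫ ω, (g1 (s, Y s ω) + g2 s (s, Y s ω)) ∂m =
      ∫ ω, g1 (s, Y s ω) ∂m + ∫ ω, g2 s (s, Y s ω) ∂m := fun s => integral_add (i1 s) (i2 s)
  refine ⟨?_, fun s => (i1 s).add (i2 s), ?_⟩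
  · rw [← hfin]
    exact intervalIntegral.integral_congr fun s _ => (ia s).symm
  · simp only [ia]
    exact (c1.comp (continuous_id.prodMk continuous_id)).add
      (c2.comp (continuous_id.prodMk continuous_id))

end

end

section

/-! ### Part G: the frozen Gaussian proxies -/

section
variable {d : ℕ} {c C : ℝ}

/-- normalisation -/
def Nm (σs Ds : ℝ → Matrix (Fin d) (Fin d) ℝ) (r κ s : ℝ) : ℝ := (√(Km σs Ds r κ s).det)⁻¹

/-- frozen Gaussian -/
def gk (σs Ds : ℝ → Matrix (Fin d) (Fin d) ℝ) (θ : ℝ → V d) (r κ s : ℝ) (x : V d) : ℝ :=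
  Nm σs Ds r κ s * Real.exp (-(qf (Pm σs Ds r κ s) (θ s) x) / 2)

/-- exponential weight -/
def ek (σs Ds : ℝ → Matrix (Fin d) (Fin d) ℝ) (θ : ℝ → V d) (r κ s : ℝ) (x : V d) : ℝ :=
  Real.exp (-(qf (Pm σs Ds r κ s) (θ s) x) / 2)

lemma qf_sym {P : Matrix (N2 d) (N2 d) ℝ} (hP : Pᵀ = P) (u w : N2 d → ℝ) :
    w ⬝ᵥ (P *ᵥ u) = u ⬝ᵥ (P *ᵥ w) := by
  rw [Matrix.dotProduct_mulVec, ← Matrix.mulVec_transpose, hP, dotProduct_comm]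

lemma qf_time_deriv {P : ℝ → Matrix (N2 d) (N2 d) ℝ} {P' : Matrix (N2 d) (N2 d) ℝ} {s : ℝ}
    (hP : MD P P' s) (hs : (P s)ᵀ = P s) {θ : ℝ → V d} {θ' : V d} (hθ : HasDerivAt θ θ' s)
    (x : V d) :
    HasDerivAt (fun s => qf (P s) (θ s) x)
      (vecL d (x - θ s) ⬝ᵥ (P' *ᵥ vecL d (x - θ s)) - 2 * (vecL d θ' ⬝ᵥ (P s *ᵥ vecL d (x - θ s)))) s := by
  have hw : ∀ i, HasDerivAt (fun s => vecL d (x - θ s) i) (-(vecL d θ' i)) s := by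
    intro i
    have h1 : HasDerivAt (fun s => vecL d (x - θ s)) (vecL d (-θ')) s :=
      (vecL d).hasFDerivAt.comp_hasDerivAt s (by simpa using hθ.const_sub x)
    have := hasDerivAt_pi.1 h1 i
    simpa using this
  have h : HasDerivAt (fun s => ∑ i, vecL d (x - θ s) i * ∑ j, P s i j * vecL d (x - θ s) j)
      (∑ i, (-(vecL d θ' i) * ∑ j, P s i j * vecL d (x - θ s) j + vecL d (x - θ s) i *
        ∑ j, (P' i j * vecL d (x - θ s) j + P s i j * -(vecL d θ' j)))) s :=
    HasDerivAt.fun_sum fun i _ => (hw i).mul (HasDerivAt.fun_sum fun j _ => (hP i j).mul (hw j))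
  refine HasDerivAt.congr_deriv h ?_
  have e := qf_sym hs (vecL d θ') (vecL d (x - θ s))
  simp only [dotProduct, Matrix.mulVec] at e ⊢
  have e2 : ∑ i, (-(vecL d θ' i) * ∑ j, P s i j * vecL d (x - θ s) j + vecL d (x - θ s) i *
        ∑ j, (P' i j * vecL d (x - θ s) j + P s i j * -(vecL d θ' j))) =
      -(∑ i, vecL d θ' i * ∑ j, P s i j * vecL d (x - θ s) j)
      + (∑ i, vecL d (x - θ s) i * ∑ j, P' i j * vecL d (x - θ s) j)
      - ∑ i, vecL d (x - θ s) i * ∑ j, P s i j * vecL d θ' j := by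
    rw [← Finset.sum_neg_distrib, ← Finset.sum_add_distrib, ← Finset.sum_sub_distrib]
    refine Finset.sum_congr rfl fun i _ => ?_
    rw [Finset.sum_add_distrib, mul_add]
    have : ∑ j, P s i j * -(vecL d θ' j) = -∑ j, P s i j * (vecL d θ' j) := by
      rw [← Finset.sum_neg_distrib]; exact Finset.sum_congr rfl fun j _ => by ring
    rw [this]; ring
  rw [e2, e]; ring

lemma ah_form (a : Matrix (Fin d) (Fin d) ℝ) (u : N2 d → ℝ) :
    u ⬝ᵥ (ah a *ᵥ u) = ∑ i, ∑ j, a i j * (u (Sum.inl i) * u (Sum.inl j)) := by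
  simp [dotProduct, Matrix.mulVec, ah, Finset.mul_sum]
  exact Finset.sum_congr rfl fun i _ => Finset.sum_congr rfl fun j _ => by ring

lemma Am_form (M : Matrix (Fin d) (Fin d) ℝ) (w u : N2 d → ℝ) :
    (Am M *ᵥ w) ⬝ᵥ u = ∑ i, (∑ j, M i j * w (Sum.inl j)) * u (Sum.inr i) := by
  simp [dotProduct, Matrix.mulVec, Am]

lemma ah_trace (a : Matrix (Fin d) (Fin d) ℝ) {P : Matrix (N2 d) (N2 d) ℝ} (hP : Pᵀ = P) :
    (ah a * P).trace = ∑ i, ∑ j, a i j * P (Sum.inl i) (Sum.inl j) := by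
  simp [Matrix.trace, Matrix.mul_apply, ah]
  refine Finset.sum_congr rfl fun i _ => Finset.sum_congr rfl fun j _ => ?_
  rw [← hP, Matrix.transpose_apply, hP]

lemma Pm'_form (σs Ds : ℝ → Matrix (Fin d) (Fin d) ℝ) (r κ s : ℝ) (w : N2 d → ℝ) :
    w ⬝ᵥ (Pm' σs Ds r κ s *ᵥ w) =
      (Pm σs Ds r κ s *ᵥ w) ⬝ᵥ (ah (σs s * (σs s)ᵀ) *ᵥ (Pm σs Ds r κ s *ᵥ w))
        - 2 * ((Am (Ds s) *ᵥ w) ⬝ᵥ (Pm σs Ds r κ s *ᵥ w)) := by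
  have hs := Pm_symm (σ := σs) (D := Ds) r κ s
  set P := Pm σs Ds r κ s with hPdef
  rw [Pm', ← hPdef, Matrix.sub_mulVec, Matrix.sub_mulVec, dotProduct_sub, dotProduct_sub]
  have t1 : w ⬝ᵥ ((P * ah (σs s * (σs s)ᵀ) * P) *ᵥ w) =
      (P *ᵥ w) ⬝ᵥ (ah (σs s * (σs s)ᵀ) *ᵥ (P *ᵥ w)) := by
    rw [← Matrix.mulVec_mulVec, ← Matrix.mulVec_mulVec, Matrix.dotProduct_mulVec w,
      ← Matrix.mulVec_transpose, hs]
  have t2 : w ⬝ᵥ ((P * Am (Ds s)) *ᵥ w) = (Am (Ds s) *ᵥ w) ⬝ᵥ (P *ᵥ w) := by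
    rw [← Matrix.mulVec_mulVec, qf_sym hs]
  have t3 : w ⬝ᵥ (((Am (Ds s))ᵀ * P) *ᵥ w) = (Am (Ds s) *ᵥ w) ⬝ᵥ (P *ᵥ w) := by
    rw [← Matrix.mulVec_mulVec, Matrix.dotProduct_mulVec w, Matrix.vecMul_transpose]
  rw [t1, t2, t3]; ring

lemma gk_deriv {σs Ds : ℝ → Matrix (Fin d) (Fin d) ℝ} (h : CH σs Ds c C) {r κ s : ℝ}
    (hs : s ≤ r) (hκ : 0 < κ) {θ : ℝ → V d} {θ' : V d} (hθ : HasDerivAt θ θ' s) (x : V d) :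
    HasDerivAt (fun s => gk σs Ds θ r κ s x)
      (-(Nm σs Ds r κ s * genR (σs s * (σs s)ᵀ) θ'.1
        (θ'.2 + Matrix.toEuclideanLin (Ds s) (x - θ s).1)
        (-(1 / 2) * ek σs Ds θ r κ s x) (1 / 4 * ek σs Ds θ r κ s x) (Pm σs Ds r κ s)
        (vecL d (x - θ s)))) s := by
  have hsym := Pm_symm (σ := σs) (D := Ds) r κ s
  have h1 := qf_time_deriv (Pm_deriv h hs hκ) hsym hθ x
  have h2 := logdet_deriv h hs hκ
  have h3 := h2.mul ((h1.neg.div_const 2).exp)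
  refine HasDerivAt.congr_deriv h3 ?_
  rw [Pm'_form, ah_form, Am_form, ah_trace _ hsym]
  simp only [Pi.neg_apply]
  rw [show Real.exp (-(qf (Pm σs Ds r κ s) (θ s) x) / 2) = ek σs Ds θ r κ s x from rfl,
    show (√(Km σs Ds r κ s).det)⁻¹ = Nm σs Ds r κ s from rfl]
  set P := Pm σs Ds r κ s
  set w := vecL d (x - θ s) with hw
  set e := ek σs Ds θ r κ s x
  set N := Nm σs Ds r κ s
  have hD : ∀ i, Matrix.toEuclideanLin (Ds s) (x - θ s).1 i = ∑ j, Ds s i j * w (Sum.inl j) := by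
    intro i; rfl
  unfold genR
  have g1 : ∑ i, ∑ j, (σs s * (σs s)ᵀ) i j * (4 * (1 / 4 * e) * (P *ᵥ w) (Sum.inl i) *
      (P *ᵥ w) (Sum.inl j) + 2 * (-(1 / 2) * e) * P (Sum.inl i) (Sum.inl j)) =
      e * (∑ i, ∑ j, (σs s * (σs s)ᵀ) i j * ((P *ᵥ w) (Sum.inl i) * (P *ᵥ w) (Sum.inl j)))
      - e * ∑ i, ∑ j, (σs s * (σs s)ᵀ) i j * P (Sum.inl i) (Sum.inl j) := by
    simp only [Finset.mul_sum, ← Finset.sum_sub_distrib]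
    exact Finset.sum_congr rfl fun i _ => Finset.sum_congr rfl fun j _ => by ring
  have g2 : ∑ i, θ'.1 i * (2 * (-(1 / 2) * e) * (P *ᵥ w) (Sum.inl i)) =
      -e * ∑ i, θ'.1 i * (P *ᵥ w) (Sum.inl i) := by
    simp only [Finset.mul_sum]
    exact Finset.sum_congr rfl fun i _ => by ring
  have g3 : ∑ i, (θ'.2 + Matrix.toEuclideanLin (Ds s) (x - θ s).1) i *
      (2 * (-(1 / 2) * e) * (P *ᵥ w) (Sum.inr i)) =
      -e * (∑ i, θ'.2 i * (P *ᵥ w) (Sum.inr i)) -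
        e * ∑ i, (∑ j, Ds s i j * w (Sum.inl j)) * (P *ᵥ w) (Sum.inr i) := by
    rw [Finset.mul_sum, Finset.mul_sum, ← Finset.sum_sub_distrib]
    refine Finset.sum_congr rfl fun i _ => ?_
    rw [PiLp.add_apply, hD]; ring
  rw [g1, g2, g3, dot_split]
  have g4 : v1 (vecL d θ') ⬝ᵥ v1 (P *ᵥ w) = ∑ i, θ'.1 i * (P *ᵥ w) (Sum.inl i) := rfl
  have g5 : v2 (vecL d θ') ⬝ᵥ v2 (P *ᵥ w) = ∑ i, θ'.2 i * (P *ᵥ w) (Sum.inr i) := rfl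
  rw [g4, g5]; ring

lemma Pm_PBd {σs Ds : ℝ → Matrix (Fin d) (Fin d) ℝ} (h : CH σs Ds c C) {r κ s : ℝ}
    (hs : s ≤ r) (hκ : 0 < κ) (hτ : r - s + κ ≤ 1) :
    PBd (Pm σs Ds r κ s) (c3 C) (√(C3 c C) * (κ ^ 3)⁻¹) := by
  have hτ0 : 0 < r - s + κ := by linarith
  have hC3 := C3_pos h
  have hc3 := c3_pos h
  have hκ3 : κ ^ 3 ≤ (r - s + κ) ^ 3 := by gcongr; linarith
  have hκτ : (r - s + κ) ^ 3 ≤ r - s + κ := by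
    have : (r - s + κ) ^ 2 ≤ 1 := by nlinarith
    nlinarith
  have hτ3 : (r - s + κ) ^ 3 ≤ 1 := by linarith
  refine ⟨Pm_symm r κ s, hc3, by positivity, fun w => ?_, fun w i => ?_⟩
  · refine le_trans ?_ (Pm_low h hs hκ w)
    gcongr
    rw [nsq_split, Wi]
    have n1 := nsq_nonneg (v1 w)
    have n2 := nsq_nonneg (v2 w)
    gcongr
    · rw [le_div_iff₀ hτ0]; nlinarith
    · rw [le_div_iff₀ (by positivity)]; nlinarith
  · have h1 := Pm_up h hs hκ w
    set u := Pm σs Ds r κ s *ᵥ w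
    have n1 := nsq_nonneg (v1 w)
    have n2 := nsq_nonneg (v2 w)
    have m1 := nsq_nonneg (v1 u)
    have m2 := nsq_nonneg (v2 u)
    have hw : Wi (r - s + κ) w ≤ (κ ^ 3)⁻¹ * nsq w := by
      rw [nsq_split, Wi, mul_add, inv_mul_eq_div, inv_mul_eq_div]
      gcongr
      exact hκ3.trans hκτ
    have hu : κ ^ 3 * nsq u ≤ W (r - s + κ) u := by
      rw [nsq_split, W, mul_add]
      gcongr
      exact hκ3.trans hκτ
    have h2 := sq_le_nsq u i
    have hk : 0 < κ ^ 3 := by positivity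
    have h3 : κ ^ 3 * nsq u ≤ C3 c C * ((κ ^ 3)⁻¹ * nsq w) :=
      hu.trans (h1.trans (by gcongr))
    have h4 : nsq u ≤ C3 c C * ((κ ^ 3)⁻¹) ^ 2 * nsq w := by
      have := mul_le_mul_of_nonneg_left h3 (inv_pos.2 hk).le
      rw [inv_mul_cancel_left₀ hk.ne'] at this
      linarith
    refine abs_le_of_sq_le_sq ?_ (by positivity)
    rw [mul_pow, mul_pow, Real.sq_sqrt hC3.le, Real.sq_sqrt (nsq_nonneg _)]
    exact h2.trans h4

end

end

section

/-! ### Part H: Ito formula for the frozen Gaussian -/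

section
variable {d : ℕ} {F1 F2 : ℝ → E d → E d → E d} {σ D : ℝ → E d → E d → Matrix (Fin d) (Fin d) ℝ}
  {c C b1 b2 b3 η : ℝ}
variable {Ω : Type*} [MeasurableSpace Ω] {m : Measure Ω} [IsFiniteMeasure m] {Y : ℝ → Ω → V d}
  {s0 T : ℝ}

lemma genR_cont {X : Type*} [TopologicalSpace X]
    {a : X → Matrix (Fin d) (Fin d) ℝ} {B1 B2 : X → E d}
    {f' f'' : X → ℝ} {P : X → Matrix (N2 d) (N2 d) ℝ} {w : X → N2 d → ℝ}
    (ha : ∀ i j, Continuous fun z => a z i j) (hB1 : Continuous B1) (hB2 : Continuous B2)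
    (hf' : Continuous f') (hf'' : Continuous f'') (hP : ∀ i j, Continuous fun z => P z i j)
    (hw : Continuous w) :
    Continuous fun z => genR (a z) (B1 z) (B2 z) (f' z) (f'' z) (P z) (w z) := by
  have hPw : ∀ i, Continuous fun z => (P z *ᵥ w z) i := fun i => by
    simp only [Matrix.mulVec, dotProduct]
    exact continuous_finsetSum _ fun k _ => (hP i k).mul ((continuous_apply k).comp hw)
  have hF1 : ∀ i, Continuous fun z => B1 z i := fun i =>
    (EuclideanSpace.proj (𝕜 := ℝ) i).continuous.comp hB1
  have hF2 : ∀ i, Continuous fun z => B2 z i := fun i =>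
    (EuclideanSpace.proj (𝕜 := ℝ) i).continuous.comp hB2
  unfold genR
  refine ((continuous_const.mul ?_).add ?_).add ?_
  · exact continuous_finsetSum _ fun i _ => continuous_finsetSum _ fun j _ => (ha i j).mul
      ((((continuous_const.mul hf'').mul (hPw _)).mul (hPw _)).add
        ((continuous_const.mul hf').mul (hP _ _)))
  · exact continuous_finsetSum _ fun i _ => (hF1 i).mul ((continuous_const.mul hf').mul (hPw _))
  · exact continuous_finsetSum _ fun i _ => (hF2 i).mul ((continuous_const.mul hf').mul (hPw _))

lemma genR_sub (a a' : Matrix (Fin d) (Fin d) ℝ) (B1 B1' B2 B2' : E d) (f' f'' : ℝ)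
    (P : Matrix (N2 d) (N2 d) ℝ) (w : N2 d → ℝ) :
    genR (a - a') (B1 - B1') (B2 - B2') f' f'' P w =
      genR a B1 B2 f' f'' P w - genR a' B1' B2' f' f'' P w := by
  unfold genR
  have e1 : ∀ i j, (a - a') i j = a i j - a' i j := fun i j => rfl
  have e2 : ∀ i, (B1 - B1') i = B1 i - B1' i := fun i => rfl
  have e3 : ∀ i, (B2 - B2') i = B2 i - B2' i := fun i => rfl
  simp only [e1, e2, e3, sub_mul, Finset.sum_sub_distrib]
  ring

lemma toE_cont {X : Type*} [TopologicalSpace X] {M : X → Matrix (Fin d) (Fin d) ℝ} {v : X → E d}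
    (hM : ∀ i j, Continuous fun z => M z i j) (hv : Continuous v) :
    Continuous fun z => Matrix.toEuclideanLin (M z) (v z) := by
  have h : Continuous fun z => (fun i => ∑ j, M z i j * v z j : Fin d → ℝ) :=
    continuous_pi fun i => continuous_finsetSum _ fun j _ => (hM i j).mul
      ((EuclideanSpace.proj (𝕜 := ℝ) j).continuous.comp hv)
  exact (PiLp.continuous_toLp 2 _).comp h

lemma toE_norm_le {M : Matrix (Fin d) (Fin d) ℝ} {K : ℝ} (hM : ∀ i j, |M i j| ≤ K) (v : E d) :
    ‖Matrix.toEuclideanLin M v‖ ≤ d * (d * K) * ‖v‖ := by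
  have h1 : ∀ i, |Matrix.toEuclideanLin M v i| ≤ d * (K * ‖v‖) := by
    intro i
    have : Matrix.toEuclideanLin M v i = ∑ j, M i j * v j := rfl
    rw [this]
    refine (abs_sum1_le (B := K * ‖v‖) fun j => ?_).trans (by simp)
    rw [abs_mul]
    exact mul_le_mul (hM i j) (abs_apply_le v j) (abs_nonneg _) ((abs_nonneg _).trans (hM i j))
  have h2 : ‖Matrix.toEuclideanLin M v‖ ≤ ∑ i, |Matrix.toEuclideanLin M v i| := by
    set z := Matrix.toEuclideanLin M v
    rw [EuclideanSpace.norm_eq]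
    refine Real.sqrt_le_iff.2 ⟨Finset.sum_nonneg fun i _ => abs_nonneg _, ?_⟩
    simp only [Real.norm_eq_abs]
    exact Finset.sum_sq_le_sq_sum_of_nonneg fun i _ => abs_nonneg _
  refine h2.trans ((Finset.sum_le_sum fun i _ => h1 i).trans (le_of_eq ?_))
  simp; ring

/-- the error density -/
def Hk (F1 F2 : ℝ → E d → E d → E d) (σ D : ℝ → E d → E d → Matrix (Fin d) (Fin d) ℝ)
    (θ dθ : ℝ → V d) (r κ s : ℝ) (x : V d) : ℝ :=
  Nm (fun u => σ u (θ u).1 (θ u).2) (fun u => D u (θ u).1 (θ u).2) r κ s *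
    genR (aσ σ s x.1 x.2 - aσ σ s (θ s).1 (θ s).2) (F1 s x.1 x.2 - (dθ s).1)
      (F2 s x.1 x.2 - ((dθ s).2 + Matrix.toEuclideanLin (D s (θ s).1 (θ s).2) (x - θ s).1))
      (-(1 / 2) * ek (fun u => σ u (θ u).1 (θ u).2) (fun u => D u (θ u).1 (θ u).2) θ r κ s x)
      (1 / 4 * ek (fun u => σ u (θ u).1 (θ u).2) (fun u => D u (θ u).1 (θ u).2) θ r κ s x)
      (Pm (fun u => σ u (θ u).1 (θ u).2) (fun u => D u (θ u).1 (θ u).2) r κ s)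
      (vecL d (x - θ s))

/-- clamping -/
def cl (s0 r s : ℝ) : ℝ := max s0 (min s r)
lemma cl_mem {s0 r : ℝ} (h : s0 ≤ r) (s : ℝ) : cl s0 r s ∈ Icc s0 r :=
  ⟨le_max_left _ _, max_le h (min_le_right _ _)⟩
lemma cl_eq {s0 r s : ℝ} (h : s ∈ Icc s0 r) : cl s0 r s = s := by
  rw [cl, min_eq_left h.2, max_eq_right h.1]
lemma cl_cont (s0 r : ℝ) : Continuous (cl s0 r) := by unfold cl; fun_prop

lemma clamp_bdd {f : ℝ → ℝ} (hf : Continuous f) {s0 r : ℝ} (h : s0 ≤ r) :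
    ∃ K, ∀ s, |f (cl s0 r s)| ≤ K := by
  obtain ⟨K, hK⟩ := isCompact_Icc.exists_bound_of_continuousOn (s := Icc s0 r) hf.continuousOn
  exact ⟨K, fun s => hK _ (cl_mem h s)⟩

lemma CH.clc {σs Ds : ℝ → Matrix (Fin d) (Fin d) ℝ} (h : CH σs Ds c C) {s0 r κ : ℝ}
    (hr : s0 ≤ r) (hκ : 0 < κ) :
    (∀ i j, Continuous fun s => Pm σs Ds r κ (cl s0 r s) i j) ∧
    Continuous fun s => Nm σs Ds r κ (cl s0 r s) := by
  have hP : ∀ i j, ContinuousOn (fun s => Pm σs Ds r κ s i j) (Iic r) := fun i j s hs =>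
    (Pm_deriv h hs hκ i j).continuousAt.continuousWithinAt
  have hN : ContinuousOn (fun s => Nm σs Ds r κ s) (Iic r) := fun s hs =>
    (logdet_deriv h hs hκ).continuousAt.continuousWithinAt
  refine ⟨fun i j => ?_, ?_⟩
  · exact (hP i j).comp_continuous (cl_cont s0 r) fun s => (cl_mem hr s).2
  · exact hN.comp_continuous (cl_cont s0 r) fun s => (cl_mem hr s).2

lemma Nm_nonneg (σs Ds : ℝ → Matrix (Fin d) (Fin d) ℝ) (r κ s : ℝ) : 0 ≤ Nm σs Ds r κ s := by
  unfold Nm; positivity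

set_option maxHeartbeats 1000000 in
lemma ito_gauss (H : Hyp F1 F2 σ D c C b1 b2 b3 η) (S : IsSol F1 F2 σ m Y s0 T)
    {θ dθ : ℝ → V d} (hθ : Continuous θ) (hdθ : Continuous dθ) {r κ : ℝ} (hr : s0 ≤ r)
    (hrT : r ≤ T) (hκ : 0 < κ) (hτ : r - s0 + κ ≤ 1)
    (hd : ∀ s ∈ Ioo s0 r, HasDerivAt θ (dθ s) s) :
    (∫ ω, gk (fun u => σ u (θ u).1 (θ u).2) (fun u => D u (θ u).1 (θ u).2) θ r κ r (Y r ω) ∂m -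
      ∫ ω, gk (fun u => σ u (θ u).1 (θ u).2) (fun u => D u (θ u).1 (θ u).2) θ r κ s0 (Y s0 ω) ∂m =
      ∫ s in s0..r, ∫ ω, Hk F1 F2 σ D θ dθ r κ s (Y s ω) ∂m) ∧
    (∀ s ∈ Icc s0 r, Integrable (fun ω => Hk F1 F2 σ D θ dθ r κ s (Y s ω)) m) ∧
    IntervalIntegrable (fun s => ∫ ω, Hk F1 F2 σ D θ dθ r κ s (Y s ω) ∂m) volume s0 r := by
  set σs : ℝ → Matrix (Fin d) (Fin d) ℝ := fun u => σ u (θ u).1 (θ u).2 with hσs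
  set Ds : ℝ → Matrix (Fin d) (Fin d) ℝ := fun u => D u (θ u).1 (θ u).2 with hDs
  have ch : CH σs Ds c C := H.ch θ hθ
  obtain ⟨cP, cN⟩ := ch.clc hr hκ
  set k := cl s0 r with hk
  have kc : Continuous k := cl_cont s0 r
  have km : ∀ s, k s ∈ Icc s0 r := cl_mem hr
  have hPB : ∀ s, PBd (Pm σs Ds r κ (k s)) (c3 C) (√(C3 c C) * (κ ^ 3)⁻¹) := fun s =>
    Pm_PBd ch (km s).2 hκ (by linarith [(km s).1])
  have hC1 := H.C1
  have hC3 := C3_pos ch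
  have hc3 := c3_pos ch
  -- bounds
  obtain ⟨R, hR⟩ := clamp_bdd hθ.norm hr
  obtain ⟨R', hR'⟩ := clamp_bdd hdθ.norm hr
  simp only [abs_norm] at hR hR'
  obtain ⟨KN, hKN⟩ : ∃ K, ∀ s, |Nm σs Ds r κ (k s)| ≤ K := by
    obtain ⟨K, hK⟩ := clamp_bdd cN hr
    refine ⟨K, fun s => ?_⟩
    have := hK s
    rwa [← hk, show k (k s) = k s from cl_eq (km s)] at this
  obtain ⟨KD, hKD⟩ : ∃ K, ∀ s i j, |Ds (k s) i j| ≤ K := by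
    have h1 : ∀ p : Fin d × Fin d, ∃ K, ∀ s, |Ds (k s) p.1 p.2| ≤ K := fun p =>
      clamp_bdd (ch.Dc p.1 p.2) hr
    choose K hK using h1
    refine ⟨∑ p, |K p|, fun s i j => ((hK (i, j) s).trans (le_abs_self _)).trans ?_⟩
    exact Finset.single_le_sum (f := fun p => |K p|) (fun p _ => abs_nonneg _) (Finset.mem_univ _)
  have hR0 : 0 ≤ R := (norm_nonneg _).trans (hR 0)
  have hR0' : 0 ≤ R' := (norm_nonneg _).trans (hR' 0)
  have hKN0 : 0 ≤ KN := (abs_nonneg _).trans (hKN 0)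
  set KD' := max KD 0 with hKD'
  have hKD0 : 0 ≤ KD' := le_max_right _ _
  have hKD2 : ∀ s i j, |Ds (k s) i j| ≤ KD' := fun s i j => (hKD s i j).trans (le_max_left _ _)
  -- functions
  let e : ℝ × V d → ℝ := fun p => ek σs Ds θ r κ (k p.1) p.2
  have he : Continuous e := by
    have := qf_cont (X := ℝ × V d) (P := fun p => Pm σs Ds r κ (k p.1)) (θ := fun p => θ (k p.1))
      (x := fun p => p.2) (fun i j => (cP i j).comp continuous_fst)
      (hθ.comp (kc.comp continuous_fst)) continuous_snd
    exact Real.continuous_exp.comp (this.neg.div_const 2)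
  have he1 : ∀ p, |e p| ≤ 1 := fun p => by
    have := (hPB p.1).qf_nonneg (θ (k p.1)) p.2
    simp only [e, ek, Real.abs_exp, Real.exp_le_one_iff]
    linarith
  let g : ℝ × V d → ℝ := fun p => gk σs Ds θ r κ (k p.1) p.2
  have hg : Continuous g := (cN.comp continuous_fst).mul he
  have hgb : ∀ p, |g p| ≤ KN := fun p => by
    have : g p = Nm σs Ds r κ (k p.1) * e p := rfl
    rw [this, abs_mul]
    nlinarith [hKN p.1, he1 p, abs_nonneg (e p)]
  let g1 : ℝ × V d → ℝ := fun p => -(Nm σs Ds r κ (k p.1) * genR (σs (k p.1) * (σs (k p.1))ᵀ)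
    (dθ (k p.1)).1 ((dθ (k p.1)).2 + Matrix.toEuclideanLin (Ds (k p.1)) (p.2 - θ (k p.1)).1)
        (-(1 / 2) * e p) (1 / 4 * e p) (Pm σs Ds r κ (k p.1))
        (vecL d (p.2 - θ (k p.1))))
  have kc1 : Continuous fun p : ℝ × V d => k p.1 := kc.comp continuous_fst
  have hxθ : Continuous fun p : ℝ × V d => p.2 - θ (k p.1) :=
    continuous_snd.sub (hθ.comp kc1)
  have hg1 : Continuous g1 := by
    refine ((cN.comp continuous_fst).mul (genR_cont ?_ ?_ ?_ ?_ ?_ ?_ ?_)).neg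
    · intro i j
      simp only [Matrix.mul_apply, Matrix.transpose_apply]
      exact continuous_finsetSum _ fun l _ => ((ch.σc i l).comp kc1).mul ((ch.σc j l).comp kc1)
    · exact (continuous_fst.comp hdθ).comp kc1
    · exact ((continuous_snd.comp hdθ).comp kc1).add
        (toE_cont (fun i j => (ch.Dc i j).comp kc1) (continuous_fst.comp hxθ))
    · exact continuous_const.mul he
    · exact continuous_const.mul he
    · exact fun i j => (cP i j).comp continuous_fst
    · exact (vecL d).continuous.comp hxθ
  have hnw : ∀ p : ℝ × V d, ‖p.2 - θ (k p.1)‖ ≤ √(nsq (vecL d (p.2 - θ (k p.1)))) := fun p =>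
    Real.le_sqrt_of_sq_le (norm_sq_le_nsq _)
  obtain ⟨K1, hg1b⟩ : ∃ K, ∀ p, |g1 p| ≤ K := by
    set C0 := √(C3 c C) * (κ ^ 3)⁻¹ with hC0
    have hC00 : 0 ≤ C0 := by positivity
    set R2 := R' + d * (d * KD') with hR2
    have hR20 : 0 ≤ R2 := by positivity
    set A := (d:ℝ) ^ 2 * (d * C ^ 2 * (2 * C0 ^ 2 + C0)) + 8 * d * R2 * C0 with hA
    have hA0 : 0 ≤ A := by positivity
    refine ⟨KN * (A * (1 + 2 / c3 C)), fun p => ?_⟩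
    simp only [g1, abs_neg, abs_mul]
    refine mul_le_mul (hKN _) ?_ (abs_nonneg _) hKN0
    have hen : |e p| = e p := abs_of_nonneg (Real.exp_pos _).le
    refine (genR_bound (hPB p.1) _ (Ca := d * C ^ 2) (fun i j => H.ab _ _ _ i j) (by positivity) _ _
      (R := R2) hR20 _ ?_ ?_ _ _ (B := e p) ?_ ?_).trans ?_
    · have h1 : ‖(dθ (k p.1)).1‖ ≤ R' := (norm_fst_le _).trans (hR' _)
      have := Real.sqrt_nonneg (nsq (vecL d (p.2 - θ (k p.1))))
      have : 0 ≤ (d:ℝ) * (d * KD') := by positivity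
      nlinarith
    · have h1 : ‖(dθ (k p.1)).2‖ ≤ R' := (norm_snd_le _).trans (hR' _)
      have h2 := toE_norm_le (hKD2 p.1) (p.2 - θ (k p.1)).1
      have h3 := (norm_fst_le (p.2 - θ (k p.1))).trans (hnw p)
      have h4 : 0 ≤ (d:ℝ) * (d * KD') := by positivity
      have h5 := norm_add_le (dθ (k p.1)).2 (Matrix.toEuclideanLin (Ds (k p.1)) (p.2 - θ (k p.1)).1)
      have h6 := mul_le_mul_of_nonneg_left h3 h4
      have h7 := Real.sqrt_nonneg (nsq (vecL d (p.2 - θ (k p.1))))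
      rw [hR2]
      nlinarith [mul_nonneg hR0' h7]
    · rw [abs_mul, hen]; norm_num; linarith [(hen ▸ abs_nonneg (e p) : 0 ≤ e p)]
    · rw [abs_mul, hen]; norm_num; linarith [(hen ▸ abs_nonneg (e p) : 0 ≤ e p)]
    · have he' := exp_absorb hc3 (nsq_nonneg (vecL d (p.2 - θ (k p.1))))
        ((hPB p.1).qf_low (θ (k p.1)) p.2)
      have := mul_le_mul_of_nonneg_left he' hA0
      rw [mul_assoc]
      exact this
  let g2 : ℝ → ℝ × V d → ℝ := fun s q => Nm σs Ds r κ (k s) * Lq F1 F2 σ (-(1 / 2) * e (s, q.2))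
    (1 / 4 * e (s, q.2)) (Pm σs Ds r κ (k s)) (θ (k s)) q.1 q.2
  have hg2 : Continuous fun p : ℝ × ℝ × V d => g2 p.1 p.2 := by
    have h1 : Continuous fun p : ℝ × ℝ × V d => e (p.1, p.2.2) :=
      he.comp (continuous_fst.prodMk (continuous_snd.comp continuous_snd))
    refine (cN.comp continuous_fst).mul (Lq_cont H ?_ ?_ ?_ ?_ ?_ ?_)
    · exact continuous_const.mul h1
    · exact continuous_const.mul h1
    · exact fun i j => (cP i j).comp continuous_fst
    · exact hθ.comp (kc.comp continuous_fst)
    · exact continuous_snd.comp continuous_snd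
    · exact continuous_fst.comp continuous_snd
  have hg2b : ∀ s p, |g2 s p| ≤ KN * KL d C (c3 C) (√(C3 c C) * (κ ^ 3)⁻¹) R 1 := fun s p => by
    simp only [g2, abs_mul]
    have hen : |e (s, p.2)| = e (s, p.2) := abs_of_nonneg (Real.exp_pos _).le
    have hen0 : 0 ≤ e (s, p.2) := (Real.exp_pos _).le
    refine mul_le_mul (hKN _) (Lq_bound H (hPB s) (hR s) zero_le_one _ _ ?_ ?_) (abs_nonneg _) hKN0
    · rw [abs_mul, hen, one_mul]; norm_num
      change 1 / 2 * e (s, p.2) ≤ e (s, p.2); linarith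
    · rw [abs_mul, hen, one_mul]; norm_num
      change 1 / 4 * e (s, p.2) ≤ e (s, p.2); linarith
  have hHk : ∀ s ∈ Icc s0 r, ∀ x, g1 (s, x) + g2 s (s, x) = Hk F1 F2 σ D θ dθ r κ s x := by
    intro s hs x
    have hks : k s = s := cl_eq hs
    simp only [g1, g2, e, hks, Hk, genR_sub, Lq]
    rw [show aσ σ s (θ s).1 (θ s).2 = σs s * (σs s)ᵀ from rfl]
    ring
  set KK := KN + |K1| + KN * KL d C (c3 C) (√(C3 c C) * (κ ^ 3)⁻¹) R 1 with hKK
  have hpos2 : 0 ≤ KN * KL d C (c3 C) (√(C3 c C) * (κ ^ 3)⁻¹) R 1 := (abs_nonneg _).trans (hg2b 0 0)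
  have hc2 : ∀ s, Continuous (g2 s) := fun s => hg2.comp (Continuous.prodMk_right s)
  have d1 : ∀ s ∈ Ioo s0 r, ∀ x, HasDerivAt (fun s => g (s, x)) (g1 (s, x)) s := by
    intro s hs x
    have hks : k s = s := cl_eq ⟨hs.1.le, hs.2.le⟩
    have h1 := gk_deriv ch hs.2.le hκ (hd s hs) x
    have h2 : g1 (s, x) = -(Nm σs Ds r κ s * genR (σs s * (σs s)ᵀ) (dθ s).1
        ((dθ s).2 + Matrix.toEuclideanLin (Ds s) (x - θ s).1)
        (-(1 / 2) * ek σs Ds θ r κ s x) (1 / 4 * ek σs Ds θ r κ s x) (Pm σs Ds r κ s)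
        (vecL d (x - θ s))) := by simp only [g1, e, hks]
    rw [h2]
    refine h1.congr_of_eventuallyEq ?_
    filter_upwards [Ioo_mem_nhds hs.1 hs.2] with u hu
    simp only [g, show k u = u from cl_eq ⟨hu.1.le, hu.2.le⟩]
  have d2 : ∀ s, ∀ t ∈ Icc s0 r, ∫ ω, g (s, Y t ω) ∂m - ∫ ω, g (s, Y s0 ω) ∂m =
      ∫ u in s0..t, ∫ ω, g2 s (u, Y u ω) ∂m := by
    intro s t ht
    have := ito_static H S (hPB s) (θ (k s)) le_rfl ht.1 (ht.2.trans hrT)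
    simp only [g, g2, e, gk, ek, integral_const_mul, intervalIntegral.integral_const_mul, ← mul_sub]
    rw [this]
  obtain ⟨main, mI, mC⟩ := diag_ito S hr (g := g) (g1 := g1) (g2 := g2) (K := KK) hg hg1 hg2
    (fun p => (hgb p).trans (by linarith [abs_nonneg K1]))
    (fun p => (hg1b p).trans (by linarith [le_abs_self K1]))
    (fun s p => (hg2b s p).trans (by linarith [abs_nonneg K1])) d1 d2
  · refine ⟨?_, ?_, ?_⟩
    · have e1 : ∀ x, g (r, x) = gk σs Ds θ r κ r x := fun x => by
        simp only [g, show k r = r from cl_eq ⟨hr, le_rfl⟩]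
      have e2 : ∀ x, g (s0, x) = gk σs Ds θ r κ s0 x := fun x => by
        simp only [g, show k s0 = s0 from cl_eq ⟨le_rfl, hr⟩]
      simp only [e1, e2] at main
      rw [main]
      refine intervalIntegral.integral_congr fun s hs => ?_
      rw [uIcc_of_le hr] at hs
      exact integral_congr_ae (Filter.Eventually.of_forall fun ω => hHk s hs _)
    · intro s hs
      exact (mI s).congr (Filter.Eventually.of_forall fun ω => hHk s hs _)
    · refine IntervalIntegrable.congr ?_ (mC.intervalIntegrable s0 r)
      intro s hs
      rw [uIoc_of_le hr] at hs
      exact integral_congr_ae (Filter.Eventually.of_forall fun ω => hHk s ⟨hs.1.le, hs.2⟩ _)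

end

end

section

/-! ### Part I: bound on the error density -/

section
variable {d : ℕ} {F1 F2 : ℝ → E d → E d → E d} {σ D : ℝ → E d → E d → Matrix (Fin d) (Fin d) ℝ}
  {c C b1 b2 b3 η : ℝ}

/-- homogeneous norm -/
def rho (τ : ℝ) (w : V d) : ℝ := √(Wi τ (vecL d w))

lemma rho_nonneg (τ : ℝ) (w : V d) : 0 ≤ rho τ w := Real.sqrt_nonneg _

lemma Wi_vec (τ : ℝ) (w : V d) : Wi τ (vecL d w) = ‖w.1‖ ^ 2 / τ + ‖w.2‖ ^ 2 / τ ^ 3 := by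
  rw [Wi, nsq_v1, nsq_v2]

lemma rho_sq {τ : ℝ} (hτ : 0 < τ) (w : V d) : rho τ w ^ 2 = ‖w.1‖ ^ 2 / τ + ‖w.2‖ ^ 2 / τ ^ 3 := by
  rw [rho, Real.sq_sqrt (Wi_nonneg hτ _), Wi_vec]

lemma rho_1 {τ : ℝ} (hτ : 0 < τ) (w : V d) : ‖w.1‖ ≤ rho τ w * τ ^ (1 / 2 : ℝ) := by
  refine le_of_sq_le_sq ?_ (by have := rho_nonneg τ w; positivity)
  rw [mul_pow, rho_sq hτ, ← Real.rpow_natCast (τ ^ (1/2:ℝ)), ← Real.rpow_mul hτ.le]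
  norm_num
  have : ‖w.1‖ ^ 2 = ‖w.1‖ ^ 2 / τ * τ := by field_simp
  rw [add_mul, ← this]
  have : 0 ≤ ‖w.2‖ ^ 2 / τ ^ 3 * τ := by positivity
  linarith

lemma rho_2 {τ : ℝ} (hτ : 0 < τ) (w : V d) : ‖w.2‖ ≤ rho τ w * τ ^ (3 / 2 : ℝ) := by
  refine le_of_sq_le_sq ?_ (by have := rho_nonneg τ w; positivity)
  rw [mul_pow, rho_sq hτ, ← Real.rpow_natCast (τ ^ (3/2:ℝ)), ← Real.rpow_mul hτ.le]
  norm_num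
  have : ‖w.2‖ ^ 2 = ‖w.2‖ ^ 2 / τ ^ 3 * τ ^ 3 := by field_simp
  rw [add_mul, ← this]
  have : 0 ≤ ‖w.1‖ ^ 2 / τ * τ ^ 3 := by positivity
  linarith

lemma genR_bound2 {P : Matrix (N2 d) (N2 d) ℝ} {a : Matrix (Fin d) (Fin d) ℝ} {B1 B2 : E d}
    {w : N2 d → ℝ} {e A β1 β2 p1 p2 p11 : ℝ} (he : 0 ≤ e) (ha : ∀ i j, |a i j| ≤ A) (hA : 0 ≤ A)
    (h1 : ‖B1‖ ≤ β1) (h2 : ‖B2‖ ≤ β2) (hp1 : ∀ i, |(P *ᵥ w) (Sum.inl i)| ≤ p1)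
    (hp2 : ∀ i, |(P *ᵥ w) (Sum.inr i)| ≤ p2)
    (hp11 : ∀ i j, |P (Sum.inl i) (Sum.inl j)| ≤ p11) (hp0 : 0 ≤ p1) :
    |genR a B1 B2 (-(1 / 2) * e) (1 / 4 * e) P w| ≤
      e * (d ^ 2 * (A * (p1 ^ 2 + p11)) + d * (β1 * p1) + d * (β2 * p2)) := by
  have t1 : |∑ i, ∑ j, a i j * (4 * (1 / 4 * e) * (P *ᵥ w) (Sum.inl i) * (P *ᵥ w) (Sum.inl j)
      + 2 * (-(1 / 2) * e) * P (Sum.inl i) (Sum.inl j))| ≤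
      (Fintype.card (Fin d) : ℝ) ^ 2 * (A * (e * (p1 ^ 2 + p11))) := by
    refine abs_sum2_le fun i j => ?_
    rw [abs_mul]
    refine mul_le_mul (ha i j) ?_ (abs_nonneg _) hA
    have e1 : 4 * (1 / 4 * e) * (P *ᵥ w) (Sum.inl i) * (P *ᵥ w) (Sum.inl j)
      + 2 * (-(1 / 2) * e) * P (Sum.inl i) (Sum.inl j) =
      e * ((P *ᵥ w) (Sum.inl i) * (P *ᵥ w) (Sum.inl j) - P (Sum.inl i) (Sum.inl j)) := by ring
    rw [e1, abs_mul, abs_of_nonneg he]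
    gcongr
    refine (abs_sub _ _).trans (add_le_add ?_ (hp11 i j))
    rw [abs_mul, sq]
    exact mul_le_mul (hp1 i) (hp1 j) (abs_nonneg _) hp0
  have t2 : |∑ i, B1 i * (2 * (-(1 / 2) * e) * (P *ᵥ w) (Sum.inl i))| ≤
      (Fintype.card (Fin d) : ℝ) * (e * (β1 * p1)) := by
    refine abs_sum1_le fun i => ?_
    have e1 : B1 i * (2 * (-(1 / 2) * e) * (P *ᵥ w) (Sum.inl i)) =
      -(e * (B1 i * (P *ᵥ w) (Sum.inl i))) := by ring
    rw [e1, abs_neg, abs_mul, abs_of_nonneg he, abs_mul]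
    gcongr
    · exact (norm_nonneg _).trans h1
    · exact (abs_apply_le _ i).trans h1
    · exact hp1 i
  have t3 : |∑ i, B2 i * (2 * (-(1 / 2) * e) * (P *ᵥ w) (Sum.inr i))| ≤
      (Fintype.card (Fin d) : ℝ) * (e * (β2 * p2)) := by
    refine abs_sum1_le fun i => ?_
    have e1 : B2 i * (2 * (-(1 / 2) * e) * (P *ᵥ w) (Sum.inr i)) =
      -(e * (B2 i * (P *ᵥ w) (Sum.inr i))) := by ring
    rw [e1, abs_neg, abs_mul, abs_of_nonneg he, abs_mul]
    gcongr
    · exact (norm_nonneg _).trans h2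
    · exact (abs_apply_le _ i).trans h2
    · exact hp2 i
  rw [Fintype.card_fin] at t1 t2 t3
  unfold genR
  refine (abs_add_le _ _).trans ((add_le_add (abs_add_le _ _) le_rfl).trans ?_)
  rw [abs_mul]
  have hh : |(1 / 2 : ℝ)| ≤ 1 := by norm_num [abs_le]
  have := mul_le_mul hh t1 (abs_nonneg _) zero_le_one
  linarith

lemma Hyp.a_diff (H : Hyp F1 F2 σ D c C b1 b2 b3 η) (t : ℝ) (x y : V d) (i j : Fin d) :
    |(aσ σ t x.1 x.2 - aσ σ t y.1 y.2) i j| ≤ d * (2 * C ^ 2 * (‖x.1 - y.1‖ + ‖x.2 - y.2‖)) := by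
  have e : (aσ σ t x.1 x.2 - aσ σ t y.1 y.2) i j =
      ∑ k, (σ t x.1 x.2 i k * σ t x.1 x.2 j k - σ t y.1 y.2 i k * σ t y.1 y.2 j k) := by
    simp only [Matrix.sub_apply, aσ, Matrix.mul_apply, Matrix.transpose_apply,
      Finset.sum_sub_distrib]
  rw [e]
  refine (abs_sum1_le (B := 2 * C ^ 2 * (‖x.1 - y.1‖ + ‖x.2 - y.2‖)) fun k => ?_).trans (by simp)
  have hC := H.C1
  have h1 := H.σh t x.1 x.2 y.1 y.2 i k
  have h2 := H.σh t x.1 x.2 y.1 y.2 j k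
  have h3 := H.σb t x.1 x.2 i k
  have h4 := H.σb t y.1 y.2 j k
  have e2 : σ t x.1 x.2 i k * σ t x.1 x.2 j k - σ t y.1 y.2 i k * σ t y.1 y.2 j k =
    σ t x.1 x.2 i k * (σ t x.1 x.2 j k - σ t y.1 y.2 j k) +
      (σ t x.1 x.2 i k - σ t y.1 y.2 i k) * σ t y.1 y.2 j k := by ring
  rw [e2]
  refine (abs_add_le _ _).trans ?_
  rw [abs_mul, abs_mul]
  have h5 := mul_le_mul h3 h2 (abs_nonneg _) (by linarith)
  have h6 := mul_le_mul h1 h4 (abs_nonneg _) ((abs_nonneg _).trans h1)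
  nlinarith

/-- polynomial-times-Gaussian is bounded -/
lemma poly_exp_bdd {c : ℝ} (hc : 0 < c) (k : ℕ) :
    ∃ K, 0 < K ∧ ∀ ρ : ℝ, 0 ≤ ρ → Real.exp (-(c * ρ ^ 2) / 2) * (1 + ρ) ^ k ≤ K := by
  refine ⟨(1 + 2 / c) ^ k * Real.exp (2 / c) ^ k * 0 + Real.exp (k ^ 2 / (2 * c) + k) , by positivity,
    fun ρ hρ => ?_⟩
  have h1 : (1 + ρ) ^ k ≤ Real.exp (k * ρ) := by
    rw [Real.exp_nat_mul]
    have := Real.add_one_le_exp ρ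
    gcongr; linarith
  calc Real.exp (-(c * ρ ^ 2) / 2) * (1 + ρ) ^ k ≤ Real.exp (-(c * ρ ^ 2) / 2) * Real.exp (k * ρ) := by
        gcongr
    _ = Real.exp (-(c * ρ ^ 2) / 2 + k * ρ) := by rw [Real.exp_add]
    _ ≤ Real.exp (k ^ 2 / (2 * c) + k) := by
        rw [Real.exp_le_exp]
        have h2 : 0 ≤ (c * ρ - k) ^ 2 / (2 * c) := by positivity
        have h3 : (c * ρ - k) ^ 2 / (2 * c) = c * ρ ^ 2 / 2 - k * ρ + k ^ 2 / (2 * c) := by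
          field_simp; ring
        have h4 : (0:ℝ) ≤ k := by positivity
        linarith
    _ = _ := by ring

/-- regularisation exponent -/
def gam (b3 η : ℝ) : ℝ := min (η / 2) ((3 * b3 - 1) / 2)

lemma Hyp.gam_pos (H : Hyp F1 F2 σ D c C b1 b2 b3 η) : 0 < gam b3 η := by
  have := H.hη.1; have := H.hb3'
  exact lt_min (by linarith) (by linarith)

lemma Hyp.gam_le (H : Hyp F1 F2 σ D c C b1 b2 b3 η) : gam b3 η ≤ 1 / 2 :=
  (min_le_left _ _).trans (by linarith [H.hη.2])

lemma rpow_le_one_add {ρ b : ℝ} (hρ : 0 ≤ ρ) (hb0 : 0 ≤ b) (hb : b ≤ 1) : ρ ^ b ≤ 1 + ρ := by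
  calc ρ ^ b ≤ (1 + ρ) ^ b := by gcongr; linarith
    _ ≤ (1 + ρ) ^ (1:ℝ) := Real.rpow_le_rpow_of_exponent_le (by linarith) hb
    _ = 1 + ρ := Real.rpow_one _

lemma Hk_fin (d : ℕ) {C K3 c' ρ τ γ : ℝ} (hC1 : 1 ≤ C) (hK3 : 0 < K3) (hc'0 : 0 < c') (hc'2 : c' ^ 2 = K3)
    (hρ0 : 0 ≤ ρ) (hτ0 : 0 < τ) (hτ1 : τ ≤ 1) (hγ1 : γ ≤ 1 / 2) : (d:ℝ) ^ 2 * (4 * d * C ^ 2 * (ρ * τ ^ (1 / 2 : ℝ)) *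
        ((c' * ρ * τ ^ (-(1 / 2) : ℝ)) ^ 2 + c' * τ ^ (-1 : ℝ))) +
      (d:ℝ) * ((2 * C + 1) * (1 + ρ) * (c' * ρ * τ ^ (-(1 / 2) : ℝ))) +
      (d:ℝ) * ((2 * C + 1) * (1 + ρ) ^ 2 * τ ^ (1 / 2 + γ) * (c' * ρ * τ ^ (-(3 / 2) : ℝ))) ≤
      ((d:ℝ) ^ 2 * (4 * d * C ^ 2 * (K3 + c')) + d * ((2 * C + 1) * c') +
    d * ((2 * C + 1) * c')) * τ ^ (-1 + γ) * (1 + ρ) ^ 3 := by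
    have hmono : ∀ {a b : ℝ}, b ≤ a → τ ^ a ≤ τ ^ b := fun h =>
      Real.rpow_le_rpow_of_exponent_ge hτ0 hτ1 h
    have rp : ∀ a b : ℝ, τ ^ a * τ ^ b = τ ^ (a + b) := fun a b => (Real.rpow_add hτ0 a b).symm
    have rp2 : ∀ a : ℝ, (τ ^ a) ^ 2 = τ ^ (2 * a) := fun a => by
      rw [← Real.rpow_natCast, ← Real.rpow_mul hτ0.le]; congr 1; push_cast; ring
    set S := τ ^ (-1 + γ) with hS
    have hS0 : 0 < S := by positivity
    have Sh : τ ^ (-(1 / 2) : ℝ) ≤ S := hmono (by linarith)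
    have q1 : τ ^ (1 / 2 : ℝ) * τ ^ (-1 : ℝ) = τ ^ (-(1 / 2) : ℝ) := by rw [rp]; norm_num
    have q2 : (τ ^ (-(1 / 2) : ℝ)) ^ 2 = τ ^ (-1 : ℝ) := by rw [rp2]; norm_num
    have q3 : τ ^ (1 / 2 + γ) * τ ^ (-(3 / 2) : ℝ) = S := by rw [rp, hS]; congr 1; ring
    have T1 : (d:ℝ) ^ 2 * (4 * d * C ^ 2 * (ρ * τ ^ (1 / 2 : ℝ)) *
        ((c' * ρ * τ ^ (-(1 / 2) : ℝ)) ^ 2 + c' * τ ^ (-1 : ℝ))) ≤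
        d ^ 2 * (4 * d * C ^ 2 * (K3 + c')) * S * (1 + ρ) ^ 3 := by
      have e1 : (d:ℝ) ^ 2 * (4 * d * C ^ 2 * (ρ * τ ^ (1 / 2 : ℝ)) *
        ((c' * ρ * τ ^ (-(1 / 2) : ℝ)) ^ 2 + c' * τ ^ (-1 : ℝ))) =
        d ^ 2 * (4 * d * C ^ 2) * (τ ^ (-(1 / 2) : ℝ)) * (K3 * ρ ^ 3 + c' * ρ) := by
        rw [mul_pow, mul_pow, q2, hc'2, ← q1]; ring
      rw [e1]
      have h1 : ρ ^ 3 ≤ (1 + ρ) ^ 3 := by gcongr; linarith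
      have h2 : ρ ≤ (1 + ρ) ^ 3 := by nlinarith [pow_nonneg hρ0 3, pow_nonneg hρ0 2]
      calc _ ≤ d ^ 2 * (4 * d * C ^ 2) * S * (K3 * (1 + ρ) ^ 3 + c' * (1 + ρ) ^ 3) := by
            gcongr
        _ = _ := by ring
    have T2 : (d:ℝ) * ((2 * C + 1) * (1 + ρ) * (c' * ρ * τ ^ (-(1 / 2) : ℝ))) ≤
        d * ((2 * C + 1) * c') * S * (1 + ρ) ^ 3 := by
      have h1 : (1 + ρ) * ρ ≤ (1 + ρ) ^ 3 := by nlinarith [pow_nonneg hρ0 3, pow_nonneg hρ0 2]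
      calc _ = d * ((2 * C + 1) * c') * τ ^ (-(1 / 2) : ℝ) * ((1 + ρ) * ρ) := by ring
        _ ≤ _ := by gcongr
    have T3 : (d:ℝ) * ((2 * C + 1) * (1 + ρ) ^ 2 * τ ^ (1 / 2 + γ) * (c' * ρ * τ ^ (-(3 / 2) : ℝ))) ≤
        d * ((2 * C + 1) * c') * S * (1 + ρ) ^ 3 := by
      have h1 : (1 + ρ) ^ 2 * ρ ≤ (1 + ρ) ^ 3 := by nlinarith [pow_nonneg hρ0 3, pow_nonneg hρ0 2]
      calc _ = d * ((2 * C + 1) * c') * (τ ^ (1 / 2 + γ) * τ ^ (-(3 / 2) : ℝ)) *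
            ((1 + ρ) ^ 2 * ρ) := by ring
        _ ≤ _ := by rw [q3]; gcongr
    calc _ ≤ _ := add_le_add (add_le_add T1 T2) T3
      _ = _ := by ring

set_option maxHeartbeats 1000000 in
lemma Hk_bound (H : Hyp F1 F2 σ D c C b1 b2 b3 η) (p : ℕ) : ∃ K, 0 ≤ K ∧
    ∀ (θ dθ : ℝ → V d) (r κ s : ℝ) (x : V d), Continuous θ → s ≤ r → 0 < κ → r - s + κ ≤ 1 →
      ‖dθ s - (F1 s (θ s).1 (θ s).2, F2 s (θ s).1 (θ s).2)‖ ≤ κ →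
      |Hk F1 F2 σ D θ dθ r κ s x| ≤ K * (r - s + κ) ^ (-1 + gam b3 η) *
        (((r - s + κ) ^ (2 * d))⁻¹ * ((1 + rho (r - s + κ) (x - θ s)) ^ p)⁻¹) := by
  have ch0 := H.ch (fun _ => 0) continuous_const
  have hC3 := C3_pos ch0
  have hc3 := c3_pos ch0
  have hC1 := H.C1
  obtain ⟨K0, hK0, hK⟩ := poly_exp_bdd hc3 (p + 3)
  set A1 : ℝ := d ^ 2 * (4 * d * C ^ 2 * (C3 c C + √(C3 c C))) + d * ((2 * C + 1) * √(C3 c C)) +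
    d * ((2 * C + 1) * √(C3 c C)) with hA1
  have hA10 : 0 ≤ A1 := by positivity
  refine ⟨√(C4 d c C) * A1 * K0, by positivity, fun θ dθ r κ s x hθ hs hκ hτ1 hδ => ?_⟩
  have ch := H.ch θ hθ
  unfold Hk
  set σs : ℝ → Matrix (Fin d) (Fin d) ℝ := fun u => σ u (θ u).1 (θ u).2
  set Ds : ℝ → Matrix (Fin d) (Fin d) ℝ := fun u => D u (θ u).1 (θ u).2
  set τ := r - s + κ with hτ
  have hτ0 : 0 < τ := by linarith
  have hκτ : κ ≤ τ := by linarith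
  set w := x - θ s with hw
  set ρ := rho τ w with hρ
  have hρ0 : 0 ≤ ρ := rho_nonneg _ _
  set γ := gam b3 η with hγ
  have hγ0 := H.gam_pos
  have hγ1 := H.gam_le
  set S := τ ^ (-1 + γ) with hS
  have hS0 : 0 < S := by positivity
  have hmono : ∀ {a b : ℝ}, b ≤ a → τ ^ a ≤ τ ^ b := fun h =>
    Real.rpow_le_rpow_of_exponent_ge hτ0 hτ1 h
  have hle1 : ∀ {a : ℝ}, 0 ≤ a → τ ^ a ≤ 1 := fun h => Real.rpow_le_one hτ0.le hτ1 h
  have w1 : ‖w.1‖ ≤ ρ * τ ^ (1 / 2 : ℝ) := rho_1 hτ0 w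
  have w2 : ‖w.2‖ ≤ ρ * τ ^ (3 / 2 : ℝ) := rho_2 hτ0 w
  have hWi : Wi τ (vecL d w) = ρ ^ 2 := (Real.sq_sqrt (Wi_nonneg hτ0 _)).symm
  -- exponential
  set e := ek σs Ds θ r κ s x with he
  have he0 : 0 ≤ e := (Real.exp_pos _).le
  have he1 : e ≤ Real.exp (-(c3 C * ρ ^ 2) / 2) := by
    rw [he, ek, Real.exp_le_exp, ← hWi]
    have := Pm_low ch hs hκ (vecL d w)
    unfold qf
    linarith
  have heK : e * (1 + ρ) ^ 3 ≤ K0 * ((1 + ρ) ^ p)⁻¹ := by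
    rw [← div_eq_mul_inv, le_div_iff₀ (by positivity), mul_assoc, ← pow_add, add_comm 3 p]
    exact le_trans (by gcongr) (hK ρ hρ0)
  have hN : Nm σs Ds r κ s ≤ √(C4 d c C) * (τ ^ (2 * d))⁻¹ := det_bound ch hs hκ
  -- P bounds
  have hPu := Pm_up ch hs hκ (vecL d w)
  rw [hWi] at hPu
  set u := Pm σs Ds r κ s *ᵥ vecL d w with hu
  have m1 := nsq_nonneg (v1 u)
  have m2 := nsq_nonneg (v2 u)
  rw [W] at hPu
  set c' := √(C3 c C) with hc'
  have hc'0 : 0 < c' := Real.sqrt_pos.2 hC3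
  have hc'2 : c' ^ 2 = C3 c C := Real.sq_sqrt hC3.le
  have rp : ∀ a b : ℝ, τ ^ a * τ ^ b = τ ^ (a + b) := fun a b => (Real.rpow_add hτ0 a b).symm
  have rp2 : ∀ a : ℝ, (τ ^ a) ^ 2 = τ ^ (2 * a) := fun a => by
    rw [← Real.rpow_natCast, ← Real.rpow_mul hτ0.le]; congr 1; push_cast; ring
  have u1 : ∀ i, |u (Sum.inl i)| ≤ c' * ρ * τ ^ (-(1 / 2) : ℝ) := fun i => by
    refine abs_le_of_sq_le_sq ?_ (by positivity)
    rw [mul_pow, mul_pow, hc'2, rp2, show (2 * -(1 / 2) : ℝ) = -1 by norm_num, Real.rpow_neg_one,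
      ← div_eq_mul_inv, le_div_iff₀ hτ0]
    have h1 := sq_le_nsq (v1 u) i
    have h2 : 0 ≤ τ ^ 3 * nsq (v2 u) := by positivity
    have h3 := mul_le_mul_of_nonneg_left h1 hτ0.le
    change u (Sum.inl i) ^ 2 * τ ≤ _
    change τ * u (Sum.inl i) ^ 2 ≤ _ at h3
    linarith
  have u2 : ∀ i, |u (Sum.inr i)| ≤ c' * ρ * τ ^ (-(3 / 2) : ℝ) := fun i => by
    refine abs_le_of_sq_le_sq ?_ (by positivity)
    rw [mul_pow, mul_pow, hc'2, rp2, show (2 * -(3 / 2) : ℝ) = -(3:ℕ) by norm_num,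
      Real.rpow_neg hτ0.le, Real.rpow_natCast,
      ← div_eq_mul_inv, le_div_iff₀ (by positivity)]
    have h1 := sq_le_nsq (v2 u) i
    have h2 : 0 ≤ τ * nsq (v1 u) := by positivity
    have h3 := mul_le_mul_of_nonneg_left h1 (pow_pos hτ0 3).le
    change u (Sum.inr i) ^ 2 * τ ^ 3 ≤ _
    change τ ^ 3 * u (Sum.inr i) ^ 2 ≤ _ at h3
    linarith
  have u11 : ∀ i j, |Pm σs Ds r κ s (Sum.inl i) (Sum.inl j)| ≤ c' * τ ^ (-1 : ℝ) := fun i j => by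
    rw [Real.rpow_neg_one, ← div_eq_mul_inv]; exact P11_bound ch hs hκ i j
  -- coefficient bounds
  have A0 : ∀ i j, |(aσ σ s x.1 x.2 - aσ σ s (θ s).1 (θ s).2) i j| ≤
      4 * d * C ^ 2 * (ρ * τ ^ (1 / 2 : ℝ)) := fun i j => by
    refine (H.a_diff s x (θ s) i j).trans ?_
    have h1 : ‖x.1 - (θ s).1‖ ≤ ρ * τ ^ (1 / 2 : ℝ) := w1
    have h2 : ‖x.2 - (θ s).2‖ ≤ ρ * τ ^ (1 / 2 : ℝ) := w2.trans (by
      exact mul_le_mul_of_nonneg_left (hmono (by norm_num)) hρ0)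
    have : ‖x.1 - (θ s).1‖ + ‖x.2 - (θ s).2‖ ≤ 2 * (ρ * τ ^ (1 / 2 : ℝ)) := by linarith
    calc _ ≤ d * (2 * C ^ 2 * (2 * (ρ * τ ^ (1 / 2 : ℝ)))) := by gcongr
      _ = _ := by ring
  have hd1 : ‖F1 s (θ s).1 (θ s).2 - (dθ s).1‖ ≤ κ := by
    rw [norm_sub_rev]; exact (norm_fst_le (dθ s - (F1 s (θ s).1 (θ s).2, F2 s (θ s).1 (θ s).2))).trans hδ
  have hd2 : ‖F2 s (θ s).1 (θ s).2 - (dθ s).2‖ ≤ κ := by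
    rw [norm_sub_rev]; exact (norm_snd_le (dθ s - (F1 s (θ s).1 (θ s).2, F2 s (θ s).1 (θ s).2))).trans hδ
  have B1 : ‖F1 s x.1 x.2 - (dθ s).1‖ ≤ (2 * C + 1) * (1 + ρ) := by
    have h1 := H.F1h s x.1 x.2 (θ s).1 (θ s).2
    have h2 : ‖x.1 - (θ s).1‖ ^ b1 ≤ 1 + ρ := by
      refine le_trans (Real.rpow_le_rpow (norm_nonneg _) (w1.trans ?_) H.hb1.1.le)
        (rpow_le_one_add hρ0 H.hb1.1.le H.hb1.2.le)
      have := hle1 (a := 1 / 2) (by norm_num)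
      nlinarith
    have h3 : ‖x.2 - (θ s).2‖ ^ b2 ≤ 1 + ρ := by
      refine le_trans (Real.rpow_le_rpow (norm_nonneg _) (w2.trans ?_) H.hb2.1.le)
        (rpow_le_one_add hρ0 H.hb2.1.le H.hb2.2.le)
      have := hle1 (a := 3 / 2) (by norm_num)
      nlinarith
    have h4 := norm_add_le (F1 s x.1 x.2 - F1 s (θ s).1 (θ s).2) (F1 s (θ s).1 (θ s).2 - (dθ s).1)
    rw [sub_add_sub_cancel] at h4
    have h5 : C * (‖x.1 - (θ s).1‖ ^ b1 + ‖x.2 - (θ s).2‖ ^ b2) ≤ C * (2 * (1 + ρ)) := by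
      gcongr; linarith
    refine h4.trans ((add_le_add (h1.trans h5) (hd1.trans (hκτ.trans (hτ1.trans (by linarith : 1 ≤ 1 + ρ))))).trans
      (le_of_eq ?_))
    ring
  have B2 : ‖F2 s x.1 x.2 - ((dθ s).2 + Matrix.toEuclideanLin (D s (θ s).1 (θ s).2) w.1)‖ ≤
      (2 * C + 1) * (1 + ρ) ^ 2 * τ ^ (1 / 2 + γ) := by
    have h1 := H.tay s x.1 x.2 (θ s).1 (θ s).2
    have h2 : ‖x.1 - (θ s).1‖ ^ (1 + η) ≤ (1 + ρ) ^ 2 * τ ^ (1 / 2 + γ) := by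
      have hη := H.hη
      calc ‖x.1 - (θ s).1‖ ^ (1 + η) ≤ (ρ * τ ^ (1 / 2 : ℝ)) ^ (1 + η) :=
            Real.rpow_le_rpow (norm_nonneg _) w1 (by linarith [hη.1])
        _ = ρ ^ (1 + η) * τ ^ ((1 + η) / 2) := by
            rw [Real.mul_rpow hρ0 (by positivity), ← Real.rpow_mul hτ0.le,
              show (1 / 2 : ℝ) * (1 + η) = (1 + η) / 2 by ring]
        _ ≤ (1 + ρ) ^ 2 * τ ^ (1 / 2 + γ) := by
            refine mul_le_mul ?_ (hmono ?_) (by positivity) (by positivity)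
            · calc ρ ^ (1 + η) ≤ (1 + ρ) ^ (1 + η) := by
                    have := hη.1; gcongr; linarith
                _ ≤ (1 + ρ) ^ (2:ℝ) :=
                    Real.rpow_le_rpow_of_exponent_le (by linarith) (by linarith [hη.2])
                _ = (1 + ρ) ^ 2 := by norm_cast
            · have : γ ≤ η / 2 := min_le_left _ _
              linarith
    have h3 : ‖x.2 - (θ s).2‖ ^ b3 ≤ (1 + ρ) ^ 2 * τ ^ (1 / 2 + γ) := by
      have hb := H.hb3
      calc ‖x.2 - (θ s).2‖ ^ b3 ≤ (ρ * τ ^ (3 / 2 : ℝ)) ^ b3 :=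
            Real.rpow_le_rpow (norm_nonneg _) w2 hb.1.le
        _ = ρ ^ b3 * τ ^ (3 / 2 * b3) := by
            rw [Real.mul_rpow hρ0 (by positivity), ← Real.rpow_mul hτ0.le]
        _ ≤ (1 + ρ) ^ 2 * τ ^ (1 / 2 + γ) := by
            refine mul_le_mul ?_ (hmono ?_) (by positivity) (by positivity)
            · refine (rpow_le_one_add hρ0 hb.1.le hb.2.le).trans ?_
              nlinarith
            · have : γ ≤ (3 * b3 - 1) / 2 := min_le_right _ _
              linarith
    have h6 : κ ≤ (1 + ρ) ^ 2 * τ ^ (1 / 2 + γ) := by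
      have h7 : τ ≤ τ ^ (1 / 2 + γ) := by
        calc τ = τ ^ (1:ℝ) := (Real.rpow_one _).symm
          _ ≤ _ := hmono (by linarith)
      have h8 : 1 ≤ (1 + ρ) ^ 2 := by nlinarith
      have : 0 ≤ τ ^ (1 / 2 + γ) := by positivity
      nlinarith
    have e1 : F2 s x.1 x.2 - ((dθ s).2 + Matrix.toEuclideanLin (D s (θ s).1 (θ s).2) w.1) =
        (F2 s x.1 x.2 - F2 s (θ s).1 (θ s).2 -
          Matrix.toEuclideanLin (D s (θ s).1 (θ s).2) (x.1 - (θ s).1)) +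
          (F2 s (θ s).1 (θ s).2 - (dθ s).2) := by
      rw [hw, Prod.fst_sub]; abel
    rw [e1]
    refine (norm_add_le _ _).trans ?_
    set Q := (1 + ρ) ^ 2 * τ ^ (1 / 2 + γ) with hQ
    have h9 : C * (‖x.1 - (θ s).1‖ ^ (1 + η) + ‖x.2 - (θ s).2‖ ^ b3) ≤ C * (2 * Q) := by
      gcongr; linarith
    rw [mul_assoc, ← hQ]
    refine (add_le_add (h1.trans h9) (hd2.trans h6)).trans (le_of_eq ?_)
    ring
  have G := genR_bound2 (P := Pm σs Ds r κ s) (w := vecL d w) (e := e) he0 A0 (by positivity) B1 B2 u1 u2 u11 (by positivity)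
  rw [abs_mul, abs_of_nonneg (Nm_nonneg _ _ _ _ _)]
  have hfin := Hk_fin d (γ := γ) hC1 hC3 hc'0 hc'2 hρ0 hτ0 hτ1 hγ1
  rw [← hA1, ← hS] at hfin
  have G2 := G.trans (mul_le_mul_of_nonneg_left hfin he0)
  refine (mul_le_mul hN G2 (abs_nonneg _) (by positivity)).trans ?_
  calc (√(C4 d c C) * (τ ^ (2 * d))⁻¹) * (e * (A1 * S * (1 + ρ) ^ 3))
    _ = √(C4 d c C) * A1 * S * (τ ^ (2 * d))⁻¹ * (e * (1 + ρ) ^ 3) := by ring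
    _ ≤ √(C4 d c C) * A1 * S * (τ ^ (2 * d))⁻¹ * (K0 * ((1 + ρ) ^ p)⁻¹) := by gcongr
    _ = _ := by ring

end

end

section

/-! ### Part J: approximate characteristics -/

section
variable {d : ℕ}

/-- one step of the delayed Picard iteration -/
def tonStep (G : ℝ → V d → V d) (s h : ℝ) (x : V d) (θ : ℝ → V d) : ℝ → V d :=
  fun u => x + ∫ v in s..u, G v (θ (max s (v - h)))

/-- delayed Picard iteration -/
def ton (G : ℝ → V d → V d) (s h : ℝ) (x : V d) : ℕ → ℝ → V d
  | 0 => fun _ => x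
  | n + 1 => tonStep G s h x (ton G s h x n)

lemma ton_int_cont {G : ℝ → V d → V d} (hG : Continuous fun p : ℝ × V d => G p.1 p.2) (s h : ℝ)
    {θ : ℝ → V d} (hθ : Continuous θ) : Continuous fun v => G v (θ (max s (v - h))) :=
  hG.comp (continuous_id.prodMk (hθ.comp (continuous_const.max (continuous_id.sub continuous_const))))

lemma ton_deriv {G : ℝ → V d → V d} (hG : Continuous fun p : ℝ × V d => G p.1 p.2) (s h : ℝ)
    (x : V d) {θ : ℝ → V d} (hθ : Continuous θ) (u : ℝ) :
    HasDerivAt (tonStep G s h x θ) (G u (θ (max s (u - h)))) u := by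
  have hc := ton_int_cont hG s h hθ
  have := (hc.integral_hasStrictDerivAt s u).hasDerivAt.const_add x
  exact this

lemma ton_cont {G : ℝ → V d → V d} (hG : Continuous fun p : ℝ × V d => G p.1 p.2) (s h : ℝ)
    (x : V d) (n : ℕ) : Continuous (ton G s h x n) := by
  induction n with
  | zero => exact continuous_const
  | succ n ih =>
    exact continuous_iff_continuousAt.2 fun u => (ton_deriv hG s h x ih u).continuousAt

lemma ton_stab (G : ℝ → V d → V d) {s h : ℝ} (hh : 0 < h) (x : V d) (n : ℕ) :
    ∀ u ∈ Icc s (s + n * h), ton G s h x (n + 1) u = ton G s h x n u := by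
  induction n with
  | zero =>
    intro u hu
    have : u = s := le_antisymm (by simpa using hu.2) hu.1
    simp [ton, tonStep, this]
  | succ n ih =>
    intro u hu
    change x + _ = x + _
    congr 1
    refine intervalIntegral.integral_congr fun v hv => ?_
    rw [uIcc_of_le hu.1] at hv
    change G v _ = G v _
    congr 1
    refine ih _ ⟨le_max_left _ _, max_le ?_ ?_⟩
    · have : 0 ≤ n * h := by positivity
      linarith
    · have := hu.2; have := hv.2; push_cast at *; linarith

/-- approximate forward solutions -/
lemma approx_fwd {G : ℝ → V d → V d} (hG : Continuous fun p : ℝ × V d => G p.1 p.2) {C : ℝ}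
    (hC : 0 < C) (hgr : ∀ t x, ‖G t x‖ ≤ C * (1 + ‖x‖))
    (huc : ∀ δ > 0, ∃ ε > 0, ∀ t x y, ‖x - y‖ ≤ ε → ‖G t x - G t y‖ ≤ δ)
    {s r : ℝ} (hsr : s ≤ r) (hCr : C * (r - s) ≤ 1 / 2) (x : V d) {δ : ℝ} (hδ : 0 < δ) :
    ∃ ψ dψ : ℝ → V d, Continuous ψ ∧ Continuous dψ ∧ ψ s = x ∧
      (∀ u, HasDerivAt ψ (dψ u) u) ∧ ∀ u ∈ Icc s r, ‖dψ u - G u (ψ u)‖ ≤ δ := by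
  obtain ⟨ε, hε, hεδ⟩ := huc δ hδ
  set R := 2 * ‖x‖ + 1 with hR
  have hR0 : 0 < R := by positivity
  set h := ε / (C * (1 + R)) with hh
  have hh0 : 0 < h := by positivity
  obtain ⟨n, hn⟩ := exists_nat_ge ((r - s) / h)
  have hn' : r ≤ s + n * h := by
    rw [div_le_iff₀ hh0] at hn; linarith
  set ψ := ton G s h x (n + 1) with hψ
  have hψc : Continuous ψ := ton_cont hG s h x (n + 1)
  have hθc := ton_cont hG s h x n
  have hd : ∀ u, HasDerivAt ψ (G u (ton G s h x n (max s (u - h)))) u :=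
    fun u => ton_deriv hG s h x hθc u
  have hst : ∀ u ∈ Icc s r, ton G s h x n (max s (u - h)) = ψ (max s (u - h)) := by
    intro u hu
    refine (ton_stab G hh0 x n _ ⟨le_max_left _ _, max_le ?_ ?_⟩).symm
    · exact hsr.trans hn'
    · linarith [hu.2]
  have hs : ψ s = x := by simp [hψ, ton, tonStep]
  obtain ⟨u0, hu0, hmax⟩ := isCompact_Icc.exists_isMaxOn ⟨s, left_mem_Icc.2 hsr⟩ hψc.norm.continuousOn
  have hM : ∀ u ∈ Icc s r, ‖ψ u‖ ≤ ‖ψ u0‖ := fun u hu => hmax hu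
  have hmx : ∀ u ∈ Icc s r, max s (u - h) ∈ Icc s r := fun u hu =>
    ⟨le_max_left _ _, max_le hsr (by linarith [hu.2])⟩
  have hdb : ∀ u ∈ Icc s r, ‖G u (ton G s h x n (max s (u - h)))‖ ≤ C * (1 + ‖ψ u0‖) := by
    intro u hu
    rw [hst u hu]
    refine (hgr _ _).trans ?_
    have := hM _ (hmx u hu)
    gcongr
  have hlip : ∀ a ∈ Icc s r, ∀ b ∈ Icc s r, ‖ψ b - ψ a‖ ≤ C * (1 + ‖ψ u0‖) * ‖b - a‖ := fun a ha b hb =>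
    (convex_Icc s r).norm_image_sub_le_of_norm_hasDerivWithin_le
      (fun u hu => (hd u).hasDerivWithinAt) hdb ha hb
  have hMR : ‖ψ u0‖ ≤ R := by
    have h1 := hlip s (left_mem_Icc.2 hsr) u0 hu0
    rw [hs, Real.norm_of_nonneg (by linarith [hu0.1] : 0 ≤ u0 - s)] at h1
    have h2 : ‖ψ u0‖ ≤ ‖ψ u0 - x‖ + ‖x‖ := by simpa using norm_add_le (ψ u0 - x) x
    have h3 : C * (1 + ‖ψ u0‖) * (u0 - s) ≤ 1 / 2 * (1 + ‖ψ u0‖) := by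
      have h4 : C * (u0 - s) ≤ C * (r - s) := by have := hu0.2; gcongr
      have h5 : 0 ≤ 1 + ‖ψ u0‖ := by positivity
      nlinarith
    linarith
  refine ⟨ψ, fun u => G u (ton G s h x n (max s (u - h))), hψc, ton_int_cont hG s h hθc, hs, hd,
    fun u hu => ?_⟩
  beta_reduce
  rw [hst u hu]
  refine hεδ _ _ _ ((hlip u hu _ (hmx u hu)).trans ?_)
  have h1 : ‖max s (u - h) - u‖ ≤ h := by
    rw [Real.norm_eq_abs, abs_le]
    constructor
    · linarith [le_max_right s (u - h)]
    · have : max s (u - h) ≤ u := max_le hu.1 (by linarith)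
      linarith
  calc C * (1 + ‖ψ u0‖) * ‖max s (u - h) - u‖ ≤ C * (1 + R) * h := by gcongr
    _ = ε := by rw [hh]; field_simp

/-- approximate backward solutions -/
lemma approx_bwd {G : ℝ → V d → V d} (hG : Continuous fun p : ℝ × V d => G p.1 p.2) {C : ℝ}
    (hC : 0 < C) (hgr : ∀ t x, ‖G t x‖ ≤ C * (1 + ‖x‖))
    (huc : ∀ δ > 0, ∃ ε > 0, ∀ t x y, ‖x - y‖ ≤ ε → ‖G t x - G t y‖ ≤ δ)
    {s r : ℝ} (hsr : s ≤ r) (hCr : C * (r - s) ≤ 1 / 2) (q : V d) {δ : ℝ} (hδ : 0 < δ) :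
    ∃ θ dθ : ℝ → V d, Continuous θ ∧ Continuous dθ ∧ θ r = q ∧
      (∀ u, HasDerivAt θ (dθ u) u) ∧ ∀ u ∈ Icc s r, ‖dθ u - G u (θ u)‖ ≤ δ := by
  have hG' : Continuous fun p : ℝ × V d => -G (-p.1) p.2 :=
    (hG.comp (continuous_fst.neg.prodMk continuous_snd)).neg
  have hgr' : ∀ t x, ‖-G (-t) x‖ ≤ C * (1 + ‖x‖) := fun t x => by rw [norm_neg]; exact hgr _ _
  have huc' : ∀ δ > 0, ∃ ε > 0, ∀ t x y, ‖x - y‖ ≤ ε → ‖-G (-t) x - -G (-t) y‖ ≤ δ := by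
    intro δ hδ
    obtain ⟨ε, hε, h⟩ := huc δ hδ
    refine ⟨ε, hε, fun t x y hxy => ?_⟩
    rw [neg_sub_neg, norm_sub_rev]; exact h _ _ _ hxy
  obtain ⟨ψ, dψ, h1, h2, h3, h4, h5⟩ := approx_fwd (G := fun t x => -G (-t) x) hG' hC hgr' huc'
    (neg_le_neg hsr) (by linarith) q hδ
  refine ⟨fun u => ψ (-u), fun u => -dψ (-u), h1.comp continuous_neg, (h2.comp continuous_neg).neg,
    h3, fun u => ?_, fun u hu => ?_⟩
  · have := (h4 (-u)).scomp u (hasDerivAt_neg u)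
    exact this.congr_deriv (by simp)
  · have := h5 (-u) ⟨neg_le_neg hu.2, neg_le_neg hu.1⟩
    rw [neg_neg] at this
    have e : -dψ (-u) - G u (ψ (-u)) = -(dψ (-u) - -G u (ψ (-u))) := by abel
    beta_reduce
    rw [e, norm_neg]
    exact this

variable {F1 F2 : ℝ → E d → E d → E d} {σ D : ℝ → E d → E d → Matrix (Fin d) (Fin d) ℝ}
  {c C b1 b2 b3 η : ℝ}

/-- the full drift -/
def FF (F1 F2 : ℝ → E d → E d → E d) (t : ℝ) (x : V d) : V d := (F1 t x.1 x.2, F2 t x.1 x.2)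

lemma Hyp.FF_cont (H : Hyp F1 F2 σ D c C b1 b2 b3 η) :
    Continuous fun p : ℝ × V d => FF F1 F2 p.1 p.2 := H.cF1.prodMk H.cF2

lemma Hyp.FF_gr (H : Hyp F1 F2 σ D c C b1 b2 b3 η) (t : ℝ) (x : V d) :
    ‖FF F1 F2 t x‖ ≤ C * (1 + ‖x‖) := by
  rw [FF, Prod.norm_mk]; exact max_le (H.gF1 t x) (H.gF2 t x)

lemma Hyp.FF_uc (H : Hyp F1 F2 σ D c C b1 b2 b3 η) :
    ∀ δ > 0, ∃ ε > 0, ∀ t x y, ‖x - y‖ ≤ ε → ‖FF F1 F2 t x - FF F1 F2 t y‖ ≤ δ := by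
  intro δ hδ
  have hC := H.C1
  have h1 : Filter.Tendsto (fun e : ℝ => C * (e ^ b1 + e ^ b2) + C * (e + e ^ b3)) (nhds 0) (nhds 0) := by
    have hc : ContinuousAt (fun e : ℝ => C * (e ^ b1 + e ^ b2) + C * (e + e ^ b3)) 0 := by
      have a1 := Real.continuousAt_rpow_const 0 b1 (Or.inr H.hb1.1.le)
      have a2 := Real.continuousAt_rpow_const 0 b2 (Or.inr H.hb2.1.le)
      have a3 := Real.continuousAt_rpow_const 0 b3 (Or.inr H.hb3.1.le)
      exact (continuousAt_const.mul (a1.add a2)).add (continuousAt_const.mul (continuousAt_id.add a3))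
    have := hc.tendsto
    simpa [Real.zero_rpow H.hb1.1.ne', Real.zero_rpow H.hb2.1.ne', Real.zero_rpow H.hb3.1.ne'] using this
  have h2 := (h1.mono_left (nhdsWithin_le_nhds (s := Ioi 0))).eventually (gt_mem_nhds hδ)
  obtain ⟨ε, hε, hε0⟩ := (h2.and self_mem_nhdsWithin).exists
  refine ⟨ε, hε0, fun t x y hxy => ?_⟩
  have n1 : ‖x.1 - y.1‖ ≤ ε := (norm_fst_le (x - y)).trans hxy
  have n2 : ‖x.2 - y.2‖ ≤ ε := (norm_snd_le (x - y)).trans hxy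
  have q0 : (0:ℝ) < ε := hε0
  have m1 := H.hb1.1; have m2 := H.hb2.1; have m3 := H.hb3.1
  have k1 : 0 ≤ C * (ε ^ b1 + ε ^ b2) := by positivity
  have k2 : 0 ≤ C * (ε + ε ^ b3) := by positivity
  rw [FF, FF, Prod.mk_sub_mk, Prod.norm_mk]
  refine max_le ((H.F1h _ _ _ _ _).trans ?_) ((H.F2h _ _ _ _ _).trans ?_)
  · calc C * (‖x.1 - y.1‖ ^ b1 + ‖x.2 - y.2‖ ^ b2) ≤ C * (ε ^ b1 + ε ^ b2) := by gcongr
      _ ≤ δ := by linarith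
  · calc C * (‖x.1 - y.1‖ + ‖x.2 - y.2‖ ^ b3) ≤ C * (ε + ε ^ b3) := by gcongr
      _ ≤ δ := by linarith

end

end

section

/-! ### Part K: comparison of approximate characteristics -/

section
variable {d : ℕ} {F1 F2 : ℝ → E d → E d → E d} {σ D : ℝ → E d → E d → Matrix (Fin d) (Fin d) ℝ}
  {c C b1 b2 b3 η : ℝ}

lemma half_sq {τ : ℝ} (hτ : 0 < τ) : (τ ^ (1 / 2 : ℝ)) ^ 2 = τ := by
  rw [← Real.rpow_natCast, ← Real.rpow_mul hτ.le]; norm_num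

lemma half_cube {τ : ℝ} (hτ : 0 < τ) : τ ^ (3 / 2 : ℝ) = (τ ^ (1 / 2 : ℝ)) ^ 3 := by
  rw [← Real.rpow_natCast, ← Real.rpow_mul hτ.le]; norm_num

lemma rho_le {τ a b : ℝ} (hτ : 0 < τ) {w : V d} (ha : 0 ≤ a) (hb : 0 ≤ b)
    (h1 : ‖w.1‖ ≤ a * τ ^ (1 / 2 : ℝ)) (h2 : ‖w.2‖ ≤ b * τ ^ (3 / 2 : ℝ)) : rho τ w ≤ a + b := by
  refine abs_le_of_sq_le_sq' ?_ (by positivity) |>.2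
  rw [rho_sq hτ]
  have e1 : ‖w.1‖ ^ 2 / τ ≤ a ^ 2 := by
    rw [div_le_iff₀ hτ]
    calc ‖w.1‖ ^ 2 ≤ (a * τ ^ (1 / 2 : ℝ)) ^ 2 := by gcongr
      _ = _ := by rw [mul_pow, half_sq hτ]
  have e2 : ‖w.2‖ ^ 2 / τ ^ 3 ≤ b ^ 2 := by
    rw [div_le_iff₀ (by positivity)]
    calc ‖w.2‖ ^ 2 ≤ (b * τ ^ (3 / 2 : ℝ)) ^ 2 := by gcongr
      _ = b ^ 2 * ((τ ^ (1 / 2 : ℝ)) ^ 2) ^ 3 := by rw [half_cube hτ]; ring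
      _ = _ := by rw [half_sq hτ]
  nlinarith [mul_nonneg ha hb]

lemma cmp_arith {C n1 n2 ρ t e : ℝ} (hC : 1 ≤ C) (hn1 : 0 ≤ n1) (hn2 : 0 ≤ n2) (hρ : 0 ≤ ρ)
    (ht : 0 < t) (ht1 : t ≤ 1) (he : C * e ≤ 1 / 2) (htC : C * t * (1 + 2 * C) ≤ 1 / 4)
    (h1 : n1 * t ≤ ρ * t + t ^ 2 * (C * (2 + n1 * t + n2 * t ^ 3) + 2))
    (h2 : n2 * t ^ 3 ≤ ρ * t ^ 3 + t ^ 2 * (C * (n1 * t + (1 + n2) * (t * e)) + 2 * t ^ 2)) :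
    n1 + n2 ≤ 30 * C * (1 + ρ) - 1 := by
  have k1 : n1 ≤ ρ + t * (C * (2 + n1 * t + n2 * t ^ 3) + 2) := by
    refine le_of_mul_le_mul_right ?_ ht
    linarith
  have k2 : n2 ≤ ρ + (C * (n1 + (1 + n2) * e) + 2 * t) := by
    refine le_of_mul_le_mul_right ?_ (by positivity : 0 < t ^ 3)
    linarith
  have k3 : n2 ≤ 2 * ρ + 2 * (C * n1) + 5 := by nlinarith
  have ht3 : t ^ 3 ≤ 1 := pow_le_one₀ ht.le ht1
  have hCt : C * t ≤ 1 / 12 := by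
    have : 0 ≤ C * t * (C - 1) := by
      have : 0 ≤ C - 1 := by linarith
      positivity
    nlinarith
  have k4 : n1 ≤ ρ + (C * t * (2 + n1 + n2) + 2 * t) := by
    have a1 : n1 * t ≤ n1 := by nlinarith
    have a2 : n2 * t ^ 3 ≤ n2 := by nlinarith
    have : C * t * (2 + n1 * t + n2 * t ^ 3) ≤ C * t * (2 + n1 + n2) := by gcongr
    linarith
  have k5 : C * t * (2 + n1 + n2) ≤ C * t * (2 + n1 + (2 * ρ + 2 * (C * n1) + 5)) := by
    gcongr
  have k6 : C * t * (2 + n1 + (2 * ρ + 2 * (C * n1) + 5)) =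
    C * t * (1 + 2 * C) * n1 + C * t * (2 * ρ + 7) := by ring
  have k7 : C * t * (1 + 2 * C) * n1 ≤ 1 / 4 * n1 := by gcongr
  have k8 : C * t * (2 * ρ + 7) ≤ 1 / 12 * (2 * ρ + 7) := by gcongr
  have k9 : n1 ≤ 2 * ρ + 7 := by linarith
  have k10 : C * n1 ≤ C * (2 * ρ + 7) := by gcongr
  nlinarith

/-- comparison of approximate characteristics -/
lemma compare_curves (H : Hyp F1 F2 σ D c C b1 b2 b3 η) {s r κ τ : ℝ} (hsr : s ≤ r) (hκ : 0 < κ)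
    (hτ : τ = r - s + κ) (hτ1 : τ ≤ 1) (he : C * τ ^ gam b3 η ≤ 1 / 2)
    (htC : C * τ ^ (1 / 2 : ℝ) * (1 + 2 * C) ≤ 1 / 4)
    {θ dθ ψ dψ : ℝ → V d} (hθ : ∀ u, HasDerivAt θ (dθ u) u) (hψ : ∀ u, HasDerivAt ψ (dψ u) u)
    (hθF : ∀ u ∈ Icc s r, ‖dθ u - FF F1 F2 u (θ u)‖ ≤ κ)
    (hψF : ∀ u ∈ Icc s r, ‖dψ u - FF F1 F2 u (ψ u)‖ ≤ κ) :
    1 + rho τ (θ r - ψ r) ≤ 30 * C * (1 + rho τ (ψ s - θ s)) := by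
  have hτ0 : 0 < τ := by linarith
  have hC := H.C1
  set ρ := rho τ (ψ s - θ s) with hρ
  have hρ0 : 0 ≤ ρ := rho_nonneg _ _
  set t := τ ^ (1 / 2 : ℝ) with ht
  have ht0 : 0 < t := by positivity
  have ht1 : t ≤ 1 := Real.rpow_le_one hτ0.le hτ1 (by norm_num)
  have htt : t ^ 2 = τ := half_sq hτ0
  have ht3 : τ ^ (3 / 2 : ℝ) = t ^ 3 := half_cube hτ0
  have w1 : ‖(ψ s - θ s).1‖ ≤ ρ * t := rho_1 hτ0 _
  have w2 : ‖(ψ s - θ s).2‖ ≤ ρ * t ^ 3 := by rw [← ht3]; exact rho_2 hτ0 _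
  have hdiff : ∀ u, HasDerivAt (fun u => ψ u - θ u) (dψ u - dθ u) u := fun u => (hψ u).sub (hθ u)
  have hc : Continuous fun u => ψ u - θ u :=
    continuous_iff_continuousAt.2 fun u => (hdiff u).continuousAt
  have hd1 : ∀ u, HasDerivAt (fun u => (ψ u - θ u).1) (dψ u - dθ u).1 u := fun u =>
    (ContinuousLinearMap.fst ℝ (E d) (E d)).hasFDerivAt.comp_hasDerivAt u (hdiff u)
  have hd2 : ∀ u, HasDerivAt (fun u => (ψ u - θ u).2) (dψ u - dθ u).2 u := fun u =>
    (ContinuousLinearMap.snd ℝ (E d) (E d)).hasFDerivAt.comp_hasDerivAt u (hdiff u)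
  obtain ⟨u1, hu1, hm1⟩ := isCompact_Icc.exists_isMaxOn ⟨s, left_mem_Icc.2 hsr⟩
    (continuous_fst.comp hc).norm.continuousOn
  obtain ⟨u2, hu2, hm2⟩ := isCompact_Icc.exists_isMaxOn ⟨s, left_mem_Icc.2 hsr⟩
    (continuous_snd.comp hc).norm.continuousOn
  have M1 : ∀ u ∈ Icc s r, ‖(ψ u - θ u).1‖ ≤ ‖(ψ u1 - θ u1).1‖ := fun u hu => hm1 hu
  have M2 : ∀ u ∈ Icc s r, ‖(ψ u - θ u).2‖ ≤ ‖(ψ u2 - θ u2).2‖ := fun u hu => hm2 hu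
  set n1 := ‖(ψ u1 - θ u1).1‖ / t with hn1
  set n2 := ‖(ψ u2 - θ u2).2‖ / t ^ 3 with hn2
  have e1 : ‖(ψ u1 - θ u1).1‖ = n1 * t := by rw [hn1]; field_simp
  have e2 : ‖(ψ u2 - θ u2).2‖ = n2 * t ^ 3 := by rw [hn2]; field_simp
  have n10 : 0 ≤ n1 := by positivity
  have n20 : 0 ≤ n2 := by positivity
  rw [e1] at M1
  rw [e2] at M2
  have hκτ : κ ≤ τ := by linarith
  -- error in the derivatives
  have err : ∀ u ∈ Icc s r, ‖(dψ u - dθ u) - (FF F1 F2 u (ψ u) - FF F1 F2 u (θ u))‖ ≤ 2 * κ := by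
    intro u hu
    have : (dψ u - dθ u) - (FF F1 F2 u (ψ u) - FF F1 F2 u (θ u)) =
      (dψ u - FF F1 F2 u (ψ u)) - (dθ u - FF F1 F2 u (θ u)) := by abel
    rw [this]
    refine (norm_sub_le _ _).trans ?_
    linarith [hθF u hu, hψF u hu]
  have B1 : ∀ u ∈ Icc s r, ‖(dψ u - dθ u).1‖ ≤ C * (2 + n1 * t + n2 * t ^ 3) + 2 := by
    intro u hu
    have a1 := (norm_fst_le _).trans (err u hu)
    have a2 := H.F1h u (ψ u).1 (ψ u).2 (θ u).1 (θ u).2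
    have a3 : ‖(ψ u).1 - (θ u).1‖ ^ b1 ≤ 1 + n1 * t :=
      (rpow_le_one_add (norm_nonneg _) H.hb1.1.le H.hb1.2.le).trans
        (add_le_add le_rfl (M1 u hu))
    have a4 : ‖(ψ u).2 - (θ u).2‖ ^ b2 ≤ 1 + n2 * t ^ 3 :=
      (rpow_le_one_add (norm_nonneg _) H.hb2.1.le H.hb2.2.le).trans
        (add_le_add le_rfl (M2 u hu))
    have a5 : (dψ u - dθ u).1 = (dψ u - dθ u - (FF F1 F2 u (ψ u) - FF F1 F2 u (θ u))).1 +
        (F1 u (ψ u).1 (ψ u).2 - F1 u (θ u).1 (θ u).2) := by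
      simp only [FF, Prod.fst_sub]; abel
    rw [a5]
    refine (norm_add_le _ _).trans ?_
    have a6 : C * (‖(ψ u).1 - (θ u).1‖ ^ b1 + ‖(ψ u).2 - (θ u).2‖ ^ b2) ≤
      C * (2 + n1 * t + n2 * t ^ 3) := mul_le_mul_of_nonneg_left (by linarith) (by linarith)
    linarith
  have B2 : ∀ u ∈ Icc s r, ‖(dψ u - dθ u).2‖ ≤
      C * (n1 * t + (1 + n2) * (t * τ ^ gam b3 η)) + 2 * t ^ 2 := by
    intro u hu
    have a1 := (norm_snd_le _).trans (err u hu)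
    have a2 := H.F2h u (ψ u).1 (ψ u).2 (θ u).1 (θ u).2
    have a3 : ‖(ψ u).1 - (θ u).1‖ ≤ n1 * t := M1 u hu
    have hb := H.hb3
    have a4 : ‖(ψ u).2 - (θ u).2‖ ^ b3 ≤ (1 + n2) * (t * τ ^ gam b3 η) := by
      calc ‖(ψ u).2 - (θ u).2‖ ^ b3 ≤ (n2 * t ^ 3) ^ b3 :=
            Real.rpow_le_rpow (norm_nonneg _) (M2 u hu) hb.1.le
        _ = n2 ^ b3 * τ ^ (3 / 2 * b3) := by
            rw [Real.mul_rpow n20 (by positivity), ← ht3, ← Real.rpow_mul hτ0.le]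
        _ ≤ (1 + n2) * τ ^ (1 / 2 + gam b3 η) := by
            refine mul_le_mul (rpow_le_one_add n20 hb.1.le hb.2.le)
              (Real.rpow_le_rpow_of_exponent_ge hτ0 hτ1 ?_) (by positivity) (by positivity)
            have : gam b3 η ≤ (3 * b3 - 1) / 2 := min_le_right _ _
            linarith
        _ = _ := by rw [Real.rpow_add hτ0]
    have a5 : (dψ u - dθ u).2 = (dψ u - dθ u - (FF F1 F2 u (ψ u) - FF F1 F2 u (θ u))).2 +
        (F2 u (ψ u).1 (ψ u).2 - F2 u (θ u).1 (θ u).2) := by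
      simp only [FF, Prod.snd_sub]; abel
    rw [a5]
    refine (norm_add_le _ _).trans ?_
    have a6 : C * (‖(ψ u).1 - (θ u).1‖ + ‖(ψ u).2 - (θ u).2‖ ^ b3) ≤
      C * (n1 * t + (1 + n2) * (t * τ ^ gam b3 η)) := by gcongr
    rw [htt]
    linarith
  have hlen : ∀ u ∈ Icc s r, ‖u - s‖ ≤ t ^ 2 := fun u hu => by
    rw [htt, Real.norm_of_nonneg (by linarith [hu.1])]; linarith [hu.2]
  have I1 := (convex_Icc s r).norm_image_sub_le_of_norm_hasDerivWithin_le
      (fun u hu => (hd1 u).hasDerivWithinAt) B1 (left_mem_Icc.2 hsr) hu1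
  have I2 := (convex_Icc s r).norm_image_sub_le_of_norm_hasDerivWithin_le
      (fun u hu => (hd2 u).hasDerivWithinAt) B2 (left_mem_Icc.2 hsr) hu2
  have J1 : n1 * t ≤ ρ * t + t ^ 2 * (C * (2 + n1 * t + n2 * t ^ 3) + 2) := by
    rw [← e1]
    have k1 := norm_add_le ((ψ u1 - θ u1).1 - (ψ s - θ s).1) (ψ s - θ s).1
    rw [sub_add_cancel] at k1
    have k2 : (C * (2 + n1 * t + n2 * t ^ 3) + 2) * ‖u1 - s‖ ≤
      (C * (2 + n1 * t + n2 * t ^ 3) + 2) * t ^ 2 := by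
      have := hlen u1 hu1
      gcongr
    rw [e1] at *
    linarith
  have J2 : n2 * t ^ 3 ≤ ρ * t ^ 3 + t ^ 2 * (C * (n1 * t + (1 + n2) * (t * τ ^ gam b3 η)) + 2 * t ^ 2) := by
    rw [← e2]
    have k1 := norm_add_le ((ψ u2 - θ u2).2 - (ψ s - θ s).2) (ψ s - θ s).2
    rw [sub_add_cancel] at k1
    have k2 : (C * (n1 * t + (1 + n2) * (t * τ ^ gam b3 η)) + 2 * t ^ 2) * ‖u2 - s‖ ≤
      (C * (n1 * t + (1 + n2) * (t * τ ^ gam b3 η)) + 2 * t ^ 2) * t ^ 2 := by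
      have := hlen u2 hu2
      gcongr
    linarith
  have fin := cmp_arith hC n10 n20 hρ0 ht0 ht1 he htC J1 J2
  have hr := right_mem_Icc.2 hsr
  have : rho τ (θ r - ψ r) ≤ n1 + n2 := by
    refine rho_le hτ0 n10 n20 ?_ ?_
    · rw [← norm_neg, ← Prod.fst_neg, neg_sub]; exact M1 r hr
    · rw [← norm_neg, ← Prod.snd_neg, neg_sub, ht3]; exact M2 r hr
  linarith

end

end

section

/-! ### Part L: anisotropic scaling -/

section
variable {d : ℕ}

lemma rho_add_le {τ : ℝ} (hτ : 0 < τ) (a b : V d) : rho τ (a + b) ≤ rho τ a + rho τ b := by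
  have ra := rho_nonneg τ a
  have rb := rho_nonneg τ b
  refine (abs_le_of_sq_le_sq' ?_ (by positivity)).2
  have sa := rho_sq hτ a
  have sb := rho_sq hτ b
  rw [rho_sq hτ]
  have n1 : ‖(a + b).1‖ ^ 2 / τ ≤ (‖a.1‖ + ‖b.1‖) ^ 2 / τ := by
    have := norm_add_le a.1 b.1
    rw [Prod.fst_add]; gcongr
  have n2 : ‖(a + b).2‖ ^ 2 / τ ^ 3 ≤ (‖a.2‖ + ‖b.2‖) ^ 2 / τ ^ 3 := by
    have := norm_add_le a.2 b.2
    rw [Prod.snd_add]; gcongr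
  have key : ‖a.1‖ * ‖b.1‖ / τ + ‖a.2‖ * ‖b.2‖ / τ ^ 3 ≤ rho τ a * rho τ b := by
    refine (abs_le_of_sq_le_sq' ?_ (by positivity)).2
    rw [mul_pow, sa, sb]
    have : 0 ≤ (‖a.1‖ * ‖b.2‖ - ‖a.2‖ * ‖b.1‖) ^ 2 / (τ * τ ^ 3) := by positivity
    have e : (‖a.1‖ ^ 2 / τ + ‖a.2‖ ^ 2 / τ ^ 3) * (‖b.1‖ ^ 2 / τ + ‖b.2‖ ^ 2 / τ ^ 3) -
      (‖a.1‖ * ‖b.1‖ / τ + ‖a.2‖ * ‖b.2‖ / τ ^ 3) ^ 2 =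
      (‖a.1‖ * ‖b.2‖ - ‖a.2‖ * ‖b.1‖) ^ 2 / (τ * τ ^ 3) := by
      field_simp; ring
    linarith
  have e2 : (‖a.1‖ + ‖b.1‖) ^ 2 / τ + (‖a.2‖ + ‖b.2‖) ^ 2 / τ ^ 3 =
    (‖a.1‖ ^ 2 / τ + ‖a.2‖ ^ 2 / τ ^ 3) + (‖b.1‖ ^ 2 / τ + ‖b.2‖ ^ 2 / τ ^ 3) +
      2 * (‖a.1‖ * ‖b.1‖ / τ + ‖a.2‖ * ‖b.2‖ / τ ^ 3) := by ring
  nlinarith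

lemma rho_neg (τ : ℝ) (a : V d) : rho τ (-a) = rho τ a := by
  rw [rho, rho, Wi_vec, Wi_vec]; simp

lemma rho_cont (τ : ℝ) : Continuous fun w : V d => rho τ w := by
  unfold rho; simp only [Wi_vec]; fun_prop

/-- scaling map -/
def Tsc (τ : ℝ) (w : V d) : V d := (τ ^ (1 / 2 : ℝ) • w.1, (τ ^ (1 / 2 : ℝ)) ^ 3 • w.2)

lemma rho_Tsc {τ : ℝ} (hτ : 0 < τ) (w : V d) : rho τ (Tsc τ w) = rho 1 w := by
  have h0 := rho_nonneg τ (Tsc τ w)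
  have h1 := rho_nonneg 1 w
  rw [← abs_of_nonneg h0, ← abs_of_nonneg h1, ← sq_eq_sq_iff_abs_eq_abs, rho_sq hτ, rho_sq one_pos]
  have ht := half_sq hτ
  have ht0 : 0 < τ ^ (1 / 2 : ℝ) := by positivity
  simp only [Tsc, norm_smul, norm_pow, Real.norm_of_nonneg ht0.le]
  generalize τ ^ (1 / 2 : ℝ) = t at *
  subst ht
  field_simp

instance haarV : (volume : Measure (V d)).IsAddHaarMeasure :=
  inferInstanceAs ((volume : Measure (E d)).prod (volume : Measure (E d))).IsAddHaarMeasure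

/-- affine scaling homeomorphism -/
def scH {τ : ℝ} (hτ : 0 < τ) (z : V d) : V d ≃ₜ V d :=
  ((Homeomorph.smulOfNeZero (τ ^ (1 / 2 : ℝ)) (by positivity)).prodCongr
    (Homeomorph.smulOfNeZero ((τ ^ (1 / 2 : ℝ)) ^ 3) (by positivity))).trans (Homeomorph.addLeft z)

lemma scH_apply {τ : ℝ} (hτ : 0 < τ) (z w : V d) : scH hτ z w = z + Tsc τ w := rfl

lemma map_scH {τ : ℝ} (hτ : 0 < τ) (z : V d) :
    Measure.map (scH hτ z) volume = ENNReal.ofReal ((τ ^ (2 * d))⁻¹) • (volume : Measure (V d)) := by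
  set t := τ ^ (1 / 2 : ℝ) with ht
  have ht0 : 0 < t := by positivity
  have htt : t ^ 2 = τ := half_sq hτ
  have e : (scH hτ z : V d → V d) = (fun w => z + w) ∘ Prod.map (fun v : E d => t • v) (fun v : E d => t ^ 3 • v) := by
    funext w; rfl
  have m1 : Measurable fun v : E d => t • v := (continuous_const_smul t).measurable
  have m2 : Measurable fun v : E d => t ^ 3 • v := (continuous_const_smul (t ^ 3)).measurable
  rw [e, ← Measure.map_map (measurable_const_add z) (m1.prodMap m2), Measure.volume_eq_prod,
    ← Measure.map_prod_map _ _ m1 m2, Measure.map_addHaar_smul _ ht0.ne',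
    Measure.map_addHaar_smul _ (pow_pos ht0 3).ne', Measure.prod_smul_left, Measure.prod_smul_right,
    ← Measure.volume_eq_prod, Measure.map_smul, Measure.map_smul, map_add_left_eq_self, smul_smul,
    ← ENNReal.ofReal_mul (abs_nonneg _)]
  congr 2
  rw [finrank_euclideanSpace_fin, abs_of_pos (by positivity), abs_of_pos (by positivity), ← htt]
  field_simp
  ring

lemma scale_integrable {τ : ℝ} (hτ : 0 < τ) (z : V d) (h : V d → ℝ) :
    Integrable (fun w => h (z + Tsc τ w)) ↔ Integrable h := by
  have e : Integrable h (Measure.map (scH hτ z) volume) ↔ Integrable (h ∘ scH hτ z) volume :=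
    (scH hτ z).measurableEmbedding.integrable_map_iff
  rw [map_scH hτ z, integrable_smul_measure (by simp; positivity) ENNReal.ofReal_ne_top] at e
  exact e.symm

lemma scale_int {τ : ℝ} (hτ : 0 < τ) (z : V d) (h : V d → ℝ) :
    ∫ w, h (z + Tsc τ w) = (τ ^ (2 * d))⁻¹ * ∫ y, h y := by
  have e := (scH hτ z).measurableEmbedding.integral_map (μ := volume) h
  rw [map_scH hτ z, integral_smul_measure, ENNReal.toReal_ofReal (by positivity)] at e
  exact e.symm

lemma base_integrable (d : ℕ) : Integrable fun w : V d => ((1 + rho 1 w) ^ (2 * d + 1))⁻¹ := by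
  have h := integrable_one_add_norm (E := V d) (μ := volume) (r := 2 * d + 1)
    (by simp [Module.finrank_prod]; linarith)
  refine h.mono' ?_ (Filter.Eventually.of_forall fun w => ?_)
  · refine Continuous.aestronglyMeasurable (Continuous.inv₀ ((continuous_const.add (rho_cont 1)).pow _) ?_)
    intro w; have := rho_nonneg 1 w; positivity
  · have h0 := rho_nonneg 1 w
    rw [Real.norm_of_nonneg (by positivity), Real.rpow_neg (by positivity)]
    have e : (1 + ‖w‖) ^ (2 * (d:ℝ) + 1) = (1 + ‖w‖) ^ (2 * d + 1) := by
      rw [← Real.rpow_natCast]; push_cast; rfl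
    rw [e]
    have h1 := rho_1 one_pos w
    have h2 := rho_2 one_pos w
    rw [Real.one_rpow, mul_one] at h1 h2
    have : ‖w‖ ≤ rho 1 w := by rw [Prod.norm_def]; exact max_le h1 h2
    gcongr

/-- total mass of the reference kernel -/
def Kref (d : ℕ) : ℝ := ∫ w : V d, ((1 + rho 1 w) ^ (2 * d + 1))⁻¹

lemma Kref_nonneg (d : ℕ) : 0 ≤ Kref d := integral_nonneg fun w => by
  have := rho_nonneg 1 w; positivity

lemma ref_integrable {τ : ℝ} (hτ : 0 < τ) (z : V d) :
    Integrable fun y : V d => ((1 + rho τ (y - z)) ^ (2 * d + 1))⁻¹ := by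
  rw [← scale_integrable hτ z]
  simp only [add_sub_cancel_left, rho_Tsc hτ]
  exact base_integrable d

lemma ref_integral {τ : ℝ} (hτ : 0 < τ) (z : V d) :
    (τ ^ (2 * d))⁻¹ * ∫ y : V d, ((1 + rho τ (y - z)) ^ (2 * d + 1))⁻¹ = Kref d := by
  rw [← scale_int hτ z]
  simp only [add_sub_cancel_left, rho_Tsc hτ]
  rfl

lemma gauss_integrable (d : ℕ) {c : ℝ} (hc : 0 < c) :
    Integrable fun w : V d => Real.exp (-(c * rho 1 w ^ 2) / 2) := by
  obtain ⟨K, hK, h⟩ := poly_exp_bdd hc (2 * d + 1)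
  refine ((base_integrable d).const_mul K).mono' ?_ (Filter.Eventually.of_forall fun w => ?_)
  · have := rho_cont (d := d) 1
    exact (by fun_prop : Continuous fun w : V d => Real.exp (-(c * rho 1 w ^ 2) / 2)).aestronglyMeasurable
  · have h0 := rho_nonneg 1 w
    rw [Real.norm_of_nonneg (Real.exp_pos _).le, ← div_eq_mul_inv, le_div_iff₀ (by positivity)]
    exact h _ h0

/-- Gaussian constant -/
def cG (d : ℕ) : ℝ := ∫ w : V d, Real.exp (-(1 * rho 1 w ^ 2) / 2)

lemma cG_pos (d : ℕ) : 0 < cG d := by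
  refine (integral_pos_iff_support_of_nonneg (fun w => (Real.exp_pos _).le) (gauss_integrable d one_pos)).2 ?_
  have : Function.support (fun w : V d => Real.exp (-(1 * rho 1 w ^ 2) / 2)) = univ := by
    ext w; simp [(Real.exp_pos _).ne']
  rw [this]
  exact isOpen_univ.measure_pos _ univ_nonempty

lemma rho_small {κ : ℝ} (hκ : 0 < κ) {e : V d} (he : ‖e‖ ≤ κ ^ 2) (hκ1 : κ ≤ 1) :
    rho κ e ≤ 2 * κ ^ (1 / 2 : ℝ) := by
  set t := κ ^ (1 / 2 : ℝ) with ht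
  have ht0 : 0 < t := by positivity
  have htt : t ^ 2 = κ := half_sq hκ
  have ht1 : t ≤ 1 := Real.rpow_le_one hκ.le hκ1 (by norm_num)
  have e1 : κ ^ 2 = t ^ 3 * t := by rw [← htt]; ring
  have e2 : κ ^ 2 = t * t ^ 3 := by rw [← htt]; ring
  have h := rho_le (w := e) hκ (a := t ^ 3) (b := t) (by positivity) ht0.le
    ((norm_fst_le e).trans (he.trans (le_of_eq e1)))
    ((norm_snd_le e).trans (he.trans (by rw [half_cube hκ]; exact le_of_eq e2)))
  have : t ^ 3 ≤ t := by nlinarith [mul_pos ht0 ht0]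
  linarith

/-- the discretised approximate identity -/
def Iap (f : V d → ℝ) (q : V d → V d) (κ : ℝ) (x : V d) : ℝ :=
  ∫ y, f y * ((κ ^ (2 * d))⁻¹ * Real.exp (-(rho κ (x - q y) ^ 2) / 2))

lemma Iap_eq (f : V d → ℝ) (q : V d → V d) {κ : ℝ} (hκ : 0 < κ) (x : V d) :
    Iap f q κ x = ∫ w, f (x + Tsc κ w) * Real.exp (-(rho κ (x - q (x + Tsc κ w)) ^ 2) / 2) := by
  rw [scale_int hκ x (fun y => f y * Real.exp (-(rho κ (x - q y) ^ 2) / 2)), ← integral_const_mul]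
  unfold Iap
  congr 1
  funext y
  ring

lemma Iap_dom {f : V d → ℝ} {q : V d → V d} {κ M : ℝ} (hκ : 0 < κ) (hκ1 : κ ≤ 1)
    (hq : ∀ y ∈ tsupport f, ‖q y - y‖ ≤ κ ^ 2) (hM : ∀ y, |f y| ≤ M) (x w : V d) :
    ‖f (x + Tsc κ w) * Real.exp (-(rho κ (x - q (x + Tsc κ w)) ^ 2) / 2)‖ ≤
      M * Real.exp 2 * Real.exp (-(1 / 2 * rho 1 w ^ 2) / 2) := by
  have hM0 : 0 ≤ M := (abs_nonneg _).trans (hM 0)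
  set y := x + Tsc κ w with hy
  by_cases hf : f y = 0
  · rw [hf, zero_mul, norm_zero]; positivity
  have hyt : y ∈ tsupport f := subset_tsupport _ hf
  rw [norm_mul, Real.norm_eq_abs, Real.norm_of_nonneg (Real.exp_pos _).le, mul_assoc, ← Real.exp_add]
  refine mul_le_mul (hM y) (Real.exp_le_exp.2 ?_) (Real.exp_pos _).le hM0
  have h1 := rho_small hκ (hq y hyt) hκ1
  have hk : κ ^ (1 / 2 : ℝ) ≤ 1 := Real.rpow_le_one hκ.le hκ1 (by norm_num)
  have h2 : rho 1 w ≤ rho κ (x - q y) + rho κ (q y - y) := by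
    have e : Tsc κ w = -((x - q y) + (q y - y)) := by rw [hy]; abel
    rw [← rho_Tsc hκ w, e, rho_neg]
    exact rho_add_le hκ _ _
  have h3 := rho_nonneg 1 w
  have h4 := rho_nonneg κ (x - q y)
  have h5 := rho_nonneg κ (q y - y)
  nlinarith [sq_nonneg (rho κ (x - q y) - rho κ (q y - y))]

lemma Iap_bound {f : V d → ℝ} {q : V d → V d} {κ M : ℝ} (hκ : 0 < κ) (hκ1 : κ ≤ 1)
    (hq : ∀ y ∈ tsupport f, ‖q y - y‖ ≤ κ ^ 2) (hM : ∀ y, |f y| ≤ M) (x : V d) :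
    |Iap f q κ x| ≤ ∫ w : V d, M * Real.exp 2 * Real.exp (-(1 / 2 * rho 1 w ^ 2) / 2) := by
  rw [Iap_eq f q hκ x, ← Real.norm_eq_abs]
  exact norm_integral_le_of_norm_le ((gauss_integrable d (by norm_num)).const_mul _)
    (Filter.Eventually.of_forall fun w => Iap_dom hκ hκ1 hq hM x w)

lemma Iap_tendsto {f : V d → ℝ} (hf : Continuous f) {q : ℕ → V d → V d} {κ : ℕ → ℝ} {M : ℝ}
    (hqm : ∀ n, Measurable (q n))
    (hκ : ∀ n, 0 < κ n) (hκ1 : ∀ n, κ n ≤ 1) (hκt : Filter.Tendsto κ Filter.atTop (nhds 0))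
    (hq : ∀ n, ∀ y ∈ tsupport f, ‖q n y - y‖ ≤ κ n ^ 2) (hM : ∀ y, |f y| ≤ M) (x : V d) :
    Filter.Tendsto (fun n => Iap f (q n) (κ n) x) Filter.atTop (nhds (f x * cG d)) := by
  have e : ∀ n, Iap f (q n) (κ n) x = _ := fun n => Iap_eq f (q n) (hκ n) x
  simp_rw [e]
  rw [cG, ← integral_const_mul]
  have hTc : ∀ n, Continuous fun w : V d => Tsc (κ n) w := fun n => by unfold Tsc; fun_prop
  have hkt : Filter.Tendsto (fun n => κ n ^ (1 / 2 : ℝ)) Filter.atTop (nhds 0) := by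
    have := (Real.continuousAt_rpow_const 0 (1 / 2) (Or.inr (by norm_num))).tendsto.comp hκt
    rwa [Real.zero_rpow (by norm_num)] at this
  refine tendsto_integral_of_dominated_convergence
    (fun w => M * Real.exp 2 * Real.exp (-(1 / 2 * rho 1 w ^ 2) / 2)) (fun n => ?_)
    ((gauss_integrable d (by norm_num)).const_mul _)
    (fun n => Filter.Eventually.of_forall fun w => Iap_dom (hκ n) (hκ1 n) (hq n) hM x w)
    (Filter.Eventually.of_forall fun w => ?_)
  · have m1 : Measurable fun w : V d => x + Tsc (κ n) w := (continuous_const.add (hTc n)).measurable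
    have m2 : Measurable fun w : V d => rho (κ n) (x - q n (x + Tsc (κ n) w)) :=
      (rho_cont (κ n)).measurable.comp (measurable_const.sub ((hqm n).comp m1))
    exact ((hf.measurable.comp m1).mul (Real.measurable_exp.comp ((m2.pow_const 2).neg.div_const 2))).aestronglyMeasurable
  · have hT0 : Filter.Tendsto (fun n => x + Tsc (κ n) w) Filter.atTop (nhds x) := by
      have h1 : Filter.Tendsto (fun n => Tsc (κ n) w) Filter.atTop (nhds ((0:ℝ) • w.1, ((0:ℝ)) ^ 3 • w.2)) :=
        (hkt.smul_const w.1).prodMk_nhds ((hkt.pow 3).smul_const w.2)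
      have h2 := h1.const_add x
      have e0 : x + ((0:ℝ) • w.1, ((0:ℝ)) ^ 3 • w.2) = x := by ext <;> simp
      rwa [e0] at h2
    classical
    set R' : ℕ → ℝ := fun n => if x + Tsc (κ n) w ∈ tsupport f then
      rho (κ n) (x - q n (x + Tsc (κ n) w)) else rho 1 w with hR'
    have hR : Filter.Tendsto R' Filter.atTop (nhds (rho 1 w)) := by
      rw [tendsto_iff_norm_sub_tendsto_zero]
      refine squeeze_zero (fun n => norm_nonneg _) (fun n => ?_) (by simpa using hkt.const_mul 2)
      simp only [hR']
      split_ifs with hmem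
      · set y := x + Tsc (κ n) w with hy
        have h1 := rho_small (hκ n) (hq n y hmem) (hκ1 n)
        have e1 : x - y = -Tsc (κ n) w := by rw [hy]; abel
        have e2 : rho (κ n) (x - y) = rho 1 w := by rw [e1, rho_neg, rho_Tsc (hκ n)]
        rw [← e2, Real.norm_eq_abs, abs_le]
        have a1 := rho_add_le (hκ n) (x - q n y) (q n y - y)
        have a2 := rho_add_le (hκ n) (x - y) (-(q n y - y))
        rw [rho_neg] at a2
        rw [sub_add_sub_cancel] at a1
        have e3 : x - y + -(q n y - y) = x - q n y := by abel
        rw [e3] at a2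
        constructor <;> linarith
      · simp only [sub_self, norm_zero]
        have := hκ n
        positivity
    have e3 : (fun n => f (x + Tsc (κ n) w) * Real.exp (-(rho (κ n) (x - q n (x + Tsc (κ n) w)) ^ 2) / 2)) =
        fun n => f (x + Tsc (κ n) w) * Real.exp (-(R' n ^ 2) / 2) := by
      funext n
      simp only [hR']
      split_ifs with hmem
      · rfl
      · rw [image_eq_zero_of_notMem_tsupport hmem, zero_mul, zero_mul]
    rw [e3]
    have hc : Continuous fun a : ℝ => Real.exp (-(a ^ 2) / 2) := by fun_prop
    have h2 := (hc.tendsto (rho 1 w)).comp hR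
    rw [one_mul]
    exact ((hf.tendsto x).comp hT0).mul h2

/-- discretisation of the identity on compacts -/
lemma exists_discr {K : Set (V d)} (hK : IsCompact K) {ε : ℝ} (hε : 0 < ε) :
    ∃ q : SimpleFunc (V d) (V d), ∀ y ∈ K, ‖q y - y‖ ≤ ε := by
  have hcov : K ⊆ ⋃ k : ℕ, Metric.ball (TopologicalSpace.denseSeq (V d) k) ε := by
    intro y _
    obtain ⟨k, hz⟩ := (TopologicalSpace.denseRange_denseSeq (V d)).exists_dist_lt y hε
    exact mem_iUnion.2 ⟨k, hz⟩
  obtain ⟨t, ht⟩ := hK.elim_finite_subcover _ (fun k => Metric.isOpen_ball) hcov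
  refine ⟨SimpleFunc.nearestPt (TopologicalSpace.denseSeq (V d)) (t.sup id), fun y hy => ?_⟩
  obtain ⟨k, hk, hyk⟩ := mem_iUnion₂.1 (ht hy)
  have h1 := SimpleFunc.edist_nearestPt_le (TopologicalSpace.denseSeq (V d)) y
    (Finset.le_sup (f := id) hk)
  rw [edist_dist, edist_dist, ENNReal.ofReal_le_ofReal_iff dist_nonneg] at h1
  rw [← dist_eq_norm]
  rw [Metric.mem_ball, dist_comm] at hyk
  exact h1.trans hyk.le

lemma simple_int (q : SimpleFunc (V d) (V d)) {f : V d → ℝ} (hf : Integrable f) (G : V d → ℝ) :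
    Integrable (fun y => f y * G (q y)) ∧
    ∫ y, f y * G (q y) = ∑ v ∈ q.range, (∫ y in q ⁻¹' {v}, f y) * G v := by
  classical
  have e : (fun y => f y * G (q y)) =
      fun y => ∑ v ∈ q.range, (q ⁻¹' {v}).indicator f y * G v := by
    funext y
    rw [Finset.sum_eq_single (q y)]
    · rw [indicator_of_mem (by simp)]
    · intro b _ hb
      rw [indicator_of_notMem (by simpa using hb.symm), zero_mul]
    · intro h; exact absurd (q.mem_range_self y) h
  have hi : ∀ v ∈ q.range, Integrable fun y => (q ⁻¹' {v}).indicator f y * G v := fun v _ =>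
    (hf.indicator (q.measurableSet_fiber v)).mul_const _
  rw [e]
  refine ⟨integrable_finset_sum _ hi, ?_⟩
  rw [integral_finset_sum _ hi]
  refine Finset.sum_congr rfl fun v _ => ?_
  rw [integral_mul_const, integral_indicator (q.measurableSet_fiber v)]

end

end

section

/-! ### Part M: contraction -/

section
variable {d : ℕ} {F1 F2 : ℝ → E d → E d → E d} {σ D : ℝ → E d → E d → Matrix (Fin d) (Fin d) ℝ}
  {c C b1 b2 b3 η : ℝ}

lemma Km_term (σs Ds : ℝ → Matrix (Fin d) (Fin d) ℝ) (r κ : ℝ) :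
    Km σs Ds r κ r = diagonal (Kd κ) := by
  unfold Km
  ext i j
  simp

lemma Pm_term (σs Ds : ℝ → Matrix (Fin d) (Fin d) ℝ) (r : ℝ) {κ : ℝ} (hκ : 0 < κ) :
    Pm σs Ds r κ r = diagonal (fun i => (Kd (d := d) κ i)⁻¹) := by
  have hR : Rm Ds r r = 1 := by
    unfold Rm
    have : Bm Ds r r = 0 := by ext i j; simp [Bm]
    rw [this, fromBlocks_one]
  have hd : ∀ i, Kd (d := d) κ i ≠ 0 := by
    rintro (i | i)
    · exact hκ.ne'
    · exact (pow_pos hκ 3).ne'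
  rw [Pm, hR, Km_term, transpose_one, one_mul, mul_one]
  refine Matrix.inv_eq_left_inv ?_
  rw [diagonal_mul_diagonal, ← diagonal_one]
  congr 1
  funext i
  exact inv_mul_cancel₀ (hd i)

lemma gk_term (σs Ds : ℝ → Matrix (Fin d) (Fin d) ℝ) (θ : ℝ → V d) (r : ℝ) {κ : ℝ} (hκ : 0 < κ)
    (x : V d) : gk σs Ds θ r κ r x = (κ ^ (2 * d))⁻¹ * Real.exp (-(rho κ (x - θ r) ^ 2) / 2) := by
  have h1 : Nm σs Ds r κ r = (κ ^ (2 * d))⁻¹ := by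
    rw [Nm, Km_term, det_diagonal, Fintype.prod_sum_type]
    simp only [Kd, Sum.elim_inl, Sum.elim_inr, Finset.prod_const, Finset.card_univ, Fintype.card_fin]
    congr 1
    have : κ ^ d * (κ ^ 3) ^ d = (κ ^ (2 * d)) ^ 2 := by ring
    rw [this, Real.sqrt_sq (by positivity)]
  have h2 : qf (Pm σs Ds r κ r) (θ r) x = rho κ (x - θ r) ^ 2 := by
    rw [qf, Pm_term _ _ _ hκ, rho, Real.sq_sqrt (Wi_nonneg hκ _), Wi, nsq_eq, nsq_eq,
      dotProduct, Fintype.sum_sum_type, Finset.sum_div, Finset.sum_div]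
    simp only [mulVec_diagonal, Kd, Sum.elim_inl, Sum.elim_inr, v1, v2]
    congr 1 <;> refine Finset.sum_congr rfl fun i _ => ?_ <;> rw [div_eq_mul_inv] <;> ring
  rw [gk, h1, h2]

lemma Hk_cont (H : Hyp F1 F2 σ D c C b1 b2 b3 η) (θ dθ : ℝ → V d) (r κ s : ℝ) :
    Continuous fun x => Hk F1 F2 σ D θ dθ r κ s x := by
  unfold Hk
  have hs : Continuous fun x : V d => (s, x) := by fun_prop
  have cx : Continuous fun x : V d => x - θ s := by fun_prop
  have hq : Continuous fun x : V d => vecL d (x - θ s) := (vecL d).continuous.comp cx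
  have hek : Continuous fun x => ek (fun u => σ u (θ u).1 (θ u).2) (fun u => D u (θ u).1 (θ u).2) θ r κ s x := by
    unfold ek qf
    refine Real.continuous_exp.comp (Continuous.div_const (Continuous.neg ?_) _)
    refine hq.dotProduct ?_
    exact Continuous.matrix_mulVec continuous_const hq
  refine continuous_const.mul (genR_cont ?_ ?_ ?_ ?_ ?_ ?_ hq)
  · intro i j
    simp only [aσ, Matrix.sub_apply, Matrix.mul_apply, Matrix.transpose_apply]
    refine Continuous.sub (continuous_finsetSum _ fun l _ => ?_) continuous_const
    exact ((H.cσ i l).comp hs).mul ((H.cσ j l).comp hs)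
  · exact (H.cF1.comp hs).sub continuous_const
  · exact (H.cF2.comp hs).sub (continuous_const.add
      (toE_cont (fun i j => continuous_const) (continuous_fst.comp cx)))
  · exact continuous_const.mul hek
  · exact continuous_const.mul hek
  · exact fun i j => continuous_const

lemma rho_mono {κ τ : ℝ} (hκ : 0 < κ) (hκτ : κ ≤ τ) (w : V d) : rho τ w ≤ rho κ w := by
  have h0 := rho_nonneg κ w
  refine (abs_le_of_sq_le_sq' ?_ h0).2
  rw [rho_sq hκ, rho_sq (hκ.trans_le hκτ)]
  gcongr

lemma exists_T0 (H : Hyp F1 F2 σ D c C b1 b2 b3 η) {K : ℝ} (hK : 0 ≤ K) : ∃ T0 > 0, T0 ≤ 1 ∧ C * T0 ≤ 1 / 2 ∧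
    ∀ τ, 0 < τ → τ ≤ T0 → C * τ ^ gam b3 η ≤ 1 / 2 ∧ C * τ ^ (1 / 2 : ℝ) * (1 + 2 * C) ≤ 1 / 4 ∧
      K * τ ^ gam b3 η ≤ cG d / 2 := by
  have hC := H.C1
  have hg := H.gam_pos
  have key : ∀ a : ℝ, 0 < a → ∀ B : ℝ, 0 ≤ B → ∀ ε : ℝ, 0 < ε → ∃ t > 0, ∀ τ, 0 < τ → τ ≤ t → B * τ ^ a ≤ ε := by
    intro a ha B hB ε hε
    refine ⟨(ε / (B + 1)) ^ a⁻¹, by positivity, fun τ h0 h1 => ?_⟩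
    have h2 : τ ^ a ≤ ε / (B + 1) := by
      have := Real.rpow_le_rpow h0.le h1 ha.le
      rwa [Real.rpow_inv_rpow (by positivity) ha.ne'] at this
    have h3 : 0 ≤ τ ^ a := by positivity
    calc B * τ ^ a ≤ (B + 1) * τ ^ a := by nlinarith
      _ ≤ (B + 1) * (ε / (B + 1)) := by gcongr
      _ = ε := by field_simp
  obtain ⟨t1, h1, k1⟩ := key _ hg C (by linarith) (1 / 2) (by norm_num)
  obtain ⟨t2, h2, k2⟩ := key (1 / 2) (by norm_num) (C * (1 + 2 * C)) (by nlinarith) (1 / 4) (by norm_num)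
  obtain ⟨t3, h3, k3⟩ := key _ hg K hK (cG d / 2) (by have := cG_pos d; linarith)
  refine ⟨min (min t1 t2) (min t3 (1 / (2 * C))), by positivity, ?_, ?_, fun τ h0 hτ => ?_⟩
  · refine (min_le_right _ _).trans ((min_le_right _ _).trans ?_)
    rw [div_le_one (by positivity)]; linarith
  · calc C * min (min t1 t2) (min t3 (1 / (2 * C))) ≤ C * (1 / (2 * C)) := by
          refine mul_le_mul_of_nonneg_left ((min_le_right _ _).trans (min_le_right _ _)) (by linarith)
      _ = 1 / 2 := by field_simp
  · have a1 := hτ.trans ((min_le_left _ _).trans (min_le_left _ _))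
    have a2 := hτ.trans ((min_le_left _ _).trans (min_le_right _ _))
    have a3 := hτ.trans ((min_le_right _ _).trans (min_le_left _ _))
    refine ⟨k1 τ h0 a1, ?_, k3 τ h0 a3⟩
    have := k2 τ h0 a2
    linarith

/-- family of curves indexed by terminal points -/
structure Curves (F1 F2 : ℝ → E d → E d → E d) (s0 r κ : ℝ) (θ dθ : V d → ℝ → V d) : Prop where
  c : ∀ v, Continuous (θ v)
  cd : ∀ v, Continuous (dθ v)
  t : ∀ v, θ v r = v
  der : ∀ v u, HasDerivAt (θ v) (dθ v u) u
  F : ∀ v, ∀ u ∈ Icc s0 r, ‖dθ v u - FF F1 F2 u (θ v u)‖ ≤ κ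

lemma exists_curves (H : Hyp F1 F2 σ D c C b1 b2 b3 η) {s0 r κ : ℝ} (hr : s0 ≤ r)
    (hC : C * (r - s0) ≤ 1 / 2) (hκ : 0 < κ) : ∃ θ dθ, Curves F1 F2 s0 r κ θ dθ := by
  have h := fun v : V d => approx_bwd H.FF_cont (by linarith [H.C1]) H.FF_gr H.FF_uc hr hC v hκ
  choose θ dθ h1 h2 h3 h4 h5 using h
  exact ⟨θ, dθ, h1, h2, h3, h4, h5⟩

/-- the sum kernel -/
def HS (F1 F2 : ℝ → E d → E d → E d) (σ D : ℝ → E d → E d → Matrix (Fin d) (Fin d) ℝ)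
    (q : SimpleFunc (V d) (V d)) (f : V d → ℝ) (θ dθ : V d → ℝ → V d) (r κ s : ℝ) (x : V d) : ℝ :=
  ∑ v ∈ q.range, (∫ y in q ⁻¹' {v}, f y) * Hk F1 F2 σ D (θ v) (dθ v) r κ s x

lemma HS_cont (H : Hyp F1 F2 σ D c C b1 b2 b3 η) (q : SimpleFunc (V d) (V d)) (f : V d → ℝ)
    (θ dθ : V d → ℝ → V d) (r κ s : ℝ) : Continuous fun x => HS F1 F2 σ D q f θ dθ r κ s x :=
  continuous_finsetSum _ fun v _ => continuous_const.mul (Hk_cont H _ _ _ _ _)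

lemma HS_bound (H : Hyp F1 F2 σ D c C b1 b2 b3 η) {K : ℝ} (hK : 0 ≤ K)
    (hKb : ∀ (θ dθ : ℝ → V d) (r κ s : ℝ) (x : V d), Continuous θ → s ≤ r → 0 < κ → r - s + κ ≤ 1 →
      ‖dθ s - (F1 s (θ s).1 (θ s).2, F2 s (θ s).1 (θ s).2)‖ ≤ κ →
      |Hk F1 F2 σ D θ dθ r κ s x| ≤ K * (r - s + κ) ^ (-1 + gam b3 η) *
        (((r - s + κ) ^ (2 * d))⁻¹ * ((1 + rho (r - s + κ) (x - θ s)) ^ (2 * d + 1))⁻¹))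
    {f : V d → ℝ} (hf : Integrable f) (hf1 : ∀ y, |f y| ≤ 1) {q : SimpleFunc (V d) (V d)} {s0 r κ s : ℝ}
    (hκ : 0 < κ) (hκ1 : κ ≤ 1) (hq : ∀ y ∈ tsupport f, ‖q y - y‖ ≤ κ ^ 2)
    {θ dθ : V d → ℝ → V d} (hθ : Curves F1 F2 s0 r κ θ dθ) (hs0 : s0 ≤ s) (hsr : s ≤ r)
    (hτ1 : r - s + κ ≤ 1) (hCr : C * (r - s) ≤ 1 / 2)
    (he : C * (r - s + κ) ^ gam b3 η ≤ 1 / 2) (htC : C * (r - s + κ) ^ (1 / 2 : ℝ) * (1 + 2 * C) ≤ 1 / 4)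
    (x : V d) :
    |HS F1 F2 σ D q f θ dθ r κ s x| ≤
      K * (90 * C) ^ (2 * d + 1) * Kref d * (r - s + κ) ^ (-1 + gam b3 η) := by
  have hC := H.C1
  set τ := r - s + κ with hτ
  have hτ0 : 0 < τ := by linarith
  have hκτ : κ ≤ τ := by linarith
  set p := 2 * d + 1 with hp
  have hS := (simple_int q hf (fun v => Hk F1 F2 σ D (θ v) (dθ v) r κ s x)).2
  have e : HS F1 F2 σ D q f θ dθ r κ s x = ∫ y, f y * Hk F1 F2 σ D (θ (q y)) (dθ (q y)) r κ s x := hS.symm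
  obtain ⟨ψ, dψ, cψ, -, ψs, ψd, ψF⟩ := approx_fwd H.FF_cont (by linarith) H.FF_gr H.FF_uc hsr hCr x hκ
  set A := K * τ ^ (-1 + gam b3 η) with hA
  have hA0 : 0 ≤ A := by positivity
  rw [e, ← Real.norm_eq_abs]
  have hb := norm_integral_le_of_norm_le (f := fun y => f y * Hk F1 F2 σ D (θ (q y)) (dθ (q y)) r κ s x)
    (g := fun y => A * (90 * C) ^ p * (τ ^ (2 * d))⁻¹ * ((1 + rho τ (y - ψ r)) ^ p)⁻¹) (μ := volume)
    ((ref_integrable hτ0 (ψ r)).const_mul _) (Filter.Eventually.of_forall fun y => ?_)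
  · refine hb.trans (le_of_eq ?_)
    rw [integral_const_mul, mul_assoc, ref_integral hτ0 (ψ r), hA]
    ring
  · have h0 := rho_nonneg τ (y - ψ r)
    by_cases hfy : f y = 0
    · rw [hfy, zero_mul, norm_zero]; positivity
    have hyt : y ∈ tsupport f := subset_tsupport _ hfy
    have h1 := hKb (θ (q y)) (dθ (q y)) r κ s x (hθ.c _) hsr hκ hτ1 (hθ.F (q y) s ⟨hs0, hsr⟩)
    rw [← hτ] at h1
    have h2 := compare_curves H hsr hκ hτ hτ1 he htC (hθ.der (q y)) ψd
      (fun u hu => hθ.F (q y) u ⟨hs0.trans hu.1, hu.2⟩) ψF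
    rw [hθ.t, ψs] at h2
    have h3 : rho τ (y - q y) ≤ 2 := by
      have a1 := rho_mono hκ hκτ (q y - y)
      have a2 := rho_small hκ (hq y hyt) hκ1
      have a3 : κ ^ (1 / 2 : ℝ) ≤ 1 := Real.rpow_le_one hκ.le hκ1 (by norm_num)
      rw [← rho_neg, neg_sub]
      linarith
    have h4 := rho_add_le hτ0 (y - q y) (q y - ψ r)
    rw [sub_add_sub_cancel] at h4
    have h5 := rho_nonneg τ (q y - ψ r)
    have h6 := rho_nonneg τ (x - θ (q y) s)
    have h7 : 1 + rho τ (y - ψ r) ≤ 90 * C * (1 + rho τ (x - θ (q y) s)) := by linarith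
    have h8 : ((1 + rho τ (x - θ (q y) s)) ^ p)⁻¹ ≤ (90 * C) ^ p * ((1 + rho τ (y - ψ r)) ^ p)⁻¹ := by
      have := pow_le_pow_left₀ (by positivity) h7 p
      rw [mul_pow] at this
      rw [inv_le_iff_one_le_mul₀ (by positivity), mul_right_comm, ← div_eq_mul_inv, one_le_div (by positivity)]
      exact this
    have h9 : |f y| * |Hk F1 F2 σ D (θ (q y)) (dθ (q y)) r κ s x| ≤
        1 * (A * ((τ ^ (2 * d))⁻¹ * ((90 * C) ^ p * ((1 + rho τ (y - ψ r)) ^ p)⁻¹))) := by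
      refine mul_le_mul (hf1 y) (h1.trans ?_) (abs_nonneg _) zero_le_one
      refine mul_le_mul_of_nonneg_left (mul_le_mul_of_nonneg_left h8 (by positivity)) hA0
    rw [norm_mul, Real.norm_eq_abs, Real.norm_eq_abs]
    exact h9.trans (le_of_eq (by ring))

variable {Ω : Type} [MeasurableSpace Ω] {m : Measure Ω} [IsFiniteMeasure m] {Y : ℝ → Ω → V d}
variable {Ω' : Type} [MeasurableSpace Ω'] {m' : Measure Ω'} [IsFiniteMeasure m'] {Y' : ℝ → Ω' → V d}
  {s0 T : ℝ}

/-- closeness of one-dimensional laws -/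
def Bd (m : Measure Ω) (m' : Measure Ω') (Y : ℝ → Ω → V d) (Y' : ℝ → Ω' → V d) (s0 T A : ℝ) : Prop :=
  ∀ s ∈ Icc s0 T, ∀ f : V d → ℝ, Continuous f → (∀ x, |f x| ≤ 1) →
    |∫ ω, f (Y s ω) ∂m - ∫ ω, f (Y' s ω) ∂m'| ≤ A

lemma Bd.scale {A : ℝ} (h : Bd m m' Y Y' s0 T A) {s : ℝ} (hs : s ∈ Icc s0 T) {f : V d → ℝ}
    (hf : Continuous f) {M : ℝ} (hM : 0 ≤ M) (hfM : ∀ x, |f x| ≤ M) :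
    |∫ ω, f (Y s ω) ∂m - ∫ ω, f (Y' s ω) ∂m'| ≤ A * M := by
  rcases hM.eq_or_lt with rfl | hM
  · have : ∀ x, f x = 0 := fun x => abs_eq_zero.1 (le_antisymm (hfM x) (abs_nonneg _))
    simp [this]
  · have h1 := h s hs (fun x => M⁻¹ * f x) (continuous_const.mul hf) (fun x => by
      rw [abs_mul, abs_of_pos (inv_pos.2 hM), inv_mul_le_iff₀ hM, mul_one]; exact hfM x)
    rw [integral_const_mul, integral_const_mul, ← mul_sub, abs_mul, abs_of_pos (inv_pos.2 hM),
      inv_mul_le_iff₀ hM] at h1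
    linarith

lemma gk_meas (σs Ds : ℝ → Matrix (Fin d) (Fin d) ℝ) (θ : ℝ → V d) (r κ s : ℝ) :
    Continuous fun x => gk σs Ds θ r κ s x := by
  unfold gk qf
  have cx : Continuous fun x : V d => x - θ s := by fun_prop
  have hq : Continuous fun x : V d => vecL d (x - θ s) := (vecL d).continuous.comp cx
  refine continuous_const.mul (Real.continuous_exp.comp (Continuous.div_const (Continuous.neg ?_) _))
  exact hq.dotProduct (Continuous.matrix_mulVec continuous_const hq)

lemma gk_int (hY : ∀ t, Measurable (Y t)) (σs Ds : ℝ → Matrix (Fin d) (Fin d) ℝ) (θ : ℝ → V d)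
    (r : ℝ) {κ : ℝ} (hκ : 0 < κ) : Integrable (fun ω => gk σs Ds θ r κ r (Y r ω)) m := by
  refine Integrable.of_bound (C := (κ ^ (2 * d))⁻¹)
    ((gk_meas σs Ds θ r κ r).measurable.comp (hY r)).aestronglyMeasurable
    (Filter.Eventually.of_forall fun ω => ?_)
  rw [gk_term _ _ _ _ hκ, norm_mul, Real.norm_of_nonneg (by positivity), Real.norm_of_nonneg (Real.exp_pos _).le]
  refine mul_le_of_le_one_right (by positivity) (Real.exp_le_one_iff.2 ?_)
  have := sq_nonneg (rho κ (Y r ω - θ r))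
  linarith

lemma Iap_half (H : Hyp F1 F2 σ D c C b1 b2 b3 η) (S : IsSol F1 F2 σ m Y s0 T)
    {f : V d → ℝ} (hf : Integrable f) {q : SimpleFunc (V d) (V d)} {r κ : ℝ}
    (hκ : 0 < κ) {θ dθ : V d → ℝ → V d} (hθ : Curves F1 F2 s0 r κ θ dθ)
    (hr : s0 ≤ r) (hrT : r ≤ T) (hτ : r - s0 + κ ≤ 1) :
    ∫ ω, Iap f q κ (Y r ω) ∂m = (∑ v ∈ q.range, (∫ y in q ⁻¹' {v}, f y) *
      ∫ ω, gk (fun u => σ u (θ v u).1 (θ v u).2) (fun u => D u (θ v u).1 (θ v u).2) (θ v) r κ s0 (Y s0 ω) ∂m) +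
      ∫ s in s0..r, ∫ ω, HS F1 F2 σ D q f θ dθ r κ s (Y s ω) ∂m ∧
    IntervalIntegrable (fun s => ∫ ω, HS F1 F2 σ D q f θ dθ r κ s (Y s ω) ∂m) volume s0 r := by
  have I := fun v => ito_gauss H S (hθ.c v) (hθ.cd v) hr hrT hκ hτ (fun s _ => hθ.der v s)
  have e1 : ∀ x, Iap f q κ x = ∑ v ∈ q.range, (∫ y in q ⁻¹' {v}, f y) *
      gk (fun u => σ u (θ v u).1 (θ v u).2) (fun u => D u (θ v u).1 (θ v u).2) (θ v) r κ r x := by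
    intro x
    rw [← (simple_int q hf (fun v => gk (fun u => σ u (θ v u).1 (θ v u).2)
      (fun u => D u (θ v u).1 (θ v u).2) (θ v) r κ r x)).2, Iap]
    refine integral_congr_ae (Filter.Eventually.of_forall fun y => ?_)
    beta_reduce
    rw [gk_term _ _ _ _ hκ, hθ.t]
  have e2 : ∀ s ∈ Icc s0 r, ∫ ω, HS F1 F2 σ D q f θ dθ r κ s (Y s ω) ∂m =
      ∑ v ∈ q.range, (∫ y in q ⁻¹' {v}, f y) * ∫ ω, Hk F1 F2 σ D (θ v) (dθ v) r κ s (Y s ω) ∂m := by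
    intro s hs
    unfold HS
    rw [integral_finset_sum _ fun v _ => ((I v).2.1 s hs).const_mul _]
    exact Finset.sum_congr rfl fun v _ => integral_const_mul _ _
  have hIntg : IntervalIntegrable (fun s => ∑ v ∈ q.range, (∫ y in q ⁻¹' {v}, f y) *
      ∫ ω, Hk F1 F2 σ D (θ v) (dθ v) r κ s (Y s ω) ∂m) volume s0 r := by
    have := IntervalIntegrable.sum (μ := volume) (a := s0) (b := r) q.range
      (f := fun v s => (∫ y in q ⁻¹' {v}, f y) * ∫ ω, Hk F1 F2 σ D (θ v) (dθ v) r κ s (Y s ω) ∂m)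
      (fun v _ => (I v).2.2.const_mul _)
    refine this.congr fun s _ => ?_
    simp
  refine ⟨?_, hIntg.congr fun s hs => (e2 s ?_).symm⟩
  swap
  · rw [uIoc_of_le hr] at hs; exact ⟨hs.1.le, hs.2⟩
  simp_rw [e1]
  rw [integral_finset_sum _ fun v _ => (gk_int S.meas _ _ _ _ hκ).const_mul _]
  have e3 : ∫ s in s0..r, ∫ ω, HS F1 F2 σ D q f θ dθ r κ s (Y s ω) ∂m =
      ∫ s in s0..r, ∑ v ∈ q.range, (∫ y in q ⁻¹' {v}, f y) *
      ∫ ω, Hk F1 F2 σ D (θ v) (dθ v) r κ s (Y s ω) ∂m :=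
    intervalIntegral.integral_congr fun s hs => e2 s (by rwa [uIcc_of_le hr] at hs)
  rw [e3, intervalIntegral.integral_finsetSum fun v _ => (I v).2.2.const_mul _, ← Finset.sum_add_distrib]
  refine Finset.sum_congr rfl fun v _ => ?_
  rw [integral_const_mul, intervalIntegral.integral_const_mul, ← (I v).1]
  ring

lemma int_pow_le {γ κ s0 r : ℝ} (hγ : 0 < γ) (hκ : 0 < κ) (hr : s0 ≤ r) :
    IntervalIntegrable (fun s => (r - s + κ) ^ (-1 + γ)) volume s0 r ∧
    ∫ s in s0..r, (r - s + κ) ^ (-1 + γ) ≤ (r - s0 + κ) ^ γ / γ := by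
  have hc : ContinuousOn (fun s => (r - s + κ) ^ (-1 + γ)) (uIcc s0 r) := by
    intro s hs
    rw [uIcc_of_le hr] at hs
    refine ContinuousAt.continuousWithinAt (ContinuousAt.rpow_const (by fun_prop) (Or.inl ?_))
    have := hs.2; linarith
  refine ⟨hc.intervalIntegrable, ?_⟩
  have hd : ∀ s ∈ uIcc s0 r, HasDerivAt (fun s => -((r - s + κ) ^ γ / γ)) ((r - s + κ) ^ (-1 + γ)) s := by
    intro s hs
    rw [uIcc_of_le hr] at hs
    have h0 : 0 < r - s + κ := by have := hs.2; linarith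
    have h1 : HasDerivAt (fun s => r - s + κ) (-1) s := ((hasDerivAt_id s).const_sub r).add_const κ
    have h2 := ((h1.rpow_const (p := γ) (Or.inl h0.ne')).div_const γ).neg
    refine h2.congr_deriv ?_
    rw [show -1 + γ = γ - 1 by ring]
    field_simp
  rw [intervalIntegral.integral_eq_sub_of_hasDerivAt hd hc.intervalIntegrable]
  have : 0 ≤ (r - r + κ) ^ γ / γ := by rw [sub_self, zero_add]; positivity
  linarith

/-- constant in the contraction -/
def K0 (d : ℕ) (K C g : ℝ) : ℝ := K * (90 * C) ^ (2 * d + 1) * Kref d / g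

lemma Iap_diff (H : Hyp F1 F2 σ D c C b1 b2 b3 η) (S : IsSol F1 F2 σ m Y s0 T)
    (S' : IsSol F1 F2 σ m' Y' s0 T) (hlaw : m.map (Y s0) = m'.map (Y' s0))
    {K : ℝ} (hK : 0 ≤ K)
    (hKb : ∀ (θ dθ : ℝ → V d) (r κ s : ℝ) (x : V d), Continuous θ → s ≤ r → 0 < κ → r - s + κ ≤ 1 →
      ‖dθ s - (F1 s (θ s).1 (θ s).2, F2 s (θ s).1 (θ s).2)‖ ≤ κ →
      |Hk F1 F2 σ D θ dθ r κ s x| ≤ K * (r - s + κ) ^ (-1 + gam b3 η) *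
        (((r - s + κ) ^ (2 * d))⁻¹ * ((1 + rho (r - s + κ) (x - θ s)) ^ (2 * d + 1))⁻¹))
    {T0 : ℝ} (hT01 : T0 ≤ 1) (hT0C : C * T0 ≤ 1 / 2)
    (hT0 : ∀ τ, 0 < τ → τ ≤ T0 → C * τ ^ gam b3 η ≤ 1 / 2 ∧ C * τ ^ (1 / 2 : ℝ) * (1 + 2 * C) ≤ 1 / 4 ∧
      K0 d K C (gam b3 η) * τ ^ gam b3 η ≤ cG d / 2)
    {A : ℝ} (hA : 0 ≤ A) (hB : Bd m m' Y Y' s0 T A)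
    {f : V d → ℝ} (hf : Integrable f) (hf1 : ∀ y, |f y| ≤ 1) {q : SimpleFunc (V d) (V d)} {r κ : ℝ}
    (hκ : 0 < κ) (hr : s0 ≤ r) (hrT : r ≤ T) (hrT0 : r - s0 + κ ≤ T0)
    (hq : ∀ y ∈ tsupport f, ‖q y - y‖ ≤ κ ^ 2) :
    |∫ ω, Iap f q κ (Y r ω) ∂m - ∫ ω, Iap f q κ (Y' r ω) ∂m'| ≤ A * (cG d / 2) := by
  have hC := H.C1
  have hg := H.gam_pos
  have hCr : C * (r - s0) ≤ 1 / 2 := by nlinarith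
  obtain ⟨θ, dθ, hθ⟩ := exists_curves H hr hCr hκ
  obtain ⟨i1, j1⟩ := Iap_half (q := q) H S hf hκ hθ hr hrT (by linarith)
  obtain ⟨i2, j2⟩ := Iap_half (q := q) H S' hf hκ hθ hr hrT (by linarith)
  have e0 : ∀ v, ∫ ω, gk (fun u => σ u (θ v u).1 (θ v u).2) (fun u => D u (θ v u).1 (θ v u).2) (θ v) r κ s0 (Y s0 ω) ∂m =
      ∫ ω, gk (fun u => σ u (θ v u).1 (θ v u).2) (fun u => D u (θ v u).1 (θ v u).2) (θ v) r κ s0 (Y' s0 ω) ∂m' := by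
    intro v
    have hc := gk_meas (fun u => σ u (θ v u).1 (θ v u).2) (fun u => D u (θ v u).1 (θ v u).2) (θ v) r κ s0
    rw [← integral_map (S.meas s0).aemeasurable (f := fun x => gk (fun u => σ u (θ v u).1 (θ v u).2)
        (fun u => D u (θ v u).1 (θ v u).2) (θ v) r κ s0 x) hc.aestronglyMeasurable, hlaw,
      integral_map (S'.meas s0).aemeasurable hc.aestronglyMeasurable]
  simp_rw [e0] at i1
  rw [i1, i2, add_sub_add_left_eq_sub, ← intervalIntegral.integral_sub j1 j2]
  set B := K * (90 * C) ^ (2 * d + 1) * Kref d with hBd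
  have hB0 : 0 ≤ B := by have := Kref_nonneg d; positivity
  obtain ⟨p1, p2⟩ := int_pow_le (γ := gam b3 η) hg hκ hr
  have hbound := intervalIntegral.norm_integral_le_of_norm_le (μ := volume) (a := s0) (b := r)
    (f := fun s => ∫ ω, HS F1 F2 σ D q f θ dθ r κ s (Y s ω) ∂m - ∫ ω, HS F1 F2 σ D q f θ dθ r κ s (Y' s ω) ∂m')
    (g := fun s => A * (B * (r - s + κ) ^ (-1 + gam b3 η))) hr
    (Filter.Eventually.of_forall fun s hs => ?_) ((p1.const_mul _).const_mul _)
  · rw [← Real.norm_eq_abs]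
    refine hbound.trans ?_
    rw [intervalIntegral.integral_const_mul, intervalIntegral.integral_const_mul]
    refine mul_le_mul_of_nonneg_left ((mul_le_mul_of_nonneg_left p2 hB0).trans ?_) hA
    have := (hT0 (r - s0 + κ) (by linarith) hrT0).2.2
    refine le_trans (le_of_eq ?_) this
    rw [K0]; ring
  · have hs1 := hs.1
    have hs2 := hs.2
    have hτ0 : 0 < r - s + κ := by linarith
    have hτT : r - s + κ ≤ T0 := by linarith
    obtain ⟨t1, t2, -⟩ := hT0 _ hτ0 hτT
    exact hB.scale ⟨hs1.le, hs2.trans hrT⟩ (HS_cont H q f θ dθ r κ s) (by positivity)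
      (HS_bound H hK hKb hf hf1 hκ (by linarith) hq hθ hs1.le hs2 (by linarith) (by nlinarith) t1 t2)

lemma contr_cs (H : Hyp F1 F2 σ D c C b1 b2 b3 η) (S : IsSol F1 F2 σ m Y s0 T)
    (S' : IsSol F1 F2 σ m' Y' s0 T) (hlaw : m.map (Y s0) = m'.map (Y' s0))
    {K : ℝ} (hK : 0 ≤ K)
    (hKb : ∀ (θ dθ : ℝ → V d) (r κ s : ℝ) (x : V d), Continuous θ → s ≤ r → 0 < κ → r - s + κ ≤ 1 →
      ‖dθ s - (F1 s (θ s).1 (θ s).2, F2 s (θ s).1 (θ s).2)‖ ≤ κ →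
      |Hk F1 F2 σ D θ dθ r κ s x| ≤ K * (r - s + κ) ^ (-1 + gam b3 η) *
        (((r - s + κ) ^ (2 * d))⁻¹ * ((1 + rho (r - s + κ) (x - θ s)) ^ (2 * d + 1))⁻¹))
    {T0 : ℝ} (hT00 : 0 < T0) (hT01 : T0 ≤ 1) (hT0C : C * T0 ≤ 1 / 2)
    (hT0 : ∀ τ, 0 < τ → τ ≤ T0 → C * τ ^ gam b3 η ≤ 1 / 2 ∧ C * τ ^ (1 / 2 : ℝ) * (1 + 2 * C) ≤ 1 / 4 ∧
      K0 d K C (gam b3 η) * τ ^ gam b3 η ≤ cG d / 2)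
    {A : ℝ} (hA : 0 ≤ A) (hB : Bd m m' Y Y' s0 T A) (hT : T ≤ s0 + T0 / 2)
    {f : V d → ℝ} (hfc : Continuous f) (hfs : HasCompactSupport f) (hf1 : ∀ y, |f y| ≤ 1) {r : ℝ}
    (hr : r ∈ Icc s0 T) :
    |∫ ω, f (Y r ω) ∂m - ∫ ω, f (Y' r ω) ∂m'| ≤ A / 2 := by
  have hf : Integrable f := hfc.integrable_of_hasCompactSupport hfs
  set κ : ℕ → ℝ := fun n => T0 / 2 * (1 / ((n:ℝ) + 1)) with hκd
  have hκ : ∀ n, 0 < κ n := fun n => by positivity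
  have hκT : ∀ n, κ n ≤ T0 / 2 := fun n => by
    refine mul_le_of_le_one_right (by positivity) ?_
    rw [div_le_one (by positivity)]
    have : (0:ℝ) ≤ n := n.cast_nonneg
    linarith
  have hκt : Filter.Tendsto κ Filter.atTop (nhds 0) := by
    have := (tendsto_one_div_add_atTop_nhds_zero_nat (𝕜 := ℝ)).const_mul (T0 / 2)
    rwa [mul_zero] at this
  have hq := fun n => exists_discr (d := d) hfs (pow_pos (hκ n) 2)
  choose q hq using hq
  have hκ1 : ∀ n, κ n ≤ 1 := fun n => (hκT n).trans (by linarith)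
  have lim : ∀ {Ω : Type} [MeasurableSpace Ω] (m : Measure Ω) [IsFiniteMeasure m] (X : Ω → V d),
      Measurable X → Filter.Tendsto (fun n => ∫ ω, Iap f (q n) (κ n) (X ω) ∂m) Filter.atTop
        (nhds (∫ ω, f (X ω) * cG d ∂m)) := by
    intro Ω _ m _ X hX
    have hmI : ∀ n, Measurable fun x => Iap f (q n) (κ n) x := by
      intro n
      have : (fun x => Iap f (q n) (κ n) x) = fun x => ∑ v ∈ (q n).range, (∫ y in (q n) ⁻¹' {v}, f y) *
          ((κ n ^ (2 * d))⁻¹ * Real.exp (-(rho (κ n) (x - v) ^ 2) / 2)) := by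
        funext x
        exact (simple_int (q n) hf (fun v => (κ n ^ (2 * d))⁻¹ * Real.exp (-(rho (κ n) (x - v) ^ 2) / 2))).2
      rw [this]
      refine (continuous_finsetSum _ fun v _ => ?_).measurable
      have hc := (rho_cont (d := d) (κ n)).comp (continuous_id.sub (continuous_const (y := v)))
      exact continuous_const.mul (continuous_const.mul (Real.continuous_exp.comp ((hc.pow 2).neg.div_const 2)))
    refine tendsto_integral_of_dominated_convergence
      (fun _ => ∫ w : V d, 1 * Real.exp 2 * Real.exp (-(1 / 2 * rho 1 w ^ 2) / 2))
      (fun n => ((hmI n).comp hX).aestronglyMeasurable) (integrable_const _)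
      (fun n => Filter.Eventually.of_forall fun ω => ?_) (Filter.Eventually.of_forall fun ω => ?_)
    · exact Iap_bound (hκ n) (hκ1 n) (hq n) hf1 (X ω)
    · exact Iap_tendsto hfc (fun n => (q n).measurable) hκ hκ1 hκt hq hf1 (X ω)
  have l3 := ((lim m (Y r) (S.meas r)).sub (lim m' (Y' r) (S'.meas r))).abs
  have hle := le_of_tendsto l3 (Filter.Eventually.of_forall fun n =>
    Iap_diff H S S' hlaw hK hKb hT01 hT0C hT0 hA hB hf hf1 (hκ n) hr.1 hr.2
      (by have := hκT n; have := hr.2; linarith) (hq n))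
  rw [integral_mul_const, integral_mul_const, ← sub_mul, abs_mul, abs_of_pos (cG_pos d)] at hle
  have := cG_pos d
  refine le_of_mul_le_mul_right ?_ this
  linarith

lemma cutoff_ext {f : V d → ℝ} (hfc : Continuous f) (hf1 : ∀ y, |f y| ≤ 1) {B : ℝ}
    {X : Ω → V d} (hX : Measurable X) {X' : Ω' → V d} (hX' : Measurable X')
    (h : ∀ g : V d → ℝ, Continuous g → HasCompactSupport g → (∀ y, |g y| ≤ 1) →
      |∫ ω, g (X ω) ∂m - ∫ ω, g (X' ω) ∂m'| ≤ B) :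
    |∫ ω, f (X ω) ∂m - ∫ ω, f (X' ω) ∂m'| ≤ B := by
  set χ : ℕ → V d → ℝ := fun n x => max 0 (min 1 (n + 1 - ‖x‖)) with hχ
  have χ0 : ∀ n x, 0 ≤ χ n x := fun n x => le_max_left _ _
  have χ1 : ∀ n x, χ n x ≤ 1 := fun n x => max_le zero_le_one (min_le_left _ _)
  have χc : ∀ n, Continuous (χ n) := fun n => by fun_prop
  have χs : ∀ n, HasCompactSupport (χ n) := fun n => by
    refine HasCompactSupport.intro (isCompact_closedBall (0 : V d) (n + 1)) fun x hx => ?_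
    rw [Metric.mem_closedBall, dist_zero_right, not_le] at hx
    exact max_eq_left ((min_le_right _ _).trans (by linarith))
  have χt : ∀ x, ∀ᶠ n : ℕ in Filter.atTop, χ n x = 1 := fun x => by
    obtain ⟨k, hk⟩ := exists_nat_ge ‖x‖
    filter_upwards [Filter.eventually_ge_atTop k] with n hn
    have : (k:ℝ) ≤ n := by exact_mod_cast hn
    simp only [hχ]
    rw [min_eq_left (by linarith), max_eq_right zero_le_one]
  have gb : ∀ n x, |f x * χ n x| ≤ 1 := fun n x => by
    rw [abs_mul, abs_of_nonneg (χ0 n x)]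
    exact mul_le_one₀ (hf1 x) (χ0 n x) (χ1 n x)
  have lim : ∀ {Ω : Type} [MeasurableSpace Ω] (m : Measure Ω) [IsFiniteMeasure m] (X : Ω → V d),
      Measurable X → Filter.Tendsto (fun n => ∫ ω, f (X ω) * χ n (X ω) ∂m) Filter.atTop
        (nhds (∫ ω, f (X ω) ∂m)) := by
    intro Ω _ m _ X hX
    refine tendsto_integral_of_dominated_convergence (fun _ => 1)
      (fun n => (((hfc.mul (χc n)).measurable).comp hX).aestronglyMeasurable) (integrable_const _)
      (fun n => Filter.Eventually.of_forall fun ω => gb n (X ω)) (Filter.Eventually.of_forall fun ω => ?_)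
    refine tendsto_const_nhds.congr' ?_
    filter_upwards [χt (X ω)] with n hn
    rw [hn, mul_one]
  refine le_of_tendsto ((lim m X hX).sub (lim m' X' hX')).abs (Filter.Eventually.of_forall fun n => ?_)
  exact h (fun x => f x * χ n x) (hfc.mul (χc n)) ((χs n).mul_left) (gb n)

lemma law_eq (hX : Bd m m' Y Y' s0 T 0) (hY : ∀ t, Measurable (Y t)) (hY' : ∀ t, Measurable (Y' t))
    {s : ℝ} (hs : s ∈ Icc s0 T) : m.map (Y s) = m'.map (Y' s) := by
  refine ext_of_forall_integral_eq_of_IsFiniteMeasure fun f => ?_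
  rw [integral_map (hY s).aemeasurable f.continuous.aestronglyMeasurable,
    integral_map (hY' s).aemeasurable f.continuous.aestronglyMeasurable]
  have h := hX.scale hs (f := f) f.continuous (norm_nonneg f) (fun x => f.norm_coe_le_norm x)
  rw [zero_mul] at h
  exact sub_eq_zero.1 (abs_eq_zero.1 (le_antisymm h (abs_nonneg _)))

/-- short-time uniqueness of one-dimensional laws, with uniform step -/
lemma short_unique (H : Hyp F1 F2 σ D c C b1 b2 b3 η) : ∃ T1 > 0, ∀ (s0 T : ℝ)
    (_ : T ≤ s0 + T1) {Ω : Type} [MeasurableSpace Ω] {m : Measure Ω} [IsFiniteMeasure m] {Y : ℝ → Ω → V d}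
    {Ω' : Type} [MeasurableSpace Ω'] {m' : Measure Ω'} [IsFiniteMeasure m'] {Y' : ℝ → Ω' → V d}
    (_ : IsSol F1 F2 σ m Y s0 T) (_ : IsSol F1 F2 σ m' Y' s0 T)
    (_ : m.map (Y s0) = m'.map (Y' s0)), ∀ s ∈ Icc s0 T, m.map (Y s) = m'.map (Y' s) := by
  obtain ⟨K, hK, hKb⟩ := Hk_bound H (2 * d + 1)
  have hC := H.C1
  have hg := H.gam_pos
  have hKr := Kref_nonneg d
  obtain ⟨T0, h0, h1, h2, h3⟩ := exists_T0 H (K := K0 d K C (gam b3 η)) (by unfold K0; positivity)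
  refine ⟨T0 / 2, by positivity, ?_⟩
  intro s0 T hT Ω _ m _ Y Ω' _ m' _ Y' S S' hlaw s hs
  have hb0 : Bd m m' Y Y' s0 T (m.real univ + m'.real univ) := by
    intro s _ f _ hf1
    have a1 := norm_integral_le_of_norm_le_const (μ := m) (f := fun ω => f (Y s ω)) (C := 1)
      (Filter.Eventually.of_forall fun ω => hf1 _)
    have a2 := norm_integral_le_of_norm_le_const (μ := m') (f := fun ω => f (Y' s ω)) (C := 1)
      (Filter.Eventually.of_forall fun ω => hf1 _)
    rw [one_mul] at a1 a2
    exact (abs_sub _ _).trans (add_le_add a1 a2)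
  have hstep : ∀ A, 0 ≤ A → Bd m m' Y Y' s0 T A → Bd m m' Y Y' s0 T (A / 2) := by
    intro A hA hB r hr f hfc hf1
    exact cutoff_ext hfc hf1 (S.meas r) (S'.meas r) fun g gc gs g1 =>
      contr_cs H S S' hlaw hK hKb h0 h1 h2 h3 hA hB hT gc gs g1 hr
  have hn : ∀ n : ℕ, Bd m m' Y Y' s0 T ((m.real univ + m'.real univ) / 2 ^ n) := by
    intro n
    induction n with
    | zero => simpa using hb0
    | succ n ih =>
      have := hstep _ (by positivity) ih
      rwa [div_div, ← pow_succ] at this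
  refine law_eq (fun s hs f hf hf1 => ?_) S.meas S'.meas hs
  refine ge_of_tendsto' (x := Filter.atTop) ?_ (fun n => hn n s hs f hf hf1)
  have := (tendsto_pow_atTop_nhds_zero_of_lt_one (r := (1 / 2 : ℝ)) (by norm_num) (by norm_num)).const_mul
    (m.real univ + m'.real univ)
  rw [mul_zero] at this
  refine this.congr fun n => ?_
  rw [div_pow, one_pow, mul_one_div]

lemma IsSol.sub (S : IsSol F1 F2 σ m Y s0 T) {a b : ℝ} (ha : s0 ≤ a) (hb : b ≤ T) :
    IsSol F1 F2 σ m Y a b :=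
  ⟨S.meas, S.cont, fun φ h1 h2 s t hs hst ht => S.eq φ h1 h2 s t (ha.trans hs) hst (ht.trans hb)⟩

end

/-- uniqueness of one-dimensional laws -/
lemma unique_1d {d : ℕ} {F1 F2 : ℝ → E d → E d → E d} {σ D : ℝ → E d → E d → Matrix (Fin d) (Fin d) ℝ}
    {c C b1 b2 b3 η : ℝ} (H : Hyp F1 F2 σ D c C b1 b2 b3 η)
    {Ω : Type} [MeasurableSpace Ω] {m : Measure Ω} [IsFiniteMeasure m] {Y : ℝ → Ω → V d}
    {Ω' : Type} [MeasurableSpace Ω'] {m' : Measure Ω'} [IsFiniteMeasure m'] {Y' : ℝ → Ω' → V d}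
    {s0 T : ℝ} (S : IsSol F1 F2 σ m Y s0 T)
    (S' : IsSol F1 F2 σ m' Y' s0 T) (hlaw : m.map (Y s0) = m'.map (Y' s0)) :
    ∀ s ∈ Icc s0 T, m.map (Y s) = m'.map (Y' s) := by
  obtain ⟨T1, hT1, h⟩ := short_unique H
  have key : ∀ n : ℕ, ∀ s ∈ Icc s0 T, s ≤ s0 + n * T1 → m.map (Y s) = m'.map (Y' s) := by
    intro n
    induction n with
    | zero =>
      intro s hs hs2
      simp only [Nat.cast_zero, zero_mul, add_zero] at hs2
      rw [le_antisymm hs2 hs.1]; exact hlaw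
    | succ n ih =>
      intro s hs hs2
      by_cases hsn : s ≤ s0 + n * T1
      · exact ih s hs hsn
      push Not at hsn
      have h0 : 0 ≤ (n:ℝ) * T1 := by positivity
      have hb := ih (s0 + n * T1) ⟨by linarith, hsn.le.trans hs.2⟩ le_rfl
      refine h (s0 + n * T1) s ?_ (S.sub (by linarith) hs.2) (S'.sub (by linarith) hs.2) hb s ⟨hsn.le, le_rfl⟩
      push_cast at hs2
      linarith
  intro s hs
  obtain ⟨n, hn⟩ := exists_nat_ge ((s - s0) / T1)
  refine key n s hs ?_
  rw [div_le_iff₀ hT1] at hn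
  linarith

end

section

/-! ### Part N: path space, uniqueness -/

section
variable {d : ℕ} {F1 F2 : ℝ → E d → E d → E d} {σ D : ℝ → E d → E d → Matrix (Fin d) (Fin d) ℝ}
  {c C b1 b2 b3 η : ℝ}

lemma fd1_cont {φ : V d → ℝ} (hφ : ContDiff ℝ (⊤ : ℕ∞) φ) (v : V d) :
    ContDiff ℝ (⊤ : ℕ∞) fun x => fderiv ℝ φ x v :=
  (hφ.fderiv_right (m := (⊤ : ℕ∞)) (by simp)).clm_apply contDiff_const

lemma fd1_supp {φ : V d → ℝ} (hs : HasCompactSupport φ) (v : V d) :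
    HasCompactSupport fun x => fderiv ℝ φ x v := by
  refine (hs.fderiv (𝕜 := ℝ)).comp_left (g := fun L : V d →L[ℝ] ℝ => L v) (by simp)

lemma gen_cont (H : Hyp F1 F2 σ D c C b1 b2 b3 η) {φ : V d → ℝ} (hφ : ContDiff ℝ (⊤ : ℕ∞) φ) :
    Continuous fun p : ℝ × V d => gen F1 F2 (aσ σ) φ p.1 p.2 := by
  unfold gen
  refine ((continuous_const.mul ?_).add ?_).add ?_
  · exact continuous_finsetSum _ fun i _ => continuous_finsetSum _ fun j _ => (H.ca i j).mul
      ((fd1_cont (fd1_cont hφ _) _).continuous.comp continuous_snd)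
  · exact continuous_finsetSum _ fun i _ => ((EuclideanSpace.proj (𝕜 := ℝ) i).continuous.comp H.cF1).mul
      ((fd1_cont hφ _).continuous.comp continuous_snd)
  · exact continuous_finsetSum _ fun i _ => ((EuclideanSpace.proj (𝕜 := ℝ) i).continuous.comp H.cF2).mul
      ((fd1_cont hφ _).continuous.comp continuous_snd)

lemma cs_bdd {g : V d → ℝ} (hg : Continuous g) (hs : HasCompactSupport g) : ∃ B, 0 ≤ B ∧
    ∀ x, |g x| * (1 + ‖x‖) ≤ B := by
  obtain ⟨B, hB⟩ := (hs.mul_right (f' := fun x => 1 + ‖x‖)).exists_bound_of_continuous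
    (hg.mul (by fun_prop))
  refine ⟨B, (norm_nonneg _).trans (hB 0), fun x => ?_⟩
  have := hB x
  rw [Pi.mul_apply, norm_mul, Real.norm_eq_abs, Real.norm_of_nonneg (by positivity)] at this
  exact this

lemma gen_bdd (H : Hyp F1 F2 σ D c C b1 b2 b3 η) {φ : V d → ℝ} (hφ : ContDiff ℝ (⊤ : ℕ∞) φ)
    (hs : HasCompactSupport φ) : ∃ K, 0 ≤ K ∧ ∀ t x, |gen F1 F2 (aσ σ) φ t x| ≤ K := by
  have h2 := fun i j => cs_bdd (fd1_cont (fd1_cont hφ (e1 d j)) (e1 d i)).continuous (fd1_supp (fd1_supp hs (e1 d j)) (e1 d i))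
  have h1 := fun i => cs_bdd (fd1_cont hφ (e1 d i)).continuous (fd1_supp hs (e1 d i))
  have h1' := fun i => cs_bdd (fd1_cont hφ (e2 d i)).continuous (fd1_supp hs (e2 d i))
  choose A hA0 hA using h2
  choose B hB0 hB using h1
  choose B' hB0' hB' using h1'
  have hC := H.C1
  have ab := H.ab
  set Ca := d * (C * C) with hCa
  have key : ∀ (M u n g R : ℝ), |u| ≤ M * n → 0 ≤ M → |g| * n ≤ R → |u * g| ≤ M * R := by
    intro M u n g R h1 h2 h3
    rw [abs_mul]
    calc |u| * |g| ≤ M * n * |g| := by gcongr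
      _ = M * (|g| * n) := by ring
      _ ≤ M * R := by gcongr
  obtain ⟨Ka, hKa0, hKa⟩ : ∃ Ka, 0 ≤ Ka ∧ ∀ t x1 x2 i j, |aσ σ t x1 x2 i j| ≤ Ka :=
    ⟨_, (abs_nonneg _).trans (le_max_right (1:ℝ) |d * C ^ 2|), fun t x1 x2 i j =>
      (ab t x1 x2 i j).trans ((le_abs_self _).trans (le_max_right _ _))⟩
  refine ⟨1 / 2 * ∑ i, ∑ j, Ka * A i j + ∑ i, C * B i + ∑ i, C * B' i, ?_, fun t x => ?_⟩
  · have : 0 ≤ C := by linarith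
    have := fun i j => mul_nonneg hKa0 (hA0 i j)
    have s1 : 0 ≤ ∑ i, ∑ j, Ka * A i j := Finset.sum_nonneg fun i _ => Finset.sum_nonneg fun j _ => this i j
    have s2 : 0 ≤ ∑ i, C * B i := Finset.sum_nonneg fun i _ => mul_nonneg (by linarith) (hB0 i)
    have s3 : 0 ≤ ∑ i, C * B' i := Finset.sum_nonneg fun i _ => mul_nonneg (by linarith) (hB0' i)
    linarith
  · unfold gen
    refine (abs_add_le _ _).trans (add_le_add ((abs_add_le _ _).trans (add_le_add ?_ ?_)) ?_)
    · rw [abs_mul, abs_of_pos (by norm_num : (0:ℝ) < 1 / 2)]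
      refine mul_le_mul_of_nonneg_left ((Finset.abs_sum_le_sum_abs _ _).trans
        (Finset.sum_le_sum fun i _ => (Finset.abs_sum_le_sum_abs _ _).trans
        (Finset.sum_le_sum fun j _ => ?_))) (by norm_num)
      refine key Ka _ (1 + ‖x‖) _ _ ((hKa t x.1 x.2 i j).trans ?_) hKa0 (hA i j x)
      have := norm_nonneg x
      nlinarith
    · refine (Finset.abs_sum_le_sum_abs _ _).trans (Finset.sum_le_sum fun i _ => ?_)
      exact key C _ (1 + ‖x‖) _ _ ((abs_apply_le _ i).trans (H.gF1 t x)) (by linarith) (hB i x)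
    · refine (Finset.abs_sum_le_sum_abs _ _).trans (Finset.sum_le_sum fun i _ => ?_)
      exact key C _ (1 + ‖x‖) _ _ ((abs_apply_le _ i).trans (H.gF2 t x)) (by linarith) (hB' i x)

/-- path space -/
abbrev PS (d : ℕ) (T : ℝ) := C(Icc (0:ℝ) T, V d)

/-- canonical process in real time -/
def Yc {T : ℝ} (hT : 0 < T) (t : ℝ) (ω : PS d T) : V d := ω (projIcc 0 T hT.le t)

variable {T : ℝ} (hT : 0 < T)

lemma Yc_cont2 : Continuous fun p : ℝ × PS d T => Yc hT p.1 p.2 := by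
  unfold Yc
  exact continuous_eval.comp (continuous_snd.prodMk ((continuous_projIcc (h := hT.le)).comp continuous_fst))

lemma Yc_cont1 (t : ℝ) : Continuous fun ω : PS d T => Yc hT t ω :=
  (Yc_cont2 hT).comp (Continuous.prodMk_right t)

lemma Yc_cont (ω : PS d T) : Continuous fun t => Yc hT t ω :=
  (Yc_cont2 hT).comp (Continuous.prodMk_left ω)

/-- the canonical filtration -/
def canF (d : ℕ) (T : ℝ) : Filtration (Icc (0:ℝ) T) (pathMeasurableSpace : MeasurableSpace (PS d T)) :=
  Filtration.natural
            (fun (t : Icc (0:ℝ) T) (ω : C(Icc (0:ℝ) T, E d × E d)) => ω t)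
            (fun t => (ContinuousEvalConst.continuous_eval_const t).stronglyMeasurable)

/-- the martingale -/
def Mp (F1 F2 : ℝ → E d → E d → E d) (σ : ℝ → E d → E d → Matrix (Fin d) (Fin d) ℝ) (φ : V d → ℝ)
    (t : Icc (0:ℝ) T) (ω : PS d T) : ℝ :=
  φ (ω t) - ∫ s in (0:ℝ)..(t : ℝ), gen F1 F2 (aσ σ) φ s (Yc hT s ω)

/-- solution of the martingale problem -/
structure IsMP (F1 F2 : ℝ → E d → E d → E d) (σ : ℝ → E d → E d → Matrix (Fin d) (Fin d) ℝ)
    (x : V d) (P : Measure (PS d T)) : Prop where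
  prob : IsProbabilityMeasure P
  ini : P {ω | ω ⟨0, left_mem_Icc.2 hT.le⟩ = x} = 1
  mart : ∀ φ : V d → ℝ, ContDiff ℝ (⊤ : ℕ∞) φ → HasCompactSupport φ →
    Martingale (Mp hT F1 F2 σ φ) (canF d T) P

lemma path_comp_cont {G : ℝ × V d → ℝ} (hG : Continuous G) :
    Continuous fun p : ℝ × PS d T => G (p.1, Yc hT p.1 p.2) :=
  hG.comp (continuous_fst.prodMk (Yc_cont2 hT))

lemma gen_path_cont (H : Hyp F1 F2 σ D c C b1 b2 b3 η) {φ : V d → ℝ} (hφ : ContDiff ℝ (⊤ : ℕ∞) φ) :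
    Continuous fun p : ℝ × PS d T => gen F1 F2 (aσ σ) φ p.1 (Yc hT p.1 p.2) :=
  path_comp_cont hT (G := fun p => gen F1 F2 (aσ σ) φ p.1 p.2) (gen_cont H hφ)

lemma gen_path_int (H : Hyp F1 F2 σ D c C b1 b2 b3 η) {φ : V d → ℝ} (hφ : ContDiff ℝ (⊤ : ℕ∞) φ)
    (ω : PS d T) (a b : ℝ) :
    IntervalIntegrable (fun u => gen F1 F2 (aσ σ) φ u (Yc hT u ω)) volume a b :=
  ((gen_path_cont hT H hφ).comp (Continuous.prodMk_left ω)).intervalIntegrable a b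

lemma gen_fubini (H : Hyp F1 F2 σ D c C b1 b2 b3 η) {φ : V d → ℝ} (hφ : ContDiff ℝ (⊤ : ℕ∞) φ)
    (hs : HasCompactSupport φ) (m : Measure (PS d T)) [IsFiniteMeasure m] {a b : ℝ} (hab : a ≤ b) :
    Integrable (fun ω => ∫ u in a..b, gen F1 F2 (aσ σ) φ u (Yc hT u ω)) m ∧
    ∫ ω, (∫ u in a..b, gen F1 F2 (aσ σ) φ u (Yc hT u ω)) ∂m =
      ∫ u in a..b, ∫ ω, gen F1 F2 (aσ σ) φ u (Yc hT u ω) ∂m := by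
  obtain ⟨K, hK0, hK⟩ := gen_bdd H hφ hs
  have hm : Measurable fun p : PS d T × ℝ => gen F1 F2 (aσ σ) φ p.2 (Yc hT p.2 p.1) :=
    ((gen_path_cont hT H hφ).comp continuous_swap).measurable
  have hi : Integrable (Function.uncurry fun (ω : PS d T) (u : ℝ) => gen F1 F2 (aσ σ) φ u (Yc hT u ω))
      (m.prod (volume.restrict (Ioc a b))) :=
    Integrable.of_bound hm.aestronglyMeasurable K (Filter.Eventually.of_forall fun p => hK _ _)
  simp only [intervalIntegral.integral_of_le hab]
  exact ⟨hi.integral_prod_left, integral_integral_swap hi⟩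

lemma IsMP.isSol (H : Hyp F1 F2 σ D c C b1 b2 b3 η) {x : V d} {P : Measure (PS d T)}
    (h : IsMP hT F1 F2 σ x P) {s0 : Icc (0:ℝ) T} {A : Set (PS d T)} (hA : MeasurableSet[canF d T s0] A) :
    IsSol F1 F2 σ (P.restrict A) (Yc hT) s0 T := by
  haveI := h.prob
  refine ⟨fun t => (Yc_cont1 hT t).measurable, Yc_cont hT, fun φ hφ hs s t hs0 hst htT => ?_⟩
  have s0' : 0 ≤ s := s0.2.1.trans hs0
  set s' : Icc (0:ℝ) T := ⟨s, s0', hst.trans htT⟩ with hs'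
  set t' : Icc (0:ℝ) T := ⟨t, s0'.trans hst, htT⟩ with ht'
  have hm := h.mart φ hφ hs
  have e := hm.setIntegral_eq (i := s') (j := t') hst ((canF d T).mono (show s0 ≤ s' from hs0) A hA)
  have hφi : ∀ r : ℝ, Integrable (fun ω => φ (Yc hT r ω)) (P.restrict A) := by
    intro r
    obtain ⟨B, hB⟩ := hs.exists_bound_of_continuous hφ.continuous
    exact Integrable.of_bound (hφ.continuous.comp (Yc_cont1 hT r)).measurable.aestronglyMeasurable B
      (Filter.Eventually.of_forall fun ω => hB _)
  have ep : ∀ r : Icc (0:ℝ) T, ∀ ω : PS d T, ω r = Yc hT r ω := by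
    intro r ω; rw [Yc, projIcc_val]
  have g1 := gen_fubini hT H hφ hs (P.restrict A) s0'
  have g2 := gen_fubini hT H hφ hs (P.restrict A) (s0'.trans hst)
  have g3 := gen_fubini hT H hφ hs (P.restrict A) hst
  simp only [Mp, ep] at e
  rw [integral_sub (hφi _) g1.1, integral_sub (hφi _) g2.1] at e
  rw [← g3.2]
  have e2 : ∀ ω : PS d T, ∫ u in s..t, gen F1 F2 (aσ σ) φ u (Yc hT u ω) =
      (∫ u in (0:ℝ)..t, gen F1 F2 (aσ σ) φ u (Yc hT u ω)) - ∫ u in (0:ℝ)..s, gen F1 F2 (aσ σ) φ u (Yc hT u ω) := by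
    intro ω
    rw [intervalIntegral.integral_interval_sub_left (gen_path_int hT H hφ ω _ _) (gen_path_int hT H hφ ω _ _)]
  simp_rw [e2]
  rw [integral_sub g2.1 g1.1]
  linarith

lemma path_borel (hT : 0 < T) : (pathMeasurableSpace : MeasurableSpace (PS d T)) =
    ⨆ t : Icc (0:ℝ) T, MeasurableSpace.comap (fun ω : PS d T => ω t) inferInstance := by
  classical
  haveI : Nonempty (Icc (0:ℝ) T) := ⟨⟨0, left_mem_Icc.2 hT.le⟩⟩
  refine le_antisymm ?_ (iSup_le fun t => ?_)
  swap
  · exact (ContinuousEvalConst.continuous_eval_const (F := PS d T) t).measurable.comap_le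
  set M : MeasurableSpace (PS d T) := ⨆ t : Icc (0:ℝ) T, MeasurableSpace.comap (fun ω : PS d T => ω t) inferInstance with hM
  have hev : ∀ t : Icc (0:ℝ) T, Measurable[M] fun ω : PS d T => ω t := fun t =>
    Measurable.mono (comap_measurable _) (le_iSup (fun t : Icc (0:ℝ) T =>
      MeasurableSpace.comap (fun ω : PS d T => ω t) inferInstance) t) le_rfl
  have hcb : ∀ (g : PS d T) (r : ℝ), MeasurableSet[M] (Metric.closedBall g r) := by
    intro g r
    rcases lt_or_ge r 0 with hr | hr
    · rw [Metric.closedBall_eq_empty.2 hr]; exact MeasurableSet.empty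
    · have : Metric.closedBall g r = ⋂ n : ℕ, {ω : PS d T | dist (ω (TopologicalSpace.denseSeq _ n))
          (g (TopologicalSpace.denseSeq _ n)) ≤ r} := by
        ext ω
        rw [Metric.mem_closedBall, ContinuousMap.dist_le hr, mem_iInter]
        refine ⟨fun h n => h _, fun h t => ?_⟩
        have hc : IsClosed {t : Icc (0:ℝ) T | dist (ω t) (g t) ≤ r} :=
          isClosed_le (ω.continuous.dist g.continuous) continuous_const
        have := (TopologicalSpace.denseRange_denseSeq (Icc (0:ℝ) T)).closure_eq
        have h2 : closure (range (TopologicalSpace.denseSeq (Icc (0:ℝ) T))) ⊆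
          {t : Icc (0:ℝ) T | dist (ω t) (g t) ≤ r} := closure_minimal (by rintro _ ⟨n, rfl⟩; exact h n) hc
        rw [this] at h2
        exact h2 (mem_univ t)
      rw [this]
      refine MeasurableSet.iInter fun n => ?_
      exact hev _ (Metric.isClosed_closedBall (x := g (TopologicalSpace.denseSeq _ n)) (ε := r)).measurableSet
  show borel (PS d T) ≤ M
  rw [borel]
  refine MeasurableSpace.generateFrom_le fun U hU => ?_
  have hU' : IsOpen U := hU
  obtain ⟨S, hSU, hSc, hSe⟩ := TopologicalSpace.isOpen_biUnion_countable U
    (fun g : PS d T => ⋃ n : ℕ, if Metric.closedBall g (1 / (n + 1)) ⊆ U then Metric.ball g (1 / (n+1)) else ∅)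
    (fun g _ => isOpen_iUnion fun n => by split_ifs; exacts [Metric.isOpen_ball, isOpen_empty])
  have hUe : U = ⋃ g ∈ S, ⋃ n : ℕ, if Metric.closedBall g (1 / ((n:ℝ) + 1)) ⊆ U then Metric.closedBall g (1 / ((n:ℝ)+1)) else ∅ := by
    refine Subset.antisymm (fun g hg => ?_) (iUnion₂_subset fun g hg => iUnion_subset fun n => ?_)
    · obtain ⟨ε, hε, hb⟩ := Metric.isOpen_iff.1 hU' g hg
      obtain ⟨n, hn⟩ := exists_nat_one_div_lt hε
      have : g ∈ ⋃ g ∈ U, ⋃ n : ℕ, if Metric.closedBall g (1 / ((n:ℝ) + 1)) ⊆ U then Metric.ball g (1 / ((n:ℝ)+1)) else ∅ := by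
        refine mem_iUnion₂.2 ⟨g, hg, mem_iUnion.2 ⟨n, ?_⟩⟩
        rw [if_pos ((Metric.closedBall_subset_ball hn).trans hb)]
        exact Metric.mem_ball_self (by positivity)
      rw [← hSe] at this
      obtain ⟨g', hg', h2⟩ := mem_iUnion₂.1 this
      obtain ⟨n', h3⟩ := mem_iUnion.1 h2
      refine mem_iUnion₂.2 ⟨g', hg', mem_iUnion.2 ⟨n', ?_⟩⟩
      split_ifs at h3 ⊢ with hh
      · exact Metric.ball_subset_closedBall h3
      · exact h3
    · split_ifs with hh
      · exact hh
      · exact empty_subset _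
  rw [hUe]
  refine MeasurableSet.biUnion hSc fun g _ => MeasurableSet.iUnion fun n => ?_
  split_ifs
  · exact hcb _ _
  · exact MeasurableSet.empty

end

end

section

/-! ### Part O: uniqueness on path space -/

section
variable {d : ℕ} {F1 F2 : ℝ → E d → E d → E d} {σ D : ℝ → E d → E d → Matrix (Fin d) (Fin d) ℝ}
  {c C b1 b2 b3 η : ℝ} {T : ℝ} (hT : 0 < T)

/-- σ-algebra of one evaluation -/
def mev (d : ℕ) (T : ℝ) (t : Icc (0:ℝ) T) : MeasurableSpace (PS d T) :=
  MeasurableSpace.comap (fun ω : PS d T => ω t) inferInstance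

lemma mev_le_canF {s t : Icc (0:ℝ) T} (h : s ≤ t) : mev d T s ≤ canF d T t :=
  le_iSup₂ (f := fun (j : Icc (0:ℝ) T) (_ : j ≤ t) => MeasurableSpace.comap (fun ω : PS d T => ω j) inferInstance) s h

lemma canF_eq (t : Icc (0:ℝ) T) : (canF d T t : MeasurableSpace (PS d T)) = ⨆ j ∈ Iic t, mev d T j := rfl

lemma cyl_meas {I : Finset (Icc (0:ℝ) T)} {f : Icc (0:ℝ) T → Set (PS d T)}
    (hf : ∀ i ∈ I, MeasurableSet[mev d T i] (f i)) {t : Icc (0:ℝ) T} (ht : ∀ i ∈ I, i ≤ t) :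
    MeasurableSet[canF d T t] (⋂ i ∈ I, f i) :=
  Finset.measurableSet_biInter (m := canF d T t) I fun i hi => mev_le_canF (ht i hi) _ (hf i hi)

lemma Yc_val (r : Icc (0:ℝ) T) (ω : PS d T) : Yc hT r ω = ω r := by rw [Yc, projIcc_val]

lemma IsMP.law0 {x : V d} {P : Measure (PS d T)} (h : IsMP hT F1 F2 σ x P) :
    P.map (Yc hT 0) = Measure.dirac x := by
  haveI := h.prob
  have h1 : ∀ᵐ ω ∂P, Yc hT 0 ω = x := by
    have hm : MeasurableSet {ω : PS d T | ω ⟨0, left_mem_Icc.2 hT.le⟩ = x} :=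
      (ContinuousEvalConst.continuous_eval_const (F := PS d T) _).measurable (measurableSet_singleton x)
    have := (prob_compl_eq_zero_iff hm).2 h.ini
    rw [ae_iff]
    refine measure_mono_null (t := {ω : PS d T | ω ⟨0, left_mem_Icc.2 hT.le⟩ = x}ᶜ) (fun ω hω hω' => hω ?_) this
    have hω2 : ω ⟨0, left_mem_Icc.2 hT.le⟩ = x := hω'
    rw [← hω2]
    exact Yc_val hT ⟨0, left_mem_Icc.2 hT.le⟩ ω
  rw [Measure.map_congr (g := fun _ => x) h1, Measure.map_const, measure_univ, one_smul]

lemma fdd (H : Hyp F1 F2 σ D c C b1 b2 b3 η) {x : V d} {P Q : Measure (PS d T)}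
    (hP : IsMP hT F1 F2 σ x P) (hQ : IsMP hT F1 F2 σ x Q) (I : Finset (Icc (0:ℝ) T)) :
    ∀ f : Icc (0:ℝ) T → Set (PS d T), (∀ i ∈ I, MeasurableSet[mev d T i] (f i)) →
      ∀ s0 : Icc (0:ℝ) T, (∀ j ∈ I, j ≤ s0) →
      (P.restrict (⋂ i ∈ I, f i)).map (Yc hT s0) = (Q.restrict (⋂ i ∈ I, f i)).map (Yc hT s0) := by
  classical
  haveI := hP.prob
  haveI := hQ.prob
  induction I using Finset.induction_on_max with
  | empty =>
    intro f _ s0 _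
    have e : (⋂ i ∈ (∅ : Finset (Icc (0:ℝ) T)), f i) = univ := by simp
    rw [e]
    have h0 : (0:ℝ) = ((⟨0, left_mem_Icc.2 hT.le⟩ : Icc (0:ℝ) T) : ℝ) := rfl
    have S := hP.isSol hT H (s0 := ⟨0, left_mem_Icc.2 hT.le⟩) (A := univ) MeasurableSet.univ
    have S' := hQ.isSol hT H (s0 := ⟨0, left_mem_Icc.2 hT.le⟩) (A := univ) MeasurableSet.univ
    refine unique_1d H S S' ?_ s0 s0.2
    rw [Measure.restrict_univ, Measure.restrict_univ]
    exact (hP.law0 hT).trans (hQ.law0 hT).symm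
  | insert a I hlt ih =>
    intro f hf s0 hs0
    have hA := cyl_meas hf (t := a) (fun i hi => by
      rcases Finset.mem_insert.1 hi with rfl | hi
      · exact le_rfl
      · exact (hlt i hi).le)
    refine unique_1d H (hP.isSol hT H hA) (hQ.isSol hT H hA) ?_ s0 ⟨hs0 a (Finset.mem_insert_self _ _), s0.2.2⟩
    have h1 := ih f (fun i hi => hf i (Finset.mem_insert_of_mem hi)) a (fun j hj => (hlt j hj).le)
    obtain ⟨B, hB, hfB⟩ := hf a (Finset.mem_insert_self _ _)
    have hfB' : f a = (Yc hT a) ⁻¹' B := by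
      rw [← hfB]; ext ω; simp only [mem_preimage, Yc_val]
    have hm := (Yc_cont1 (d := d) hT a).measurable
    rw [Finset.set_biInter_insert, hfB', ← Measure.restrict_restrict (hm hB), ← Measure.restrict_restrict (hm hB),
      ← Measure.restrict_map hm hB, ← Measure.restrict_map hm hB, h1]

lemma path_unique (H : Hyp F1 F2 σ D c C b1 b2 b3 η) {x : V d} {P Q : Measure (PS d T)}
    (hP : IsMP hT F1 F2 σ x P) (hQ : IsMP hT F1 F2 σ x Q) : P = Q := by
  haveI := hP.prob
  haveI := hQ.prob
  refine ext_of_generate_finite (piiUnionInter (fun t => {s | MeasurableSet[mev d T t] s}) univ) ?_ ?_ ?_ (by simp)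
  · rw [generateFrom_piiUnionInter_measurableSet (mev d T) univ, path_borel hT]
    simp [mev]
  · exact isPiSystem_piiUnionInter _ (fun t => @MeasurableSpace.isPiSystem_measurableSet _ (mev d T t)) _
  · rintro s ⟨I, -, f, hf, rfl⟩
    have h := fdd hT H hP hQ I f hf ⟨T, right_mem_Icc.2 hT.le⟩ (fun j _ => j.2.2)
    have h2 := congrArg (fun m => m univ) h
    have hm := (Yc_cont1 (d := d) hT (⟨T, right_mem_Icc.2 hT.le⟩ : Icc (0:ℝ) T)).measurable
    simpa [Measure.map_apply hm MeasurableSet.univ] using h2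

end

end

section

/-! ### Part P: packaging of the hypotheses -/

section
variable {d : ℕ}

lemma joint_cont {X W : Type*} [NormedAddCommGroup X] [NormedAddCommGroup W] {f : ℝ → X → W} {g : X → ℝ}
    (h1 : ∀ x, Continuous fun t => f t x) (h2 : ∀ t x y, ‖f t x - f t y‖ ≤ g (x - y))
    (hg : Continuous g) (hg0 : g 0 = 0) : Continuous fun p : ℝ × X => f p.1 p.2 := by
  rw [continuous_iff_continuousAt]
  rintro ⟨t0, x0⟩
  rw [ContinuousAt, tendsto_iff_norm_sub_tendsto_zero]
  have l1 : Filter.Tendsto (fun p : ℝ × X => g (p.2 - x0) + ‖f p.1 x0 - f t0 x0‖) (nhds (t0, x0)) (nhds 0) := by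
    have : Continuous fun p : ℝ × X => g (p.2 - x0) + ‖f p.1 x0 - f t0 x0‖ :=
      (hg.comp (continuous_snd.sub continuous_const)).add
        ((((h1 x0).comp continuous_fst).sub continuous_const).norm)
    have := this.tendsto (t0, x0)
    simpa [hg0] using this
  refine squeeze_zero (fun _ => norm_nonneg _) (fun p => ?_) l1
  calc ‖f p.1 p.2 - f t0 x0‖ = ‖(f p.1 p.2 - f p.1 x0) + (f p.1 x0 - f t0 x0)‖ := by congr 1; abel
    _ ≤ _ := (norm_add_le _ _).trans (add_le_add (h2 _ _ _) le_rfl)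

lemma rpow_le_one_add' {y b : ℝ} (hy : 0 ≤ y) (hb : b ∈ Ioo (0:ℝ) 1) : y ^ b ≤ 1 + y := by
  rcases le_or_gt y 1 with h | h
  · have := Real.rpow_le_one hy h hb.1.le
    linarith
  · have := Real.rpow_le_rpow_of_exponent_le h.le hb.2.le
    rw [Real.rpow_one] at this
    linarith

lemma quad_eq (M : Matrix (Fin d) (Fin d) ℝ) (ζ : Fin d → ℝ) :
    ∑ i, ∑ j, (M * Mᵀ) i j * ζ i * ζ j = nsq (Mᵀ *ᵥ ζ) := by
  rw [← form_mul_transpose]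
  simp only [dotProduct, mulVec, Finset.mul_sum]
  exact Finset.sum_congr rfl fun i _ => Finset.sum_congr rfl fun j _ => by ring

lemma ell_nsq {M : Matrix (Fin d) (Fin d) ℝ} {L : ℝ}
    (h : ∀ ζ : E d, L⁻¹ * ‖ζ‖ ^ 2 ≤ ∑ i, ∑ j, (M * Mᵀ) i j * ζ i * ζ j ∧
      ∑ i, ∑ j, (M * Mᵀ) i j * ζ i * ζ j ≤ L * ‖ζ‖ ^ 2) (ζ : Fin d → ℝ) :
    L⁻¹ * nsq ζ ≤ nsq (Mᵀ *ᵥ ζ) ∧ nsq (Mᵀ *ᵥ ζ) ≤ L * nsq ζ := by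
  have := h (WithLp.toLp 2 ζ)
  rw [← nsq_ofLp] at this
  have e := quad_eq M ζ
  exact ⟨by rw [← e]; exact this.1, by rw [← e]; exact this.2⟩

lemma entry_bd {M : Matrix (Fin d) (Fin d) ℝ} {L : ℝ} (hL : 1 ≤ L)
    (h : ∀ ζ : Fin d → ℝ, nsq (Mᵀ *ᵥ ζ) ≤ L * nsq ζ) (i j : Fin d) : |M i j| ≤ L := by
  classical
  have h1 := h (Pi.single i 1)
  have h2 := sq_le_nsq (Mᵀ *ᵥ Pi.single i 1) j
  have e : (Mᵀ *ᵥ Pi.single i 1) j = M i j := by simp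
  have e2 : nsq (Pi.single i 1 : Fin d → ℝ) = 1 := by simp [nsq]
  rw [e] at h2
  rw [e2] at h1
  refine abs_le_of_sq_le_sq (by nlinarith) (by linarith)

lemma nsq_mulVec_le {M : Matrix (Fin d) (Fin d) ℝ} {K : ℝ} (hK : 0 ≤ K) (h : ∀ i j, |M i j| ≤ K) (ξ : Fin d → ℝ) :
    nsq (M *ᵥ ξ) ≤ (d * (d * K)) ^ 2 * nsq ξ := by
  have h1 := toE_norm_le h (WithLp.toLp 2 ξ)
  have h2 : nsq (M *ᵥ ξ) = ‖Matrix.toEuclideanLin M (WithLp.toLp 2 ξ)‖ ^ 2 := by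
    rw [← nsq_ofLp]; rfl
  have h3 : nsq ξ = ‖(WithLp.toLp 2 ξ : E d)‖ ^ 2 := by
    rw [← nsq_ofLp]
  rw [h2, h3, ← mul_pow]
  exact pow_le_pow_left₀ (norm_nonneg _) h1 2

/-- uniform lower bound on a compact set of invertible matrices -/
lemma inv_low (hd : 0 < d) {S : Set (Matrix (Fin d) (Fin d) ℝ)} (hS : IsClosed S) {K : ℝ}
    (hK : ∀ M ∈ S, ∀ i j, |M i j| ≤ K) (hu : ∀ M ∈ S, IsUnit M) :
    ∃ c, 0 < c ∧ ∀ M ∈ S, ∀ ξ : Fin d → ℝ, c * nsq ξ ≤ nsq (Mᵀ *ᵥ ξ) := by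
  classical
  have hc1 : IsCompact S := by
    have : S ⊆ Set.pi univ fun _ : Fin d => Set.pi univ fun _ : Fin d => Icc (-K) K := by
      intro M hM i _ j _
      exact abs_le.1 (hK M hM i j)
    exact (isCompact_univ_pi fun _ => isCompact_univ_pi fun _ => isCompact_Icc).of_isClosed_subset hS this
  have nc : Continuous fun v : Fin d → ℝ => nsq v := by
    unfold nsq dotProduct; fun_prop
  have hc2 : IsCompact {v : Fin d → ℝ | nsq v = 1} := by
    have : {v : Fin d → ℝ | nsq v = 1} ⊆ Set.pi univ fun _ : Fin d => Icc (-1) 1 := by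
      intro v hv i _
      have := sq_le_nsq v i
      rw [show nsq v = 1 from hv] at this
      exact abs_le.1 (abs_le_of_sq_le_sq (by linarith) (by norm_num))
    exact (isCompact_univ_pi fun _ => isCompact_Icc).of_isClosed_subset (isClosed_eq nc continuous_const) this
  rcases S.eq_empty_or_nonempty with rfl | hne
  · exact ⟨1, one_pos, by simp⟩
  have hne2 : ({v : Fin d → ℝ | nsq v = 1}).Nonempty := ⟨Pi.single ⟨0, hd⟩ 1, by simp [nsq]⟩
  obtain ⟨⟨M0, v0⟩, ⟨hM0, hv0⟩, hmin⟩ := (hc1.prod hc2).exists_isMinOn (hne.prod hne2)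
    (f := fun p : Matrix (Fin d) (Fin d) ℝ × (Fin d → ℝ) => nsq (p.1ᵀ *ᵥ p.2))
    (by
      refine Continuous.continuousOn (nc.comp ?_)
      exact continuous_fst.matrix_transpose.matrix_mulVec continuous_snd)
  have hpos : 0 < nsq (M0ᵀ *ᵥ v0) := by
    refine lt_of_le_of_ne (nsq_nonneg _) fun h0 => ?_
    have hz : M0ᵀ *ᵥ v0 = 0 := by
      funext i
      have := sq_le_nsq (M0ᵀ *ᵥ v0) i
      rw [← h0] at this
      have := sq_nonneg ((M0ᵀ *ᵥ v0) i)
      exact pow_eq_zero_iff (two_ne_zero) |>.1 (le_antisymm ‹_› this)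
    have hut : IsUnit M0ᵀ := by
      rw [Matrix.isUnit_iff_isUnit_det, Matrix.det_transpose, ← Matrix.isUnit_iff_isUnit_det]
      exact hu M0 hM0
    have : v0 = 0 := by
      refine Matrix.mulVec_injective_of_isUnit hut ?_
      rw [hz, Matrix.mulVec_zero]
    have h1 : nsq v0 = 1 := hv0
    rw [this] at h1
    simp [nsq] at h1
  refine ⟨_, hpos, fun M hM ξ => ?_⟩
  rcases (nsq_nonneg ξ).eq_or_lt with h0 | h0
  · rw [← h0, mul_zero]; exact nsq_nonneg _
  · have hs : nsq ((√(nsq ξ))⁻¹ • ξ) = 1 := by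
      rw [nsq, smul_dotProduct, dotProduct_smul, smul_smul, ← nsq, smul_eq_mul, ← mul_inv,
        Real.mul_self_sqrt h0.le, inv_mul_cancel₀ h0.ne']
    have h1 := hmin (⟨hM, hs⟩ : (M, (√(nsq ξ))⁻¹ • ξ) ∈ S ×ˢ {v : Fin d → ℝ | nsq v = 1})
    have h2 : nsq (M0ᵀ *ᵥ v0) ≤ nsq (Mᵀ *ᵥ ((√(nsq ξ))⁻¹ • ξ)) := h1
    rw [mulVec_smul, nsq, nsq, smul_dotProduct, dotProduct_smul, smul_smul, ← nsq, ← nsq, smul_eq_mul, ← mul_inv,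
        Real.mul_self_sqrt h0.le] at h2
    calc nsq (M0ᵀ *ᵥ v0) * nsq ξ ≤ ((nsq ξ)⁻¹ * nsq (Mᵀ *ᵥ ξ)) * nsq ξ := by gcongr
      _ = nsq (Mᵀ *ᵥ ξ) := by field_simp

lemma avg_mem {S : Set (Matrix (Fin d) (Fin d) ℝ)} (hS : IsClosed S) (hc : Convex ℝ S)
    {D : ℝ → Matrix (Fin d) (Fin d) ℝ} (hD : ∀ i j, Continuous fun u => D u i j) (hm : ∀ u, D u ∈ S)
    (u u' : ℝ) : ∃ M ∈ S, Bm D u' u = (u' - u) • M := by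
  have hp : IsProbabilityMeasure (volume.restrict (Ioc (0:ℝ) 1)) := ⟨by simp⟩
  have hDc : ∀ i j, Continuous fun r => D (u + r * (u' - u)) i j := fun i j =>
    (hD i j).comp (by fun_prop)
  have key : ∀ (G : ℝ → Fin d → Fin d → ℝ) (S' : Set (Fin d → Fin d → ℝ)), IsClosed S' → Convex ℝ S' →
      (∀ i j, Continuous fun r => G r i j) → (∀ r, G r ∈ S') →
      (fun i j => ∫ r in Ioc (0:ℝ) 1, G r i j) ∈ S' := by
    intro G S' h1 h2 h3 h4
    have hIntg : ∀ i j, Integrable (fun r => G r i j) (volume.restrict (Ioc (0:ℝ) 1)) := fun i j =>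
      (((h3 i j).intervalIntegrable 0 1)).1
    have hIntg2 : ∀ i, Integrable (fun r => G r i) (volume.restrict (Ioc (0:ℝ) 1)) :=
      fun i => Integrable.of_eval (hIntg i)
    have := Convex.integral_mem (μ := volume.restrict (Ioc (0:ℝ) 1)) h2 h1
      (f := G) (Filter.Eventually.of_forall h4) (Integrable.of_eval hIntg2)
    convert this using 1
    ext i j
    rw [eval_integral hIntg2, eval_integral (hIntg i)]
  refine ⟨Matrix.of fun i j => ∫ r in Ioc (0:ℝ) 1, D (u + r * (u' - u)) i j,
    key (fun r => D (u + r * (u' - u))) S hS hc hDc (fun r => hm _), ?_⟩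
  ext i j
  show (∫ u in u..u', D u i j) = (u' - u) * (∫ r in Ioc (0:ℝ) 1, D (u + r * (u' - u)) i j)
  rw [← intervalIntegral.integral_of_le zero_le_one]
  have := intervalIntegral.mul_integral_comp_add_mul (a := 0) (b := 1) (f := fun v => D v i j) (c := u' - u) (d := u)
  simp only [mul_zero, add_zero, mul_one, add_sub_cancel] at this
  rw [← this]
  congr 1
  refine intervalIntegral.integral_congr fun r _ => ?_
  simp only [mul_comm]

lemma tay1 {F : E d → E d} {Df : E d → Matrix (Fin d) (Fin d) ℝ} {K η : ℝ} (hη : 0 < η) (hK : 0 ≤ K)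
    (h1 : ∀ x, HasFDerivAt F (LinearMap.toContinuousLinearMap (Matrix.toEuclideanLin (Df x))) x)
    (h2 : ∀ x y i j, |Df x i j - Df y i j| ≤ K * ‖x - y‖ ^ η) (x y : E d) :
    ‖F x - F y - Matrix.toEuclideanLin (Df y) (x - y)‖ ≤ d * (d * K) * ‖x - y‖ ^ (1 + η) := by
  have := Convex.norm_image_sub_le_of_norm_hasFDerivWithin_le' (s := Metric.closedBall y ‖x - y‖) (x := y) (y := x)
    (f := F) (φ := LinearMap.toContinuousLinearMap (Matrix.toEuclideanLin (Df y)))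
    (C := d * (d * (K * ‖x - y‖ ^ η))) (fun z _ => (h1 z).hasFDerivWithinAt) ?_ (convex_closedBall _ _)
    (Metric.mem_closedBall_self (norm_nonneg _)) (by rw [Metric.mem_closedBall, dist_eq_norm])
  · refine this.trans (le_of_eq ?_)
    rw [Real.rpow_add' (norm_nonneg _) (by linarith), Real.rpow_one]; ring
  · intro z hz
    rw [Metric.mem_closedBall, dist_eq_norm] at hz
    refine ContinuousLinearMap.opNorm_le_bound _ (by positivity) fun v => ?_
    have e : (LinearMap.toContinuousLinearMap (Matrix.toEuclideanLin (Df z)) -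
      LinearMap.toContinuousLinearMap (Matrix.toEuclideanLin (Df y))) v = Matrix.toEuclideanLin (Df z - Df y) v := by
      rw [map_sub]; rfl
    rw [e]
    refine toE_norm_le (fun i j => ?_) v
    rw [Matrix.sub_apply]
    refine (h2 z y i j).trans ?_
    gcongr

lemma mk_hyp (hd : 0 < d) {F1 F2 : ℝ → E d → E d → E d} {σ D : ℝ → E d → E d → Matrix (Fin d) (Fin d) ℝ}
    {b1 b2 b3 η : ℝ} (hb1 : b1 ∈ Ioo (0:ℝ) 1) (hb2 : b2 ∈ Ioo (0:ℝ) 1) (hb3 : b3 ∈ Ioo (0:ℝ) 1)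
    (hb3' : 1 / 3 < b3) (hη : η ∈ Ioo (0:ℝ) 1) {K : ℝ} (hK : 1 ≤ K)
    (hF1 : ∀ t x1 x2 y1 y2, ‖F1 t x1 x2 - F1 t y1 y2‖ ≤ K * (‖x1 - y1‖ ^ b1 + ‖x2 - y2‖ ^ b2))
    (hF2 : ∀ t x1 x2 y1 y2, ‖F2 t x1 x2 - F2 t y1 y2‖ ≤ K * (‖x1 - y1‖ + ‖x2 - y2‖ ^ b3))
    (hσ : ∀ t x1 x2 y1 y2 i j, |σ t x1 x2 i j - σ t y1 y2 i j| ≤ K * (‖x1 - y1‖ + ‖x2 - y2‖))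
    (tF1 : ∀ x1 x2, Continuous fun t => F1 t x1 x2) (tF2 : ∀ x1 x2, Continuous fun t => F2 t x1 x2)
    (tσ : ∀ x1 x2 i j, Continuous fun t => σ t x1 x2 i j)
    (h01 : ∀ t, ‖F1 t 0 0‖ ≤ K) (h02 : ∀ t, ‖F2 t 0 0‖ ≤ K)
    (hell : ∀ t x1 x2, ∀ ζ : Fin d → ℝ, K⁻¹ * nsq ζ ≤ nsq ((σ t x1 x2)ᵀ *ᵥ ζ) ∧ nsq ((σ t x1 x2)ᵀ *ᵥ ζ) ≤ K * nsq ζ)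
    (hD : ∀ t x1 x2, HasFDerivAt (fun y1 => F2 t y1 x2)
        (LinearMap.toContinuousLinearMap (Matrix.toEuclideanLin (D t x1 x2))) x1)
    (hDh : ∀ t x1 y1 x2 i j, |D t x1 x2 i j - D t y1 x2 i j| ≤ K * ‖x1 - y1‖ ^ η)
    {S : Set (Matrix (Fin d) (Fin d) ℝ)} (hS : IsClosed S) (hSc : Convex ℝ S) (hSu : ∀ M ∈ S, IsUnit M)
    (hDS : ∀ t x1 x2, D t x1 x2 ∈ S)
    (hDb : ∀ t x1 x2 i j, |D t x1 x2 i j| ≤ K) :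
    ∃ c C, Hyp F1 F2 σ D c C b1 b2 b3 η := by
  have K0 : 0 < K := by linarith
  have cF1 : Continuous fun p : ℝ × V d => F1 p.1 p.2.1 p.2.2 :=
    joint_cont (f := fun t (x : V d) => F1 t x.1 x.2) (g := fun x => K * (‖x.1‖ ^ b1 + ‖x.2‖ ^ b2))
      (fun x => tF1 x.1 x.2) (fun t x y => hF1 t x.1 x.2 y.1 y.2)
      (continuous_const.mul ((continuous_fst.norm.rpow_const fun _ => Or.inr hb1.1.le).add
        (continuous_snd.norm.rpow_const fun _ => Or.inr hb2.1.le)))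
      (by simp [Real.zero_rpow hb1.1.ne', Real.zero_rpow hb2.1.ne'])
  have cF2 : Continuous fun p : ℝ × V d => F2 p.1 p.2.1 p.2.2 :=
    joint_cont (f := fun t (x : V d) => F2 t x.1 x.2) (g := fun x => K * (‖x.1‖ + ‖x.2‖ ^ b3))
      (fun x => tF2 x.1 x.2) (fun t x y => hF2 t x.1 x.2 y.1 y.2)
      (continuous_const.mul (continuous_fst.norm.add
        (continuous_snd.norm.rpow_const fun _ => Or.inr hb3.1.le)))
      (by simp [Real.zero_rpow hb3.1.ne'])
  have cσ : ∀ i j, Continuous fun p : ℝ × V d => σ p.1 p.2.1 p.2.2 i j := fun i j =>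
    joint_cont (f := fun t (x : V d) => σ t x.1 x.2 i j) (g := fun x => K * (‖x.1‖ + ‖x.2‖))
      (fun x => tσ x.1 x.2 i j) (fun t x y => hσ t x.1 x.2 y.1 y.2 i j)
      (continuous_const.mul (continuous_fst.norm.add continuous_snd.norm))
      (by simp)
  have ht1 : ∀ t x2 x y, ‖F2 t x x2 - F2 t y x2 - Matrix.toEuclideanLin (D t y x2) (x - y)‖ ≤
      d * (d * K) * ‖x - y‖ ^ (1 + η) := fun t x2 x y =>
    tay1 (F := fun z => F2 t z x2) (Df := fun z => D t z x2) hη.1 K0.le (fun z => hD t z x2)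
      (fun a b i j => hDh t a b x2 i j) x y
  have cD : ∀ i j, Continuous fun p : ℝ × V d => D p.1 p.2.1 p.2.2 i j := by
    classical
    intro i j
    set hn : ℕ → ℝ := fun n => 1 / ((n:ℝ) + 1) with hhn
    have hn0 : ∀ n, 0 < hn n := fun n => by positivity
    have hu : TendstoUniformly (fun (n : ℕ) (p : ℝ × V d) =>
        (hn n)⁻¹ * (F2 p.1 (p.2.1 + hn n • EuclideanSpace.single j 1) p.2.2 i - F2 p.1 p.2.1 p.2.2 i))
        (fun p => D p.1 p.2.1 p.2.2 i j) Filter.atTop := by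
      rw [Metric.tendstoUniformly_iff]
      intro ε hε
      have hl : Filter.Tendsto (fun n => d * (d * K) * (hn n) ^ η) Filter.atTop (nhds 0) := by
        have h1 : Filter.Tendsto hn Filter.atTop (nhds 0) := tendsto_one_div_add_atTop_nhds_zero_nat
        have h2 := (h1.rpow_const (Or.inr hη.1.le : (0:ℝ) ≠ 0 ∨ 0 ≤ η)).const_mul ((d:ℝ) * (d * K))
        rwa [Real.zero_rpow hη.1.ne', mul_zero] at h2
      filter_upwards [hl.eventually (gt_mem_nhds hε)] with n hnn p
      refine lt_of_le_of_lt ?_ hnn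
      have h1 := (abs_apply_le _ i).trans (ht1 p.1 p.2.2 (p.2.1 + hn n • EuclideanSpace.single j 1) p.2.1)
      have e : p.2.1 + hn n • EuclideanSpace.single j (1:ℝ) - p.2.1 = hn n • EuclideanSpace.single j (1:ℝ) := by abel
      have e2 : Matrix.toEuclideanLin (D p.1 p.2.1 p.2.2) (hn n • EuclideanSpace.single j (1:ℝ)) i = hn n * D p.1 p.2.1 p.2.2 i j := by
        have : Matrix.toEuclideanLin (D p.1 p.2.1 p.2.2) (hn n • EuclideanSpace.single j (1:ℝ)) i =
          ∑ k, D p.1 p.2.1 p.2.2 i k * (hn n • EuclideanSpace.single j (1:ℝ)) k := rfl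
        rw [this]
        simp [PiLp.smul_apply, Pi.single_apply, mul_comm]
      rw [e, norm_smul, Real.norm_of_nonneg (hn0 n).le, PiLp.norm_single, norm_one, mul_one, PiLp.sub_apply,
        PiLp.sub_apply, e2, Real.rpow_add (hn0 n), Real.rpow_one] at h1
      rw [dist_comm, Real.dist_eq]
      have e3 : (hn n)⁻¹ * (F2 p.1 (p.2.1 + hn n • EuclideanSpace.single j 1) p.2.2 i - F2 p.1 p.2.1 p.2.2 i) - D p.1 p.2.1 p.2.2 i j
        = (hn n)⁻¹ * (F2 p.1 (p.2.1 + hn n • EuclideanSpace.single j 1) p.2.2 i - F2 p.1 p.2.1 p.2.2 i - hn n * D p.1 p.2.1 p.2.2 i j) := by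
        have := (hn0 n).ne'
        field_simp
      rw [e3, abs_mul, abs_of_pos (inv_pos.2 (hn0 n)), inv_mul_le_iff₀ (hn0 n)]
      refine h1.trans (le_of_eq (by ring))
    refine hu.continuous (Filter.Frequently.of_forall fun n => ?_)
    have c1 : Continuous fun p : ℝ × V d => (p.1, ((p.2.1 + hn n • EuclideanSpace.single j 1, p.2.2) : V d)) := by fun_prop
    have c2 := (EuclideanSpace.proj (𝕜 := ℝ) i).continuous.comp (cF2.comp c1)
    have c3 := (EuclideanSpace.proj (𝕜 := ℝ) i).continuous.comp cF2
    exact continuous_const.mul (c2.sub c3)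
  obtain ⟨c, hc, hlow⟩ := inv_low (K := K) hd (S := S ∩ {M | ∀ i j, |M i j| ≤ K})
    (hS.inter (by
      simp only [setOf_forall]
      refine isClosed_iInter fun i => isClosed_iInter fun j => isClosed_le ?_ continuous_const
      exact (continuous_apply_apply i j).abs)) (fun M hM => hM.2) (fun M hM => hSu M hM.1)
  set C : ℝ := max (d * (d * K) + 4 * K) ((d * (d * K)) ^ 2) with hC
  have hdK : 0 ≤ (d:ℝ) * (d * K) := by positivity
  have hCK : 4 * K ≤ C := le_trans (by linarith) (le_max_left _ _)
  have hCK' : d * (d * K) + 4 * K ≤ C := le_max_left _ _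
  have hCd : (d * (d * K)) ^ 2 ≤ C := le_max_right _ _
  have hSK : IsClosed {M : Matrix (Fin d) (Fin d) ℝ | ∀ i j, |M i j| ≤ K} := by
    simp only [setOf_forall]
    refine isClosed_iInter fun i => isClosed_iInter fun j => isClosed_le ?_ continuous_const
    exact (continuous_apply_apply i j).abs
  have hSKc : Convex ℝ {M : Matrix (Fin d) (Fin d) ℝ | ∀ i j, |M i j| ≤ K} := by
    intro M hM N hN a b ha hb hab i j
    rw [Matrix.add_apply, Matrix.smul_apply, Matrix.smul_apply, smul_eq_mul, smul_eq_mul]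
    refine (abs_add_le _ _).trans ?_
    rw [abs_mul, abs_mul, abs_of_nonneg ha, abs_of_nonneg hb]
    have h1 := mul_le_mul_of_nonneg_left (hM i j) ha
    have h2 := mul_le_mul_of_nonneg_left (hN i j) hb
    have : a * K + b * K = K := by rw [← add_mul, hab, one_mul]
    linarith
  have nsm : ∀ (a : ℝ) (v : Fin d → ℝ), nsq (a • v) = a ^ 2 * nsq v := by
    intro a v
    rw [nsq, smul_dotProduct, dotProduct_smul, smul_smul, ← nsq, smul_eq_mul, sq]
  refine ⟨min c K⁻¹, C, ⟨lt_min hc (inv_pos.2 K0), by linarith, hb1, hb2, hb3, hb3', hη, cF1, cF2, cσ, cD, ?_, ?_, ?_, ?_, ?_, ?_, ?_, ?_⟩⟩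
  · intro t x1 x2 y1 y2
    refine (hF1 t x1 x2 y1 y2).trans (mul_le_mul_of_nonneg_right (by linarith) (by positivity))
  · intro t x1 x2 y1 y2
    refine (hF2 t x1 x2 y1 y2).trans (mul_le_mul_of_nonneg_right (by linarith) (by positivity))
  · intro t x1 x2 y1 y2 i j
    refine (hσ t x1 x2 y1 y2 i j).trans (mul_le_mul_of_nonneg_right (by linarith) (by positivity))
  · intro t x
    have h1 := hF1 t x.1 x.2 0 0
    rw [sub_zero, sub_zero] at h1
    have h2 := rpow_le_one_add' (norm_nonneg x.1) hb1
    have h3 := rpow_le_one_add' (norm_nonneg x.2) hb2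
    have h4 : ‖F1 t x.1 x.2‖ ≤ ‖F1 t x.1 x.2 - F1 t 0 0‖ + ‖F1 t 0 0‖ := by
      simpa using norm_add_le (F1 t x.1 x.2 - F1 t 0 0) (F1 t 0 0)
    have h5 := norm_fst_le x
    have h6 := norm_snd_le x
    have h7 := h01 t
    have h8 := norm_nonneg x
    calc ‖F1 t x.1 x.2‖ ≤ K * ((1 + ‖x‖) + (1 + ‖x‖)) + K := by
          refine h4.trans (add_le_add (h1.trans (mul_le_mul_of_nonneg_left ?_ K0.le)) h7)
          linarith
      _ ≤ 4 * K * (1 + ‖x‖) := by nlinarith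
      _ ≤ C * (1 + ‖x‖) := by gcongr
  · intro t x
    have h1 := hF2 t x.1 x.2 0 0
    rw [sub_zero, sub_zero] at h1
    have h3 := rpow_le_one_add' (norm_nonneg x.2) hb3
    have h4 : ‖F2 t x.1 x.2‖ ≤ ‖F2 t x.1 x.2 - F2 t 0 0‖ + ‖F2 t 0 0‖ := by
      simpa using norm_add_le (F2 t x.1 x.2 - F2 t 0 0) (F2 t 0 0)
    have h5 := norm_fst_le x
    have h6 := norm_snd_le x
    have h7 := h02 t
    have h8 := norm_nonneg x
    calc ‖F2 t x.1 x.2‖ ≤ K * ((1 + ‖x‖) + (1 + ‖x‖)) + K := by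
          refine h4.trans (add_le_add (h1.trans (mul_le_mul_of_nonneg_left ?_ K0.le)) h7)
          linarith
      _ ≤ 4 * K * (1 + ‖x‖) := by nlinarith
      _ ≤ C * (1 + ‖x‖) := by gcongr
  · intro t x1 x2 i j
    exact (entry_bd hK (fun ζ => (hell t x1 x2 ζ).2) i j).trans (by linarith)
  · intro t x1 x2 y1 y2
    have h1 := hF2 t x1 x2 x1 y2
    rw [sub_self, norm_zero, zero_add] at h1
    have h2 := ht1 t y2 x1 y1
    have e : F2 t x1 x2 - F2 t y1 y2 - Matrix.toEuclideanLin (D t y1 y2) (x1 - y1) =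
      (F2 t x1 x2 - F2 t x1 y2) + (F2 t x1 y2 - F2 t y1 y2 - Matrix.toEuclideanLin (D t y1 y2) (x1 - y1)) := by abel
    rw [e, mul_add]
    refine (norm_add_le _ _).trans ?_
    rw [add_comm]
    refine add_le_add (h2.trans ?_) (h1.trans ?_)
    · exact mul_le_mul_of_nonneg_right (by linarith) (by positivity)
    · exact mul_le_mul_of_nonneg_right (by linarith) (by positivity)
  · intro θ hθ
    have hθp : Continuous fun u => (u, θ u) := by fun_prop
    have hDθ : ∀ i j, Continuous fun u => D u (θ u).1 (θ u).2 i j := fun i j => (cD i j).comp hθp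
    have hav := fun u u' => avg_mem (hS.inter hSK) (hSc.inter hSKc) hDθ
      (fun u => ⟨hDS u (θ u).1 (θ u).2, hDb u (θ u).1 (θ u).2⟩) u u'
    refine ⟨fun i j => (cσ i j).comp hθp, hDθ, lt_min hc (inv_pos.2 K0), by linarith, ?_, ?_, ?_, ?_, ?_⟩
    · intro u ζ
      exact (mul_le_mul_of_nonneg_right (min_le_right _ _) (nsq_nonneg _)).trans (hell u _ _ ζ).1
    · intro u ζ
      exact (hell u _ _ ζ).2.trans (mul_le_mul_of_nonneg_right (by linarith) (nsq_nonneg _))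
    · intro u u' ξ _
      obtain ⟨M, hM, e⟩ := hav u u'
      rw [e, transpose_smul, smul_mulVec, nsm]
      have h1 := (mul_le_mul_of_nonneg_right (min_le_left c K⁻¹) (nsq_nonneg ξ)).trans (hlow M hM ξ)
      nlinarith [sq_nonneg (u' - u), mul_le_mul_of_nonneg_left h1 (sq_nonneg (u' - u))]
    · intro u u' ξ _
      obtain ⟨M, hM, e⟩ := hav u u'
      rw [e, transpose_smul, smul_mulVec, nsm]
      have h1 := (nsq_mulVec_le K0.le (M := Mᵀ) (fun i j => hM.2 j i) ξ).trans (mul_le_mul_of_nonneg_right hCd (nsq_nonneg ξ))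
      nlinarith [sq_nonneg (u' - u), mul_le_mul_of_nonneg_left h1 (sq_nonneg (u' - u))]
    · intro u u' ξ _
      obtain ⟨M, hM, e⟩ := hav u u'
      rw [e, smul_mulVec, nsm]
      have h1 := (nsq_mulVec_le K0.le (M := M) hM.2 ξ).trans (mul_le_mul_of_nonneg_right hCd (nsq_nonneg ξ))
      nlinarith [sq_nonneg (u' - u), mul_le_mul_of_nonneg_left h1 (sq_nonneg (u' - u))]

end

end

section

/-! ### Part Q: Euler scheme -/

/-- one-step noise space -/
abbrev SS (d : ℕ) := Fin d × Bool
/-- noise space -/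
abbrev Om (d N : ℕ) := Fin N → SS d
/-- uniform expectation -/
def EE {α : Type} [Fintype α] (G : α → ℝ) : ℝ := (∑ ω, G ω) / Fintype.card α

section
variable {α : Type} [Fintype α]
lemma EE_add (f g : α → ℝ) : EE (fun a => f a + g a) = EE f + EE g := by
  simp only [EE, Finset.sum_add_distrib, add_div]
lemma EE_sub (f g : α → ℝ) : EE (fun a => f a - g a) = EE f - EE g := by
  simp only [EE, Finset.sum_sub_distrib, sub_div]
lemma EE_mul (r : ℝ) (f : α → ℝ) : EE (fun a => r * f a) = r * EE f := by
  simp only [EE, ← Finset.mul_sum, mul_div_assoc]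
lemma EE_sum {ι : Type} (s : Finset ι) (f : ι → α → ℝ) :
    EE (fun a => ∑ i ∈ s, f i a) = ∑ i ∈ s, EE (f i) := by
  simp only [EE]
  rw [Finset.sum_comm, Finset.sum_div]
lemma EE_mono {f g : α → ℝ} (h : ∀ a, f a ≤ g a) : EE f ≤ EE g := by
  unfold EE
  gcongr with a _
  exact h a
lemma EE_const [Nonempty α] (r : ℝ) : EE (fun _ : α => r) = r := by
  have : (Fintype.card α : ℝ) ≠ 0 := by exact_mod_cast Fintype.card_ne_zero
  simp only [EE, Finset.sum_const, Finset.card_univ, nsmul_eq_mul]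
  field_simp
lemma EE_nonneg {f : α → ℝ} (h : ∀ a, 0 ≤ f a) : 0 ≤ EE f :=
  div_nonneg (Finset.sum_nonneg fun a _ => h a) (by positivity)
lemma EE_abs (f : α → ℝ) : |EE f| ≤ EE fun a => |f a| := by
  unfold EE
  rw [abs_div, abs_of_nonneg (by positivity : (0:ℝ) ≤ Fintype.card α)]
  gcongr
  exact Finset.abs_sum_le_sum_abs _ _
end

lemma EE_avg {d N : ℕ} [NeZero d] (k : Fin N) (A : Om d N → SS d → ℝ)
    (hA : ∀ ω b s, A (Function.update ω k b) s = A ω s) :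
    EE (fun ω => A ω (ω k)) = EE (fun ω => (∑ i, (A ω (i, true) + A ω (i, false))) / (2 * d)) := by
  classical
  have hd : (d:ℝ) ≠ 0 := by exact_mod_cast NeZero.ne d
  let e : (Om d N × SS d) → (Om d N × SS d) := fun p => (Function.update p.1 k p.2, p.1 k)
  have he : Function.Involutive e := by
    intro p; simp [e]
  have h1 : ∑ p : Om d N × SS d, A p.1 p.2 = ∑ p : Om d N × SS d, A p.1 (p.1 k) := by
    rw [← Equiv.sum_comp (he.toPerm e) (fun p : Om d N × SS d => A p.1 (p.1 k))]
    refine Finset.sum_congr rfl fun p _ => ?_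
    simp [Function.Involutive.coe_toPerm, e, hA]
  rw [Fintype.sum_prod_type, Fintype.sum_prod_type] at h1
  simp only [Finset.sum_const, Finset.card_univ, Fintype.card_prod, Fintype.card_fin, Fintype.card_bool,
    nsmul_eq_mul, ← Finset.mul_sum] at h1
  simp only [EE]
  congr 1
  rw [← Finset.sum_div, eq_div_iff (by positivity)]
  rw [mul_comm]
  push_cast at h1
  rw [mul_comm (2:ℝ), ← h1]
  refine Finset.sum_congr rfl fun ω _ => ?_
  rw [Fintype.sum_prod_type]
  simp

lemma EE_avg_le {d N : ℕ} [NeZero d] (k : Fin N) (A : Om d N → SS d → ℝ) (B : Om d N → ℝ)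
    (hA : ∀ ω b s, A (Function.update ω k b) s = A ω s)
    (hB : ∀ ω i, A ω (i, true) + A ω (i, false) ≤ 2 * B ω) :
    EE (fun ω => A ω (ω k)) ≤ EE B := by
  have hd : (0:ℝ) < d := by exact_mod_cast NeZero.pos d
  rw [EE_avg k A hA]
  refine EE_mono fun ω => ?_
  rw [div_le_iff₀ (by positivity)]
  calc _ ≤ ∑ _i : Fin d, 2 * B ω := Finset.sum_le_sum fun i _ => hB ω i
    _ = _ := by simp; ring

/-- sign -/
def sgn (b : Bool) : ℝ := if b then 1 else -1

lemma rw_mom {d N : ℕ} [NeZero d] {a : ℝ} (q : ℕ → Om d N → ℝ) (g : ℕ → Om d N → Fin d → ℝ) (k : ℕ)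
    (h0 : ∀ ω, q k ω = 0)
    (hs : ∀ l (hl : l < N), k ≤ l → ∀ ω, q (l+1) ω = q l ω + sgn (ω ⟨l, hl⟩).2 * g l ω (ω ⟨l, hl⟩).1)
    (hq : ∀ l (hl : l < N), k ≤ l → ∀ ω b, q l (Function.update ω ⟨l, hl⟩ b) = q l ω)
    (hg : ∀ l (hl : l < N), k ≤ l → ∀ ω b, g l (Function.update ω ⟨l, hl⟩ b) = g l ω)
    (ha : ∀ l ω i, |g l ω i| ≤ a) (m : ℕ) (hm : k + m ≤ N) :
    EE (fun ω => q (k+m) ω ^ 2) ≤ a ^ 2 * m ∧ EE (fun ω => q (k+m) ω ^ 4) ≤ 3 * a ^ 4 * m ^ 2 := by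
  haveI : Nonempty (Om d N) := ⟨fun _ => (⟨0, NeZero.pos d⟩, true)⟩
  induction m with
  | zero => simp [h0, EE]
  | succ m ih =>
    obtain ⟨i2, i4⟩ := ih (by omega)
    have hl : k + m < N := by omega
    have hkl : k ≤ k + m := by omega
    have g2 : ∀ ω i, g (k+m) ω i ^ 2 ≤ a ^ 2 := fun ω i => by
      have := ha (k+m) ω i
      rw [← sq_abs]; exact pow_le_pow_left₀ (abs_nonneg _) this 2
    have g4 : ∀ ω i, g (k+m) ω i ^ 4 ≤ a ^ 4 := fun ω i => by
      have := pow_le_pow_left₀ (sq_nonneg _) (g2 ω i) 2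
      nlinarith [this]
    rw [← add_assoc]
    simp only [hs _ hl hkl]
    constructor
    · have := EE_avg_le ⟨k+m, hl⟩ (fun ω s => (q (k+m) ω + sgn s.2 * g (k+m) ω s.1)^2)
        (fun ω => q (k+m) ω ^ 2 + a^2) (fun ω b s => by simp only [hq _ hl hkl, hg _ hl hkl])
        (fun ω i => by
          simp only [sgn]
          norm_num
          nlinarith [g2 ω i])
      refine this.trans ?_
      rw [EE_add, EE_const]
      push_cast
      linarith
    · have := EE_avg_le ⟨k+m, hl⟩ (fun ω s => (q (k+m) ω + sgn s.2 * g (k+m) ω s.1)^4)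
        (fun ω => q (k+m) ω ^ 4 + (6 * a^2 * q (k+m) ω ^ 2 + a ^ 4)) (fun ω b s => by simp only [hq _ hl hkl, hg _ hl hkl])
        (fun ω i => by
          simp only [sgn]
          norm_num
          nlinarith [g4 ω i, mul_le_mul_of_nonneg_left (g2 ω i) (sq_nonneg (q (k+m) ω))])
      refine this.trans ?_
      rw [EE_add, EE_add, EE_const, EE_mul]
      push_cast
      nlinarith [mul_le_mul_of_nonneg_left i2 (by positivity : 0 ≤ 6 * a^2), sq_nonneg (a^2)]

section
variable {d : ℕ} {F1 F2 : ℝ → E d → E d → E d} {σ D : ℝ → E d → E d → Matrix (Fin d) (Fin d) ℝ}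
  {c C b1 b2 b3 η : ℝ}

/-- noise -/
def nz (σ : ℝ → E d → E d → Matrix (Fin d) (Fin d) ℝ) (h t : ℝ) (z : V d) (s : SS d) : V d :=
  (WithLp.toLp 2 (fun i => sgn s.2 * (√(h * d) * σ t z.1 z.2 i s.1)), 0)

/-- Euler chain -/
def Zc (F1 F2 : ℝ → E d → E d → E d) (σ : ℝ → E d → E d → Matrix (Fin d) (Fin d) ℝ) (x : V d)
    (N : ℕ) (h : ℝ) : ℕ → Om d N → V d
  | 0, _ => x
  | k+1, ω => Zc F1 F2 σ x N h k ω + h • FF F1 F2 (k * h) (Zc F1 F2 σ x N h k ω) +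
      if hk : k < N then nz σ h (k * h) (Zc F1 F2 σ x N h k ω) (ω ⟨k, hk⟩) else 0

/-- Martingale part of the Euler chain -/
def Mc (F1 F2 : ℝ → E d → E d → E d) (σ : ℝ → E d → E d → Matrix (Fin d) (Fin d) ℝ) (x : V d)
    (N : ℕ) (h : ℝ) (k : ℕ) (ω : Om d N) : V d :=
  Zc F1 F2 σ x N h k ω - x - h • ∑ j ∈ Finset.range k, FF F1 F2 (j * h) (Zc F1 F2 σ x N h j ω)

lemma Zc_succ (x : V d) {N : ℕ} (h : ℝ) (k : ℕ) (hk : k < N) (ω : Om d N) :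
    Zc F1 F2 σ x N h (k+1) ω = Zc F1 F2 σ x N h k ω + h • FF F1 F2 (k * h) (Zc F1 F2 σ x N h k ω) +
      nz σ h (k * h) (Zc F1 F2 σ x N h k ω) (ω ⟨k, hk⟩) := by
  simp [Zc, hk]

lemma Mc_succ (x : V d) {N : ℕ} (h : ℝ) (k : ℕ) (hk : k < N) (ω : Om d N) :
    Mc F1 F2 σ x N h (k+1) ω = Mc F1 F2 σ x N h k ω +
      nz σ h (k * h) (Zc F1 F2 σ x N h k ω) (ω ⟨k, hk⟩) := by
  simp only [Mc, Zc_succ x h k hk ω, Finset.sum_range_succ, smul_add]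
  abel

lemma Zc_upd (x : V d) {N : ℕ} (h : ℝ) (l : Fin N) (b : SS d) (ω : Om d N) : ∀ k : ℕ, k ≤ l →
    Zc F1 F2 σ x N h k (Function.update ω l b) = Zc F1 F2 σ x N h k ω
  | 0, _ => rfl
  | k+1, hk => by
    have hkN : k < N := by omega
    rw [Zc_succ x h k hkN, Zc_succ x h k hkN, Zc_upd x h l b ω k (by omega),
      Function.update_of_ne (by intro e; have := congrArg Fin.val e; simp at this; omega)]

lemma Mc_upd (x : V d) {N : ℕ} (h : ℝ) (l : Fin N) (b : SS d) (ω : Om d N) (k : ℕ) (hk : k ≤ l) :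
    Mc F1 F2 σ x N h k (Function.update ω l b) = Mc F1 F2 σ x N h k ω := by
  simp only [Mc]
  rw [Zc_upd x h l b ω k hk]
  congr 2
  refine Finset.sum_congr rfl fun j hj => ?_
  rw [Zc_upd x h l b ω j (by have := Finset.mem_range.1 hj; omega)]

lemma Mc_snd (x : V d) {N : ℕ} (h : ℝ) (ω : Om d N) : ∀ k : ℕ, k ≤ N → (Mc F1 F2 σ x N h k ω).2 = 0
  | 0, _ => by simp [Mc, Zc]
  | k+1, hk => by
    rw [Mc_succ x h k (by omega), Prod.snd_add, Mc_snd x h ω k (by omega)]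
    simp [nz]

lemma pow4_norm_le (u : E d) : ‖u‖ ^ 4 ≤ d * ∑ i, u i ^ 4 := by
  have h1 : ‖u‖ ^ 4 = (∑ i, u i ^ 2) ^ 2 := by
    rw [show ‖u‖ ^ 4 = (‖u‖^2)^2 by ring, EuclideanSpace.norm_sq_eq]
    simp
  rw [h1]
  have := sq_sum_le_card_mul_sum_sq (s := (Finset.univ : Finset (Fin d))) (f := fun i => u i ^ 2)
  simp only [Finset.card_univ, Fintype.card_fin] at this
  refine this.trans (le_of_eq ?_)
  congr 1
  exact Finset.sum_congr rfl fun i _ => by ring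

lemma Mc_mom [NeZero d] (H : Hyp F1 F2 σ D c C b1 b2 b3 η) (x : V d) {N : ℕ} {h : ℝ} (hh : 0 ≤ h) (k m : ℕ) (hm : k + m ≤ N) :
    EE (fun ω => ‖Mc F1 F2 σ x N h (k+m) ω - Mc F1 F2 σ x N h k ω‖ ^ 4) ≤ 3 * d^4 * C^4 * (m * h) ^ 2 := by
  have hC := H.C1
  have hi : ∀ i : Fin d, EE (fun ω => ((Mc F1 F2 σ x N h (k+m) ω).1 i - (Mc F1 F2 σ x N h k ω).1 i) ^ 4)
      ≤ 3 * (√(h * d) * C) ^ 4 * m ^ 2 := fun i => by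
    refine (rw_mom (a := √(h * d) * C) (fun l ω => (Mc F1 F2 σ x N h l ω).1 i - (Mc F1 F2 σ x N h k ω).1 i)
      (fun l ω j => √(h * d) * σ (l * h) (Zc F1 F2 σ x N h l ω).1 (Zc F1 F2 σ x N h l ω).2 i j) k
      (fun ω => by simp) ?_ ?_ ?_ ?_ m hm).2
    · intro l hl hkl ω
      simp only [Mc_succ x h l hl, Prod.fst_add, nz, PiLp.add_apply]
      ring
    · intro l hl hkl ω b
      simp only [Mc_upd x h ⟨l, hl⟩ b ω l le_rfl, Mc_upd x h ⟨l, hl⟩ b ω k hkl]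
    · intro l hl hkl ω b
      simp only [Zc_upd x h ⟨l, hl⟩ b ω l le_rfl]
    · intro l ω j
      rw [abs_mul, abs_of_nonneg (Real.sqrt_nonneg _)]
      gcongr
      exact H.σb _ _ _ _ _
  have e4 : √(h * d) ^ 4 = (h * d)^2 := by
    rw [show √(h * d) ^ 4 = (√(h * d) ^ 2)^2 by ring, Real.sq_sqrt (by positivity)]
  calc _ ≤ EE (fun ω => (d:ℝ) * ∑ i, ((Mc F1 F2 σ x N h (k+m) ω).1 i - (Mc F1 F2 σ x N h k ω).1 i) ^ 4) := by
        refine EE_mono fun ω => ?_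
        have : ‖Mc F1 F2 σ x N h (k+m) ω - Mc F1 F2 σ x N h k ω‖
          = ‖(Mc F1 F2 σ x N h (k+m) ω).1 - (Mc F1 F2 σ x N h k ω).1‖ := by
          rw [Prod.norm_def, Prod.fst_sub, Prod.snd_sub, Mc_snd x h ω _ hm, Mc_snd x h ω k (by omega)]
          simp
        rw [this]
        exact pow4_norm_le _
    _ ≤ d * ∑ i : Fin d, 3 * (√(h * d) * C) ^ 4 * m ^ 2 := by
        rw [EE_mul, EE_sum]
        gcongr with i _
        exact hi i
    _ = _ := by
        simp only [Finset.sum_const, Finset.card_univ, Fintype.card_fin, nsmul_eq_mul, mul_pow, e4]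
        ring

lemma sum_pow4 (s : Finset ℕ) (f : ℕ → ℝ) (hf : ∀ i, 0 ≤ f i) :
    (∑ i ∈ s, f i) ^ 4 ≤ (s.card : ℝ)^3 * ∑ i ∈ s, f i ^ 4 := by
  rcases s.eq_empty_or_nonempty with rfl | hs
  · simp
  have h := pow_sum_div_card_le_sum_pow (s := s) (f := f) (fun i _ => hf i) 3
  rw [div_le_iff₀ (by have := hs.card_pos; positivity)] at h
  rw [mul_comm]
  exact h

lemma FF_sum_le (H : Hyp F1 F2 σ D c C b1 b2 b3 η) (x : V d) {N : ℕ} {h : ℝ} (hh : 0 ≤ h) (s : Finset ℕ) (ω : Om d N) :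
    ‖h • ∑ j ∈ s, FF F1 F2 (j * h) (Zc F1 F2 σ x N h j ω)‖ ^ 4 ≤
      C^4 * h * (s.card * h)^3 * ∑ j ∈ s, (1 + ‖Zc F1 F2 σ x N h j ω‖)^4 := by
  have hC := H.C1
  have h1 : ‖h • ∑ j ∈ s, FF F1 F2 (j * h) (Zc F1 F2 σ x N h j ω)‖ ≤
      h * C * ∑ j ∈ s, (1 + ‖Zc F1 F2 σ x N h j ω‖) := by
    rw [norm_smul, Real.norm_of_nonneg hh, mul_assoc]
    gcongr
    rw [Finset.mul_sum]
    exact (norm_sum_le _ _).trans (Finset.sum_le_sum fun j _ => H.FF_gr _ _)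
  have h2 := sum_pow4 s (fun j => 1 + ‖Zc F1 F2 σ x N h j ω‖) (fun j => by positivity)
  calc _ ≤ (h * C * ∑ j ∈ s, (1 + ‖Zc F1 F2 σ x N h j ω‖))^4 := pow_le_pow_left₀ (norm_nonneg _) h1 4
    _ = (h*C)^4 * (∑ j ∈ s, (1 + ‖Zc F1 F2 σ x N h j ω‖))^4 := by ring
    _ ≤ (h*C)^4 * ((s.card : ℝ)^3 * ∑ j ∈ s, (1 + ‖Zc F1 F2 σ x N h j ω‖)^4) := by gcongr
    _ = _ := by ring

lemma gron {B A : ℝ} (hB : 0 ≤ B) (n : ℕ) (y : ℕ → ℝ) (hy : ∀ l ≤ n, y l ≤ A + B * ∑ j ∈ Finset.range l, y j) (l : ℕ) (hl : l ≤ n) :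
    A + B * ∑ j ∈ Finset.range l, y j ≤ A * (1 + B)^l := by
  induction l with
  | zero => simp
  | succ l ih =>
    have h1 := ih (by omega)
    have h2 := hy l (by omega)
    rw [Finset.sum_range_succ, pow_succ]
    nlinarith

lemma pow4_add3 (a b c : ℝ) : (a + b + c)^4 ≤ 27 * (a^4 + b^4 + c^4) := by
  have h1 : (a+b+c)^2 ≤ 3*(a^2+b^2+c^2) := by nlinarith [sq_nonneg (a-b), sq_nonneg (b-c), sq_nonneg (a-c)]
  have h2 : (a^2+b^2+c^2)^2 ≤ 3*(a^4+b^4+c^4) := by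
    nlinarith [sq_nonneg (a^2-b^2), sq_nonneg (b^2-c^2), sq_nonneg (a^2-c^2)]
  have h3 := pow_le_pow_left₀ (sq_nonneg _) h1 2
  nlinarith

lemma pow4_add2 (a b : ℝ) : (a + b)^4 ≤ 8 * (a^4 + b^4) := by
  have h1 : (a+b)^2 ≤ 2*(a^2+b^2) := by nlinarith [sq_nonneg (a-b)]
  have h2 : (a^2+b^2)^2 ≤ 2*(a^4+b^4) := by
    nlinarith [sq_nonneg (a^2-b^2)]
  have h3 := pow_le_pow_left₀ (sq_nonneg _) h1 2
  nlinarith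

lemma Zc_mom [NeZero d] (H : Hyp F1 F2 σ D c C b1 b2 b3 η) (x : V d) {T : ℝ} (hT : 0 < T) :
    ∃ Y : ℝ, 0 ≤ Y ∧ ∀ (N : ℕ) (h : ℝ), 0 ≤ h → N * h ≤ T → ∀ l ≤ N,
      EE (fun ω => (1 + ‖Zc F1 F2 σ x N h l ω‖)^4) ≤ Y := by
  have hC := H.C1
  set K1 : ℝ := 3 * d^4 * C^4 with hK1
  set A : ℝ := 27 * ((1 + ‖x‖)^4 + K1 * T^2) with hA
  set B : ℝ := 27 * (C^4 * T^3) with hB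
  refine ⟨A * Real.exp (B * T), by positivity, fun N h hh hN l hl => ?_⟩
  haveI : Nonempty (Om d N) := ⟨fun _ => (⟨0, NeZero.pos d⟩, true)⟩
  have hlT : ∀ l ≤ N, (l:ℝ) * h ≤ T := fun l hl =>
    (mul_le_mul_of_nonneg_right (by exact_mod_cast hl) hh).trans hN
  set y : ℕ → ℝ := fun l => EE (fun ω => (1 + ‖Zc F1 F2 σ x N h l ω‖)^4) with hy
  have key : ∀ l ≤ N, y l ≤ A + (B * h) * ∑ j ∈ Finset.range l, y j := by
    intro l hl
    have hm := Mc_mom H x hh 0 l (N := N) (by omega)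
    have : y l ≤ EE (fun ω => 27 * ((1 + ‖x‖)^4 + (C^4 * h * T^3 * ∑ j ∈ Finset.range l, (1 + ‖Zc F1 F2 σ x N h j ω‖)^4
        + ‖Mc F1 F2 σ x N h (0+l) ω - Mc F1 F2 σ x N h 0 ω‖ ^ 4))) := by
      refine EE_mono fun ω => ?_
      have e : Zc F1 F2 σ x N h l ω = x + h • ∑ j ∈ Finset.range l, FF F1 F2 (j * h) (Zc F1 F2 σ x N h j ω)
          + (Mc F1 F2 σ x N h (0+l) ω - Mc F1 F2 σ x N h 0 ω) := by
        simp [Mc, Zc]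
      have hF := FF_sum_le H x hh (Finset.range l) ω (N := N)
      rw [Finset.card_range] at hF
      have hF' : ‖h • ∑ j ∈ Finset.range l, FF F1 F2 (j * h) (Zc F1 F2 σ x N h j ω)‖ ^ 4 ≤
          C^4 * h * T^3 * ∑ j ∈ Finset.range l, (1 + ‖Zc F1 F2 σ x N h j ω‖)^4 := by
        refine hF.trans ?_
        gcongr
        exact hlT l hl
      calc (1 + ‖Zc F1 F2 σ x N h l ω‖)^4 ≤ ((1 + ‖x‖) + ‖h • ∑ j ∈ Finset.range l, FF F1 F2 (j * h) (Zc F1 F2 σ x N h j ω)‖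
            + ‖Mc F1 F2 σ x N h (0+l) ω - Mc F1 F2 σ x N h 0 ω‖)^4 := by
            refine pow_le_pow_left₀ (by positivity) ?_ 4
            conv_lhs => rw [e]
            have := norm_add₃_le (a := x) (b := h • ∑ j ∈ Finset.range l, FF F1 F2 (j * h) (Zc F1 F2 σ x N h j ω))
              (c := Mc F1 F2 σ x N h (0+l) ω - Mc F1 F2 σ x N h 0 ω)
            linarith
        _ ≤ _ := by
            refine (pow4_add3 _ _ _).trans ?_
            linarith
    refine this.trans ?_
    rw [EE_mul, EE_add, EE_add, EE_const, EE_mul, EE_sum]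
    have h3 : K1 * (l * h)^2 ≤ K1 * T^2 := by
      gcongr
      exact hlT l hl
    rw [hA, hB]
    simp only [hy]
    nlinarith
  have g := gron (by positivity) N y key l hl
  refine (key l hl).trans (g.trans ?_)
  gcongr
  calc (1 + B * h)^l ≤ (Real.exp (B*h))^l := by
        gcongr
        linarith [Real.add_one_le_exp (B*h)]
    _ = Real.exp (B * (l * h)) := by rw [← Real.exp_nat_mul]; ring_nf
    _ ≤ _ := by
        gcongr
        exact hlT l hl

lemma Zc_inc [NeZero d] (H : Hyp F1 F2 σ D c C b1 b2 b3 η) (x : V d) {T : ℝ} (hT : 0 < T) :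
    ∃ K : ℝ, 0 ≤ K ∧ ∀ (N : ℕ) (h : ℝ), 0 ≤ h → N * h ≤ T → ∀ k m, k + m ≤ N →
      EE (fun ω => ‖Zc F1 F2 σ x N h (k+m) ω - Zc F1 F2 σ x N h k ω‖^4) ≤ K * (m * h)^2 := by
  have hC := H.C1
  obtain ⟨Y, hY, hZ⟩ := Zc_mom H x hT
  refine ⟨8 * (C^4 * T^2 * Y + 3 * d^4*C^4), by positivity, fun N h hh hN k m hkm => ?_⟩
  have hmT : (m:ℝ) * h ≤ T := (mul_le_mul_of_nonneg_right (by exact_mod_cast (by omega : m ≤ N)) hh).trans hN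
  have hm := Mc_mom H x hh k m (N := N) hkm
  set s := Finset.Ico k (k+m) with hs
  have hc : (s.card : ℝ) = m := by simp [hs]
  have : EE (fun ω => ‖Zc F1 F2 σ x N h (k+m) ω - Zc F1 F2 σ x N h k ω‖^4) ≤
      EE (fun ω => 8 * (C^4 * h * (m * h)^3 * ∑ j ∈ s, (1 + ‖Zc F1 F2 σ x N h j ω‖)^4 +
        ‖Mc F1 F2 σ x N h (k+m) ω - Mc F1 F2 σ x N h k ω‖ ^ 4)) := by
    refine EE_mono fun ω => ?_
    have e : Zc F1 F2 σ x N h (k+m) ω - Zc F1 F2 σ x N h k ω = h • ∑ j ∈ s, FF F1 F2 (j * h) (Zc F1 F2 σ x N h j ω)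
          + (Mc F1 F2 σ x N h (k+m) ω - Mc F1 F2 σ x N h k ω) := by
      have := Finset.sum_range_add_sum_Ico (fun j => FF F1 F2 (j * h) (Zc F1 F2 σ x N h j ω)) (show k ≤ k+m by omega)
      simp only [Mc, ← this, smul_add]
      rw [← hs]
      abel
    have hF := FF_sum_le H x hh s ω (N := N)
    rw [hc] at hF
    rw [e]
    refine (pow_le_pow_left₀ (norm_nonneg _) (norm_add_le _ _) 4).trans ((pow4_add2 _ _).trans ?_)
    linarith
  refine this.trans ?_
  rw [EE_mul, EE_add, EE_mul, EE_sum]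
  have h5 : ∑ j ∈ s, EE (fun ω => (1 + ‖Zc F1 F2 σ x N h j ω‖)^4) ≤ m * Y := by
    calc _ ≤ ∑ j ∈ s, Y := Finset.sum_le_sum fun j hj => hZ N h hh hN j (by
            have := Finset.mem_Ico.1 hj; omega)
      _ = _ := by rw [Finset.sum_const, nsmul_eq_mul, hc]
  have h6 : C^4 * h * (m * h)^3 * ∑ j ∈ s, EE (fun ω => (1 + ‖Zc F1 F2 σ x N h j ω‖)^4) ≤ C^4 * T^2 * Y * (m*h)^2 := by
    calc _ ≤ C^4 * h * (m * h)^3 * (m * Y) := by gcongr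
      _ = C^4 * (m*h)^2 * Y * (m*h)^2 := by ring
      _ ≤ _ := by gcongr
  linarith

end

end

section

/-! ### Part R: one-step consistency -/

lemma sym2 {g g' g'' : ℝ → ℝ} (hg : ∀ s, HasDerivAt g (g' s) s) (hg' : ∀ s, HasDerivAt g' (g'' s) s)
    {q δ : ℝ} (hb : ∀ s ∈ Icc (-1:ℝ) 1, |g'' s - q| ≤ δ) : |g 1 + g (-1) - 2 * g 0 - q| ≤ 2 * δ := by
  have n1 : ∀ s : ℝ, HasDerivAt (fun s : ℝ => g (-s)) (-(g' (-s))) s := fun s => by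
    have := (hg (-s)).comp s (hasDerivAt_neg s)
    exact this.congr_deriv (by ring)
  have n2 : ∀ s : ℝ, HasDerivAt (fun s : ℝ => g' (-s)) (-(g'' (-s))) s := fun s => by
    have := (hg' (-s)).comp s (hasDerivAt_neg s)
    exact this.congr_deriv (by ring)
  have d1 : ∀ s : ℝ, HasDerivAt (fun s => g s + g (-s) - q * s ^ 2) (g' s - g' (-s) - 2 * q * s) s := fun s => by
    have := ((hg s).add (n1 s)).sub ((hasDerivAt_pow 2 s).const_mul q)
    exact this.congr_deriv (by simp; ring)
  have d2 : ∀ s : ℝ, HasDerivAt (fun s => g' s - g' (-s) - 2 * q * s) (g'' s + g'' (-s) - 2 * q) s := fun s => by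
    have := ((hg' s).sub (n2 s)).sub ((hasDerivAt_id s).const_mul (2*q))
    exact this.congr_deriv (by ring)
  have hδ : 0 ≤ δ := (abs_nonneg _).trans (hb 0 (by norm_num))
  have b1 : ∀ s ∈ Icc (0:ℝ) 1, |g' s - g' (-s) - 2 * q * s| ≤ 2 * δ := by
    intro s hs
    have := norm_image_sub_le_of_norm_deriv_le_segment' (a := 0) (b := 1) (C := 2 * δ)
      (fun x _ => (d2 x).hasDerivWithinAt) (fun x hx => by
        have h1 := abs_le.1 (hb x ⟨by linarith [hx.1], hx.2.le⟩)
        have h2 := abs_le.1 (hb (-x) ⟨by linarith [hx.2], by linarith [hx.1]⟩)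
        rw [Real.norm_eq_abs, abs_le]
        constructor <;> linarith [h1.1, h1.2, h2.1, h2.2]) s hs
    simp only [Real.norm_eq_abs, neg_zero, sub_self, mul_zero, sub_zero] at this
    nlinarith [hs.2]
  have := norm_image_sub_le_of_norm_deriv_le_segment_01' (C := 2 * δ)
      (fun x _ => (d1 x).hasDerivWithinAt) (fun x hx => b1 x ⟨hx.1, hx.2.le⟩)
  simp only [Real.norm_eq_abs, neg_zero] at this
  convert this using 2
  ring

section
variable {d : ℕ} {F1 F2 : ℝ → E d → E d → E d} {σ D : ℝ → E d → E d → Matrix (Fin d) (Fin d) ℝ}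
  {c C b1 b2 b3 η : ℝ}

lemma vec_decomp (v : V d) : v = ∑ i, v.1 i • e1 d i + ∑ i, v.2 i • e2 d i := by
  have h : ∀ u : E d, u = ∑ i, u i • EuclideanSpace.single i (1:ℝ) := fun u => by
    ext j
    simp [Pi.single_apply]
  refine Prod.ext ?_ ?_
  · simp only [Prod.fst_add, Prod.fst_sum, e1, e2, Prod.smul_fst, smul_zero, Finset.sum_const_zero, add_zero]
    exact h v.1
  · simp only [Prod.snd_add, Prod.snd_sum, e1, e2, Prod.smul_snd, smul_zero, Finset.sum_const_zero, zero_add]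
    exact h v.2

lemma clm_decomp (L : V d →L[ℝ] ℝ) (v : V d) :
    L v = ∑ i, v.1 i * L (e1 d i) + ∑ i, v.2 i * L (e2 d i) := by
  conv_lhs => rw [vec_decomp v]
  simp [map_add, map_sum]

lemma E_norm_le_sum (u : E d) {B : ℝ} (h : ∀ i, |u i| ≤ B) : ‖u‖ ≤ d * B := by
  have : u = ∑ i, u i • EuclideanSpace.single i (1:ℝ) := by
    ext j
    simp [Pi.single_apply]
  rw [this]
  refine (norm_sum_le _ _).trans ?_
  calc _ ≤ ∑ _i : Fin d, B := Finset.sum_le_sum fun i _ => by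
          rw [norm_smul]; simpa using h i
    _ = _ := by simp

lemma one_step [NeZero d] (H : Hyp F1 F2 σ D c C b1 b2 b3 η) {φ : V d → ℝ} (hφ : ContDiff ℝ (⊤ : ℕ∞) φ)
    (hs : HasCompactSupport φ) {T : ℝ} (hT : 0 < T) :
    ∃ K : ℝ, 0 ≤ K ∧ ∀ h, 0 ≤ h → h ≤ T → ∀ t z,
      |(∑ i, (φ (z + h • FF F1 F2 t z + nz σ h t z (i, true)) + φ (z + h • FF F1 F2 t z + nz σ h t z (i, false)))) / (2 * d)
        - φ z - h * gen F1 F2 (aσ σ) φ t z| ≤ K * (h * √h) * (1 + ‖z‖)^4 := by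
  have hC := H.C1
  have hd : (0:ℝ) < d := by exact_mod_cast NeZero.pos d
  -- Lipschitz constants
  have hdφ : ContDiff ℝ (⊤ : ℕ∞) (fderiv ℝ φ) := hφ.fderiv_right (m := (⊤ : ℕ∞)) (by simp)
  obtain ⟨L1, hL1⟩ := ContDiff.lipschitzWith_of_hasCompactSupport (hs.fderiv (𝕜 := ℝ)) hdφ (by simp)
  set Hs : Fin d → Fin d → V d → ℝ := fun i j y => fderiv ℝ (fun y => fderiv ℝ φ y (e1 d j)) y (e1 d i) with hHs
  have hLe : ∀ i j, ∃ L : NNReal, LipschitzWith L (Hs i j) := fun i j =>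
    ContDiff.lipschitzWith_of_hasCompactSupport (fd1_supp (fd1_supp hs _) _) (fd1_cont (fd1_cont hφ _) _) (by simp)
  choose L hL using hLe
  set L2 : ℝ := ∑ i, ∑ j, (L i j : ℝ) with hL2
  have hL2' : ∀ i j x y, |Hs i j x - Hs i j y| ≤ L2 * ‖x - y‖ := by
    intro i j x y
    have h1 := (hL i j).dist_le_mul x y
    rw [Real.dist_eq, dist_eq_norm] at h1
    refine h1.trans ?_
    gcongr
    calc (L i j : ℝ) ≤ ∑ j, (L i j : ℝ) := Finset.single_le_sum (f := fun j => (L i j : ℝ)) (fun j _ => (L i j).2) (Finset.mem_univ j)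
      _ ≤ _ := Finset.single_le_sum (f := fun i => ∑ j, (L i j : ℝ)) (fun i _ => Finset.sum_nonneg fun j _ => (L i j).2) (Finset.mem_univ i)
  have hL20 : 0 ≤ L2 := Finset.sum_nonneg fun i _ => Finset.sum_nonneg fun j _ => (L i j).2
  set S := √T with hS
  set sd := √(d:ℝ) with hsd
  set K2 : ℝ := d^2 * (d * C^2) * L2 * (S * C + d * sd * C) with hK2
  refine ⟨K2 + L1 * S * C^2, by positivity, fun h hh hhT t z => ?_⟩
  set r := √h with hr
  have hr0 : 0 ≤ r := Real.sqrt_nonneg _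
  have hr2 : r * r = h := Real.mul_self_sqrt hh
  have hrS : r ≤ S := Real.sqrt_le_sqrt hhT
  have hhr : h ≤ S * r := by rw [← hr2]; gcongr
  have hhd : √(h * d) = r * sd := Real.sqrt_mul hh _
  have hF := H.FF_gr t z
  set F := FF F1 F2 t z with hFd
  set z' := z + h • F with hz'
  set w : Fin d → E d := fun l => WithLp.toLp 2 (fun i => √(h * d) * σ t z.1 z.2 i l) with hw
  have hwi : ∀ l i, w l i = √(h * d) * σ t z.1 z.2 i l := fun l i => rfl
  have hwb : ∀ l i, |w l i| ≤ r * sd * C := fun l i => by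
    rw [hwi, hhd, abs_mul, abs_of_nonneg (by positivity)]
    gcongr
    exact H.σb _ _ _ _ _
  have hwn : ∀ l, ‖w l‖ ≤ d * (r * sd * C) := fun l => E_norm_le_sum _ (hwb l)
  have nzt : ∀ l, nz σ h t z (l, true) = (w l, 0) := fun l => by
    simp [nz, sgn, hw]
  have nzf : ∀ l, nz σ h t z (l, false) = -(w l, 0) := fun l => by
    refine Prod.ext ?_ ?_
    · ext i
      simp [nz, sgn, hw]
    · simp [nz]
  have hFn : ‖h • F‖ ≤ h * (C * (1 + ‖z‖)) := by
    rw [norm_smul, Real.norm_of_nonneg hh]; gcongr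
  set q : Fin d → ℝ := fun l => ∑ j, w l j * ∑ i, w l i * Hs i j z with hq
  set n := 1 + ‖z‖ with hn
  have hn1 : 1 ≤ n := by simp [hn]
  -- second order
  have so : ∀ l, |φ (z' + (w l, 0)) + φ (z' - (w l, 0)) - 2 * φ z' - q l| ≤ 2 * (K2 * (h * r) * n) := by
    intro l
    have dl : ∀ s : ℝ, HasDerivAt (fun s : ℝ => z' + s • ((w l, 0) : V d)) (w l, 0) s := fun s => by
      have := ((hasDerivAt_id s).smul_const ((w l, 0) : V d)).const_add z'
      simpa using this
    have g1 : ∀ s, HasDerivAt (fun s : ℝ => φ (z' + s • ((w l, 0) : V d)))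
        (∑ j, w l j * fderiv ℝ φ (z' + s • ((w l, 0) : V d)) (e1 d j)) s := fun s => by
      have := ((hφ.differentiable (by simp)) (z' + s • ((w l, 0) : V d))).hasFDerivAt.comp_hasDerivAt s (dl s)
      refine this.congr_deriv ?_
      rw [clm_decomp]
      simp [hHs]
    have g2 : ∀ s, HasDerivAt (fun s : ℝ => ∑ j, w l j * fderiv ℝ φ (z' + s • ((w l, 0) : V d)) (e1 d j))
        (∑ j, w l j * ∑ i, w l i * Hs i j (z' + s • ((w l, 0) : V d))) s := fun s => by
      refine HasDerivAt.fun_sum fun j _ => HasDerivAt.const_mul _ ?_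
      have := (((fd1_cont hφ (e1 d j)).differentiable (by simp)) (z' + s • ((w l, 0) : V d))).hasFDerivAt.comp_hasDerivAt s (dl s)
      refine this.congr_deriv ?_
      rw [clm_decomp]
      simp [hHs]
    have := sym2 g1 g2 (q := q l) (δ := K2 * (h * r) * n) (fun s hs => by
      have e : (∑ j, w l j * ∑ i, w l i * Hs i j (z' + s • ((w l, 0) : V d))) - q l =
          ∑ j, ∑ i, w l j * (w l i * (Hs i j (z' + s • ((w l, 0) : V d)) - Hs i j z)) := by
        simp only [hq, ← Finset.sum_sub_distrib, Finset.mul_sum, mul_sub]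
      rw [e]
      have hdz : ‖z' + s • ((w l, 0) : V d) - z‖ ≤ (S * C + d * sd * C) * r * n := by
        have h1 : z' + s • ((w l, 0) : V d) - z = h • F + s • ((w l, 0) : V d) := by rw [hz']; abel
        have h2 : ‖s • ((w l, 0) : V d)‖ ≤ d * (r * sd * C) := by
          rw [norm_smul, Prod.norm_def]
          simp only [norm_zero, norm_nonneg, sup_of_le_left]
          calc ‖s‖ * ‖w l‖ ≤ 1 * (d * (r * sd * C)) := by
                gcongr
                · exact abs_le.2 hs
                · exact hwn l
            _ = _ := one_mul _
        have h3 : h * (C * n) ≤ S * r * (C * n) := by gcongr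
        have h4 : d * (r * sd * C) * 1 ≤ d * (r * sd * C) * n := by gcongr
        rw [h1]
        refine (norm_add_le _ _).trans ?_
        linarith
      have := abs_sum2_le (f := fun j i => w l j * (w l i * (Hs i j (z' + s • ((w l, 0) : V d)) - Hs i j z)))
        (B := (r * sd * C) * ((r * sd * C) * (L2 * ((S * C + d * sd * C) * r * n)))) (fun j i => by
          rw [abs_mul (w l j), abs_mul (w l i)]
          exact mul_le_mul (hwb l j) (mul_le_mul (hwb l i) ((hL2' i j _ _).trans
            (mul_le_mul_of_nonneg_left hdz hL20)) (abs_nonneg _) (by positivity)) (by positivity) (by positivity))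
      refine this.trans (le_of_eq ?_)
      have hsd2 : sd * sd = d := Real.mul_self_sqrt hd.le
      rw [Fintype.card_fin, hK2]
      calc _ = (d:ℝ)^2 * ((sd * sd) * C^2) * L2 * (S * C + d * sd * C) * ((r*r) * r) * n := by ring
        _ = _ := by rw [hsd2, hr2])
    simpa [sub_eq_add_neg] using this
  -- first order
  have fo : |φ z' - φ z - h * fderiv ℝ φ z F| ≤ L1 * S * C^2 * (h * r) * n^2 := by
    have h1 := Convex.norm_image_sub_le_of_norm_fderiv_le' (𝕜 := ℝ) (f := φ) (s := Metric.closedBall z ‖h • F‖)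
      (φ := fderiv ℝ φ z) (C := L1 * ‖h • F‖) (x := z) (y := z')
      (fun y _ => (hφ.differentiable (by simp)) y) (fun y hy => by
        have := hL1.dist_le_mul y z
        rw [dist_eq_norm] at this
        refine this.trans ?_
        gcongr
        exact hy) (convex_closedBall _ _) (by simp) (by simp [hz'])
    have h2 : z' - z = h • F := by simp [hz']
    rw [h2, map_smul, smul_eq_mul, Real.norm_eq_abs] at h1
    refine h1.trans ?_
    calc L1 * ‖h • F‖ * ‖h • F‖ ≤ L1 * (h * (C * n)) * (h * (C * n)) := by gcongr
      _ ≤ L1 * (h * (C * n)) * ((S * r) * (C * n)) := by gcongr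
      _ = _ := by ring
  -- combine
  have hgen : h * gen F1 F2 (aσ σ) φ t z = (∑ l, q l) / (2 * d) + h * fderiv ℝ φ z F := by
    have e1' : fderiv ℝ φ z F = ∑ i, F1 t z.1 z.2 i * fderiv ℝ φ z (e1 d i) + ∑ i, F2 t z.1 z.2 i * fderiv ℝ φ z (e2 d i) :=
      clm_decomp _ _
    have e2' : ∑ l, q l = h * d * ∑ i, ∑ j, aσ σ t z.1 z.2 i j * Hs i j z := by
      have : ∀ i j l, w l j * (w l i * Hs i j z) = h * d * (σ t z.1 z.2 i l * σ t z.1 z.2 j l * Hs i j z) := fun i j l => by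
        rw [hwi, hwi]
        have := Real.mul_self_sqrt (show 0 ≤ h * d by positivity)
        calc _ = (√(h * d) * √(h * d)) * (σ t z.1 z.2 i l * σ t z.1 z.2 j l * Hs i j z) := by ring
          _ = _ := by rw [this]
      simp only [hq, Finset.mul_sum, this, aσ, Matrix.mul_apply, Matrix.transpose_apply, Finset.sum_mul]
      rw [Finset.sum_comm]
      calc _ = ∑ j, ∑ i, ∑ l, h * d * (σ t z.1 z.2 i l * σ t z.1 z.2 j l * Hs i j z) :=
            Finset.sum_congr rfl fun j _ => Finset.sum_comm
        _ = _ := Finset.sum_comm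
    rw [e1', e2']
    unfold gen
    field_simp
    ring
  simp only [nzt, nzf, ← sub_eq_add_neg]
  rw [hgen]
  have e : (∑ l, (φ (z' + (w l, 0)) + φ (z' - (w l, 0)))) / (2 * d) - φ z - ((∑ l, q l) / (2 * d) + h * fderiv ℝ φ z F)
      = (∑ l, (φ (z' + (w l, 0)) + φ (z' - (w l, 0)) - 2 * φ z' - q l)) / (2 * d) + (φ z' - φ z - h * fderiv ℝ φ z F) := by
    simp only [Finset.sum_sub_distrib, Finset.sum_const, Finset.card_univ, Fintype.card_fin, nsmul_eq_mul]
    field_simp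
    ring
  rw [e]
  have s1 : |(∑ l, (φ (z' + (w l, 0)) + φ (z' - (w l, 0)) - 2 * φ z' - q l)) / (2 * d)| ≤ K2 * (h * r) * n := by
    rw [abs_div, abs_of_pos (by positivity : (0:ℝ) < 2 * d), div_le_iff₀ (by positivity)]
    refine (abs_sum1_le so).trans (le_of_eq ?_)
    rw [Fintype.card_fin]; ring
  refine (abs_add_le _ _).trans ?_
  have p1 : n ≤ n^4 := le_self_pow₀ hn1 (by norm_num)
  have p2 : n^2 ≤ n^4 := pow_le_pow_right₀ hn1 (by norm_num)
  calc _ ≤ K2 * (h * r) * n + L1 * S * C^2 * (h * r) * n^2 := add_le_add s1 fo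
    _ ≤ K2 * (h * r) * n^4 + L1 * S * C^2 * (h * r) * n^4 := by gcongr
    _ = _ := by ring

/-- consistency of the Euler chain -/
lemma chain_step [NeZero d] (H : Hyp F1 F2 σ D c C b1 b2 b3 η) {φ : V d → ℝ} (hφ : ContDiff ℝ (⊤ : ℕ∞) φ)
    (hs : HasCompactSupport φ) {T : ℝ} (hT : 0 < T) (x : V d) :
    ∃ K : ℝ, 0 ≤ K ∧ ∀ (N : ℕ) (h : ℝ), 0 ≤ h → N * h ≤ T → ∀ (k : ℕ) (hk : k < N) (Φ : Om d N → ℝ),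
      (∀ ω, |Φ ω| ≤ 1) → (∀ ω b, Φ (Function.update ω ⟨k, hk⟩ b) = Φ ω) →
      |EE (fun ω => Φ ω * (φ (Zc F1 F2 σ x N h (k+1) ω) - φ (Zc F1 F2 σ x N h k ω)
        - h * gen F1 F2 (aσ σ) φ (k * h) (Zc F1 F2 σ x N h k ω)))| ≤ K * (h * √h) := by
  obtain ⟨K, hK, hst⟩ := one_step H hφ hs hT
  obtain ⟨Y, hY, hZ⟩ := Zc_mom H x hT
  refine ⟨K * Y, by positivity, fun N h hh hN k hk Φ hΦ hΦu => ?_⟩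
  have hd : (d:ℝ) ≠ 0 := by exact_mod_cast NeZero.ne d
  have hhT : h ≤ T := by
    have : (1:ℝ) ≤ N := by exact_mod_cast (by omega : 1 ≤ N)
    nlinarith
  have e := EE_avg ⟨k, hk⟩ (fun ω s => Φ ω * (φ (Zc F1 F2 σ x N h k ω + h • FF F1 F2 (k * h) (Zc F1 F2 σ x N h k ω) +
      nz σ h (k * h) (Zc F1 F2 σ x N h k ω) s) - φ (Zc F1 F2 σ x N h k ω)
        - h * gen F1 F2 (aσ σ) φ (k * h) (Zc F1 F2 σ x N h k ω)))
      (fun ω b s => by simp only [hΦu, Zc_upd x h ⟨k, hk⟩ b ω k le_rfl])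
  simp only [Zc_succ x h k hk]
  rw [e]
  refine (EE_abs _).trans ?_
  calc _ ≤ EE (fun ω => K * (h * √h) * (1 + ‖Zc F1 F2 σ x N h k ω‖)^4) := by
        refine EE_mono fun ω => ?_
        have h1 := hst h hh hhT (k * h) (Zc F1 F2 σ x N h k ω)
        set z := Zc F1 F2 σ x N h k ω
        have : (∑ i, (Φ ω * (φ (z + h • FF F1 F2 (k * h) z + nz σ h (k * h) z (i, true)) - φ z - h * gen F1 F2 (aσ σ) φ (k * h) z)
            + Φ ω * (φ (z + h • FF F1 F2 (k * h) z + nz σ h (k * h) z (i, false)) - φ z - h * gen F1 F2 (aσ σ) φ (k * h) z))) / (2 * d)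
            = Φ ω * ((∑ i, (φ (z + h • FF F1 F2 (k * h) z + nz σ h (k * h) z (i, true)) + φ (z + h • FF F1 F2 (k * h) z + nz σ h (k * h) z (i, false)))) / (2 * d)
        - φ z - h * gen F1 F2 (aσ σ) φ (k * h) z) := by
          simp only [← mul_add, ← Finset.mul_sum, Finset.sum_add_distrib, Finset.sum_sub_distrib, Finset.sum_const, Finset.card_univ, Fintype.card_fin, nsmul_eq_mul]
          field_simp
          ring
        rw [this, abs_mul]
        calc _ ≤ 1 * _ := mul_le_mul_of_nonneg_right (hΦ ω) (abs_nonneg _)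
          _ ≤ _ := by rw [one_mul]; exact h1
    _ = K * (h * √h) * EE (fun ω => (1 + ‖Zc F1 F2 σ x N h k ω‖)^4) := EE_mul _ _
    _ ≤ K * (h * √h) * Y := by
        gcongr
        exact hZ N h hh hN k hk.le
    _ = _ := by ring

end

end

section

/-! ### Part T: tightness -/
open Filter Topology ENNReal

section
variable {d : ℕ} {T : ℝ} (hT : 0 < T)

/-- dyadic grid -/
def gr (T : ℝ) (m k : ℕ) : ℝ := k * (T / 2 ^ m)

lemma gr_double (T : ℝ) (m k : ℕ) : gr T (m+1) (2*k) = gr T m k := by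
  unfold gr
  push_cast
  field_simp
  ring

lemma floor_double {y : ℝ} (hy : 0 ≤ y) : ⌊2*y⌋₊ = 2 * ⌊y⌋₊ ∨ ⌊2*y⌋₊ = 2 * ⌊y⌋₊ + 1 := by
  have h1 := Nat.floor_le hy
  have h2 := Nat.lt_floor_add_one y
  have h3 : 2 * ⌊y⌋₊ ≤ ⌊2*y⌋₊ := Nat.le_floor (by push_cast; linarith)
  have h4 : ⌊2*y⌋₊ < 2 * ⌊y⌋₊ + 2 := (Nat.floor_lt (by linarith)).2 (by push_cast; linarith)
  omega

lemma floor_close {y y' : ℝ} (h0 : 0 ≤ y) (hy : y ≤ y') (hy' : y' ≤ y + 1) : ⌊y'⌋₊ = ⌊y⌋₊ ∨ ⌊y'⌋₊ = ⌊y⌋₊ + 1 := by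
  have h2 := Nat.lt_floor_add_one y
  have h3 : ⌊y⌋₊ ≤ ⌊y'⌋₊ := Nat.floor_mono hy
  have h4 : ⌊y'⌋₊ < ⌊y⌋₊ + 2 := (Nat.floor_lt (by linarith)).2 (by push_cast; linarith)
  omega

lemma chaining (hT : 0 < T) {f : ℝ → V d} (hf : Continuous f) {R : ℝ} (hR : 0 ≤ R)
    (hb : ∀ m k, k < 2 ^ m → ‖f (gr T m (k+1)) - f (gr T m k)‖ ≤ R * (9/10)^m) {m : ℕ} {s t : ℝ}
    (hs : 0 ≤ s) (hst : s ≤ t) (ht : t ≤ T) (hd : t - s ≤ T / 2 ^ m) : ‖f t - f s‖ ≤ 19 * R * (9/10)^m := by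
  have hκ : ∀ t, 0 ≤ t → t ≤ T → ∀ m : ℕ, ⌊t * 2^m / T⌋₊ ≤ 2^m := by
    intro t h0 h1 m
    refine Nat.floor_le_of_le ?_
    rw [div_le_iff₀ hT]
    push_cast
    nlinarith [pow_pos (show (0:ℝ) < 2 by norm_num) m]
  have key : ∀ t, 0 ≤ t → t ≤ T → ∀ m, dist (f (gr T m ⌊t * 2^m / T⌋₊)) (f t) ≤ 9 * R * (9/10)^m := by
    intro t h0 h1 m
    have hu : ∀ n, dist (f (gr T n ⌊t * 2^n / T⌋₊)) (f (gr T (n+1) ⌊t * 2^(n+1) / T⌋₊)) ≤ (R * (9/10)) * (9/10)^n := by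
      intro n
      have e : t * 2^(n+1) / T = 2 * (t * 2^n/T) := by ring
      rw [e]
      rcases floor_double (y := t * 2^n/T) (by positivity) with h | h
      · rw [h, gr_double, dist_self]; positivity
      · have hk := hκ t h0 h1 (n+1)
        rw [e, h] at hk
        rw [h, ← gr_double, dist_comm, dist_eq_norm]
        refine (hb (n+1) _ (by omega)).trans (le_of_eq ?_)
        ring
    have hlim : Tendsto (fun n => f (gr T n ⌊t * 2^n / T⌋₊)) atTop (𝓝 (f t)) := by
      refine (hf.tendsto t).comp ?_
      have h2 : Tendsto (fun n : ℕ => T * (1/2:ℝ)^n) atTop (𝓝 0) := by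
        have := (tendsto_pow_atTop_nhds_zero_of_lt_one (r := (1/2:ℝ)) (by norm_num) (by norm_num)).const_mul T
        simpa using this
      have h3 : Tendsto (fun n : ℕ => t - T * (1/2:ℝ)^n) atTop (𝓝 t) := by
        simpa using tendsto_const_nhds.sub h2
      refine tendsto_of_tendsto_of_tendsto_of_le_of_le h3 tendsto_const_nhds (fun n => ?_) (fun n => ?_)
      · have := Nat.lt_floor_add_one (t * 2^n / T)
        rw [div_lt_iff₀ hT] at this
        have p : (0:ℝ) < 2^n := by positivity
        simp only [gr, one_div, inv_pow]
        have e1 : t - T * (2^n)⁻¹ = (t * 2^n - T) / 2^n := by field_simp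
        have e2 : (⌊t * 2 ^ n / T⌋₊ : ℝ) * (T / 2^n) = ⌊t * 2 ^ n / T⌋₊ * T / 2^n := by ring
        rw [e1, e2]
        gcongr
        linarith
      · have := Nat.floor_le (show 0 ≤ t * 2^n / T by positivity)
        rw [le_div_iff₀ hT] at this
        have p : (0:ℝ) < 2^n := by positivity
        simp only [gr]
        have e2 : (⌊t * 2 ^ n / T⌋₊ : ℝ) * (T / 2^n) = ⌊t * 2 ^ n / T⌋₊ * T / 2^n := by ring
        rw [e2, div_le_iff₀ p]
        exact this
    refine (dist_le_of_le_geometric_of_tendsto _ _ (by norm_num) hu hlim m).trans (le_of_eq ?_)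
    ring
  have k1 := key t (hs.trans hst) ht m
  have k2 := key s hs (hst.trans ht) m
  have k3 : dist (f (gr T m ⌊t * 2^m / T⌋₊)) (f (gr T m ⌊s * 2^m / T⌋₊)) ≤ R * (9/10)^m := by
    have p : (0:ℝ) < 2^m := by positivity
    rcases floor_close (y := s * 2^m/T) (y' := t * 2^m/T) (by positivity) (by gcongr) (by
      rw [le_div_iff₀ p] at hd
      have : s * 2^m/T + 1 = (s * 2^m + T)/T := by field_simp
      rw [this]
      gcongr
      linarith) with h | h
    · rw [h, dist_self]; positivity
    · have hk := hκ t (hs.trans hst) ht m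
      rw [h] at hk
      rw [h, dist_eq_norm]
      exact hb m _ (by omega)
  rw [← dist_eq_norm]
  have := dist_triangle4 (f t) (f (gr T m ⌊t * 2^m / T⌋₊)) (f (gr T m ⌊s * 2^m / T⌋₊)) (f s)
  rw [dist_comm] at k1
  linarith

/-- compact sets of paths -/
def Kset (x : V d) (R : ℝ) : Set (PS d T) :=
  {ω | ω ⟨0, left_mem_Icc.2 hT.le⟩ = x ∧ ∀ (m : ℕ) (s t : Icc (0:ℝ) T), dist s t ≤ T / 2 ^ m → dist (ω s) (ω t) ≤ 19 * R * (9/10)^m}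

lemma mod_lim (R : ℝ) {ε : ℝ} (hε : 0 < ε) : ∃ m : ℕ, 19 * R * (9/10:ℝ)^m < ε := by
  have h : Tendsto (fun m : ℕ => 19 * R * (9/10:ℝ)^m) atTop (𝓝 0) := by
    have := (tendsto_pow_atTop_nhds_zero_of_lt_one (r := (9/10:ℝ)) (by norm_num) (by norm_num)).const_mul (19 * R)
    simpa using this
  exact ((tendsto_order.1 h).2 ε hε).exists

lemma mod_cont (hT : 0 < T) {f : Icc (0:ℝ) T → V d} {R : ℝ}
    (hf : ∀ (m : ℕ) (s t : Icc (0:ℝ) T), dist s t ≤ T / 2 ^ m → dist (f s) (f t) ≤ 19 * R * (9/10)^m) :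
    Continuous f := by
  rw [Metric.continuous_iff]
  intro b ε hε
  obtain ⟨m, hm⟩ := mod_lim R hε
  exact ⟨T / 2^m, by positivity, fun a ha => (hf m a b ha.le).trans_lt hm⟩

lemma Kset_compact (x : V d) (R : ℝ) : IsCompact (Kset hT x R) := by
  refine ArzelaAscoli.isCompact_of_equicontinuous _ ?_ ?_
  · have e : ContinuousMap.toFun '' (Kset hT x R) = {f : Icc (0:ℝ) T → V d | f ⟨0, left_mem_Icc.2 hT.le⟩ = x ∧
        ∀ (m : ℕ) (s t : Icc (0:ℝ) T), dist s t ≤ T / 2 ^ m → dist (f s) (f t) ≤ 19 * R * (9/10)^m} := by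
      ext f
      constructor
      · rintro ⟨ω, hω, rfl⟩
        exact hω
      · intro hf
        exact ⟨⟨f, mod_cont hT hf.2⟩, hf, rfl⟩
    rw [e]
    refine IsCompact.of_isClosed_subset (isCompact_univ_pi (fun _ : Icc (0:ℝ) T => isCompact_closedBall x (19 * R))) ?_ ?_
    · have e2 : {f : Icc (0:ℝ) T → V d | f ⟨0, left_mem_Icc.2 hT.le⟩ = x ∧
        ∀ (m : ℕ) (s t : Icc (0:ℝ) T), dist s t ≤ T / 2 ^ m → dist (f s) (f t) ≤ 19 * R * (9/10)^m} =
        {f : Icc (0:ℝ) T → V d | f ⟨0, left_mem_Icc.2 hT.le⟩ = x} ∩ ⋂ (m : ℕ), ⋂ (s : Icc (0:ℝ) T), ⋂ (t : Icc (0:ℝ) T),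
          ⋂ (_ : dist s t ≤ T / 2 ^ m), {f | dist (f s) (f t) ≤ 19 * R * (9/10)^m} := by
        ext f
        simp only [mem_inter_iff, mem_iInter, mem_ofPred_eq]
      rw [e2]
      refine IsClosed.inter (isClosed_eq (continuous_apply _) continuous_const) ?_
      refine isClosed_iInter fun m => isClosed_iInter fun s => isClosed_iInter fun t => isClosed_iInter fun _ => ?_
      exact isClosed_le ((continuous_apply s).dist (continuous_apply t)) continuous_const
    · rintro f ⟨h0, hf⟩ t _
      have := hf 0 t ⟨0, left_mem_Icc.2 hT.le⟩ (by
        rw [Subtype.dist_eq, Real.dist_eq]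
        simp [abs_of_nonneg t.2.1, t.2.2])
      rw [h0] at this
      simpa using this
  · intro b
    rw [Metric.equicontinuousAt_iff]
    intro ε hε
    obtain ⟨m, hm⟩ := mod_lim R hε
    refine ⟨T / 2^m, by positivity, fun a ha ω => ?_⟩
    refine (ω.2.2 m b a ?_).trans_lt hm
    rw [dist_comm]; exact ha.le

lemma tight (x : V d) {K : ℝ} (hK : 0 ≤ K) {ε : ℝ≥0∞} (hε : 0 < ε) :
    ∃ S : Set (PS d T), IsCompact S ∧ ∀ P : Measure (PS d T), P {ω | ω ⟨0, left_mem_Icc.2 hT.le⟩ ≠ x} = 0 →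
      (∀ m k, k < 2^m → ∫⁻ ω, ENNReal.ofReal (‖Yc hT (gr T m (k+1)) ω - Yc hT (gr T m k) ω‖^4) ∂P ≤ ENNReal.ofReal (K * (1/4)^m)) →
      P Sᶜ ≤ ε := by
  obtain ⟨e, he0, heε⟩ := ENNReal.lt_iff_exists_nnreal_btwn.1 hε
  have he : (0:ℝ) < e := by exact_mod_cast he0
  set r : ℝ := 5000/6561 with hr
  set A : ℝ := K * (1 - r)⁻¹ with hA
  have hA0 : 0 ≤ A := by rw [hA, hr]; exact mul_nonneg hK (by norm_num)
  set R : ℝ := 1 + A / e with hR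
  have hR1 : 1 ≤ R := by rw [hR]; have : 0 ≤ A / e := by positivity
                         linarith
  refine ⟨Kset hT x R, Kset_compact hT x R, fun P hP0 hP => ?_⟩
  set t : ℕ → ℕ → PS d T → ℝ≥0∞ := fun m k ω =>
    ENNReal.ofReal (((10/9)^m)^4) * ENNReal.ofReal (‖Yc hT (gr T m (k+1)) ω - Yc hT (gr T m k) ω‖^4) with ht
  have tm0 : ∀ m k, Measurable (fun ω : PS d T => ENNReal.ofReal (‖Yc hT (gr T m (k+1)) ω - Yc hT (gr T m k) ω‖^4)) := fun m k =>
    ((((Yc_cont1 hT _).sub (Yc_cont1 hT _)).norm.pow 4).measurable.ennreal_ofReal)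
  have tm : ∀ m k, Measurable (t m k) := fun m k => (tm0 m k).const_mul _
  set G : PS d T → ℝ≥0∞ := fun ω => ∑' m, ∑ k ∈ Finset.range (2^m), t m k ω with hG
  have Gm : Measurable G := Measurable.ennreal_tsum fun m => Finset.measurable_fun_sum _ fun k _ => tm m k
  have hI : ∫⁻ ω, G ω ∂P ≤ ENNReal.ofReal A := by
    rw [hG, lintegral_tsum fun m => (Finset.measurable_fun_sum _ fun k _ => tm m k).aemeasurable]
    calc _ ≤ ∑' m : ℕ, ENNReal.ofReal (K * r^m) := by
          refine ENNReal.tsum_le_tsum fun m => ?_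
          rw [lintegral_finsetSum _ fun k _ => tm m k]
          calc _ ≤ ∑ k ∈ Finset.range (2^m), ENNReal.ofReal (((10/9)^m)^4) * ENNReal.ofReal (K * (1/4)^m) := by
                refine Finset.sum_le_sum fun k hk => ?_
                rw [lintegral_const_mul _ (tm0 m k)]
                gcongr
                exact hP m k (Finset.mem_range.1 hk)
            _ = ENNReal.ofReal (K * r^m) := by
                rw [Finset.sum_const, Finset.card_range, nsmul_eq_mul, ← ENNReal.ofReal_natCast, ← ENNReal.ofReal_mul (by positivity), ← ENNReal.ofReal_mul (by positivity)]
                congr 1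
                push_cast
                rw [← pow_mul, mul_comm m 4, pow_mul, mul_comm K, ← mul_assoc, ← mul_pow, ← mul_assoc, ← mul_pow, mul_comm, hr]
                norm_num
      _ = ENNReal.ofReal A := by
          rw [← ENNReal.ofReal_tsum_of_nonneg (fun m => by rw [hr]; positivity), tsum_mul_left, tsum_geometric_of_lt_one]
          · rw [hr]; norm_num
          · rw [hr]; norm_num
          · exact (summable_geometric_of_lt_one (by rw [hr]; norm_num) (by rw [hr]; norm_num)).mul_left K
  have hsub : (Kset hT x R)ᶜ ⊆ {ω | ω ⟨0, left_mem_Icc.2 hT.le⟩ ≠ x} ∪ {ω | ENNReal.ofReal (R^4) ≤ G ω} := by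
    intro ω hω
    by_contra hcon
    simp only [mem_union, mem_ofPred_eq, not_or, not_not, not_le] at hcon
    refine hω ⟨hcon.1, ?_⟩
    have hb : ∀ m k, k < 2 ^ m → ‖Yc hT (gr T m (k+1)) ω - Yc hT (gr T m k) ω‖ ≤ R * (9/10)^m := by
      intro m k hk
      by_contra hlt
      push Not at hlt
      have h1 : t m k ω ≤ G ω := by
        refine le_trans ?_ (ENNReal.le_tsum m)
        exact Finset.single_le_sum (f := fun k => t m k ω) (fun _ _ => zero_le) (Finset.mem_range.2 hk)
      have h2 : ENNReal.ofReal (R^4) ≤ t m k ω := by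
        rw [ht]
        beta_reduce
        rw [← ENNReal.ofReal_mul (by positivity)]
        refine ENNReal.ofReal_le_ofReal ?_
        rw [← mul_pow]
        refine pow_le_pow_left₀ (by linarith) ?_ 4
        calc R = (10/9)^m * (R * (9/10)^m) := by
              rw [mul_comm R, ← mul_assoc, ← mul_pow]; norm_num
          _ ≤ _ := by gcongr
      exact absurd (h2.trans h1) (not_le.2 hcon.2)
    have main : ∀ (m : ℕ) (s t : Icc (0:ℝ) T), s ≤ t → dist s t ≤ T / 2 ^ m → dist (ω s) (ω t) ≤ 19 * R * (9/10)^m := by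
      intro m s t hst hdst
      have := chaining hT (Yc_cont hT ω) (R := R) (by linarith) hb (m := m) s.2.1 hst t.2.2 (by
        rw [dist_comm, Subtype.dist_eq, Real.dist_eq] at hdst
        exact (le_abs_self _).trans hdst)
      rw [Yc_val, Yc_val] at this
      rwa [dist_comm, dist_eq_norm]
    intro m s t hd
    rcases le_total s t with h | h
    · exact main m s t h hd
    · rw [dist_comm]; rw [dist_comm] at hd; exact main m t s h hd
  refine (measure_mono hsub).trans ((measure_union_le _ _).trans ?_)
  rw [hP0, zero_add]
  have hR4 : ENNReal.ofReal (R^4) ≠ 0 := by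
    have : 0 < R^4 := by positivity
    simpa using this
  refine (meas_ge_le_lintegral_div Gm.aemeasurable hR4 ofReal_ne_top).trans ?_
  refine le_trans ?_ heε.le
  refine ENNReal.div_le_of_le_mul (hI.trans ?_)
  rw [← ENNReal.ofReal_coe_nnreal, ← ENNReal.ofReal_mul he.le]
  refine ENNReal.ofReal_le_ofReal ?_
  have : R ≤ R^4 := le_self_pow₀ hR1 (by norm_num)
  have h2 : A ≤ e * R := by
    rw [hR]
    field_simp
    linarith
  nlinarith

end

end

section

open Filter Topology ENNReal

/-! ### Part U: interpolated paths and their laws -/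

section
variable {d : ℕ} {T : ℝ}

/-- clamp to the unit interval -/
def clp (u : ℝ) : ℝ := max 0 (min 1 u)

lemma clp_cont : Continuous clp := by unfold clp; fun_prop
lemma clp_le {u : ℝ} (h : u ≤ 0) : clp u = 0 := by
  unfold clp; exact max_eq_left ((min_le_right _ _).trans h)
lemma clp_ge {u : ℝ} (h : 1 ≤ u) : clp u = 1 := by
  unfold clp; rw [min_eq_left h]; norm_num
lemma clp_mid {u : ℝ} (h0 : 0 ≤ u) (h : u ≤ 1) : clp u = u := by
  unfold clp; rw [min_eq_right h, max_eq_right h0]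

/-- polygonal path -/
def XR (Z : ℕ → V d) (N : ℕ) (h t : ℝ) : V d :=
  Z 0 + ∑ j ∈ Finset.range N, clp (t / h - j) • (Z (j+1) - Z j)

lemma XR_cont (Z : ℕ → V d) (N : ℕ) (h : ℝ) : Continuous (XR Z N h) := by
  unfold XR
  exact continuous_const.add (continuous_finsetSum _ fun j _ =>
    (clp_cont.comp ((continuous_id.div_const h).sub continuous_const)).smul continuous_const)

lemma XR_piece (Z : ℕ → V d) {N k : ℕ} {h t : ℝ} (hh : 0 < h) (hk : k < N) (h1 : k * h ≤ t)
    (h2 : t ≤ (k+1) * h) : XR Z N h t = Z k + (t / h - k) • (Z (k+1) - Z k) := by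
  have e1 : (k:ℝ) ≤ t / h := by rwa [le_div_iff₀ hh]
  have e2 : t / h ≤ k + 1 := by rwa [div_le_iff₀ hh]
  have key : ∑ j ∈ Finset.range N, clp (t / h - j) • (Z (j+1) - Z j) =
      ∑ j ∈ Finset.range (k+1), clp (t / h - j) • (Z (j+1) - Z j) := by
    symm
    refine Finset.sum_subset (fun j hj => ?_) fun j _ hj => ?_
    · rw [Finset.mem_range] at *; omega
    · rw [Finset.mem_range] at hj
      have : (k:ℝ) + 1 ≤ j := by exact_mod_cast (by omega : k + 1 ≤ j)
      rw [clp_le (by linarith), zero_smul]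
  have key2 : ∑ j ∈ Finset.range k, clp (t / h - j) • (Z (j+1) - Z j) = Z k - Z 0 := by
    rw [← Finset.sum_range_sub]
    refine Finset.sum_congr rfl fun j hj => ?_
    rw [Finset.mem_range] at hj
    have : (j:ℝ) + 1 ≤ k := by exact_mod_cast (by omega : j + 1 ≤ k)
    rw [clp_ge (by linarith), one_smul]
  unfold XR
  rw [key, Finset.sum_range_succ, key2, clp_mid (by linarith) (by linarith)]
  abel

lemma XR_grid (Z : ℕ → V d) {N k : ℕ} {h : ℝ} (hh : 0 < h) (hN : 0 < N) (hk : k ≤ N) :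
    XR Z N h (k * h) = Z k := by
  rcases hk.lt_or_eq with hk | hk
  · rw [XR_piece Z hh hk le_rfl (by nlinarith), mul_div_cancel_right₀ _ hh.ne', sub_self, zero_smul, add_zero]
  · obtain ⟨m, rfl⟩ : ∃ m, N = m + 1 := ⟨N - 1, by omega⟩
    subst hk
    rw [XR_piece Z (k := m) hh (by omega) (by push_cast; nlinarith) (by push_cast; linarith),
      mul_div_cancel_right₀ _ hh.ne']
    push_cast
    rw [add_sub_cancel_left, one_smul]; abel

lemma XR_congr {Z Z' : ℕ → V d} {N k : ℕ} {h t : ℝ} (hh : 0 < h) (hk : k ≤ N) (ht : t ≤ k * h)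
    (hZ : ∀ j ≤ k, Z j = Z' j) : XR Z N h t = XR Z' N h t := by
  have e2 : t / h ≤ k := by rwa [div_le_iff₀ hh]
  unfold XR
  rw [hZ 0 (by omega)]
  congr 1
  refine Finset.sum_congr rfl fun j _ => ?_
  by_cases hj : j < k
  · rw [hZ j (by omega), hZ (j+1) (by omega)]
  · have : (k:ℝ) ≤ j := by exact_mod_cast (by omega : k ≤ j)
    rw [clp_le (by linarith), zero_smul, zero_smul]

/-- polygonal path as an element of path space -/
def Xp (T : ℝ) (Z : ℕ → V d) (N : ℕ) (h : ℝ) : PS d T := ⟨fun t => XR Z N h t, (XR_cont Z N h).comp continuous_subtype_val⟩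

lemma Yc_Xp (hT : 0 < T) (Z : ℕ → V d) (N : ℕ) (h : ℝ) {t : ℝ} (ht : t ∈ Icc 0 T) :
    Yc hT t (Xp T Z N h) = XR Z N h t := by
  unfold Yc Xp
  rw [projIcc_of_mem hT.le ht]; rfl

/-- uniform law of a finite family -/
def pn {α : Type} [Fintype α] {Ω : Type} [MeasurableSpace Ω] (X : α → Ω) : Measure Ω :=
  ∑ a, ((Fintype.card α : ℝ≥0∞)⁻¹) • Measure.dirac (X a)

section
variable {α : Type} [Fintype α] [Nonempty α] {Ω : Type} [MeasurableSpace Ω] (X : α → Ω)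

lemma pn_prob : IsProbabilityMeasure (pn X) := by
  constructor
  unfold pn
  simp only [Measure.coe_finsetSum, Finset.sum_apply, Measure.smul_apply, measure_univ, smul_eq_mul, mul_one,
    Finset.sum_const, Finset.card_univ, nsmul_eq_mul]
  exact ENNReal.mul_inv_cancel (by simp) (by simp)

lemma pn_lint {f : Ω → ℝ} (hf : Measurable f) (h0 : ∀ x, 0 ≤ f x) :
    ∫⁻ x, ENNReal.ofReal (f x) ∂pn X = ENNReal.ofReal (EE fun a => f (X a)) := by
  have hc : (0:ℝ) < Fintype.card α := by exact_mod_cast Fintype.card_pos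
  unfold pn EE
  rw [lintegral_finsetSum_measure]
  simp only [lintegral_smul_measure, lintegral_dirac' _ hf.ennreal_ofReal, smul_eq_mul]
  rw [← Finset.mul_sum, ← ENNReal.ofReal_sum_of_nonneg (fun a _ => h0 _), ENNReal.ofReal_div_of_pos hc,
    ENNReal.ofReal_natCast, ENNReal.div_eq_inv_mul]

lemma pn_int {f : Ω → ℝ} (hf : Measurable f) : ∫ x, f x ∂pn X = EE fun a => f (X a) := by
  unfold pn EE
  rw [integral_finsetSum_measure]
  · simp only [integral_smul_measure, integral_dirac' _ _ hf.stronglyMeasurable, smul_eq_mul]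
    rw [← Finset.mul_sum, ENNReal.toReal_inv, ENNReal.toReal_natCast]
    ring
  · intro a _
    exact (integrable_dirac' hf.stronglyMeasurable (by simp)).smul_measure (by simp)

lemma pn_null {S : Set Ω} (hS : MeasurableSet S) (h : ∀ a, X a ∉ S) : pn X S = 0 := by
  unfold pn
  simp only [Measure.coe_finsetSum, Finset.sum_apply, Measure.smul_apply, smul_eq_mul]
  refine Finset.sum_eq_zero fun a _ => ?_
  rw [Measure.dirac_apply' _ hS, indicator_of_notMem (h a), mul_zero]
end

end

end

section

open Filter Topology ENNReal

/-! ### Part V: moments of the polygonal paths -/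

section
variable {d : ℕ} {F1 F2 : ℝ → E d → E d → E d} {σ D : ℝ → E d → E d → Matrix (Fin d) (Fin d) ℝ}
  {c C b1 b2 b3 η : ℝ} {T : ℝ}

/-- polygonal Euler path at level `n` -/
def Xe (F1 F2 : ℝ → E d → E d → E d) (σ : ℝ → E d → E d → Matrix (Fin d) (Fin d) ℝ) (x : V d) (T : ℝ) (n : ℕ)
    (ω : Om d (2^n)) : PS d T :=
  Xp T (fun k => Zc F1 F2 σ x (2^n) (T/2^n) k ω) (2^n) (T/2^n)

lemma gr_mem (hT : 0 < T) {m k : ℕ} (hk : k ≤ 2^m) : gr T m k ∈ Icc 0 T := by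
  have : (k:ℝ) ≤ 2^m := by exact_mod_cast hk
  unfold gr
  refine ⟨by positivity, ?_⟩
  rw [← mul_div_assoc, div_le_iff₀ (by positivity)]
  nlinarith

lemma gr_refine (T : ℝ) {m n : ℕ} (h : m ≤ n) (k : ℕ) : gr T m k = gr T n (k * 2^(n-m)) := by
  obtain ⟨p, rfl⟩ := Nat.exists_eq_add_of_le h
  unfold gr
  rw [Nat.add_sub_cancel_left]
  push_cast
  rw [pow_add]
  field_simp

lemma Xe_grid (hT : 0 < T) (x : V d) {n k : ℕ} (hk : k ≤ 2^n) (ω : Om d (2^n)) :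
    Yc hT (gr T n k) (Xe F1 F2 σ x T n ω) = Zc F1 F2 σ x (2^n) (T/2^n) k ω := by
  unfold Xe
  rw [Yc_Xp hT _ _ _ (gr_mem hT hk)]
  unfold gr
  rw [XR_grid _ (by positivity) (by positivity) hk]

lemma Xe_piece (hT : 0 < T) (x : V d) {n k : ℕ} (hk : k < 2^n) (ω : Om d (2^n)) {t : ℝ}
    (h1 : gr T n k ≤ t) (h2 : t ≤ gr T n (k+1)) :
    Yc hT t (Xe F1 F2 σ x T n ω) = Zc F1 F2 σ x (2^n) (T/2^n) k ω + (t / (T/2^n) - k) •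
      (Zc F1 F2 σ x (2^n) (T/2^n) (k+1) ω - Zc F1 F2 σ x (2^n) (T/2^n) k ω) := by
  unfold Xe
  rw [Yc_Xp hT _ _ _ ⟨(gr_mem hT hk.le).1.trans h1, h2.trans (gr_mem hT hk).2⟩]
  unfold gr at h1 h2
  push_cast at h2
  rw [XR_piece _ (by positivity) hk h1 h2]

lemma Xe_mom [NeZero d] (H : Hyp F1 F2 σ D c C b1 b2 b3 η) (x : V d) (hT : 0 < T) :
    ∃ K, 0 ≤ K ∧ ∀ n m k, k < 2^m → ∫⁻ ω, ENNReal.ofReal (‖Yc hT (gr T m (k+1)) ω - Yc hT (gr T m k) ω‖^4)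
      ∂(pn (Xe F1 F2 σ x T n)) ≤ ENNReal.ofReal (K * (1/4)^m) := by
  obtain ⟨K, hK0, hK⟩ := Zc_inc H x hT
  refine ⟨K * T^2, by positivity, fun n m k hk => ?_⟩
  rw [pn_lint _ (f := fun ω => ‖Yc hT (gr T m (k+1)) ω - Yc hT (gr T m k) ω‖^4)
    (((Yc_cont1 hT _).sub (Yc_cont1 hT _)).norm.pow 4).measurable (fun _ => by positivity)]
  refine ENNReal.ofReal_le_ofReal ?_
  have hNh : ((2^n : ℕ):ℝ) * (T/2^n) ≤ T := by push_cast; field_simp; exact le_rfl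
  have e4 : (1/4:ℝ)^m = (1/2^m)^2 := by
    rw [← _root_.one_div_pow, ← pow_mul, mul_comm m 2, pow_mul]; norm_num
  rcases le_or_gt m n with hmn | hmn
  · have hp : k * 2^(n-m) + 2^(n-m) ≤ 2^n := by
      calc k * 2^(n-m) + 2^(n-m) = (k+1) * 2^(n-m) := by ring
        _ ≤ 2^m * 2^(n-m) := Nat.mul_le_mul_right _ hk
        _ = 2^n := by rw [← pow_add]; congr 1; omega
    have := hK (2^n) (T/2^n) (by positivity) hNh (k * 2^(n-m)) (2^(n-m)) hp
    rw [gr_refine T hmn (k+1), gr_refine T hmn k, show (k+1) * 2^(n-m) = k * 2^(n-m) + 2^(n-m) by ring]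
    simp only [Xe_grid hT x (le_of_add_le_left hp), Xe_grid hT x hp]
    refine this.trans (le_of_eq ?_)
    obtain ⟨p, rfl⟩ := Nat.exists_eq_add_of_le hmn
    rw [Nat.add_sub_cancel_left, e4, pow_add]
    push_cast
    field_simp
  · obtain ⟨p, rfl⟩ := Nat.exists_eq_add_of_le hmn.le
    set j := k / 2^p with hj
    have hq : 0 < 2^p := by positivity
    have j1 : j * 2^p ≤ k := Nat.div_mul_le_self _ _
    have j2 : k + 1 ≤ (j+1) * 2^p := by
      have := Nat.lt_div_mul_add hq (a := k)
      rw [← hj] at this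
      have e : (j+1) * 2^p = j * 2^p + 2^p := by ring
      omega
    have j3 : j < 2^n := by
      rw [hj]; refine Nat.div_lt_of_lt_mul ?_
      rwa [mul_comm, ← pow_add]
    have gm : ∀ a b : ℕ, a ≤ b → gr T (n+p) a ≤ gr T (n+p) b := by
      intro a b hab
      unfold gr
      have : (a:ℝ) ≤ b := by exact_mod_cast hab
      gcongr
    have g1 : gr T n j ≤ gr T (n+p) k := by
      rw [gr_refine T (Nat.le_add_right n p), Nat.add_sub_cancel_left]; exact gm _ _ j1
    have g2 : gr T (n+p) (k+1) ≤ gr T n (j+1) := by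
      rw [gr_refine T (Nat.le_add_right n p) (j+1), Nat.add_sub_cancel_left]; exact gm _ _ j2
    have g3 := gm k (k+1) (by omega)
    have hq1 : (1/2^p:ℝ) ≤ 1 := by
      rw [div_le_one (by positivity)]; exact one_le_pow₀ (by norm_num)
    have := hK (2^n) (T/2^n) (by positivity) hNh j 1 (by omega)
    have step : ∀ ω, ‖Yc hT (gr T (n+p) (k+1)) (Xe F1 F2 σ x T n ω) - Yc hT (gr T (n+p) k) (Xe F1 F2 σ x T n ω)‖^4 =
        (1/2^p)^4 * ‖Zc F1 F2 σ x (2^n) (T/2^n) (j+1) ω - Zc F1 F2 σ x (2^n) (T/2^n) j ω‖^4 := by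
      intro ω
      rw [Xe_piece hT x j3 ω (g1.trans g3) g2, Xe_piece hT x j3 ω g1 (g3.trans g2), add_sub_add_left_eq_sub, ← sub_smul,
        norm_smul, mul_pow]
      congr 2
      rw [Real.norm_eq_abs, show gr T (n+p) (k+1) / (T/2^n) - j - (gr T (n+p) k / (T/2^n) - j) = 1/2^p by
        unfold gr; push_cast; rw [pow_add]; field_simp; ring, abs_of_pos (by positivity)]
    simp only [step]
    rw [EE_mul]
    refine (mul_le_mul_of_nonneg_left this (by positivity)).trans ?_
    rw [e4, pow_add]
    have h0 : (0:ℝ) ≤ 1/2^p := by positivity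
    calc (1/2^p:ℝ)^4 * (K * ((1:ℕ) * (T/2^n))^2) ≤ (1/2^p)^2 * (K * ((1:ℕ) * (T/2^n))^2) := by
          gcongr ?_ * _
          exact pow_le_pow_of_le_one h0 hq1 (by norm_num)
      _ = K * T^2 * (1/(2^n*2^p))^2 := by push_cast; field_simp

end

end

section

open Filter Topology ENNReal

/-! ### Part W: approximate martingale property of the polygonal paths -/

section
variable {d : ℕ} {F1 F2 : ℝ → E d → E d → E d} {σ D : ℝ → E d → E d → Matrix (Fin d) (Fin d) ℝ}
  {c C b1 b2 b3 η : ℝ} {T : ℝ}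

lemma fd_zero {φ : V d → ℝ} {y : V d} (hy : y ∉ tsupport φ) (v : V d) :
    y ∉ tsupport (fun y => fderiv ℝ φ y v) := by
  intro h
  refine hy (tsupport_fderiv_subset ℝ ?_)
  exact closure_mono (fun z hz => by
    rw [Function.mem_support] at *; intro e; rw [e] at hz; simp at hz) h

lemma gen_zero {φ : V d → ℝ} {y : V d} (hy : y ∉ tsupport φ) (t : ℝ) : gen F1 F2 (aσ σ) φ t y = 0 := by
  have h1 : ∀ v, fderiv ℝ φ y v = 0 := fun v =>
    image_eq_zero_of_notMem_tsupport (f := fun y => fderiv ℝ φ y v) (fd_zero hy v)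
  have h2 : ∀ v w, fderiv ℝ (fun y => fderiv ℝ φ y v) y w = 0 := fun v w =>
    image_eq_zero_of_notMem_tsupport (f := fun y => fderiv ℝ (fun y => fderiv ℝ φ y v) y w) (fd_zero (fd_zero hy v) w)
  unfold gen
  simp [h1, h2]

lemma gen_uc (H : Hyp F1 F2 σ D c C b1 b2 b3 η) {φ : V d → ℝ} (hφ : ContDiff ℝ (⊤ : ℕ∞) φ)
    (hs : HasCompactSupport φ) (T : ℝ) {ε : ℝ} (hε : 0 < ε) :
    ∃ Q, 0 ≤ Q ∧ ∀ u ∈ Icc 0 T, ∀ u' ∈ Icc 0 T, ∀ y y' : V d,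
      |gen F1 F2 (aσ σ) φ u y - gen F1 F2 (aσ σ) φ u' y'| ≤ ε + Q * (|u - u'| + ‖y - y'‖) := by
  obtain ⟨K, hK0, hK⟩ := gen_bdd H hφ hs
  set G : ℝ × V d → ℝ := fun p => clp (p.1 + 1) * clp (T + 1 - p.1) * gen F1 F2 (aσ σ) φ p.1 p.2 with hG
  have cG : Continuous G := ((clp_cont.comp (continuous_fst.add continuous_const)).mul
    (clp_cont.comp (continuous_const.sub continuous_fst))).mul (gen_cont H hφ)
  have sG : HasCompactSupport G := by
    refine HasCompactSupport.intro ((isCompact_Icc (a := (-1:ℝ)) (b := T+1)).prod hs.isCompact) fun p hp => ?_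
    simp only [hG]
    by_cases h1 : p.2 ∈ tsupport φ
    · by_cases h2 : p.1 < -1
      · rw [clp_le (by linarith)]; ring
      · rw [clp_le (u := T + 1 - p.1), mul_zero, zero_mul]
        by_contra h3
        exact hp ⟨⟨by linarith, by linarith⟩, h1⟩
    · rw [gen_zero h1, mul_zero]
  have eG : ∀ u ∈ Icc 0 T, ∀ y, G (u, y) = gen F1 F2 (aσ σ) φ u y := by
    intro u hu y
    simp only [hG]
    rw [clp_ge (by linarith [hu.1]), clp_ge (by linarith [hu.2]), one_mul, one_mul]
  obtain ⟨δ, hδ, h⟩ := Metric.uniformContinuous_iff.1 (sG.uniformContinuous_of_continuous cG) ε hε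
  refine ⟨2 * K / δ, by positivity, fun u hu u' hu' y y' => ?_⟩
  by_cases hd : dist (u, y) (u', y') < δ
  · have := h hd
    rw [Real.dist_eq, eG u hu, eG u' hu'] at this
    refine this.le.trans (le_add_of_nonneg_right (by positivity))
  · push Not at hd
    have hd' : δ ≤ |u - u'| + ‖y - y'‖ := by
      refine hd.trans ?_
      rw [Prod.dist_eq, Real.dist_eq, dist_eq_norm]
      exact max_le (le_add_of_nonneg_right (norm_nonneg _)) (le_add_of_nonneg_left (abs_nonneg _))
    calc _ ≤ |gen F1 F2 (aσ σ) φ u y| + |gen F1 F2 (aσ σ) φ u' y'| := abs_sub _ _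
      _ ≤ K + K := add_le_add (hK _ _) (hK _ _)
      _ = 2 * K / δ * δ := by field_simp; ring
      _ ≤ 2 * K / δ * (|u - u'| + ‖y - y'‖) := by gcongr
      _ ≤ _ := le_add_of_nonneg_left hε.le

lemma cube_trick {a r : ℝ} (ha : 0 ≤ a) (hr : 0 < r) : a ≤ r + a^4 / r^3 := by
  rcases le_total a r with h | h
  · exact h.trans (le_add_of_nonneg_right (by positivity))
  · refine le_add_of_nonneg_of_le hr.le ?_
    rw [le_div_iff₀ (by positivity)]
    have : r^3 ≤ a^3 := by gcongr
    nlinarith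

lemma step_riem (H : Hyp F1 F2 σ D c C b1 b2 b3 η) {φ : V d → ℝ} (hφ : ContDiff ℝ (⊤ : ℕ∞) φ)
    (hT : 0 < T) (x : V d) {ε Q : ℝ} (hQ : 0 ≤ Q)
    (hu : ∀ u ∈ Icc 0 T, ∀ u' ∈ Icc 0 T, ∀ y y' : V d,
      |gen F1 F2 (aσ σ) φ u y - gen F1 F2 (aσ σ) φ u' y'| ≤ ε + Q * (|u - u'| + ‖y - y'‖)) {n k : ℕ} (hk : k < 2^n)
    (ω : Om d (2^n)) :
    |T/2^n * gen F1 F2 (aσ σ) φ (k * (T/2^n)) (Zc F1 F2 σ x (2^n) (T/2^n) k ω) -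
      ∫ u in (gr T n k)..(gr T n (k+1)), gen F1 F2 (aσ σ) φ u (Yc hT u (Xe F1 F2 σ x T n ω))| ≤
      (ε + Q * (T/2^n + ‖Zc F1 F2 σ x (2^n) (T/2^n) (k+1) ω - Zc F1 F2 σ x (2^n) (T/2^n) k ω‖)) * (T/2^n) := by
  have hh : 0 < T/2^n := by positivity
  have e : gr T n (k+1) - gr T n k = T/2^n := by unfold gr; push_cast; ring
  have m1 := gr_mem hT hk.le
  have m2 := gr_mem hT (Nat.succ_le_of_lt hk)
  have e2 : T/2^n * gen F1 F2 (aσ σ) φ (k * (T/2^n)) (Zc F1 F2 σ x (2^n) (T/2^n) k ω) =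
      ∫ u in (gr T n k)..(gr T n (k+1)), gen F1 F2 (aσ σ) φ (k * (T/2^n)) (Zc F1 F2 σ x (2^n) (T/2^n) k ω) := by
    rw [intervalIntegral.integral_const, e, smul_eq_mul]
  rw [e2, ← intervalIntegral.integral_sub intervalIntegrable_const (gen_path_int hT H hφ _ _ _), ← Real.norm_eq_abs]
  refine (intervalIntegral.norm_integral_le_of_norm_le_const (C := (ε + Q * (T/2^n + ‖Zc F1 F2 σ x (2^n) (T/2^n) (k+1) ω - Zc F1 F2 σ x (2^n) (T/2^n) k ω‖))) fun u hu' => ?_).trans (le_of_eq ?_)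
  · rw [uIoc_of_le (by linarith)] at hu'
    have hu1 : u / (T/2^n) - k ≤ 1 := by
      rw [sub_le_iff_le_add, div_le_iff₀ hh]
      have := hu'.2; unfold gr at this; push_cast at this; linarith
    have hu0 : 0 ≤ u / (T/2^n) - k := by
      rw [sub_nonneg, le_div_iff₀ hh]
      have := hu'.1; unfold gr at this; exact this.le
    rw [Real.norm_eq_abs, Xe_piece hT x hk ω hu'.1.le hu'.2]
    refine (hu _ m1 _ ⟨m1.1.trans hu'.1.le, hu'.2.trans m2.2⟩ _ _).trans ?_
    gcongr
    · have := hu'.1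
      rw [abs_sub_comm, abs_of_nonneg (by linarith)]; linarith [hu'.2]
    · rw [sub_add_cancel_left, norm_neg, norm_smul, Real.norm_eq_abs, abs_of_nonneg hu0]
      exact mul_le_of_le_one_left (norm_nonneg _) hu1
  · rw [e, abs_of_pos hh]

lemma approx_mart [NeZero d] (H : Hyp F1 F2 σ D c C b1 b2 b3 η) {φ : V d → ℝ} (hφ : ContDiff ℝ (⊤ : ℕ∞) φ)
    (hs : HasCompactSupport φ) (hT : 0 < T) (x : V d) {ε : ℝ} (hε : 0 < ε) :
    ∃ Q, 0 ≤ Q ∧ ∀ n k0 k1 : ℕ, k0 ≤ k1 → k1 ≤ 2^n → ∀ Φ : Om d (2^n) → ℝ, (∀ ω, |Φ ω| ≤ 1) →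
      (∀ ω b (l : Fin (2^n)), k0 ≤ l → Φ (Function.update ω l b) = Φ ω) →
      |EE (fun ω => Φ ω * (φ (Yc hT (gr T n k1) (Xe F1 F2 σ x T n ω)) - φ (Yc hT (gr T n k0) (Xe F1 F2 σ x T n ω))
        - ∫ u in (gr T n k0)..(gr T n k1), gen F1 F2 (aσ σ) φ u (Yc hT u (Xe F1 F2 σ x T n ω))))| ≤
        T * (ε + Q * (T/2^n + √(T/2^n))) := by
  obtain ⟨K, hK0, hK⟩ := chain_step H hφ hs hT x
  obtain ⟨K2, hK20, hK2⟩ := Zc_inc H x hT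
  obtain ⟨Q, hQ0, hQ⟩ := gen_uc H hφ hs T hε
  refine ⟨K + Q * (1 + K2), by positivity, fun n k0 k1 h01 h1n Φ hΦ1 hΦ => ?_⟩
  set h := T/2^n with hh
  have h0 : 0 < h := by positivity
  have hr0 : 0 < √h := Real.sqrt_pos.2 h0
  have hr2 : √h * √h = h := Real.mul_self_sqrt h0.le
  have hNh : ((2^n : ℕ):ℝ) * h ≤ T := by rw [hh]; push_cast; field_simp; exact le_rfl
  set B := ε + (K + Q * (1 + K2)) * (h + √h) with hB
  have hB0 : 0 ≤ B := by positivity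
  suffices hind : ∀ k1, k0 ≤ k1 → k1 ≤ 2^n → |EE (fun ω => Φ ω * (φ (Yc hT (gr T n k1) (Xe F1 F2 σ x T n ω)) - φ (Yc hT (gr T n k0) (Xe F1 F2 σ x T n ω))
        - ∫ u in (gr T n k0)..(gr T n k1), gen F1 F2 (aσ σ) φ u (Yc hT u (Xe F1 F2 σ x T n ω))))| ≤ (k1 - k0) * (h * B) by
    refine (hind k1 h01 h1n).trans ?_
    rw [← mul_assoc]
    refine mul_le_mul_of_nonneg_right (le_trans ?_ hNh) hB0
    have : (k1:ℝ) ≤ (2^n:ℕ) := by exact_mod_cast h1n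
    refine mul_le_mul_of_nonneg_right ?_ h0.le
    have : (0:ℝ) ≤ k0 := by positivity
    linarith
  intro k1 h01
  induction k1, h01 using Nat.le_induction with
  | base =>
    intro _
    simp [EE]
  | succ k hk ih =>
    intro hk1
    have hkN : k < 2^n := hk1
    have ih := ih hkN.le
    have s1 := hK (2^n) h h0.le hNh k hkN Φ hΦ1 (fun ω b => hΦ ω b ⟨k, hkN⟩ hk)
    have s2 : |EE (fun ω => Φ ω * (h * gen F1 F2 (aσ σ) φ (k * h) (Zc F1 F2 σ x (2^n) h k ω) -
        ∫ u in (gr T n k)..(gr T n (k+1)), gen F1 F2 (aσ σ) φ u (Yc hT u (Xe F1 F2 σ x T n ω))))| ≤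
        h * (ε + Q * (1 + K2) * (h + √h)) := by
      refine (EE_abs _).trans ((EE_mono (g := fun ω => (ε + Q * (h + √h)) * h + (Q * h / (√h)^3) *
        ‖Zc F1 F2 σ x (2^n) h (k+1) ω - Zc F1 F2 σ x (2^n) h k ω‖^4) fun ω => ?_).trans ?_)
      · rw [abs_mul]
        refine (mul_le_of_le_one_left (abs_nonneg _) (hΦ1 ω)).trans
          ((step_riem H hφ hT x hQ0 hQ hkN ω).trans ?_)
        have := cube_trick (norm_nonneg (Zc F1 F2 σ x (2^n) h (k+1) ω - Zc F1 F2 σ x (2^n) h k ω)) hr0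
        rw [← hh]
        calc _ ≤ (ε + Q * (h + (√h + ‖Zc F1 F2 σ x (2^n) h (k+1) ω - Zc F1 F2 σ x (2^n) h k ω‖^4 / (√h)^3))) * h := by
              gcongr
          _ = _ := by ring
      · have e := hK2 (2^n) h h0.le hNh k 1 (by omega)
        rw [EE_add, EE_const, EE_mul]
        have e' : Q * h / (√h)^3 * (K2 * ((1:ℕ) * h)^2) = Q * K2 * h * √h := by
          push_cast
          have : ∀ r : ℝ, 0 < r → Q * (r*r) / r^3 * (K2 * (1 * (r*r))^2) = Q * K2 * (r*r) * r := by
            intro r hr; field_simp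
          have := this _ hr0
          rwa [hr2] at this
        have : Q * h / (√h)^3 * EE (fun ω => ‖Zc F1 F2 σ x (2^n) h (k+1) ω - Zc F1 F2 σ x (2^n) h k ω‖^4) ≤ Q * K2 * h * √h := by
          rw [← e']; gcongr
        have p : 0 ≤ Q * K2 * h * h := by positivity
        nlinarith
    have split : (fun ω => Φ ω * (φ (Yc hT (gr T n (k+1)) (Xe F1 F2 σ x T n ω)) - φ (Yc hT (gr T n k0) (Xe F1 F2 σ x T n ω))
        - ∫ u in (gr T n k0)..(gr T n (k+1)), gen F1 F2 (aσ σ) φ u (Yc hT u (Xe F1 F2 σ x T n ω)))) = fun ω =>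
        (Φ ω * (φ (Yc hT (gr T n k) (Xe F1 F2 σ x T n ω)) - φ (Yc hT (gr T n k0) (Xe F1 F2 σ x T n ω))
        - ∫ u in (gr T n k0)..(gr T n k), gen F1 F2 (aσ σ) φ u (Yc hT u (Xe F1 F2 σ x T n ω))) +
        Φ ω * (φ (Zc F1 F2 σ x (2^n) h (k+1) ω) - φ (Zc F1 F2 σ x (2^n) h k ω)
        - h * gen F1 F2 (aσ σ) φ (k * h) (Zc F1 F2 σ x (2^n) h k ω))) +
        Φ ω * (h * gen F1 F2 (aσ σ) φ (k * h) (Zc F1 F2 σ x (2^n) h k ω) -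
        ∫ u in (gr T n k)..(gr T n (k+1)), gen F1 F2 (aσ σ) φ u (Yc hT u (Xe F1 F2 σ x T n ω))) := by
      funext ω
      rw [← intervalIntegral.integral_add_adjacent_intervals (gen_path_int hT H hφ _ _ (gr T n k)) (gen_path_int hT H hφ _ _ _),
        Xe_grid hT x hkN.le, Xe_grid hT x hk1]
      ring
    rw [split, EE_add, EE_add]
    refine (abs_add_le _ _).trans ((add_le_add ((abs_add_le _ _).trans (add_le_add ih s1)) s2).trans ?_)
    push_cast
    have : 0 ≤ h * (K * h) := by positivity
    rw [hB]
    nlinarith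

end

end

section

open Filter Topology ENNReal

/-! ### Part X: weak limit -/

section
variable {d : ℕ} {F1 F2 : ℝ → E d → E d → E d} {σ D : ℝ → E d → E d → Matrix (Fin d) (Fin d) ℝ}
  {c C b1 b2 b3 η : ℝ} {T : ℝ}

lemma path_int_cont {G : ℝ × PS d T → ℝ} (hG : Continuous G) (s t : ℝ) :
    Continuous fun ω => ∫ u in s..t, G (u, ω) :=
  intervalIntegral.continuous_parametric_intervalIntegral_of_continuous' (f := fun ω u => G (u, ω))
    (hG.comp continuous_swap) s t

/-- martingale increment -/
def Dl (hT : 0 < T) (F1 F2 : ℝ → E d → E d → E d) (σ : ℝ → E d → E d → Matrix (Fin d) (Fin d) ℝ) (φ : V d → ℝ)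
    (s t : ℝ) (ω : PS d T) : ℝ :=
  φ (Yc hT t ω) - φ (Yc hT s ω) - ∫ u in s..t, gen F1 F2 (aσ σ) φ u (Yc hT u ω)

lemma Dl_cont (hT : 0 < T) (H : Hyp F1 F2 σ D c C b1 b2 b3 η) {φ : V d → ℝ} (hφ : ContDiff ℝ (⊤ : ℕ∞) φ) (s t : ℝ) :
    Continuous (Dl hT F1 F2 σ φ s t) := by
  unfold Dl
  refine ((hφ.continuous.comp (Yc_cont1 hT t)).sub (hφ.continuous.comp (Yc_cont1 hT s))).sub ?_
  exact path_int_cont (G := fun p => gen F1 F2 (aσ σ) φ p.1 (Yc hT p.1 p.2)) (gen_path_cont hT H hφ) s t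

lemma Dl_bdd (hT : 0 < T) (H : Hyp F1 F2 σ D c C b1 b2 b3 η) {φ : V d → ℝ} (hφ : ContDiff ℝ (⊤ : ℕ∞) φ)
    (hs : HasCompactSupport φ) : ∃ M, 0 ≤ M ∧ ∀ s ∈ Icc 0 T, ∀ t ∈ Icc 0 T, ∀ ω, |Dl hT F1 F2 σ φ s t ω| ≤ M := by
  obtain ⟨K, hK0, hK⟩ := gen_bdd H hφ hs
  obtain ⟨B, hB⟩ := hs.exists_bound_of_continuous hφ.continuous
  have hB0 := (norm_nonneg _).trans (hB 0)
  refine ⟨B + B + K * T, by positivity, fun s hs t ht ω => ?_⟩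
  unfold Dl
  refine (abs_sub _ _).trans (add_le_add ((abs_sub _ _).trans (add_le_add (hB _) (hB _))) ?_)
  rw [← Real.norm_eq_abs]
  refine (intervalIntegral.norm_integral_le_of_norm_le_const (C := K) fun u _ => hK _ _).trans ?_
  gcongr
  rw [abs_le]; constructor <;> linarith [hs.1, hs.2, ht.1, ht.2]

lemma Dl_lim (hT : 0 < T) (H : Hyp F1 F2 σ D c C b1 b2 b3 η) {φ : V d → ℝ} (hφ : ContDiff ℝ (⊤ : ℕ∞) φ)
    (ω : PS d T) {s t : ℕ → ℝ} {s0 t0 : ℝ} (h1 : Tendsto s atTop (𝓝 s0)) (h2 : Tendsto t atTop (𝓝 t0)) :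
    Tendsto (fun n => Dl hT F1 F2 σ φ (s n) (t n) ω) atTop (𝓝 (Dl hT F1 F2 σ φ s0 t0 ω)) := by
  have cφ : Continuous fun t => φ (Yc hT t ω) := hφ.continuous.comp (Yc_cont hT ω)
  have cI : Continuous fun t => ∫ u in (0:ℝ)..t, gen F1 F2 (aσ σ) φ u (Yc hT u ω) :=
    intervalIntegral.continuous_primitive (fun a b => gen_path_int hT H hφ ω a b) 0
  have e : ∀ s t, Dl hT F1 F2 σ φ s t ω = φ (Yc hT t ω) - φ (Yc hT s ω) -
      ((∫ u in (0:ℝ)..t, gen F1 F2 (aσ σ) φ u (Yc hT u ω)) - ∫ u in (0:ℝ)..s, gen F1 F2 (aσ σ) φ u (Yc hT u ω)) := by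
    intro s t
    rw [intervalIntegral.integral_interval_sub_left (gen_path_int hT H hφ ω _ _) (gen_path_int hT H hφ ω _ _)]
    rfl
  simp only [e]
  exact (((cφ.tendsto _).comp h2).sub ((cφ.tendsto _).comp h1)).sub (((cI.tendsto _).comp h2).sub ((cI.tendsto _).comp h1))

instance om_ne [NeZero d] (N : ℕ) : Nonempty (Om d N) := ⟨fun _ => (⟨0, Nat.pos_of_ne_zero (NeZero.ne d)⟩, true)⟩

lemma Xe_zero (hT : 0 < T) (x : V d) (n : ℕ) (ω : Om d (2^n)) :
    (Xe F1 F2 σ x T n ω) ⟨0, left_mem_Icc.2 hT.le⟩ = x := by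
  have := Xe_grid (F1 := F1) (F2 := F2) (σ := σ) hT x (n := n) (k := 0) (by positivity) ω
  unfold gr Yc at this
  simp only [Nat.cast_zero, zero_mul, projIcc_left] at this
  exact this

lemma ini_closed (hT : 0 < T) (x : V d) : IsClosed {ω : PS d T | ω ⟨0, left_mem_Icc.2 hT.le⟩ = x} :=
  isClosed_eq (ContinuousEvalConst.continuous_eval_const _) continuous_const

lemma weak_lim [NeZero d] (H : Hyp F1 F2 σ D c C b1 b2 b3 η) (x : V d) (hT : 0 < T) :
    ∃ P : Measure (PS d T), IsProbabilityMeasure P ∧ ∀ f : PS d T → ℝ, Continuous f → (∃ B, ∀ ω, |f ω| ≤ B) →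
      Tendsto (fun n => EE (fun ω => f (Xe F1 F2 σ x T n ω))) (hyperfilter ℕ) (𝓝 (∫ ω, f ω ∂P)) := by
  obtain ⟨K, hK0, hK⟩ := Xe_mom H x hT
  let μ : ℕ → ProbabilityMeasure (PS d T) := fun n => ⟨pn (Xe F1 F2 σ x T n), pn_prob _⟩
  have ht : IsTightMeasureSet {((m : ProbabilityMeasure (PS d T)) : Measure (PS d T)) | m ∈ range μ} := by
    rw [isTightMeasureSet_iff_exists_isCompact_measure_compl_le]
    intro ε hε
    obtain ⟨S, hS, h⟩ := tight hT x hK0 hε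
    refine ⟨S, hS, ?_⟩
    rintro _ ⟨_, ⟨n, rfl⟩, rfl⟩
    exact h _ (pn_null _ (ini_closed hT x).measurableSet.compl fun ω => by simpa using Xe_zero hT x n ω) (hK n)
  have hc := isCompact_closure_of_isTightMeasureSet ht
  obtain ⟨P, -, hP⟩ := hc.ultrafilter_le_nhds ((hyperfilter ℕ).map μ) (by
    rw [le_principal_iff]
    exact mem_of_superset (mem_map.2 (univ_mem' fun n => mem_range_self n)) subset_closure)
  have hP : Tendsto μ (hyperfilter ℕ) (𝓝 P) := hP
  rw [ProbabilityMeasure.tendsto_iff_forall_integral_tendsto] at hP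
  refine ⟨P, inferInstance, fun f hf ⟨B, hB⟩ => ?_⟩
  have := hP (BoundedContinuousFunction.ofNormedAddCommGroup f hf B hB)
  refine this.congr fun n => ?_
  exact pn_int _ hf.measurable

lemma lim_ini [NeZero d] (x : V d) (hT : 0 < T) {P : Measure (PS d T)} [IsProbabilityMeasure P]
    (hP : ∀ f : PS d T → ℝ, Continuous f → (∃ B, ∀ ω, |f ω| ≤ B) →
      Tendsto (fun n => EE (fun ω => f (Xe F1 F2 σ x T n ω))) (hyperfilter ℕ) (𝓝 (∫ ω, f ω ∂P))) :
    P {ω | ω ⟨0, left_mem_Icc.2 hT.le⟩ = x} = 1 := by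
  set f : PS d T → ℝ := fun ω => min 1 ‖ω ⟨0, left_mem_Icc.2 hT.le⟩ - x‖ with hf
  have cf : Continuous f := continuous_const.min
    ((ContinuousEvalConst.continuous_eval_const _).sub continuous_const).norm
  have f0 : ∀ ω, 0 ≤ f ω := fun ω => le_min zero_le_one (norm_nonneg _)
  have fb : ∀ ω, |f ω| ≤ 1 := fun ω => by rw [abs_of_nonneg (f0 ω)]; exact min_le_left _ _
  have h := hP f cf ⟨1, fb⟩
  have e : ∀ n, EE (fun ω => f (Xe F1 F2 σ x T n ω)) = 0 := by
    intro n
    simp [hf, Xe_zero hT x n, EE]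
  simp only [e] at h
  have h0 : ∫ ω, f ω ∂P = 0 := tendsto_nhds_unique h tendsto_const_nhds
  rw [integral_eq_zero_iff_of_nonneg f0 (Integrable.of_bound cf.aestronglyMeasurable 1 (ae_of_all _ fb))] at h0
  rw [← prob_compl_eq_zero_iff (ini_closed hT x).measurableSet]
  refine measure_mono_null (fun ω hω => ?_) (ae_iff.1 h0)
  intro e
  apply hω
  have e : min 1 ‖ω ⟨0, left_mem_Icc.2 hT.le⟩ - x‖ = 0 := e
  rcases min_choice 1 ‖ω ⟨0, left_mem_Icc.2 hT.le⟩ - x‖ with h | h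
  · rw [h] at e; norm_num at e
  · rw [h] at e
    exact sub_eq_zero.1 (norm_eq_zero.1 e)

lemma lim_dyadic [NeZero d] (H : Hyp F1 F2 σ D c C b1 b2 b3 η) {φ : V d → ℝ} (hφ : ContDiff ℝ (⊤ : ℕ∞) φ)
    (hs : HasCompactSupport φ) (x : V d) (hT : 0 < T) {P : Measure (PS d T)}
    (hP : ∀ f : PS d T → ℝ, Continuous f → (∃ B, ∀ ω, |f ω| ≤ B) →
      Tendsto (fun n => EE (fun ω => f (Xe F1 F2 σ x T n ω))) (hyperfilter ℕ) (𝓝 (∫ ω, f ω ∂P)))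
    {Ψ : PS d T → ℝ} (cΨ : Continuous Ψ) (bΨ : ∀ ω, |Ψ ω| ≤ 1) {m k0 k1 : ℕ} (h01 : k0 ≤ k1) (h1 : k1 ≤ 2^m)
    (hΨ : ∀ ω ω' : PS d T, (∀ r : Icc (0:ℝ) T, (r:ℝ) ≤ gr T m k0 → ω r = ω' r) → Ψ ω = Ψ ω') :
    ∫ ω, Ψ ω * Dl hT F1 F2 σ φ (gr T m k0) (gr T m k1) ω ∂P = 0 := by
  have m0 := gr_mem hT (h01.trans h1)
  have m1 := gr_mem hT h1
  obtain ⟨M, hM0, hM⟩ := Dl_bdd hT H hφ hs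
  have hlim := hP (fun ω => Ψ ω * Dl hT F1 F2 σ φ (gr T m k0) (gr T m k1) ω) (cΨ.mul (Dl_cont hT H hφ _ _))
    ⟨M, fun ω => by
      rw [abs_mul]
      exact (mul_le_of_le_one_left (abs_nonneg _) (bΨ ω)).trans (hM _ m0 _ m1 ω)⟩
  refine abs_eq_zero.1 (le_antisymm (le_of_forall_pos_le_add fun ε hε => ?_) (abs_nonneg _))
  obtain ⟨Q, hQ0, hQ⟩ := approx_mart H hφ hs hT x (ε := ε / T) (by positivity)
  have hh : Tendsto (fun n : ℕ => T / 2^n) atTop (𝓝 0) := by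
    have := (tendsto_pow_atTop_nhds_zero_of_lt_one (r := (1/2:ℝ)) (by norm_num) (by norm_num)).const_mul T
    rw [mul_zero] at this
    refine this.congr fun n => ?_
    rw [_root_.one_div_pow]; ring
  have hup : Tendsto (fun n : ℕ => T * (ε / T + Q * (T/2^n + √(T/2^n)))) atTop (𝓝 (T * (ε / T + Q * (0 + √0)))) :=
    ((hh.add ((Real.continuous_sqrt.tendsto _).comp hh)).const_mul Q).const_add _ |>.const_mul T
  have hfin : T * (ε / T + Q * (0 + √0)) = 0 + ε := by rw [Real.sqrt_zero]; field_simp; ring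
  rw [hfin] at hup
  refine le_of_tendsto_of_tendsto hlim.abs (hup.mono_left Nat.hyperfilter_le_atTop)
    (Filter.Eventually.filter_mono Nat.hyperfilter_le_atTop ?_)
  filter_upwards [eventually_ge_atTop m] with n hn
  have hpos : 0 < 2^(n-m) := by positivity
  have hk1 : k1 * 2^(n-m) ≤ 2^n := by
    calc k1 * 2^(n-m) ≤ 2^m * 2^(n-m) := Nat.mul_le_mul_right _ h1
      _ = 2^n := by rw [← pow_add]; congr 1; omega
  have e0 := gr_refine T hn k0
  rw [gr_refine T hn k0, gr_refine T hn k1]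
  refine hQ n (k0 * 2^(n-m)) (k1 * 2^(n-m)) (Nat.mul_le_mul_right _ h01) hk1 (fun ω => Ψ (Xe F1 F2 σ x T n ω))
    (fun ω => bΨ _) (fun ω b l hl => hΨ _ _ fun r hr => ?_)
  rw [e0] at hr
  unfold Xe Xp
  exact XR_congr (by positivity) ((Nat.mul_le_mul_right _ h01).trans hk1) (by simpa [gr] using hr)
    fun j hj => Zc_upd x _ l b ω j (hj.trans hl)

/-- dyadic approximation from above -/
def sd (T s : ℝ) (n : ℕ) : ℕ := ⌈s * 2^n / T⌉₊

lemma sd_le (hT : 0 < T) {s : ℝ} (hs : s ≤ T) (n : ℕ) : sd T s n ≤ 2^n := by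
  unfold sd
  rw [Nat.ceil_le, div_le_iff₀ hT]
  push_cast
  rw [mul_comm]
  gcongr

lemma sd_ge (hT : 0 < T) (s : ℝ) (n : ℕ) : s ≤ gr T n (sd T s n) := by
  unfold gr sd
  have := Nat.le_ceil (s * 2^n / T)
  rw [div_le_iff₀ hT] at this
  rw [← mul_div_assoc, le_div_iff₀ (by positivity)]
  exact this

lemma sd_lim (hT : 0 < T) {s : ℝ} (hs : 0 ≤ s) : Tendsto (fun n => gr T n (sd T s n)) atTop (𝓝 s) := by
  have hh : Tendsto (fun n : ℕ => s + T / 2^n) atTop (𝓝 (s + 0)) := by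
    have := (tendsto_pow_atTop_nhds_zero_of_lt_one (r := (1/2:ℝ)) (by norm_num) (by norm_num)).const_mul T
    rw [mul_zero] at this
    refine (this.const_add s).congr fun n => ?_
    rw [_root_.one_div_pow]; ring
  rw [add_zero] at hh
  refine tendsto_of_tendsto_of_tendsto_of_le_of_le tendsto_const_nhds hh (fun n => sd_ge hT s n) fun n => ?_
  unfold gr sd
  have := (Nat.ceil_lt_add_one (show 0 ≤ s * 2^n / T by positivity)).le
  calc _ ≤ (s * 2^n / T + 1) * (T / 2^n) := by gcongr
    _ = _ := by field_simp

lemma lim_st [NeZero d] (H : Hyp F1 F2 σ D c C b1 b2 b3 η) {φ : V d → ℝ} (hφ : ContDiff ℝ (⊤ : ℕ∞) φ)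
    (hs : HasCompactSupport φ) (x : V d) (hT : 0 < T) {P : Measure (PS d T)} [IsProbabilityMeasure P]
    (hP : ∀ f : PS d T → ℝ, Continuous f → (∃ B, ∀ ω, |f ω| ≤ B) →
      Tendsto (fun n => EE (fun ω => f (Xe F1 F2 σ x T n ω))) (hyperfilter ℕ) (𝓝 (∫ ω, f ω ∂P)))
    {Ψ : PS d T → ℝ} (cΨ : Continuous Ψ) (bΨ : ∀ ω, |Ψ ω| ≤ 1) {s t : ℝ} (h0 : 0 ≤ s) (hst : s ≤ t) (htT : t ≤ T)
    (hΨ : ∀ ω ω' : PS d T, (∀ r : Icc (0:ℝ) T, (r:ℝ) ≤ s → ω r = ω' r) → Ψ ω = Ψ ω') :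
    ∫ ω, Ψ ω * Dl hT F1 F2 σ φ s t ω ∂P = 0 := by
  obtain ⟨M, hM0, hM⟩ := Dl_bdd hT H hφ hs
  have hz : ∀ n, ∫ ω, Ψ ω * Dl hT F1 F2 σ φ (gr T n (sd T s n)) (gr T n (sd T t n)) ω ∂P = 0 := by
    intro n
    refine lim_dyadic H hφ hs x hT hP cΨ bΨ ?_ (sd_le hT htT n) fun ω ω' h => hΨ ω ω' fun r hr =>
      h r (hr.trans (sd_ge hT s n))
    unfold sd
    gcongr
  have hl : Tendsto (fun n => ∫ ω, Ψ ω * Dl hT F1 F2 σ φ (gr T n (sd T s n)) (gr T n (sd T t n)) ω ∂P) atTop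
      (𝓝 (∫ ω, Ψ ω * Dl hT F1 F2 σ φ s t ω ∂P)) := by
    refine tendsto_integral_of_dominated_convergence (fun _ => M)
      (fun n => (cΨ.mul (Dl_cont hT H hφ _ _)).aestronglyMeasurable) (integrable_const _) (fun n => ae_of_all _ fun ω => ?_)
      (ae_of_all _ fun ω => (Dl_lim hT H hφ ω (sd_lim hT h0) (sd_lim hT (h0.trans hst))).const_mul _)
    rw [norm_mul]
    exact (mul_le_of_le_one_left (abs_nonneg _) (bΨ ω)).trans (hM _ (gr_mem hT (sd_le hT (hst.trans htT) n)) _ (gr_mem hT (sd_le hT htT n)) ω)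
  simp only [hz] at hl
  exact tendsto_nhds_unique hl tendsto_const_nhds

end

end

section

open Filter Topology ENNReal

/-! ### Part Y: existence -/

section
variable {d : ℕ} {F1 F2 : ℝ → E d → E d → E d} {σ D : ℝ → E d → E d → Matrix (Fin d) (Fin d) ℝ}
  {c C b1 b2 b3 η : ℝ} {T : ℝ}

lemma int_meas {Ω : Type} {m : MeasurableSpace Ω} {u : ℝ → Ω → ℝ} (hc : ∀ ω, Continuous fun r => u r ω)
    (hm : ∀ r, Measurable (u r)) {a b : ℝ} (hab : a ≤ b) : StronglyMeasurable fun ω => ∫ r in a..b, u r ω := by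
  have h : Measurable (Function.uncurry u) := measurable_uncurry_of_continuous_of_measurable hc hm
  have h2 : StronglyMeasurable (Function.uncurry fun ω r => u r ω) := (h.comp measurable_swap).stronglyMeasurable
  simp only [intervalIntegral.integral_of_le hab]
  exact h2.integral_prod_right

lemma eval_meas {s t : Icc (0:ℝ) T} (h : s ≤ t) : Measurable[canF d T t] (fun ω : PS d T => ω s) := by
  intro B hB
  exact mev_le_canF h _ ⟨B, hB, rfl⟩

lemma Mp_adapted (hT : 0 < T) {G : ℝ × V d → ℝ} (hG : Continuous G) {φ : V d → ℝ} (hφ : Continuous φ) (t : Icc (0:ℝ) T) :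
    StronglyMeasurable[canF d T t] (fun ω : PS d T => φ (ω t) - ∫ s in (0:ℝ)..(t:ℝ), G (s, Yc hT s ω)) := by
  have h1 : StronglyMeasurable[canF d T t] (fun ω : PS d T => φ (ω t)) := by
    have : Measurable[canF d T t] (fun ω : PS d T => φ (ω t)) := hφ.measurable.comp (eval_meas le_rfl)
    exact this.stronglyMeasurable
  have e : ∀ ω : PS d T, ∫ s in (0:ℝ)..(t:ℝ), G (s, Yc hT s ω) = ∫ s in (0:ℝ)..(t:ℝ), G (s, Yc hT (min s t) ω) := by
    intro ω
    refine intervalIntegral.integral_congr fun s hs => ?_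
    rw [uIcc_of_le t.2.1] at hs
    beta_reduce
    rw [min_eq_left hs.2]
  simp only [e]
  refine h1.sub (int_meas (m := canF d T t) (u := fun r ω => G (r, Yc hT (min r t) ω)) (fun ω => ?_) (fun r => ?_) t.2.1)
  · exact hG.comp (continuous_id.prodMk ((Yc_cont hT ω).comp (continuous_id.min continuous_const)))
  · have hr : projIcc 0 T hT.le (min r t) ≤ t := by
      have := monotone_projIcc hT.le (min_le_right r (t:ℝ))
      rwa [projIcc_val] at this
    have hg : Measurable fun y : V d => G (r, y) := (hG.comp (Continuous.prodMk_right r)).measurable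
    exact hg.comp (eval_meas hr)

/-- finite-dimensional sets -/
lemma cyl_zero (P : Measure (PS d T)) [IsProbabilityMeasure P] {g : PS d T → ℝ} (cg : Continuous g) {M : ℝ} (hM0 : 0 ≤ M)
    (hM : ∀ ω, |g ω| ≤ M) (s : Icc (0:ℝ) T)
    (h : ∀ Ψ : PS d T → ℝ, Continuous Ψ → (∀ ω, |Ψ ω| ≤ 1) →
      (∀ ω ω' : PS d T, (∀ r : Icc (0:ℝ) T, r ≤ s → ω r = ω' r) → Ψ ω = Ψ ω') → ∫ ω, Ψ ω * g ω ∂P = 0)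
    {A : Set (PS d T)} (hA : MeasurableSet[canF d T s] A) : ∫ ω in A, g ω ∂P = 0 := by
  have gi : Integrable g P := Integrable.of_bound cg.aestronglyMeasurable M (ae_of_all _ hM)
  have gn : ∀ ω, 0 ≤ g ω + M := fun ω => by linarith [neg_le_of_abs_le (hM ω)]
  have gmi : Integrable (fun ω => g ω + M) P := gi.add (integrable_const M)
  set μ := P.withDensity (fun ω => ENNReal.ofReal (g ω + M)) with hμ
  set ν := ENNReal.ofReal M • P with hν
  haveI : IsFiniteMeasure μ := isFiniteMeasure_withDensity_ofReal gmi.2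
  haveI : IsFiniteMeasure ν := by rw [hν]; exact Measure.smul_finite P ENNReal.ofReal_ne_top
  have iμ : ∀ f : PS d T → ℝ, ∫ ω, f ω ∂μ = ∫ ω, (g ω + M) * f ω ∂P := by
    intro f
    have gm : Measurable fun ω => ENNReal.ofReal (g ω + M) := (cg.add continuous_const).measurable.ennreal_ofReal
    rw [hμ, integral_withDensity_eq_integral_toReal_smul gm (ae_of_all _ fun _ => ENNReal.ofReal_lt_top)]
    simp only [ENNReal.toReal_ofReal (gn _), smul_eq_mul]
  have iν : ∀ f : PS d T → ℝ, ∫ ω, f ω ∂ν = M * ∫ ω, f ω ∂P := by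
    intro f
    rw [hν, integral_smul_measure, ENNReal.toReal_ofReal hM0, smul_eq_mul]
  have key : ∀ Ψ : PS d T → ℝ, Continuous Ψ → (∃ B, 0 < B ∧ ∀ ω, |Ψ ω| ≤ B) →
      (∀ ω ω' : PS d T, (∀ r : Icc (0:ℝ) T, r ≤ s → ω r = ω' r) → Ψ ω = Ψ ω') → ∫ ω, Ψ ω ∂μ = ∫ ω, Ψ ω ∂ν := by
    intro Ψ cΨ ⟨B, hB0, hB⟩ hΨ
    have Ψi : Integrable Ψ P := Integrable.of_bound cΨ.aestronglyMeasurable B (ae_of_all _ hB)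
    have h1 := h (fun ω => B⁻¹ * Ψ ω) (continuous_const.mul cΨ) (fun ω => by
      rw [abs_mul, abs_of_pos (inv_pos.2 hB0), inv_mul_le_one₀ hB0]; exact hB ω) (fun ω ω' hh => by
      beta_reduce; rw [hΨ ω ω' hh])
    have h2 : ∫ ω, Ψ ω * g ω ∂P = 0 := by
      simp only [mul_assoc, integral_const_mul] at h1
      exact (mul_eq_zero.1 h1).resolve_left (inv_ne_zero hB0.ne')
    have hΨg : Integrable (fun ω => Ψ ω * g ω) P := by
      refine Integrable.of_bound (cΨ.mul cg).aestronglyMeasurable (B * M) (ae_of_all _ fun ω => ?_)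
      rw [norm_mul]
      exact mul_le_mul (hB ω) (hM ω) (norm_nonneg _) hB0.le
    rw [iμ, iν]
    have : ∀ ω, (g ω + M) * Ψ ω = Ψ ω * g ω + M * Ψ ω := fun ω => by ring
    simp only [this]
    rw [integral_add hΨg (Ψi.const_mul M), h2, integral_const_mul, zero_add]
  have hset : μ A = ν A := by
    refine ext_on_measurableSpace_of_generate_finite pathMeasurableSpace
      (piiUnionInter (fun t => {s | MeasurableSet[mev d T t] s}) (Iic s)) ?_ ((canF d T).le s)
      ((canF_eq s).trans (generateFrom_piiUnionInter_measurableSet (mev d T) (Iic s)).symm)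
      (isPiSystem_piiUnionInter _ (fun t => @MeasurableSpace.isPiSystem_measurableSet _ (mev d T t)) _) ?_ hA
    · rintro _ ⟨I, hI, f, hf, rfl⟩
      let e : PS d T → (I → V d) := fun ω i => ω i
      have ce : Continuous e := continuous_pi fun i => ContinuousEvalConst.continuous_eval_const _
      have hmap : μ.map e = ν.map e := by
        refine ext_of_forall_integral_eq_of_IsFiniteMeasure fun f => ?_
        rw [integral_map ce.measurable.aemeasurable f.continuous.aestronglyMeasurable,
          integral_map ce.measurable.aemeasurable f.continuous.aestronglyMeasurable]
        refine key _ (f.continuous.comp ce) ⟨‖f‖ + 1, by positivity, fun ω => (f.norm_coe_le_norm _).trans (by linarith)⟩ fun ω ω' hh => ?_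
        have : e ω = e ω' := funext fun i => hh i (hI i.2)
        simp only [Function.comp, this]
      have hB : ∀ i : I, ∃ B : Set (V d), MeasurableSet B ∧ (fun ω : PS d T => ω i) ⁻¹' B = f i := fun i => hf i i.2
      choose B hBm hBe using hB
      have hS : (⋂ i ∈ I, f i) = e ⁻¹' (Set.pi univ B) := by
        ext ω
        simp only [mem_iInter, mem_preimage, mem_univ_pi, e]
        constructor
        · intro hh i
          have := hh i i.2
          rw [← hBe i] at this
          exact this
        · intro hh i hi
          have := hBe ⟨i, hi⟩
          rw [← this]
          exact hh ⟨i, hi⟩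
      have hSm : MeasurableSet (Set.pi univ B) := MeasurableSet.univ_pi hBm
      rw [hS, ← Measure.map_apply ce.measurable hSm, ← Measure.map_apply ce.measurable hSm, hmap]
    · have := key (fun _ => 1) continuous_const ⟨1, one_pos, fun _ => by simp⟩ fun _ _ _ => rfl
      simp only [integral_const, smul_eq_mul, mul_one] at this
      rwa [measureReal_eq_measureReal_iff] at this
  have hAm : MeasurableSet A := (canF d T).le s _ hA
  have h3 : ∫ ω in A, (g ω + M) ∂P = M * P.real A := by
    have e1 : μ A = ENNReal.ofReal (∫ ω in A, (g ω + M) ∂P) := by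
      rw [hμ, withDensity_apply _ hAm, ofReal_integral_eq_lintegral_ofReal gmi.integrableOn (ae_of_all _ gn)]
    have e2 : ν A = ENNReal.ofReal (M * P.real A) := by
      rw [hν, Measure.smul_apply, smul_eq_mul, ENNReal.ofReal_mul hM0, ofReal_measureReal]
    rw [e1, e2, ENNReal.ofReal_eq_ofReal_iff (integral_nonneg gn) (by positivity)] at hset
    exact hset
  rw [integral_add gi.integrableOn (integrable_const M).integrableOn] at h3
  simp only [setIntegral_const, smul_eq_mul] at h3
  linarith

theorem exists_MP [NeZero d] (H : Hyp F1 F2 σ D c C b1 b2 b3 η) (x : V d) (hT : 0 < T) :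
    ∃ P, IsMP hT F1 F2 σ x P := by
  obtain ⟨P, hPp, hP⟩ := weak_lim H x hT
  refine ⟨P, hPp, lim_ini x hT hP, fun φ hφ hs => ?_⟩
  have had := fun t => Mp_adapted hT (G := fun p => gen F1 F2 (aσ σ) φ p.1 p.2) (gen_cont H hφ) hφ.continuous t
  obtain ⟨M, hM0, hM⟩ := Dl_bdd hT H hφ hs
  have hin : ∀ t, Integrable (Mp hT F1 F2 σ φ t) P := by
    intro t
    obtain ⟨B, hB⟩ := hs.exists_bound_of_continuous hφ.continuous
    have h1 : Integrable (fun ω : PS d T => φ (ω t)) P := Integrable.of_bound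
      (hφ.continuous.comp (ContinuousEvalConst.continuous_eval_const t)).measurable.aestronglyMeasurable B
      (Filter.Eventually.of_forall fun ω => hB _)
    exact h1.sub (gen_fubini hT H hφ hs P t.2.1).1
  refine ⟨had, fun s t hst => ?_⟩
  refine (ae_eq_condExp_of_forall_setIntegral_eq ((canF d T).le s) (hin t) (fun A _ _ => (hin s).integrableOn)
    (fun A hA _ => ?_) (had s).aestronglyMeasurable).symm
  have hz := cyl_zero P (Dl_cont hT H hφ s t) hM0 (hM s s.2 t t.2) s (fun Ψ cΨ bΨ hΨ =>
    lim_st H hφ hs x hT hP cΨ bΨ s.2.1 hst t.2.2 hΨ) hA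
  have e : ∀ ω, Dl hT F1 F2 σ φ s t ω = Mp hT F1 F2 σ φ t ω - Mp hT F1 F2 σ φ s ω := by
    intro ω
    unfold Dl Mp
    rw [Yc_val, Yc_val, ← intervalIntegral.integral_interval_sub_left (gen_path_int hT H hφ ω 0 t) (gen_path_int hT H hφ ω 0 s)]
    ring
  simp only [e] at hz
  rw [integral_sub (hin t).integrableOn (hin s).integrableOn] at hz
  linarith

end

end

/-- **Well-posedness of the martingale problem** (Theorem 2.2 of the paper).
Under assumptions (H), for every initial point `x = (x1, x2)` there exists exactly one
probability measure `P` on `C([0,T], ℝ^d × ℝ^d)` such that `P(X_0 = x) = 1` and, for every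
`φ ∈ C_c^∞(ℝ^{2d})`, the process `t ↦ φ(X_t) − ∫_0^t (Lφ)(s, X_s) ds` is a `P`-martingale
with respect to the canonical filtration. -/
theorem weak_wellposedness_martingale_problem
    (d : ℕ) (hd : 0 < d) (T : ℝ) (hT : 0 < T)
    (F1 F2 : ℝ → E d → E d → E d)
    (σm : ℝ → E d → E d → Matrix (Fin d) (Fin d) ℝ)
    -- (H1) : Hölder regularity of the coefficients, with exponents > 1/3 in the degenerate
    -- direction, and continuity in time
    (β11 β12 β22 : ℝ)
    (hβ11 : β11 ∈ Ioo (0:ℝ) 1) (hβ12 : β12 ∈ Ioo (0:ℝ) 1) (hβ22 : β22 ∈ Ioo (0:ℝ) 1)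
    (hβ12' : 1 / 3 < β12) (hβ22' : 1 / 3 < β22)
    (C1 C2 Cσ : ℝ)
    (hF1 : ∀ t ∈ Icc (0:ℝ) T, ∀ x1 x2 y1 y2 : E d,
      ‖F1 t x1 x2 - F1 t y1 y2‖ ≤ C1 * (‖x1 - y1‖ ^ β11 + ‖x2 - y2‖ ^ β12))
    (hF2 : ∀ t ∈ Icc (0:ℝ) T, ∀ x1 x2 y1 y2 : E d,
      ‖F2 t x1 x2 - F2 t y1 y2‖ ≤ C2 * (‖x1 - y1‖ + ‖x2 - y2‖ ^ β22))
    (hσ : ∀ t ∈ Icc (0:ℝ) T, ∀ x1 x2 y1 y2 : E d, ∀ i j,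
      |σm t x1 x2 i j - σm t y1 y2 i j| ≤ Cσ * (‖x1 - y1‖ + ‖x2 - y2‖))
    (htime : ∀ x1 x2 : E d,
      ContinuousOn (fun t => (F1 t x1 x2, F2 t x1 x2, σm t x1 x2)) (Icc (0:ℝ) T))
    -- (H2) : uniform ellipticity of a = σσ*
    (Λ : ℝ) (hΛ : 1 < Λ)
    (hell : ∀ t ∈ Icc (0:ℝ) T, ∀ x1 x2 : E d, ∀ ζ : E d,
      Λ⁻¹ * ‖ζ‖ ^ 2 ≤ ∑ i, ∑ j, (σm t x1 x2 * (σm t x1 x2)ᵀ) i j * ζ i * ζ j ∧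
      ∑ i, ∑ j, (σm t x1 x2 * (σm t x1 x2)ᵀ) i j * ζ i * ζ j ≤ Λ * ‖ζ‖ ^ 2)
    -- (H3-a) : differentiability of x1 ↦ F2 and Hölder continuity of D1F2
    (DF2 : ℝ → E d → E d → Matrix (Fin d) (Fin d) ℝ)
    (hDF2 : ∀ t ∈ Icc (0:ℝ) T, ∀ x1 x2 : E d,
      HasFDerivAt (fun y1 => F2 t y1 x2)
        (LinearMap.toContinuousLinearMap (Matrix.toEuclideanLin (DF2 t x1 x2))) x1)
    (hDF2c : ∀ t ∈ Icc (0:ℝ) T, ∀ x2 : E d, Continuous fun x1 => DF2 t x1 x2)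
    (η : ℝ) (hη : η ∈ Ioo (0:ℝ) 1) (C2' : ℝ)
    (hDF2hold : ∀ t ∈ Icc (0:ℝ) T, ∀ x1 y1 x2 : E d, ∀ i j,
      |DF2 t x1 x2 i j - DF2 t y1 x2 i j| ≤ C2' * ‖x1 - y1‖ ^ η)
    -- (H3-b) : non-degeneracy of (D1F2)(D1F2)*
    (Ecal : Set (Matrix (Fin d) (Fin d) ℝ))
    (hEclosed : IsClosed Ecal) (hEconv : Convex ℝ Ecal)
    (hEinv : ∀ M ∈ Ecal, IsUnit M)
    (hDF2mem : ∀ t ∈ Icc (0:ℝ) T, ∀ x1 x2 : E d, DF2 t x1 x2 ∈ Ecal)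
    (Λ' : ℝ) (hΛ' : 1 < Λ')
    (hnd : ∀ t ∈ Icc (0:ℝ) T, ∀ x1 x2 : E d, ∀ ζ : E d,
      Λ'⁻¹ * ‖ζ‖ ^ 2 ≤ ∑ i, ∑ j, (DF2 t x1 x2 * (DF2 t x1 x2)ᵀ) i j * ζ i * ζ j ∧
      ∑ i, ∑ j, (DF2 t x1 x2 * (DF2 t x1 x2)ᵀ) i j * ζ i * ζ j ≤ Λ' * ‖ζ‖ ^ 2)
    -- initial condition
    (x : E d × E d) :
    ∃! P : Measure C(Icc (0:ℝ) T, E d × E d),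
      IsProbabilityMeasure P ∧
      P {ω | ω ⟨0, left_mem_Icc.2 hT.le⟩ = x} = 1 ∧
      ∀ φ : E d × E d → ℝ, ContDiff ℝ (⊤ : ℕ∞) φ → HasCompactSupport φ →
        Martingale
          (fun (t : Icc (0:ℝ) T) (ω : C(Icc (0:ℝ) T, E d × E d)) =>
            φ (ω t) - ∫ s in (0:ℝ)..(t : ℝ),
              gen F1 F2 (fun r y1 y2 => σm r y1 y2 * (σm r y1 y2)ᵀ) φ s
                (ω (projIcc 0 T hT.le s)))
          (Filtration.natural
            (fun (t : Icc (0:ℝ) T) (ω : C(Icc (0:ℝ) T, E d × E d)) => ω t)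
            (fun t => (ContinuousEvalConst.continuous_eval_const t).stronglyMeasurable)) P := by
  haveI : NeZero d := ⟨hd.ne'⟩
  have hp : ∀ t : ℝ, (projIcc 0 T hT.le t : ℝ) ∈ Icc (0:ℝ) T := fun t => (projIcc 0 T hT.le t).2
  have cp : Continuous fun t : ℝ => (projIcc 0 T hT.le t : ℝ) := continuous_subtype_val.comp continuous_projIcc
  have cc : ∀ x1 x2 : E d, Continuous fun t : ℝ => (F1 (projIcc 0 T hT.le t : ℝ) x1 x2,
      F2 (projIcc 0 T hT.le t : ℝ) x1 x2, σm (projIcc 0 T hT.le t : ℝ) x1 x2) := fun x1 x2 =>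
    (htime x1 x2).comp_continuous cp hp
  obtain ⟨B1, hB1⟩ : ∃ B, ∀ t ∈ Icc (0:ℝ) T, ‖F1 t 0 0‖ ≤ B :=
    isCompact_Icc.exists_bound_of_continuousOn (htime 0 0).fst
  obtain ⟨B2, hB2⟩ : ∃ B, ∀ t ∈ Icc (0:ℝ) T, ‖F2 t 0 0‖ ≤ B :=
    isCompact_Icc.exists_bound_of_continuousOn (htime 0 0).snd.fst
  obtain ⟨K, hK1, hKC1, hKC2, hKσ, hKD, hKΛ, hKΛ', hKB1, hKB2⟩ : ∃ K : ℝ, 1 ≤ K ∧ C1 ≤ K ∧ C2 ≤ K ∧ Cσ ≤ K ∧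
      C2' ≤ K ∧ Λ ≤ K ∧ Λ' ≤ K ∧ B1 ≤ K ∧ B2 ≤ K := by
    refine ⟨1 + |C1| + |C2| + |Cσ| + |C2'| + |Λ| + |Λ'| + |B1| + |B2|, ?_, ?_, ?_, ?_, ?_, ?_, ?_, ?_, ?_⟩ <;>
    linarith [abs_nonneg C1, abs_nonneg C2, abs_nonneg Cσ, abs_nonneg C2', abs_nonneg Λ, abs_nonneg Λ',
      abs_nonneg B1, abs_nonneg B2, le_abs_self C1, le_abs_self C2, le_abs_self Cσ, le_abs_self C2',
      le_abs_self Λ, le_abs_self Λ', le_abs_self B1, le_abs_self B2]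
  obtain ⟨c, C, H⟩ := mk_hyp hd (F1 := fun t => F1 (projIcc 0 T hT.le t : ℝ))
    (F2 := fun t => F2 (projIcc 0 T hT.le t : ℝ)) (σ := fun t => σm (projIcc 0 T hT.le t : ℝ))
    (D := fun t => DF2 (projIcc 0 T hT.le t : ℝ)) hβ11 hβ12 hβ22 hβ22' hη hK1
    (fun t x1 x2 y1 y2 => (hF1 _ (hp t) x1 x2 y1 y2).trans
      (mul_le_mul_of_nonneg_right hKC1 (by positivity)))
    (fun t x1 x2 y1 y2 => (hF2 _ (hp t) x1 x2 y1 y2).trans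
      (mul_le_mul_of_nonneg_right hKC2 (by positivity)))
    (fun t x1 x2 y1 y2 i j => (hσ _ (hp t) x1 x2 y1 y2 i j).trans
      (mul_le_mul_of_nonneg_right hKσ (by positivity)))
    (fun x1 x2 => (cc x1 x2).fst) (fun x1 x2 => (cc x1 x2).snd.fst)
    (fun x1 x2 i j => (cc x1 x2).snd.snd.matrix_elem i j)
    (fun t => (hB1 _ (hp t)).trans hKB1) (fun t => (hB2 _ (hp t)).trans hKB2)
    (fun t x1 x2 ζ => by
      have h := ell_nsq (hell _ (hp t) x1 x2) ζ
      have hi : K⁻¹ ≤ Λ⁻¹ := inv_anti₀ (by linarith) hKΛ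
      exact ⟨(mul_le_mul_of_nonneg_right hi (nsq_nonneg ζ)).trans h.1,
        h.2.trans (mul_le_mul_of_nonneg_right hKΛ (nsq_nonneg ζ))⟩)
    (fun t x1 x2 => hDF2 _ (hp t) x1 x2)
    (fun t x1 y1 x2 i j => (hDF2hold _ (hp t) x1 y1 x2 i j).trans
      (mul_le_mul_of_nonneg_right hKD (by positivity)))
    hEclosed hEconv hEinv (fun t x1 x2 => hDF2mem _ (hp t) x1 x2)
    (fun t x1 x2 i j => (entry_bd hΛ'.le (fun ζ => (ell_nsq (hnd _ (hp t) x1 x2) ζ).2) i j).trans hKΛ')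
  have hM : ∀ φ : E d × E d → ℝ, (fun (t : Icc (0:ℝ) T) (ω : C(Icc (0:ℝ) T, E d × E d)) =>
            φ (ω t) - ∫ s in (0:ℝ)..(t : ℝ),
              gen F1 F2 (fun r y1 y2 => σm r y1 y2 * (σm r y1 y2)ᵀ) φ s
                (ω (projIcc 0 T hT.le s))) =
      Mp hT (fun t => F1 (projIcc 0 T hT.le t : ℝ)) (fun t => F2 (projIcc 0 T hT.le t : ℝ))
        (fun t => σm (projIcc 0 T hT.le t : ℝ)) φ := by
    intro φ
    funext t ω
    unfold Mp Yc
    congr 1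
    refine intervalIntegral.integral_congr fun s hs => ?_
    rw [uIcc_of_le t.2.1] at hs
    have hs' : s ∈ Icc (0:ℝ) T := ⟨hs.1, hs.2.trans t.2.2⟩
    have e : (projIcc 0 T hT.le s : ℝ) = s := by rw [projIcc_of_mem _ hs']
    simp only [gen, aσ, e]
  obtain ⟨P, hP⟩ := exists_MP H x hT
  refine ⟨P, ⟨hP.prob, hP.ini, fun φ hφ hs => ?_⟩, ?_⟩
  · rw [hM φ]
    exact hP.mart φ hφ hs
  · rintro Q ⟨hQ1, hQ2, hQ3⟩
    refine path_unique hT H (x := x) ⟨hQ1, hQ2, fun φ hφ hs => ?_⟩ hP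
    rw [← hM φ]
    exact hQ3 φ hφ hs

end Stmt0
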